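/- Let Ω = (0,L) ⊂ ℝ be a bounded open interval and T > 0. Suppose either f(s) = (λ/(α−1)) s^α for some α ∈ (0,1) and λ > 0, or f(s) = λ s log(s) for some λ > 0, and set g(s) := ∫_1^s z f''(z) dz. Assume: ρ_{1,0}, ρ_{2,0} ∈ L¹(Ω) are probability densities; there exists a measurable r₀ : Ω → [0,1] with r₀·(ρ_{1,0}+ρ_{2,0}) = ρ_{1,0} almost everywhere whose total variation TV(r₀) is finite; V₁, V₂ ∈ W^{2,1}(Ω), V₁ − V₂ ∈ W^{3,1}(Ω), and V₁' = V₂' = 0 at x = 0 and x = L; and ∫_Ω f(ρ_{1,0}+ρ_{2,0}) dx < ∞. Then there exist measurable ρ₁, ρ₂ : [0,T]×Ω → [0,∞) such that: (i) for almost every t ∈ [0,T], ρ₁(t,·) and ρ₂(t,·) are probability densities on Ω; (ii) writing σ := ρ₁+ρ₂, there exists h ∈ L¹([0,T]×Ω) with ∫_0^T∫_Ω g(σ) ∂_x ψ dx dt = −∫_0^T∫_Ω h ψ dx dt for every ψ ∈ C_c^∞((0,T)×Ω); and (iii) for every φ ∈ C¹([0,T]×[0,L]) vanishing for t in a neighbourhood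 of T, and each i ∈ {1,2}: ∫_Ω ρ_{i,0} φ(0,·) dx + ∫_0^T∫_Ω ρ_i ∂_t φ dx dt = ∫_0^T∫_Ω ((ρ_i/σ) h + ρ_i V_i') ∂_x φ dx dt, where ρ_i/σ := 0 on the set {σ = 0}. -/

import Mathlib

open MeasureTheory Set

/-- The pressure law is of fast-diffusion power type or logarithmic type
(Hypothesis 1). -/
def PressureLaw (f : ℝ → ℝ) : Prop :=
  (∃ α lam : ℝ, α ∈ Ioo (0:ℝ) 1 ∧ 0 < lam ∧
    ∀ s ∈ Ioi (0:ℝ), f s = lam / (α - 1) * s ^ α) ∨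
  (∃ lam : ℝ, 0 < lam ∧ ∀ s ∈ Ioi (0:ℝ), f s = lam * s * Real.log s)

/-- `g(s) = ∫_1^s z f''(z) dz`. -/
noncomputable def gfun (f : ℝ → ℝ) (s : ℝ) : ℝ :=
  ∫ z in (1:ℝ)..s, z * deriv (deriv f) z

/-- A probability density on `(0,L)`. -/
def IsProbDensity (L : ℝ) (u : ℝ → ℝ) : Prop :=
  (∀ x ∈ Ioo 0 L, 0 ≤ u x) ∧ IntegrableOn u (Ioo 0 L) ∧ (∫ x in Ioo 0 L, u x) = 1

/-- The total variation of `w` on `(0,L)` is finite: the set of values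
`∫_Ω w φ' dx`, over `φ ∈ C_c¹((0,L))` with `‖φ‖_∞ ≤ 1`, is bounded above. -/
def HasFiniteTV (L : ℝ) (w : ℝ → ℝ) : Prop :=
  BddAbove {v | ∃ φ : ℝ → ℝ, ContDiff ℝ 1 φ ∧ HasCompactSupport φ ∧
    tsupport φ ⊆ Ioo 0 L ∧ (∀ x, |φ x| ≤ 1) ∧ v = ∫ x in Ioo 0 L, w x * deriv φ x}

/-- Membership in `W^{k,1}((0,L))`: classical derivatives up to order `k` exist on
`(0,L)` and are integrable. -/
def MemW (k : ℕ) (L : ℝ) (V : ℝ → ℝ) : Prop :=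
  (∀ j : ℕ, j ≤ k → IntegrableOn (iteratedDeriv j V) (Ioo 0 L)) ∧
  ∀ j : ℕ, j < k → ∀ x ∈ Ioo 0 L, DifferentiableAt ℝ (iteratedDeriv j V) x

namespace CD
open Real renaming norm_eq_abs → rnoeqab, dist_eq → rdisteq, sqrt → rsqrt, log → rlog, sqrt_pos → rsqrtpos, sqrt_nonneg → rsqno, exp → rexp, exp_log → rexplog, exp_add → rexpadd, add_one_le_exp → radonleex, exp_le_exp → rexleex, exp_pos → rexppos, rpow_one → rrpowone, volume_Ioc → rvoIo
open intervalIntegral renaming integral_of_le → iinofle, continuous_primitive → icopr, norm_integral_le_integral_norm_uIoc → inoinleinnouI, integral_nonneg → iinno, norm_integral_le_of_norm_le_const → inoinleofnoleco, abs_integral_le_integral_abs → iabinleinab, integral_mono_on → iinmoon, integral_add → iinad, integral_const_mul → iincomu, integral_const → iinco, integral_mono_interval → iinmoin, integral_sub → iinsu, integral_mul_const → iinmuco, integral_add_adjacent_intervals → iinadadin, integral_neg → iinne, integral_congr → iincoz, integral_eq_sub_of_hasDerivAt → iineqsuofha, sum_integral_adjacent_intervals → isuinadin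
open Continuous renaming intervalIntegrable → cin
open _root_.Finset renaming mem_range → fmera, range → frange, sum_range_succ → fsurasu, mul_sum → fmulsum, sum_congr → fsuco, sum_nonneg → fsuno, single_le_sum → fsilesu, sum_range_sub → fsurasuz, sum_add_distrib → fsuaddi, sum_le_sum → fsulesu, sum_sub_distrib → fsusudi, sum_div → fsumdiv, sum_const → fsucoz, card_range → fcara
open Filter Topology
set_option hygiene false
local notation:max f:max "‡" => f q.1 q.2
local notation:max "∫m" F:60 => ∫ m in (0:ℝ)..2, F
local notation:max "∫t" F:60 => ∫ t in (0:ℝ)..P.T, F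
local notation:max "∫y" F:60 => ∫ y in (0:ℝ)..x, F
local notation:max "∫M" F:60 => ∫ m in Ioc (0:ℝ) 2, F
local notation:max "∑k" F:67 => ∑ k ∈ frange (2 * n), F
local notation:max "∑j" F:67 => ∑ j ∈ frange (2 * n), F
local notation "ℝˣ" => ℝ × ℝ
local notation:max "∀q" F:0 => ∀ᵐ q ∂(kap P.T), F
local notation "♠" => (Q.S i)
local notation "Ja" => P.T
local notation "Jb" => (q.1, Q.X‡)
local notation "Jc" => (0:ℝ)
local notation "Jd" => (kap Ja)
local notation "Je" => P.L
local notation "Jf" => (k + 1)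
local notation "Jg" => P.B
local notation "Jh" => (by positivity)
local notation "Ji" => (j + 1)
local notation "Jj" => (t ^ 2 * S.s t ^ 2 + t ^ 2 * Sd.s t ^ 2)
local notation "Jk" => (-P.α)
local notation "Jl" => (n:ℝ)
local notation "Jm" => P.W
local notation "Jn" => (q.1, ♠.X‡)
local notation "Jo" => S.X
local notation "Jp" => (ix n m)
local notation "Jq" => D.X
local notation "Jr" => D.p
local notation "Js" => (by linarith)
local notation "Jt" => S.p
local notation "Ju" => F.fx
local notation "Jv" => P.lam
local notation "Jw" => (q.1, Jo‡)
local notation "♣" => (Q.S j)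
local notation "Jx" => (- (r‡ * v‡) + (r‡ - r‡ ^ 2) * Jm Q.X‡)
local notation "Jy" => (abs_nonneg _)
local notation "Jz" => (2 * n)
local notation "J0" => (j - 1)
local notation "J1" => (by simp)
local notation "J3" => P.α
local notation "J4" => D.r
local notation "J5" => (by omega)
local notation "J6" => (Jt t m - Sd.p t m)
local notation "J7" => (S.r‡ ^ 2 - Sd.r‡ ^ 2)
local notation "J8" => (2 * n - 1)
local notation "J9" => (3 * q.1 ^ 2 * Jm Jo‡ + q.1 ^ 3 * (P.Wp Jo‡ * S.v‡))
local notation "Za" => (a - b)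
local notation "Zb" => (Jo t m)
local notation "Zc" => (3 * Ja * (2 * Ja) + Ja ^ 2 * (2 * Ja + C) + 2 * C + 2 * C ^ 2 * Je + 2 * Ja ^ 2)
local notation "Zd" => Q.p
local notation "Ze" => Q.X
local notation "Zf" => F.f
local notation "Zg" => (1 - α)
local notation "Zh" => (3 * (S.v t m ^ 2 + Sd.v t m ^ 2 + 16 * Jg ^ 2))
local notation "Zj" => (X t)
local notation "Zk" => P.T0
local notation "Zl" => S.r
local notation "Zm" => D.v
local notation "Zn" => (by fun_prop)
local notation "Zo" => (S.G‡ - Sd.G‡)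
local notation "Zp" => I.hn
local notation "Zq" => P.b
local notation "Zr" => Jt t m
local notation "Zs" => S.v
local notation "♥" => (S (φ a))
local notation "♦" => (S (φ c))
local notation "Zt" => (t, x)
local notation "Zu" => (gE P (p Ji) - gE P (p j))
local notation "Zv" => D.s
local notation "Zw" => D.a
local notation "Zx" => (𝓝 0)
local notation "♪" => (S i)
local notation "Zy" => (Jq t)
local notation "Zz" => (r‡ - r‡ ^ 2)
local notation "Z0" => (t0 ^ 2 * K ^ 2)
local notation "Z1" => (fun t ht x hx ↦ (hK t ht x hx).2)
local notation "Z2" => Jr t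
local notation "Z3" => (φ i)
local notation "Z4" => F.ft
local notation "♫" => (S.np.sub Sd.np)
local notation "Z5" => (Jq t k)
local notation "Z6" => Sd.p
local notation "Z7" => (Jo t m - Sd.X t m)
local notation "Z8" => (S.ψ‡ - Sd.ψ‡)
local notation "Z9" => (P.R1 x + P.R2 x)
local notation "Ya" => Sd.r
local notation "Yb" => I.x
local notation "Yc" => f i x
local notation "Yd" => (exp ((2 - α) * a) - exp ((2 - α) * b))
local notation "Ye" => (fmera.1 hk)
local notation "Yf" => (|S.π t m| + |Sd.π t m|)
local notation "Yg" => (fun t ht x hx ↦ (hK t ht x hx).1)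
local notation "Yh" => (0, x)
local notation "Yi" => (K * (1 + Zd‡))
local notation "Yj" => S.s
local notation "Yk" => (rexp (2 * K) / (J3 * Jv * η))
local notation "Yl" => (S.θ Ja m * (Zl Ja m ^ 2 - Ya Ja m ^ 2))
local notation "Yn" => (y - x)
local notation "Yo" => (r - r ^ 2)
local notation "Yp" => (ix n m + 1)
local notation "Yq" => Q.κ
local notation "Yr" => (p j)
local notation "Ys" => (Ioc Jc 2)
local notation "Yt" => (e * S.q t + ep * Sd.q t)
local notation "Yu" => (q.1 ^ 2 * Yj q.1 ^ 2 + q.1 ^ 2 * Sd.s q.1 ^ 2)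
local notation "Yv" => (exp (α * a) - exp (α * b))
local notation "Yw" => (2 - J3)
local notation "Yx" => (t, Jo t m)
local notation "Yy" => (Z4 Jb + Ju Jb * v‡)
local notation "Yz" => J4 t
local notation "Y0" => D.A
local notation "Y1" => (1:ℝ)
local notation "☆" => (abs_nonneg _)
local notation "Y2" => Zs t m
local notation "Y3" => (Z6 t m ^ Jk - Zr ^ Jk)
local notation "Y4" => (S.A‡ - Sd.A‡)
local notation "★" => (Q₀.S i)
local notation "Y5" => (kap T)
local notation "☾" => (abs_add_le _ _)
local notation "Y6" => P.B0
local notation "Y7" => (Zl‡ - Ya‡)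
local notation "Y8" => (♠.r‡ - ♠.r‡ ^ 2)
local notation "Y9" => (Zd‡ * (Jv * Zd‡ ^ Jk))
local notation "Ua" => (p Ji)
local notation "Ub" => (Zv t + D.SD t)
local notation "Uc" => Zw t j
local notation "Ud" => (S.nX.comp2 F.c)
local notation "Ue" => (-(t ^ 2 / δ))
local notation "Uf" => (x - y)
local notation "Ug" => S.θ
local notation "Uh" => (Ze t m)
local notation "Ui" => (Zg * a)
local notation "Uj" => (fun k ↦ cl Je (X y k))
local notation "Uk" => (fun k ↦ cl 1 (r y k))
local notation "Ul" => D.pos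
local notation "Um" => Sd.s
local notation "Un" => (g i x - gp x)
local notation "Uo" => (v‡ + Zq Ze‡ + r‡ * Jm Ze‡)
local notation "Up" => ((volume.restrict Ys).withDensity (fun m ↦ ENNReal.ofReal (p m)))
local notation "Uq" => (exp (J3 * a) - exp (J3 * b))
local notation "Ur" => (Ioi 0)
local notation "Us" => (gE P)
local notation "Ut" => (hh.toLp h)
local notation "Uu" => (P.ρ1 x + P.ρ2 x)
local notation "Uv" => P.k
local notation "Uw" => P.hL
local notation "Ux" => Zl t m
local notation "Uy" => (2 * Je * (C + Ja))
local notation "Uz" => (x ^ 2 - y ^ 2)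
local notation "U0" => (-(Zg * log ε / α))
local notation "U2" => (Jq t Jf - Jq t k)
local notation "U3" => pr P
local notation "U4" => Zm t
local notation "U5" => (Jg * (3 * Ja * (2 * Ja) + Ja ^ 2 * (2 * Ja + C) + 2 * C + 2 * C ^ 2 * Je))
local notation "U6" => (Z2)
local notation "U7" => D.r01
local notation "U8" => D.e
local notation "U9" => (4 * h * (Jg * Zv t) + 2 * Jg * h ^ 2)
local notation "Ka" => r t
local notation "Kb" => (t, m)
local notation "Kc" => Icc Jc 2
local notation "☀" => (S Z3)
local notation "Kd" => (2 * Je)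
local notation "Ke" => (♥.X t m - ♦.X t m)
local notation "Kf" => Z6 t m
local notation "☁" => (abs_sub _ _)
local notation "Kg" => (P.Wp Jo‡ * Jt‡)
local notation "Kh" => (S.ψ Ja m - Sd.ψ Ja m)
local notation "Ki" => (y ^ 2 - 4 / 3 * y ^ 3)
local notation "Kj" => F.cx
local notation "Kk" => pp n
local notation "Kl" => (ix_lt hn m)
local notation "Km" => Q.p0
local notation "Kn" => (-K)
local notation "Ko" => (fun k ↦ cl Je (X t k))
local notation "Kq" => (itp n (U4) 1 m - U4 Jp)
local notation "Kr" => (t - tp)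
local notation "Ks" => (fun i ↦ (♠.nX.comp2 hg).int.aestronglyMeasurable)
local notation "Kt" => (pt1 (H.hp j J5) (H.hp Ji J5))
local notation "Ku" => (le_max_right _ _)
local notation "Kv" => (Continuous.inv₀ ((D.cp _).max (D.cp _)) fun t ↦ ((Ul t k h.2).trans_le Ku).ne')
local notation "Kw" => (pc n c (X y))
local notation "Kx" => Z2 k
local notation "Ky" => D.vv
local notation "Kz" => (Y0 t Jf - Y0 t k)
local notation "K3" => ((16 * Jg + 12) * ∫t t ^ 2 * Ub)
local notation "K4" => (Ioc_subset_Icc_self hm)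
local notation "K5" => (fun m ↦ ♥.X t m - ♦.X t m)
local notation "K6" => (Sd.X t m)
local notation "K7" => (a k)
local notation "K8" => (b k)
local notation "K9" => (Jm Ze‡ * Zz)
local notation "Na" => Ju Jb
local notation "Nb" => (measurable_const.prodMk measurable_id)
local notation "Nc" => (Q.Y t x)
local notation "Nd" => (fun k ↦ cl 1 (Ka k))
local notation "Ne" => D.cr
local notation "Nf" => (f Jf - f k)
local notation "Ng" => (rsqrt |x0.1.1 - x.1.1| + |x0.1.2 - x.1.2|)
local notation "Nh" => Icc 0
local notation "Ni" => (S.nv.pow 2)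
local notation "Nj" => (-(α * a))
local notation "☂" => ((S.nX.sub Sd.nX).pow 2)
local notation "Nk" => (|S.π‡| + |Sd.π‡|)
local notation "Nl" => Q.S
local notation "Nm" => F.c
local notation "Nn" => (Zd‡ * (Jv * Zd‡ ^ Jk - Jv))
local notation "No" => (1 - J3)
local notation "Nq" => (fun z hz ↦ (continuousAt_log (ne_of_gt hz)).continuousWithinAt)
local notation "Nr" => (ℕ → ℝ)
local notation "Ns" => Icc Jc 1
local notation "Nt" => (D.cc t h k + D.cc t h Jf)
local notation "Nu" => itp n
local notation "Nv" => f t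
local notation "Nw" => (Ioc_subset_Icc_self ht)
local notation "Nx" => (sq_nonneg t)
local notation "☃" => (S j)
local notation "Ny" => (volume.restrict (Ioc 0 Ja))
local notation "☎" => (S (φ1 (φ2 i)))
local notation "Nz" => (Z4 Jw + Ju Jw * Zs‡)
local notation "☏" => (♠.nA.mul ♠.np)
local notation "N0" => Ds P n p
local notation "N5" => (x j)
local notation "N6" => (prc P)
local notation "N7" => S.ψ
local notation "N8" => (2 * rsqrt Ja + C * (C + 1))
local notation "N9" => Or.inl
local notation "Ea" => bn P n
local notation "Eb" => D.cX
local notation "Ec" => (Lp ℝ 2 μ)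
local notation "Ed" => (S.dX t)
local notation "Ee" => (f i)
local notation "Ef" => (Ioo 0 L)
local notation "Eg" => (hM t ht m hm)
local notation "Eh" => (2 * K)
local notation "Ei" => (-α)
local notation "Ej" => (α * Za)
local notation "Ek" => (Jv * Zr ^ Jk)
local notation "El" => Ya t m
local notation "Em" => (Jo‡ - Sd.X‡)
local notation "Eo" => P.hα0
local notation "Ep" => (S.p_pos t m)
local notation "☐" => (S k)
local notation "Er" => (1 + Y2 ^ 2)
local notation "Es" => (Nice.const _ 1)
local notation "Et" => (y - y ^ 2)
local notation "Eu" => (♠.θ t m * ♠.a t m)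
local notation "Ev" => (3 * (K + 1))
local notation "Ew" => (-g x)
local notation "Ex" => (τ * s ^ 2)
local notation "Ey" => (1 + 1 / η)
local notation "Ez" => (Jl + 1)
local notation "E4" => ((P.Wcont.comp continuous_snd).mul Nm)
local notation "E5" => ((P.bcont.comp continuous_snd).mul Nm)
local notation "E6" => (-Yw)
local notation "E7" => P.R1
local notation "E8" => (Z2 j)
local notation "E9" => (om x + om y)
local notation "Ga" => (A - a * Yo)
local notation "Gb" => (∑k U8 t k + ∑k U8 t Jf)
local notation "Gc" => (6 * Jg + 1)
local notation "Gd" => (ix n q.2)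
local notation "Ge" => (ix n m / n)
local notation "Gf" => (k / n)
local notation "Gg" => (3 * t ^ 2 * Jm Zb + t ^ 3 * (P.Wp Zb * Y2))
local notation "Gh" => Jq t
local notation "Gj" => D.dd
local notation "Gk" => D.SD
local notation "Gl" => Yj t
local notation "☑" => (S.nX.comp2 Kj)
local notation "Gn" => (log (Je / 2))
local notation "Go" => (gEc P)
local notation "Gq" => (fun t ↦ X t j)
local notation "Gr" => (Yb k)
local notation "Gs" => hN i hi j hj
local notation "Gt" => (2*(C+1)/ε)
local notation "Gu" => (sub_nonneg.2 h)
local notation "Gv" => ((Xc i t).intervalIntegrable _ _)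
local notation "Gw" => (hi.trans (hφ.id_le i))
local notation "Gx" => (hj.trans (hφ.id_le j))
local notation "Gy" => P.hlam
local notation "Gz" => P.hWB
local notation "G0" => (Y2 + Zq Zb + Ux * Jm Zb)
local notation "G1" => (S.π‡ - Sd.π‡)
local notation "G2" => (2 * Zl‡ * S.rt‡ - 2 * Ya‡ * Sd.rt‡)
local notation "G3" => (C * Zr)
local notation "☒" => (Nice.const _ (3 * Ja))
local notation "G4" => (θ * (Uf * (G - Gp) - (A - Ad) * Uz))
local notation "G5" => (Jg * Ja)
local notation "G6" => (Jg + 1)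
local notation "G7" => (12 * (Jg * Ja + 1))
local notation "G8" => (♠.r‡ - ♣.r‡)
local notation "☚" => (Q₀.S Z3)
local notation "G9" => (fun i ↦ ♠.nv.memLp 2)
local notation "Ha" => (Je * C)
local notation "Hb" => (fun t _ ↦ Approx.chi δ t)
local notation "Hc" => Q.eu
local notation "Hd" => (fun t _ x _ ↦ by rw [(F.dt t x).deriv])
local notation "He" => (sub_nonneg.2 h1)
local notation "Hf" => (2 - α)
local notation "Hg" => P.c1
local notation "Hh" => (fmera.1 hj)
local notation "Hi" => (-J3 - 1)
local notation "Hj" => (k:ℝ)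
local notation "Hk" => (4 * Q)
local notation "Hl" => (Nu Zy 1 m)
local notation "Hm" => (2 + 3 * Jg + Jg * Je)
set_option hygiene true
section
lemma aeSubseq {α : Type*} [MeasurableSpace α] {μ : Measure α} (f : ℕ → α → ℝ)
    (hf : ∀ i, Integrable Ee μ)
    (hc : Tendsto (fun i ↦ ∫ x, |Yc| ∂μ) atTop Zx) :
    ∃ φ : ℕ → ℕ, StrictMono φ ∧ ∀ᵐ x ∂μ, Tendsto (fun i ↦ f Z3 x) atTop Zx := by
  have h1 : Tendsto (fun i ↦ eLpNorm (f i - 0) 1 μ) atTop Zx := by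
    have : ∀ i, eLpNorm (f i - 0) 1 μ = ENNReal.ofReal (∫ x, |Yc| ∂μ) := by
      intro i
      rw [sub_zero, eLpNorm_one_eq_lintegral_enorm, ← ofReal_integral_norm_eq_lintegral_enorm (hf i)]
      rfl
    simp_rw [this]
    simpa using ENNReal.tendsto_ofReal hc
  have h2 := tendstoInMeasure_of_tendsto_eLpNorm (g := 0) one_ne_zero
    (fun i ↦ (hf i).aestronglyMeasurable) aestronglyMeasurable_zero h1
  obtain ⟨φ, h3, h4⟩ := h2.exists_seq_tendsto_ae
  exact ⟨φ, h3, by simpa using h4⟩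
lemma cauchyL1 {α : Type*} [MeasurableSpace α] {μ : Measure α} (f : ℕ → α → ℝ)
    (hf : ∀ i, Integrable Ee μ)
    (hc : ∀ ε > 0, ∃ N, ∀ i ≥ N, ∀ j ≥ N, ∫ x, |Yc - f j x| ∂μ ≤ ε) :
    ∃ g : α → ℝ, Measurable g ∧ Integrable g μ ∧
      Tendsto (fun i ↦ ∫ x, |Yc - g x| ∂μ) atTop Zx := by
  have h1 : CauchySeq (fun i ↦ (hf i).toL1 Ee) := by
    rw [Metric.cauchySeq_iff]
    intro ε hε
    obtain ⟨N, hN⟩ := hc (ε/2) Jh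
    refine ⟨N, fun i hi j hj ↦ ?_⟩
    rw [dist_eq_norm, ← Integrable.toL1_sub, L1.norm_of_fun_eq_integral_norm]
    have := Gs
    simp only [Pi.sub_apply, rnoeqab]
    linarith
  obtain ⟨G, hG⟩ := cauchySeq_tendsto_of_complete h1
  have hGi := L1.integrable_coeFn G
  obtain ⟨g, hg, hgG⟩ := hGi.aestronglyMeasurable.aemeasurable
  have hgi : Integrable g μ := hGi.congr hgG
  refine ⟨g, hg, hgi, ?_⟩
  rw [tendsto_iff_norm_sub_tendsto_zero] at hG
  refine hG.congr fun i ↦ ?_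
  have : G = hgi.toL1 g := by
    rw [← Integrable.toL1_coeFn G hGi]
    exact (Integrable.toL1_eq_toL1_iff _ _ _ _).2 hgG
  rw [this, ← Integrable.toL1_sub, L1.norm_of_fun_eq_integral_norm]
  rfl
lemma smallL1 {α : Type*} [MeasurableSpace α] {μ : Measure α} [IsFiniteMeasure μ] (f : ℕ → α → ℝ)
    (hf : ∀ i, AEStronglyMeasurable Ee μ) (C : ℝ)
    (h2 : ∀ i, Integrable (fun x ↦ Yc ^ 2) μ) (hC : ∀ i, ∫ x, Yc ^ 2 ∂μ ≤ C)
    (h0 : ∀ᵐ x ∂μ, Tendsto (fun i ↦ Yc) atTop Zx) :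
    Tendsto (fun i ↦ ∫ x, |Yc| ∂μ) atTop Zx := by
  have key : ∀ K : ℝ, 0 < K → ∀ i,
      ∫ x, |Yc| ∂μ ≤ ∫ x, min |Yc| K ∂μ + C / K := by
    intro K hK i
    have hmi : Integrable (fun x ↦ min |Yc| K) μ := by
      refine Integrable.of_bound (C := K)
        ((hf i).norm.inf aestronglyMeasurable_const) ?_
      refine Eventually.of_forall fun x ↦ ?_
      rw [rnoeqab, abs_of_nonneg (le_min Jy hK.le)]
      exact min_le_right _ _
    have hle : ∀ x, |Yc| ≤ min |Yc| K + Yc ^ 2 / K := by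
      intro x
      rcases le_total |f i x| K with h | h
      · rw [min_eq_left h]; have : 0 ≤ Yc ^ 2 / K := by positivity
        linarith
      · rw [min_eq_right h]
        have : |Yc| ≤ Yc ^ 2 / K := by
          rw [le_div_iff₀ hK, ← sq_abs]; nlinarith [abs_nonneg (Yc)]
        linarith
    calc ∫ x, |Yc| ∂μ ≤ ∫ x, (min |Yc| K + Yc ^ 2 / K) ∂μ := by
          refine integral_mono_of_nonneg (Eventually.of_forall fun x ↦ abs_nonneg _)
            (hmi.add ((h2 i).div_const K)) (Eventually.of_forall hle)
      _ = ∫ x, min |Yc| K ∂μ + (∫ x, Yc ^ 2 ∂μ) / K := by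
          rw [integral_add hmi ((h2 i).div_const K), integral_div]
      _ ≤ _ := by gcongr; exact hC i
  have hdct : ∀ K : ℝ, 0 < K → Tendsto (fun i ↦ ∫ x, min |Yc| K ∂μ) atTop Zx := by
    intro K hK
    have := tendsto_integral_of_dominated_convergence (μ := μ) (F := fun i x ↦ min |Yc| K)
      (f := fun _ ↦ Jc) (fun _ ↦ K)
      (fun i ↦ (hf i).norm.inf aestronglyMeasurable_const) (integrable_const K)
      (fun i ↦ Eventually.of_forall fun x ↦ by
        rw [rnoeqab, abs_of_nonneg (le_min Jy hK.le)]
        exact min_le_right _ _)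
      (by
        filter_upwards [h0] with x hx
        have := (hx.abs).min (tendsto_const_nhds (x := K))
        simpa [hK.le] using this)
    simpa using this
  rw [Metric.tendsto_atTop]
  intro ε hε
  have hC0 : 0 ≤ C := le_trans (integral_nonneg fun x ↦ sq_nonneg _) (hC 0)
  obtain ⟨N, hN⟩ := (Metric.tendsto_atTop.1 (hdct Gt Jh)) (ε/2) Jh
  refine ⟨N, fun i hi ↦ ?_⟩
  have h3 := hN i hi
  have h4 := key Gt Jh i
  rw [rdisteq, sub_zero] at h3 ⊢
  rw [abs_of_nonneg (integral_nonneg fun x ↦ abs_nonneg _)]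
  have h5 := (abs_lt.1 h3).2
  have h6 : C / Gt ≤ ε/2 := by
    rw [div_le_iff₀ Jh]
    field_simp; linarith
  linarith
lemma weakLim {α : Type*} [MeasurableSpace α] {μ : Measure α} (f : ℕ → α → ℝ)
    (hf : ∀ i, MemLp Ee 2 μ) (C : ℝ) (hC : ∀ i, ∫ x, Yc ^ 2 ∂μ ≤ C) (U : Ultrafilter ℕ) :
    ∃ g : α → ℝ, Measurable g ∧ MemLp g 2 μ ∧ ∀ h : α → ℝ, MemLp h 2 μ →
      Tendsto (fun i ↦ ∫ x, Yc * h x ∂μ) U (𝓝 (∫ x, g x * h x ∂μ)) := by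
  have hinner : ∀ (u v : α → ℝ) (hu : MemLp u 2 μ) (hv : MemLp v 2 μ),
      inner ℝ (hu.toLp u) (hv.toLp v) = ∫ x, u x * v x ∂μ := by
    intro u v hu hv
    rw [L2.inner_def]
    refine integral_congr_ae ?_
    filter_upwards [hu.coeFn_toLp, hv.coeFn_toLp] with x h1 h2
    rw [h1, h2]; simp [mul_comm]
  let x : ℕ → Lp ℝ 2 μ := fun i ↦ (hf i).toLp Ee
  have hx : ∀ i, ‖x i‖ ≤ rsqrt C := by
    intro i
    refine Real.le_sqrt_of_sq_le ?_
    rw [← real_inner_self_eq_norm_sq, hinner]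
    refine le_trans (le_of_eq ?_) (hC i)
    congr 1; ext x; ring
  have hcomp : IsCompact (WeakDual.toStrongDual ⁻¹'
      Metric.closedBall (0 : StrongDual ℝ Ec) (rsqrt C)) :=
    WeakDual.isCompact_closedBall 0 _
  let D : ℕ → WeakDual ℝ Ec := fun i ↦
    StrongDual.toWeakDual (InnerProductSpace.toDual ℝ Ec (x i))
  obtain ⟨y, -, hy⟩ := hcomp.ultrafilter_le_nhds (U.map D) (by
    rw [le_principal_iff]
    refine Filter.mem_map.2 (univ_mem' fun i ↦ ?_)
    simp only [mem_preimage, D, Metric.mem_closedBall, dist_zero_right]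
    change ‖InnerProductSpace.toDual ℝ Ec (x i)‖ ≤ _
    rw [LinearIsometryEquiv.norm_map]; exact hx i)
  have hyt : Tendsto D U (𝓝 y) := hy
  let z : Lp ℝ 2 μ := (InnerProductSpace.toDual ℝ Ec).symm (WeakDual.toStrongDual y)
  obtain ⟨g, hg, hgz⟩ := (Lp.memLp z).aestronglyMeasurable.aemeasurable
  have hg2 : MemLp g 2 μ := (memLp_congr_ae hgz).1 (Lp.memLp z)
  refine ⟨g, hg, hg2, fun h hh ↦ ?_⟩
  have h1 : Tendsto (fun i ↦ D i Ut) U (𝓝 (y Ut)) :=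
    ((WeakDual.eval_continuous Ut).tendsto y).comp hyt
  have h2 : ∀ i, D i Ut = ∫ x, Yc * h x ∂μ := by
    intro i
    change InnerProductSpace.toDual ℝ Ec (x i) Ut = _
    rw [InnerProductSpace.toDual_apply_apply, hinner]
  have h3 : y Ut = ∫ x, g x * h x ∂μ := by
    have : (WeakDual.toStrongDual y) Ut = inner ℝ z Ut :=
      (InnerProductSpace.toDual_symm_apply).symm
    change (WeakDual.toStrongDual y) Ut = _
    rw [this, ← hinner g h hg2 hh]
    congr 1
    exact Lp.ext (hgz.trans hg2.coeFn_toLp.symm)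
  rw [h3] at h1
  exact h1.congr h2
lemma arzela (T : ℝ) (F : ℕ → ℝ → ℝ → ℝ) (C : ℝ)
    (hb : ∀ i, ∀ t ∈ Icc 0 T, ∀ m ∈ Icc Jc 2, |F i t m| ≤ C)
    (he : ∀ i, ∀ t ∈ Icc 0 T, ∀ tp ∈ Icc 0 T, ∀ m ∈ Icc Jc 2, ∀ mp ∈ Icc Jc 2,
      |F i t m - F i tp mp| ≤ C * (rsqrt |t - tp| + |m - mp|)) :
    ∃ φ : ℕ → ℕ, StrictMono φ ∧ ∀ ε > 0, ∃ N, ∀ i ≥ N, ∀ j ≥ N, ∀ t ∈ Icc 0 T,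
      ∀ m ∈ Icc Jc 2, |F Z3 t m - F (φ j) t m| ≤ ε := by
  let K := (Nh T ×ˢ Icc Jc 2 : Set (ℝˣ))
  have : CompactSpace K := isCompact_iff_compactSpace.1 (isCompact_Icc.prod isCompact_Icc)
  have hmod : ∀ x0 : K, Tendsto (fun x : K ↦ C * Ng)
      (𝓝 x0) Zx := by
    intro x0
    have : Continuous (fun x : K ↦ C * Ng) := by
      fun_prop
    simpa using this.tendsto x0
  have hec : ∀ x0 : K, ∀ ε > 0, ∃ V ∈ 𝓝 x0, ∀ x ∈ V, ∀ i,
      |F i x0.1.1 x0.1.2 - F i x.1.1 x.1.2| < ε := by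
    intro x0 ε hε
    refine ⟨_, (hmod x0).eventually (gt_mem_nhds hε), fun x hx i ↦ lt_of_le_of_lt ?_ hx⟩
    exact he i _ x0.2.1 _ x.2.1 _ x0.2.2 _ x.2.2
  have hcont : ∀ i, Continuous (fun x : K ↦ F i x.1.1 x.1.2) := by
    intro i
    rw [continuous_iff_continuousAt]
    intro x0
    rw [ContinuousAt, Metric.tendsto_nhds]
    intro ε hε
    obtain ⟨V, hV, h⟩ := hec x0 ε hε
    filter_upwards [hV] with x hx
    rw [dist_comm, rdisteq]; exact h x hx i
  let g : ℕ → BoundedContinuousFunction K ℝ := fun i ↦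
    BoundedContinuousFunction.mkOfCompact ⟨_, hcont i⟩
  have hcl := BoundedContinuousFunction.arzela_ascoli (Icc (-C) C) isCompact_Icc (range g)
    (by rintro f x ⟨i, rfl⟩; exact abs_le.1 (hb i _ x.2.1 _ x.2.2))
    (by
      intro x0
      rw [Metric.equicontinuousAt_iff_right]
      intro ε hε
      obtain ⟨V, hV, h⟩ := hec x0 ε hε
      filter_upwards [hV] with x hx
      rintro ⟨f, i, rfl⟩
      exact h x hx i)
  obtain ⟨a, -, φ, hφ, ha⟩ := hcl.tendsto_subseq (fun i ↦ subset_closure (mem_range_self i))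
  refine ⟨φ, hφ, fun ε hε ↦ ?_⟩
  obtain ⟨N, hN⟩ := (Metric.cauchySeq_iff.1 ha.cauchySeq) ε hε
  refine ⟨N, fun i hi j hj t ht m hm ↦ ?_⟩
  have h1 := Gs
  have h2 := BoundedContinuousFunction.dist_coe_le_dist (f := g Z3) (g := g (φ j))
    (⟨Kb, ht, hm⟩ : K)
  rw [rdisteq] at h2
  exact (h2.trans_lt h1).le
/-- Data of the problem in unified form. -/
structure Par where
  L : ℝ
  T : ℝ
  α : ℝ
  lam : ℝ
  B : ℝ
  b : ℝ → ℝ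
  k : ℝ → ℝ
  W : ℝ → ℝ
  Wp : ℝ → ℝ
  ρ1 : ℝ → ℝ
  ρ2 : ℝ → ℝ
  hL : 0 < L
  hT : 0 < T
  hα0 : 0 < α
  hα1 : α ≤ 1
  hlam : 0 < lam
  hk : Integrable k
  hb : ∀ x, b x = b 0 + ∫y k y
  hbB : |b 0| + ∫ y, |k y| ≤ B
  hW : ∀ x, HasDerivAt W (Wp x) x
  hW'c : Continuous Wp
  hW'B : ∀ x, |Wp x| ≤ B
  hWB : ∀ x ∈ Icc 0 L, |W x| ≤ B
  h1p : ∀ x ∈ Ioo 0 L, 0 ≤ ρ1 x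
  h2p : ∀ x ∈ Ioo 0 L, 0 ≤ ρ2 x
  h1i : IntegrableOn ρ1 Ef
  h2i : IntegrableOn ρ2 Ef
  h1 : ∫ x in Ioo 0 L, ρ1 x = 1
  h2 : ∫ x in Ioo 0 L, ρ2 x = 1
  hent : α = 1 → IntegrableOn (fun x ↦ (ρ1 x + ρ2 x) * rlog (ρ1 x + ρ2 x)) Ef
/-- measurable, and bounded on `[0,T] × [0,2]` -/
def Nice (T : ℝ) (f : ℝ → ℝ → ℝ) : Prop :=
  Measurable (fun q : ℝˣ ↦ f‡) ∧ ∃ M, ∀ t ∈ Icc 0 T, ∀ m ∈ Icc Jc 2, |Nv m| ≤ M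
/-- reference measure -/
noncomputable abbrev kap (T : ℝ) : Measure (ℝˣ) :=
  (volume.restrict (Ioc 0 T)).prod (volume.restrict Ys)
lemma kap_eq (T : ℝ) : kap T = (volume : Measure (ℝˣ)).restrict (Ioc 0 T ×ˢ Ioc Jc 2) := by
  rw [kap, Measure.prod_restrict]; rfl
lemma ae_kap {T : ℝ} {P : ℝˣ → Prop} (h : ∀ t ∈ Ioc 0 T, ∀ m ∈ Ioc Jc 2, P Kb) :
    ∀ᵐ q ∂ Y5, P q := by
  rw [kap_eq, ae_restrict_iff' (measurableSet_Ioc.prod measurableSet_Ioc)]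
  exact Eventually.of_forall fun q hq ↦ h q.1 hq.1 q.2 hq.2
namespace Nice
variable {T : ℝ} {f g : ℝ → ℝ → ℝ}
lemma add (hf : Nice T f) (hg : Nice T g) : Nice T (fun t m ↦ Nv m + g t m) := by
  obtain ⟨h1, M, hM⟩ := hf; obtain ⟨h2, N, hN⟩ := hg
  exact ⟨h1.add h2, M + N, fun t ht m hm ↦ ☾.trans (add_le_add Eg (hN t ht m hm))⟩
lemma mul (hf : Nice T f) (hg : Nice T g) : Nice T (fun t m ↦ Nv m * g t m) := by
  obtain ⟨h1, M, hM⟩ := hf; obtain ⟨h2, N, hN⟩ := hg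
  refine ⟨h1.mul h2, M * N, fun t ht m hm ↦ ?_⟩
  rw [abs_mul]
  exact mul_le_mul Eg (hN t ht m hm) Jy (☆.trans Eg)
lemma neg (hf : Nice T f) : Nice T (fun t m ↦ - Nv m) := by
  obtain ⟨h1, M, hM⟩ := hf
  exact ⟨h1.neg, M, fun t ht m hm ↦ by rw [abs_neg]; exact hM t ht m hm⟩
lemma sub (hf : Nice T f) (hg : Nice T g) : Nice T (fun t m ↦ Nv m - g t m) := by
  simpa [sub_eq_add_neg] using hf.add hg.neg
lemma comp2 {φ : ℝˣ → ℝ} (hφ : Continuous φ) (hf : Nice T f) :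
    Nice T (fun t m ↦ φ (t, Nv m)) := by
  obtain ⟨h1, M, hM⟩ := hf
  refine ⟨hφ.measurable.comp (measurable_fst.prodMk h1), ?_⟩
  obtain ⟨N, hN⟩ := ((isCompact_Icc (a := 0) (b := T)).prod
    (isCompact_Icc (a := -M) (b := M))).exists_bound_of_continuousOn hφ.continuousOn
  exact ⟨N, fun t ht m hm ↦ hN (t, Nv m) ⟨ht, abs_le.1 Eg⟩⟩
lemma comp {φ : ℝ → ℝ} (hφ : Continuous φ) (hf : Nice T f) : Nice T (fun t m ↦ φ (Nv m)) :=
  comp2 (φ := fun q ↦ φ q.2) Zn hf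
lemma const (T c : ℝ) : Nice T (fun _ _ ↦ c) := ⟨measurable_const, |c|, fun _ _ _ _ ↦ le_rfl⟩
lemma ofT {φ : ℝ → ℝ} (hφ : Continuous φ) : Nice T (fun t _ ↦ φ t) :=
  comp2 (φ := fun q ↦ φ q.1) Zn (const T 0)
lemma abs (hf : Nice T f) : Nice T (fun t m ↦ |Nv m|) := comp continuous_abs hf
lemma pow (hf : Nice T f) (n : ℕ) : Nice T (fun t m ↦ Nv m ^ n) := comp (continuous_pow n) hf
lemma of_le (hm : Measurable (fun q : ℝˣ ↦ f‡)) (hg : Nice T g)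
    (h : ∀ t ∈ Icc 0 T, ∀ m ∈ Icc Jc 2, |Nv m| ≤ g t m) : Nice T f := by
  obtain ⟨h1, M, hM⟩ := hg
  exact ⟨hm, M, fun t ht m hm ↦ (h t ht m hm).trans ((le_abs_self _).trans Eg)⟩
lemma memLp (hf : Nice T f) (p : ENNReal) : MemLp (fun q : ℝˣ ↦ f‡) p Y5 := by
  obtain ⟨h1, M, hM⟩ := hf
  refine MemLp.of_bound h1.aestronglyMeasurable M (ae_kap fun t ht m hm ↦ ?_)
  exact hM t Nw m K4
lemma int (hf : Nice T f) : Integrable (fun q : ℝˣ ↦ f‡) Y5 :=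
  memLp_one_iff_integrable.1 (hf.memLp 1)
lemma intm (hf : Nice T f) {t : ℝ} (ht : t ∈ Nh T) : IntervalIntegrable (Nv) volume 0 2 := by
  obtain ⟨h1, M, hM⟩ := hf
  rw [intervalIntegrable_iff_integrableOn_Ioc_of_le (by norm_num)]
  refine Integrable.of_bound (C := M) (h1.comp measurable_prodMk_left).aestronglyMeasurable ?_
  refine (ae_restrict_iff' measurableSet_Ioc).2 (Eventually.of_forall fun m hm ↦ ?_)
  exact hM t ht m K4
lemma intt (hf : Nice T f) {t0 : ℝ} (ht0 : t0 ∈ Nh T) {m : ℝ} (hm : m ∈ Kc) :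
    IntervalIntegrable (fun t ↦ Nv m) volume t0 T := by
  obtain ⟨h1, M, hM⟩ := hf
  rw [intervalIntegrable_iff_integrableOn_Ioc_of_le ht0.2]
  refine Integrable.of_bound (C := M)
    (h1.comp (measurable_id.prodMk measurable_const)).aestronglyMeasurable ?_
  refine (ae_restrict_iff' measurableSet_Ioc).2 (Eventually.of_forall fun t ht ↦ ?_)
  exact hM t ⟨ht0.1.trans ht.1.le, ht.2⟩ m hm
lemma mono {t0 : ℝ} (h : t0 ≤ T) (hf : Nice T f) : Nice t0 f :=
  ⟨hf.1, hf.2.imp fun _ hM t ht ↦ hM t ⟨ht.1, ht.2.trans h⟩⟩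
lemma fub (hT : 0 ≤ T) (hf : Nice T f) :
    ∫ q, f‡ ∂ Y5 = ∫ t in Jc..T, ∫m f t m := by
  rw [integral_prod _ hf.int, iinofle hT]
  simp_rw [iinofle (zero_le_two (α := ℝ))]
lemma fubp (hT : 0 ≤ T) (hf : Nice T f) :
    ∫ q, f‡ ∂ Y5 = ∫m ∫ t in Jc..T, f t m := by
  rw [integral_prod_symm _ hf.int, iinofle (zero_le_two (α := ℝ))]
  simp_rw [iinofle hT]
/-- integrability in time of the mass integral -/
lemma intT (hT : 0 ≤ T) (hf : Nice T f) :
    IntervalIntegrable (fun t ↦ ∫m f t m) volume 0 T := by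
  rw [intervalIntegrable_iff_integrableOn_Ioc_of_le hT]
  have := hf.int.integral_prod_left
  simp_rw [iinofle (zero_le_two (α := ℝ))]
  exact this
end Nice
/-- A right derivative of a continuous function on `[0,2]`. -/
def RD (ζ ζp : ℝ → ℝ) : Prop :=
  Continuous ζ ∧ ∀ m ∈ Ico Jc 2, HasDerivWithinAt ζ (ζp m) (Ioi m) m
lemma RD.ftc {ζ ζp : ℝ → ℝ} (h : RD ζ ζp) (hi : IntervalIntegrable ζp volume 0 2) {a c : ℝ}
    (ha : 0 ≤ a) (hac : a ≤ c) (hc : c ≤ 2) : ∫ m in a..c, ζp m = ζ c - ζ a := by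
  refine intervalIntegral.integral_eq_sub_of_hasDeriv_right_of_le hac h.1.continuousOn
    (fun x hx ↦ h.2 x ⟨ha.trans hx.1.le, hx.2.trans_le hc⟩) (hi.mono_set ?_)
  rw [uIcc_of_le hac, uIcc_of_le Js]
  exact Icc_subset_Icc ha hc
lemma RD.parts {u up w wd : ℝ → ℝ} (hu : RD u up) (hw : RD w wd)
    (hiu : IntervalIntegrable up volume 0 2) (hiw : IntervalIntegrable wd volume 0 2) :
    ∫m u m * wd m = u 2 * w 2 - u 0 * w 0 - ∫m up m * w m := by
  refine intervalIntegral.integral_mul_deriv_eq_deriv_mul_of_hasDeriv_right hu.1.continuousOn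
    hw.1.continuousOn ?_ ?_ hiu hiw
  · intro x hx; simp at hx; exact hu.2 x ⟨hx.1.le, hx.2⟩
  · intro x hx; simp at hx; exact hw.2 x ⟨hx.1.le, hx.2⟩
/-- Time derivative on `(0,T)` of a continuous function. -/
def TD (T : ℝ) (u up : ℝ → ℝ) : Prop :=
  Continuous u ∧ ∀ t ∈ Ioo 0 T, HasDerivAt u (up t) t
lemma TD.ftc {T : ℝ} {u up : ℝ → ℝ} (h : TD T u up) (hi : IntervalIntegrable up volume 0 T)
    {a c : ℝ} (ha : 0 ≤ a) (hac : a ≤ c) (hc : c ≤ T) : ∫ t in a..c, up t = u c - u a := by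
  refine intervalIntegral.integral_eq_sub_of_hasDerivAt_of_le hac h.1.continuousOn
    (fun x hx ↦ h.2 x ⟨ha.trans_lt hx.1, hx.2.trans_le hc⟩) (hi.mono_set ?_)
  rw [uIcc_of_le hac, uIcc_of_le Js]
  exact Icc_subset_Icc ha hc
lemma TD.parts {T : ℝ} {u up w wd : ℝ → ℝ} (hu : TD T u up) (hw : TD T w wd) {t0 : ℝ}
    (h0 : t0 ∈ Nh T)
    (hiu : IntervalIntegrable up volume t0 T) (hiw : IntervalIntegrable wd volume t0 T) :
    ∫ t in t0..T, u t * wd t = u T * w T - u t0 * w t0 - ∫ t in t0..T, up t * w t := by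
  refine intervalIntegral.integral_mul_deriv_eq_deriv_mul_of_hasDeriv_right hu.1.continuousOn
    hw.1.continuousOn ?_ ?_ hiu hiw
  · intro x hx; simp [h0.2] at hx; exact (hu.2 x ⟨h0.1.trans_lt hx.1, hx.2⟩).hasDerivWithinAt
  · intro x hx; simp [h0.2] at hx; exact (hw.2 x ⟨h0.1.trans_lt hx.1, hx.2⟩).hasDerivWithinAt
/-- The properties of one approximate solution (in mass coordinates), with uniform constant `C`
and small parameter `e`. -/
structure Approx (P : Par) (C e : ℝ) where
  p : ℝ → ℝ → ℝ
  r : ℝ → ℝ → ℝ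
  rt : ℝ → ℝ → ℝ
  X : ℝ → ℝ → ℝ
  v : ℝ → ℝ → ℝ
  ψ : ℝ → ℝ → ℝ
  A : ℝ → ℝ → ℝ
  G : ℝ → ℝ → ℝ
  π : ℝ → ℝ → ℝ
  s : ℝ → ℝ
  q : ℝ → ℝ
  np : Nice Ja p
  nr : Nice Ja r
  nrt : Nice Ja rt
  nX : Nice Ja X
  nv : Nice Ja v
  nψ : Nice Ja ψ
  nA : Nice Ja A
  nG : Nice Ja G
  nπ : Nice Ja π
  p_pos : ∀ t m, 0 < p t m
  r0 : ∀ t m, 0 ≤ Ka m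
  r1 : ∀ t m, Ka m ≤ 1
  dX : ∀ t, RD Zj (p t)
  X0 : ∀ t, X t 0 = 0
  X2 : ∀ t, X t 2 = Je
  tX : ∀ m, TD Ja (fun t ↦ X t m) (fun t ↦ v t m)
  dψ : ∀ t, RD (ψ t) (Ka)
  ψ0 : ∀ t, ψ t 0 = 0
  ψ2 : ∀ t, ψ t 2 = 1
  tψ : ∀ m, TD Ja (fun t ↦ ψ t m) (fun t ↦ A t m)
  dA : ∀ t, RD (A t) (rt t)
  A0 : ∀ t, A t 0 = 0
  A2 : ∀ t, A t 2 = 0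
  tr : ∀ m, TD Ja (fun t ↦ Ka m) (fun t ↦ rt t m)
  dG : ∀ t, RD (G t) (fun m ↦ 2 * Ka m * rt t m - π t m)
  cs : Continuous s
  s1 : ∀ t, 1 ≤ s t
  hps : ∀ t m, 1 / p t m ≤ s t
  hls : ∀ t m, |rlog (p t m)| ≤ s t
  hs2 : ∫t t ^ 2 * s t ^ 2 ≤ C
  hv2 : ∫ q, v‡ ^ 2 ∂ Jd ≤ C
  hA : ∀ t m, m ∈ Kc → |A t m| ≤ C * s t
  hG : ∀ t m, m ∈ Kc → |G t m| ≤ C * s t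
  hAp : ∀ t m, m ∈ Kc → |A t m * p t m| ≤ C
  hπ : ∫ q, q.1 ^ 2 * |π‡| ∂ Jd ≤ C
  eA : ∫ q, q.1 ^ 2 * |A‡ - Jm X‡ / p‡ * Zz|
    ∂ Jd ≤ e
  eG : ∫ q, q.1 ^ 2 * |G‡ - Jm X‡ / p‡ *
    (r‡ ^ 2 - 4 / 3 * r‡ ^ 3)| ∂ Jd ≤ e
  cq : Continuous q
  q0 : ∀ t, 0 ≤ q t
  hq2 : ∫t q t ^ 2 ≤ C
  hQ : ∀ t ∈ Ioc 0 Ja, ∀ ζ ζp : ℝ → ℝ, RD ζ ζp → IntervalIntegrable ζp volume 0 2 →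
    ζ 0 = 0 → ζ 2 = 0 →
    |(∫m ζp m * (Jv * p t m ^ Jk)) -
      ∫m (v t m + Zq (X t m) + Ka m * Jm (X t m)) * ζ m| ≤
      e * q t * ∫m |ζp m|
  i1 : ∀ (φ : ℝ → ℝ) (K : ℝ), Continuous φ → (∀ x ∈ Icc 0 Je, ∀ y ∈ Icc 0 Je,
    |φ x - φ y| ≤ K * |x - y|) →
    |(∫m r 0 m * φ (X 0 m)) - ∫ x in Ioo 0 Je, P.ρ1 x * φ x| ≤ e * K
  i2 : ∀ (φ : ℝ → ℝ) (K : ℝ), Continuous φ → (∀ x ∈ Icc 0 Je, ∀ y ∈ Icc 0 Je,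
    |φ x - φ y| ≤ K * |x - y|) →
    |(∫m φ (X 0 m)) - ∫ x in Ioo 0 Je, Uu * φ x| ≤ e * K
namespace Par
variable (P : Par)
lemma B0 : 0 ≤ Jg := ☆.trans (P.hW'B 0)
lemma bcont : Continuous Zq := by
  have : Zq = fun x ↦ Zq 0 + ∫y Uv y := funext P.hb
  rw [this]
  exact continuous_const.add (icopr
    (fun a c ↦ P.hk.intervalIntegrable) 0)
lemma bB (x : ℝ) : |Zq x| ≤ Jg := by
  rw [P.hb x]
  refine ☾.trans (le_trans (add_le_add le_rfl ?_) P.hbB)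
  rw [← rnoeqab]
  refine inoinleinnouI.trans ?_
  exact setIntegral_le_integral P.hk.norm (Eventually.of_forall fun _ ↦ norm_nonneg _)
lemma Wcont : Continuous Jm := continuous_iff_continuousAt.2 fun x ↦ (P.hW x).continuousAt
lemma T0 : 0 ≤ Ja := P.hT.le
end Par
namespace Approx
variable {P : Par} {C e : ℝ} (S : Approx P C e)
lemma C0 {P : Par} {C e : ℝ} (S : Approx P C e) : 0 ≤ C := le_trans (iinno Zk fun t _ ↦ by positivity) S.hs2
lemma intp {t : ℝ} (ht : t ∈ Nh Ja) : ∫m Jt t m = Je := by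
  rw [(S.dX t).ftc (S.np.intm ht) le_rfl zero_le_two le_rfl, S.X2, S.X0, sub_zero]
lemma Xmono {t : ℝ} (ht : t ∈ Nh Ja) {a c : ℝ} (ha : 0 ≤ a) (hac : a ≤ c) (hc : c ≤ 2) :
    Jo t a ≤ Jo t c := by
  rw [← sub_nonneg, ← (S.dX t).ftc (S.np.intm ht) ha hac hc]
  exact iinno hac fun m _ ↦ (S.p_pos t m).le
lemma Xmem {t : ℝ} (ht : t ∈ Nh Ja) {m : ℝ} (hm : m ∈ Kc) : Jo t m ∈ Icc 0 Je :=
  ⟨by simpa [S.X0] using S.Xmono ht le_rfl hm.1 hm.2,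
    by simpa [S.X2] using S.Xmono ht hm.1 hm.2 le_rfl⟩
lemma ψlip {t : ℝ} (ht : t ∈ Nh Ja) {a c : ℝ} (ha : a ∈ Kc) (hc : c ∈ Kc) :
    |N7 t a - N7 t c| ≤ |a - c| := by
  wlog hac : a ≤ c generalizing a c
  · rw [abs_sub_comm, abs_sub_comm a]; exact this hc ha (le_of_not_ge hac)
  have h := (S.dψ t).ftc (S.nr.intm ht) ha.1 hac hc.2
  have h2 := inoinleofnoleco (a := a) (b := c) (C := 1)
    (f := Zl t) (fun x _ ↦ by rw [rnoeqab, abs_of_nonneg (S.r0 t x)]; exact S.r1 t x)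
  rw [h, rnoeqab, one_mul] at h2
  rw [abs_sub_comm, abs_sub_comm a]; exact h2
lemma ψ1 {t : ℝ} (ht : t ∈ Nh Ja) {m : ℝ} (hm : m ∈ Kc) : |N7 t m| ≤ 2 := by
  have := S.ψlip ht hm (c := 0) J1
  rw [S.ψ0, sub_zero, sub_zero, abs_of_nonneg hm.1] at this
  exact this.trans hm.2
lemma Xtime {t tp : ℝ} (htp : 0 ≤ tp) (htt : tp ≤ t) (ht : t ≤ Ja) {m : ℝ} (hm : m ∈ Kc) :
    |Jo t m - Jo tp m| ≤ ∫ τ in tp..t, |Zs τ m| := by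
  have h := (S.tX m).ftc (S.nv.intt ⟨le_rfl, Zk⟩ hm) htp htt ht
  rw [← h]
  exact iabinleinab htt
end Approx
lemma young_int {f : ℝ → ℝ} {a c s : ℝ} (hac : a ≤ c) (hs : 0 < s)
    (h1 : IntervalIntegrable (fun t ↦ |Nv|) volume a c)
    (h2 : IntervalIntegrable (fun t ↦ Nv ^ 2) volume a c) :
    ∫ t in a..c, |Nv| ≤ s * (∫ t in a..c, Nv ^ 2) + (c - a) / s := by
  calc ∫ t in a..c, |Nv| ≤ ∫ t in a..c, (s * Nv ^ 2 + 1 / s) := by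
        refine iinmoon hac h1 ((h2.const_mul s).add J1) ?_
        intro t _
        have : 0 ≤ s * (|Nv| - 1 / (2*s))^2 := by positivity
        have e : s * (|Nv| - 1 / (2*s))^2 = s * |Nv|^2 - |Nv| + 1 / (4 * s) := by
          field_simp; ring
        rw [sq_abs] at e
        have : 1 / (4 * s) ≤ 1 / s := by
          apply one_div_le_one_div_of_le hs; linarith
        linarith
    _ = _ := by
        rw [iinad (h2.const_mul s) J1,
          iincomu, iinco, smul_eq_mul]
        ring
lemma ii_mono {f : ℝ → ℝ} {a c T : ℝ} (h : IntervalIntegrable f volume 0 T) (ha : 0 ≤ a) (hac : a ≤ c)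
    (hc : c ≤ T) : IntervalIntegrable f volume a c := by
  refine h.mono_set ?_
  rw [uIcc_of_le hac, uIcc_of_le Js]
  exact Icc_subset_Icc ha hc
lemma int_sub_le {f : ℝ → ℝ} {a c T : ℝ} (h : IntervalIntegrable f volume 0 T) (ha : 0 ≤ a) (hac : a ≤ c)
    (hc : c ≤ T) (h0 : ∀ t, 0 ≤ Nv) : ∫ t in a..c, Nv ≤ ∫ t in Jc..T, f t :=
  iinmoin ha hac hc (Eventually.of_forall h0) h
namespace Approx
variable {P : Par} {C e : ℝ} (S : Approx P C e)
lemma XL1time {t tp : ℝ} (htp : 0 ≤ tp) (htt : tp ≤ t) (ht : t ≤ Ja) :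
    ∫m |Jo t m - Jo tp m| ≤ (C + 2) * rsqrt Kr := by
  rcases htt.eq_or_lt with rfl | hlt
  · simp
  have hs : 0 < rsqrt Kr := rsqrtpos.2 Js
  set s := rsqrt Kr with hsd
  have hss : s * s = t - tp := Real.mul_self_sqrt Js
  have htI : t ∈ Icc 0 Ja := ⟨by linarith, ht⟩
  have htIp : tp ∈ Icc 0 Ja := ⟨htp, by linarith⟩
  have hv2 := Ni
  have key : ∀ m ∈ Icc Jc 2, |Jo t m - Jo tp m| ≤ s * (∫ τ in Jc..P.T, Zs τ m ^ 2) + s := by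
    intro m hm
    refine (S.Xtime htp htt ht hm).trans ?_
    have i0 := hv2.intt (t0 := 0) ⟨le_rfl, Zk⟩ hm
    refine (young_int htt hs (ii_mono (S.nv.abs.intt ⟨le_rfl, Zk⟩ hm) htp htt ht)
      (ii_mono i0 htp htt ht)).trans ?_
    rw [← hss, mul_div_assoc, div_self hs.ne', mul_one]
    gcongr
    exact int_sub_le i0 htp htt ht (fun _ ↦ sq_nonneg _)
  have hi : IntervalIntegrable (fun m ↦ ∫ τ in Jc..P.T, Zs τ m ^ 2) volume 0 2 := by
    rw [intervalIntegrable_iff_integrableOn_Ioc_of_le zero_le_two]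
    have := hv2.int.integral_prod_right
    simp_rw [iinofle Zk]
    exact this
  calc ∫m |Jo t m - Jo tp m|
      ≤ ∫m (s * (∫ τ in Jc..P.T, Zs τ m ^ 2) + s) := by
        refine iinmoon zero_le_two ?_
          ((hi.const_mul s).add intervalIntegrable_const) key
        exact ((S.nX.intm htI).sub (S.nX.intm htIp)).abs
    _ = s * (∫ q, Zs‡ ^ 2 ∂ Jd) + 2 * s := by
        rw [iinad (hi.const_mul s) intervalIntegrable_const,
          iincomu, iinco, smul_eq_mul,
          hv2.fubp Zk]
        ring
    _ ≤ (C + 2) * s := by nlinarith [S.hv2]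
lemma tψtime {t tp : ℝ} (htp : 0 ≤ tp) (htt : tp ≤ t) (ht : t ≤ Ja) {m : ℝ} (hm : m ∈ Kc) :
    |t * N7 t m - tp * N7 tp m| ≤ N8 * rsqrt Kr := by
  rcases htt.eq_or_lt with rfl | hlt
  · simp
  have hs : 0 < rsqrt Kr := rsqrtpos.2 Js
  have hsT : rsqrt Kr ≤ rsqrt Ja := Real.sqrt_le_sqrt Js
  set s := rsqrt Kr with hsd
  have hss : s * s = t - tp := Real.mul_self_sqrt Js
  have htd : TD Ja (fun t ↦ t * N7 t m) (fun t ↦ N7 t m + t * S.A t m) := by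
    refine ⟨continuous_id.mul (S.tψ m).1, fun t ht ↦ ?_⟩
    have := (hasDerivAt_id' t).mul ((S.tψ m).2 t ht)
    rw [one_mul] at this
    exact this
  have i1 := S.nψ.intt (t0 := 0) ⟨le_rfl, Zk⟩ hm
  have i2 := ((Nice.ofT (T := Ja) continuous_id).mul S.nA).intt (t0 := 0) ⟨le_rfl, Zk⟩ hm
  have h := htd.ftc (i1.add i2) htp htt ht
  rw [← h]
  refine (iabinleinab htt).trans ?_
  have c1 : Continuous (fun t : ℝ ↦ t * Gl) := continuous_id.mul S.cs
  calc ∫ τ in tp..t, |N7 τ m + τ * S.A τ m| ≤ ∫ τ in tp..t, (2 + C * |τ * Yj τ|) := by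
        refine iinmoon htt (ii_mono (i1.add i2).abs htp htt ht)
          (cin Zn _ _) fun τ hτ ↦ ?_
        have hτ0 : 0 ≤ τ := htp.trans hτ.1
        refine ☾.trans (add_le_add (S.ψ1 ⟨hτ0, hτ.2.trans ht⟩ hm) ?_)
        rw [abs_mul, abs_mul, mul_left_comm, abs_of_nonneg (zero_le_one.trans (S.s1 τ))]
        exact mul_le_mul_of_nonneg_left (S.hA τ m hm) Jy
    _ = 2 * Kr + C * ∫ τ in tp..t, |τ * Yj τ| := by
        rw [iinad intervalIntegrable_const
          ((c1.abs.intervalIntegrable _ _).const_mul C),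
          iincomu, iinco, smul_eq_mul]
        ring
    _ ≤ 2 * Kr + C * (s * C + s) := by
        have := S.C0
        gcongr
        refine (young_int htt hs (c1.abs.intervalIntegrable _ _)
          ((c1.pow 2).intervalIntegrable _ _)).trans ?_
        rw [← hss, mul_div_assoc, div_self hs.ne', mul_one]
        gcongr
        refine (int_sub_le ((c1.pow 2).intervalIntegrable 0 Ja) htp htt ht
          (fun _ ↦ sq_nonneg _)).trans ?_
        simpa [mul_pow] using S.hs2
    _ ≤ _ := by rw [← hss]; nlinarith
end Approx
theorem unifCauchy {P : Par} {C : ℝ} {e : ℕ → ℝ} (S : ∀ i, Approx P C (e i)) :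
    ∃ φ : ℕ → ℕ, StrictMono φ ∧
      (∀ ε > 0, ∃ N, ∀ i ≥ N, ∀ j ≥ N, ∀ t ∈ Icc 0 Ja, ∀ m ∈ Icc Jc 2,
        |t * ☀.ψ t m - t * (S (φ j)).ψ t m| ≤ ε) ∧
      (∀ ε > 0, ∃ N, ∀ i ≥ N, ∀ j ≥ N, ∀ t ∈ Icc 0 Ja,
        ∫m (☀.X t m - (S (φ j)).X t m) ^ 2 ≤ ε) := by
  have C0 := (S 0).C0
  have hT := Zk
  have hL := Uw
  set C1 := 2 * rsqrt Ja + C * (C + 1) + Ja * 2 with hC1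
  have sT := rsqno Ja
  have hC1p : 0 ≤ C * (C+1) := by positivity
  obtain ⟨φ, hφ, h1⟩ := arzela Ja (fun i t m ↦ t * ♪.ψ t m) C1
    (fun i t ht m hm ↦ by
      rw [abs_mul, abs_of_nonneg ht.1]
      have := mul_le_mul ht.2 (♪.ψ1 ht hm) Jy hT
      linarith)
    (by
      intro i t ht tp htp m hm mp hmp
      have a1 : |t * ♪.ψ t m - tp * ♪.ψ tp m| ≤
          N8 * rsqrt |t - tp| := by
        rcases le_total t tp with h | h
        · rw [abs_sub_comm, abs_sub_comm t, abs_of_nonneg Gu]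
          exact ♪.tψtime ht.1 h htp.2 hm
        · rw [abs_of_nonneg Gu]
          exact ♪.tψtime htp.1 h ht.2 hm
      have a2 : |tp * ♪.ψ tp m - tp * ♪.ψ tp mp| ≤ Ja * |m - mp| := by
        rw [← mul_sub, abs_mul, abs_of_nonneg htp.1]
        exact mul_le_mul htp.2 (♪.ψlip htp hm hmp) Jy hT
      have := abs_sub_le (t * ♪.ψ t m) (tp * ♪.ψ tp m) (tp * ♪.ψ tp mp)
      have s1 := rsqno |t - tp|
      have s2 := abs_nonneg (m - mp)
      have : Ja * |m-mp| ≤ C1 * |m - mp| := by gcongr; linarith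
      have : N8 * rsqrt |t - tp| ≤ C1 * rsqrt |t - tp| := by
        gcongr; linarith
      linarith)
  set Y : ℕ → ℝ → ℝ → ℝ := fun i t m ↦ ∫ n in Jc..m, ☀.X t n with hY
  have Xc : ∀ i t, Continuous (☀.X t) := fun i t ↦ (☀.dX t).1
  have Xb : ∀ i, ∀ t ∈ Icc 0 Ja, ∀ m ∈ Icc Jc 2, |☀.X t m| ≤ Je := by
    intro i t ht m hm
    have := ☀.Xmem ht hm
    rw [abs_of_nonneg this.1]; exact this.2
  set C2 := C + 2 + 2 * Je with hC2
  have Ylip : ∀ i, ∀ t ∈ Icc 0 Ja, ∀ m ∈ Icc Jc 2, ∀ mp ∈ Icc Jc 2,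
      |Y i t m - Y i t mp| ≤ Je * |m - mp| := by
    intro i t ht m hm mp hmp
    rw [hY]
    simp only
    rw [intervalIntegral.integral_interval_sub_left Gv
      Gv, ← rnoeqab]
    refine inoinleofnoleco fun x hx ↦ ?_
    refine Xb i t ht x ?_
    exact uIcc_subset_Icc hmp hm (uIoc_subset_uIcc hx)
  obtain ⟨φp, hφp, h2⟩ := arzela Ja Y C2
    (fun i t ht m hm ↦ by
      have := Ylip i t ht m hm 0 J1
      have e0 : Y i t 0 = 0 := by simp [hY]
      rw [e0, sub_zero, sub_zero, abs_of_nonneg hm.1] at this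
      nlinarith [hm.2])
    (by
      intro i t ht tp htp m hm mp hmp
      have b1 : ∀ t tp : ℝ, t ∈ Nh Ja → tp ∈ Nh Ja → tp ≤ t →
          |Y i t m - Y i tp m| ≤ (C + 2) * rsqrt |t - tp| := by
        intro t tp ht htp h
        rw [abs_of_nonneg Gu]
        refine le_trans ?_ (☀.XL1time htp.1 h ht.2)
        simp only [hY]
        rw [← iinsu Gv
          ((Xc i tp).intervalIntegrable _ _)]
        refine (iabinleinab hm.1).trans ?_
        refine iinmoin le_rfl hm.1 hm.2
          (Eventually.of_forall fun _ ↦ abs_nonneg _)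
          (cin (((Xc i t).sub (Xc i tp)).abs) _ _)
      have a1 : |Y i t m - Y i tp m| ≤ (C + 2) * rsqrt |t - tp| := by
        rcases le_total t tp with h | h
        · rw [abs_sub_comm, abs_sub_comm t]; exact b1 tp t htp ht h
        · exact b1 t tp ht htp h
      have a2 := Ylip i tp htp m hm mp hmp
      have := abs_sub_le (Y i t m) (Y i tp m) (Y i tp mp)
      have s1 := rsqno |t - tp|
      have s2 := abs_nonneg (m - mp)
      have : Je * |m-mp| ≤ C2 * |m - mp| := by gcongr; linarith
      have : (C + 2) * rsqrt |t - tp| ≤ C2 * rsqrt |t - tp| := by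
        gcongr; linarith
      linarith)
  refine ⟨φ ∘ φp, hφ.comp hφp, fun ε hε ↦ ?_, fun ε hε ↦ ?_⟩
  · obtain ⟨N, hN⟩ := h1 ε hε
    exact ⟨N, fun i hi j hj t ht m hm ↦ hN _ (hi.trans (hφp.id_le i)) _ (hj.trans (hφp.id_le j)) t ht m hm⟩
  · obtain ⟨N, hN⟩ := h2 (ε / Kd) Jh
    refine ⟨N, fun i hi j hj t ht ↦ ?_⟩
    have hNp := fun m hm ↦ Gs t ht m hm
    set a := φp i with ha
    set c := φp j with hc
    have hd : RD K5
        (fun m ↦ ♥.p t m - ♦.p t m) :=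
      ⟨(Xc a t).sub (Xc c t), fun m hm ↦ ((♥.dX t).2 m hm).sub ((♦.dX t).2 m hm)⟩
    have hdY : RD (fun m ↦ Y a t m - Y c t m) K5 := by
      refine ⟨?_, fun m hm ↦ ?_⟩
      · exact (icopr (fun _ _ ↦ (Xc a t).intervalIntegrable _ _) 0).sub
          (icopr (fun _ _ ↦ (Xc c t).intervalIntegrable _ _) 0)
      · exact (((Xc a t).integral_hasStrictDerivAt 0 m).hasDerivAt.sub
          ((Xc c t).integral_hasStrictDerivAt 0 m).hasDerivAt).hasDerivWithinAt
    have hip := (♥.np.intm ht).sub (♦.np.intm ht)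
    have hix : IntervalIntegrable K5 volume 0 2 :=
      hd.1.intervalIntegrable _ _
    have hp := RD.parts hd hdY hip hix
    have e1 : ∀ m, Ke ^ 2 =
      Ke * Ke := fun m ↦ by ring
    change ∫m Ke ^ 2 ≤ ε
    simp_rw [e1, hp, (S _).X2, (S _).X0]
    simp only [sub_self, zero_mul, zero_sub, neg_le]
    have h3 : |∫m (♥.p t m - ♦.p t m) * (Y a t m - Y c t m)| ≤
        ∫m (ε / Kd) * (♥.p t m + ♦.p t m) := by
      refine (iabinleinab zero_le_two).trans ?_
      refine iinmoon zero_le_two ?_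
        (((♥.np.intm ht).add (♦.np.intm ht)).const_mul _) fun m hm ↦ ?_
      · exact (hip.mul_continuousOn hdY.1.continuousOn).abs
      · rw [abs_mul, mul_comm]
        refine mul_le_mul (hNp m hm) ?_ Jy Jh
        have := ♥.p_pos t m
        have := ♦.p_pos t m
        rw [abs_le]; constructor <;> linarith
    rw [iincomu, iinad
      (♥.np.intm ht) (♦.np.intm ht), (S _).intp ht, (S _).intp ht] at h3
    have h4 : ε / Kd * (Je + Je) = ε := by field_simp; ring
    rw [h4] at h3
    linarith [(abs_le.1 h3).1]
namespace Nice
variable {T : ℝ} {f g : ℝ → ℝ → ℝ}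
lemma iadd (hf : Nice T f) (hg : Nice T g) : ∫ q, f‡ + g‡ ∂ Y5 =
    (∫ q, f‡ ∂ Y5) + ∫ q, g‡ ∂ Y5 := integral_add hf.int hg.int
lemma isub (hf : Nice T f) (hg : Nice T g) : ∫ q, f‡ - g‡ ∂ Y5 =
    (∫ q, f‡ ∂ Y5) - ∫ q, g‡ ∂ Y5 := integral_sub hf.int hg.int
lemma iconst (hT : 0 ≤ T) (c : ℝ) : ∫ _, c ∂ Y5 = 2 * T * c := by
  rw [integral_const, smul_eq_mul, Measure.real, kap, ← univ_prod_univ, Measure.prod_prod]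
  simp [hT]; left; ring
lemma imono (hf : Nice T f) (hg : Nice T g)
    (h : ∀ t ∈ Ioc 0 T, ∀ m ∈ Ioc Jc 2, Nv m ≤ g t m) :
    ∫ q, f‡ ∂ Y5 ≤ ∫ q, g‡ ∂ Y5 :=
  integral_mono_ae hf.int hg.int (ae_kap h)
lemma iofT (hT : 0 ≤ T) {φ : ℝ → ℝ} (hφ : Continuous φ) :
    ∫ q, φ q.1 ∂ Y5 = 2 * ∫ t in Jc..T, φ t := by
  rw [(Nice.ofT (T := T) hφ).fub hT]; simp
end Nice
lemma log_ineq {α K x y : ℝ} (hα : 0 < α) (hα1 : α ≤ 1) (hx : 0 < x) (hy : 0 < y)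
    (hKx : |rlog x| ≤ K) (hKy : |rlog y| ≤ K) :
    (rlog x - rlog y) ^ 2 ≤
      rexp Eh / α * (Uf * (y ^ Ei - x ^ Ei)) := by
  wlog h : y ≤ x generalizing x y
  · have := this hy hx hKy hKx (le_of_not_ge h)
    calc (rlog x - rlog y) ^ 2 = (rlog y - rlog x) ^ 2 := by ring
      _ ≤ _ := this
      _ = _ := by ring
  have hab : rlog y ≤ rlog x := Real.log_le_log hy h
  set a := rlog x with ha
  set b := rlog y with hb
  have ex : x = rexp a := (rexplog hx).symm
  have ey : y = rexp b := (rexplog hy).symm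
  have px : x ^ Ei = rexp Nj := by
    rw [Real.rpow_def_of_pos hx]; congr 1; ring
  have py : y ^ Ei = rexp (-(α * b)) := by
    rw [Real.rpow_def_of_pos hy]; congr 1; ring
  have hk := abs_le.1 hKx
  have hkp := abs_le.1 hKy
  have d0 : 0 ≤ a - b := by linarith
  have h1 : rexp Kn * Za ≤ x - y := by
    have e1 : x = rexp b * rexp Za := by rw [ex, ← rexpadd]; congr 1; ring
    have e2 := radonleex Za
    have e3 : rexp Kn ≤ rexp b := rexleex.2 hkp.1
    calc rexp Kn * Za ≤ rexp b * Za := by gcongr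
      _ ≤ rexp b * (rexp Za - 1) :=
          mul_le_mul_of_nonneg_left Js (rexppos _).le
      _ = x - y := by rw [mul_sub, ← e1, mul_one, ey]
  have h2 : rexp Kn * Ej ≤ y ^ Ei - x ^ Ei := by
    have e1 : y ^ Ei = rexp Nj * rexp Ej := by
      rw [py, ← rexpadd]; congr 1; ring
    have e2 := radonleex Ej
    have e3 : rexp Kn ≤ rexp Nj := rexleex.2 (by nlinarith)
    calc rexp Kn * Ej ≤ rexp Nj * Ej := by gcongr
      _ ≤ rexp Nj * (rexp Ej - 1) :=
          mul_le_mul_of_nonneg_left Js (rexppos _).le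
      _ = _ := by rw [mul_sub, ← e1, mul_one, px]
  have h3 := mul_le_mul h1 h2 Jh ((by positivity : Jc ≤ _).trans h1)
  have e4 : rexp Eh * (rexp Kn * rexp Kn) = 1 := by
    rw [← rexpadd, ← rexpadd, ← Real.exp_zero]; congr 1; ring
  calc Za ^ 2 = rexp Eh * (rexp Kn * rexp Kn) * Za ^ 2 := by rw [e4, one_mul]
    _ = rexp Eh / α * (rexp Kn * Za * (rexp Kn * Ej)) := by
        field_simp
    _ ≤ _ := by gcongr
lemma sub_log {K x y : ℝ} (hx : 0 < x) (hy : 0 < y)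
    (hKx : |rlog x| ≤ K) (hKy : |rlog y| ≤ K) :
    |x - y| ≤ rexp K * |rlog x - rlog y| := by
  wlog h : y ≤ x generalizing x y
  · have := this hy hx hKy hKx (le_of_not_ge h)
    rw [abs_sub_comm, abs_sub_comm (rlog x)]; exact this
  have hab : rlog y ≤ rlog x := Real.log_le_log hy h
  rw [abs_of_nonneg Gu, abs_of_nonneg (sub_nonneg.2 hab)]
  have e2 := radonleex (rlog y - rlog x)
  rw [Real.exp_sub, rexplog hx, rexplog hy] at e2
  have h1 : x - y ≤ x * (rlog x - rlog y) := by
    have : y = x * (y / x) := by field_simp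
    nlinarith
  refine h1.trans (mul_le_mul_of_nonneg_right ?_ (sub_nonneg.2 hab))
  rw [← rexplog hx]
  exact rexleex.2 (by simpa using (abs_le.1 hKx).2)
/-- doubly-indexed quantity becoming small -/
def Cau (F : ℕ → ℕ → ℝ) : Prop := ∀ ε > 0, ∃ N, ∀ i ≥ N, ∀ j ≥ N, F i j ≤ ε
lemma Cau.sub {F : ℕ → ℕ → ℝ} (h : Cau F) {φ : ℕ → ℕ} (hφ : StrictMono φ) :
    Cau (fun i j ↦ F Z3 (φ j)) := fun ε hε ↦ by
  obtain ⟨N, hN⟩ := h ε hε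
  exact ⟨N, fun i hi j hj ↦ hN _ Gw _ Gx⟩
lemma young (a c δ : ℝ) (hδ : 0 < δ) : a * c ≤ δ * a ^ 2 + c ^ 2 / δ := by
  have : 0 ≤ (δ * a - c) ^ 2 / δ := by positivity
  have e : (δ * a - c) ^ 2 / δ = δ * a ^ 2 - 2 * (a * c) + c ^ 2 / δ := by field_simp; ring
  rw [e] at this
  have : 0 ≤ δ * a ^ 2 + c ^ 2 / δ := by positivity
  linarith
namespace Approx
variable {P : Par} {C e : ℝ} (S : Approx P C e)
lemma nP : Nice Ja (fun t m ↦ Jv * Zr ^ Jk) := by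
  refine Nice.of_le (g := fun t m ↦ Jv * Gl) ?_ (Nice.ofT (by have := S.cs; fun_prop)) ?_
  · exact (measurable_const.mul (S.np.1.pow_const _))
  · intro t _ m _
    have hp := S.p_pos t m
    have := Gy
    rw [abs_of_nonneg Jh]
    gcongr
    rw [Real.rpow_neg hp.le, ← Real.inv_rpow hp.le]
    have h1 := S.hps t m
    rw [one_div] at h1
    calc (Zr)⁻¹ ^ J3 ≤ Gl ^ J3 := Real.rpow_le_rpow Jh h1 P.hα0.le
      _ ≤ Gl ^ Y1 := Real.rpow_le_rpow_of_exponent_le (S.s1 t) P.hα1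
      _ = Yj t := rrpowone _
lemma nlog : Nice Ja (fun t m ↦ rlog (Zr)) :=
  Nice.of_le (g := fun t _ ↦ Gl) (Real.measurable_log.comp S.np.1) (Nice.ofT S.cs)
    fun t _ m _ ↦ S.hls t m
lemma e0 {P : Par} {C e : ℝ} (S : Approx P C e) : 0 ≤ e := le_trans (integral_nonneg fun q ↦ by positivity) S.eA
lemma hq1 : ∫t S.q t ≤ C + Ja := by
  calc ∫t S.q t ≤ ∫t (S.q t ^ 2 + 1) := by
        refine iinmoon Zk (S.cq.intervalIntegrable _ _)
          (cin (by have := S.cq; fun_prop) _ _) fun t _ ↦ ?_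
        nlinarith [sq_nonneg (S.q t - 1)]
    _ ≤ _ := by
        rw [iinad (f := fun t ↦ S.q t ^ 2)
          (cin (S.cq.pow 2) _ _) J1]
        have := S.hq2
        simp; linarith
lemma absζ {ep : ℝ} (Sd : Approx P C ep) {t : ℝ} (ht : t ∈ Nh Ja) :
    ∫m |Zr - Kf| ≤ 2 * Je := by
  calc ∫m |Zr - Kf| ≤ ∫m (Zr + Kf) := by
        refine iinmoon zero_le_two (♫.abs.intm ht)
          ((S.np.add Sd.np).intm ht) fun m _ ↦ ?_
        have := S.p_pos t m
        have := Sd.p_pos t m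
        rw [abs_le]; constructor <;> linarith
    _ = 2 * Je := by
        rw [iinad (S.np.intm ht) (Sd.np.intm ht), S.intp ht, Sd.intp ht]; ring
lemma drift {t m : ℝ} (ht : t ∈ Nh Ja) (hm : m ∈ Kc) :
    |Zs t m + Zq Zb + Zl t m * Jm Zb| ≤ |Zs t m| + 2 * Jg := by
  have h1 := P.bB Zb
  have h2 := Gz _ (S.Xmem ht hm)
  have h3 : |Ux * Jm Zb| ≤ Jg := by
    rw [abs_mul, abs_of_nonneg (S.r0 t m)]
    have := S.r1 t m
    nlinarith [abs_nonneg (Jm Zb), S.r0 t m]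
  have := abs_add_three (Y2) (Zq Zb) (Ux * Jm Zb)
  linarith
lemma ndrift : Nice Ja (fun t m ↦ Y2 + Zq Zb + Ux * Jm Zb) :=
  (S.nv.add (S.nX.comp P.bcont)).add (S.nr.mul (S.nX.comp P.Wcont))
lemma quad {ep : ℝ} (Sd : Approx P C ep) {ε δ : ℝ} (hδ : 0 < δ)
    (hX : ∀ t ∈ Icc 0 Ja, ∫m Z7 ^ 2 ≤ ε) :
    ∫ q, Jv * ((Jt‡ - Z6‡) *
      (Z6‡ ^ Jk - Jt‡ ^ Jk)) ∂ Jd ≤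
      δ * (6 * C + 96 * Jg ^ 2 * Ja) + Ja * ε / δ + (e + ep) * Uy := by
  have hB := Y6
  have hT := Zk
  have nq : Nice Ja (fun t m ↦ J6 * (Jv * Kf ^ Jk) -
      J6 * Ek) :=
    (♫.mul Sd.nP).sub (♫.mul S.nP)
  have nb : Nice Ja (fun t m ↦ δ * Zh +
      Z7 ^ 2 / δ) := by
    have := (((Nice.const Ja (δ * 3)).mul (((S.nv.pow 2).add (Sd.nv.pow 2)).add
      (Nice.const Ja (16 * Jg ^ 2)))).add (☂.mul (Nice.const Ja δ⁻¹)))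
    simpa [mul_assoc, div_eq_mul_inv] using this
  have key : ∀ t ∈ Ioc 0 Ja, ∫m (J6 * (Jv * Kf ^ Jk) -
      J6 * Ek) ≤
      (∫m (δ * Zh +
      Z7 ^ 2 / δ)) + Yt * Kd := by
    intro t ht
    have htI : t ∈ Icc 0 Ja := Ioc_subset_Icc_self ht
    have hd : RD (fun m ↦ Jo t m - Sd.X t m) (fun m ↦ Zr - Kf) :=
      ⟨Ed.1.sub (Sd.dX t).1, fun m hm ↦ (Ed.2 m hm).sub ((Sd.dX t).2 m hm)⟩
    have hi := ♫.intm htI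
    have q1 := S.hQ t ht _ _ hd hi (by simp [S.X0, Sd.X0]) (by simp [S.X2, Sd.X2])
    have q2 := Sd.hQ t ht _ _ hd hi (by simp [S.X0, Sd.X0]) (by simp [S.X2, Sd.X2])
    have a1 := S.absζ Sd htI
    have g1 : e * S.q t * (∫m |Zr - Kf|) ≤ e * S.q t * Kd :=
      mul_le_mul_of_nonneg_left a1 (mul_nonneg S.e0 (S.q0 t))
    have g2 : ep * Sd.q t * (∫m |Zr - Kf|) ≤ ep * Sd.q t * Kd :=
      mul_le_mul_of_nonneg_left a1 (mul_nonneg Sd.e0 (Sd.q0 t))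
    have nX := S.nX.sub Sd.nX
    have g3 : (∫m (Sd.v t m + Zq K6 + El * Jm K6) *
          Z7) -
        (∫m G0 *
          Z7) ≤ ∫ m in Jc..2,
          (δ * Zh + Z7 ^ 2 / δ) := by
      rw [← iinsu ((Sd.ndrift.mul nX).intm htI) ((S.ndrift.mul nX).intm htI)]
      refine iinmoon zero_le_two
        (((Sd.ndrift.mul nX).sub (S.ndrift.mul nX)).intm htI) (nb.intm htI) fun m hm ↦ ?_
      rw [← sub_mul]
      refine (young _ _ δ hδ).trans ?_
      gcongr
      have d1 := S.drift htI hm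
      have d2 := Sd.drift htI hm
      rw [← sq_abs, ← sq_abs (Y2), ← sq_abs (Sd.v t m)]
      have d3 := abs_sub (Sd.v t m + Zq K6 + El * Jm K6)
        G0
      set z := |Sd.v t m + Zq K6 + El * Jm K6 -
        G0|
      have d4 : z ≤ |Y2| + |Sd.v t m| + 4 * Jg := by linarith
      have z0 : 0 ≤ z := abs_nonneg _
      calc z ^ 2 ≤ (|Y2| + |Sd.v t m| + 4 * Jg) ^ 2 := by gcongr
        _ ≤ _ := by
          nlinarith [sq_nonneg (|Y2| - |Sd.v t m|), sq_nonneg (|Y2| - 4 * Jg),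
            sq_nonneg (|Sd.v t m| - 4 * Jg)]
    rw [iinsu ((♫.mul Sd.nP).intm htI)
      ((♫.mul S.nP).intm htI)]
    have := (abs_le.1 q1).1
    have := (abs_le.1 q2).2
    nlinarith
  have i3 : Continuous (fun t ↦ Yt * Kd) := by
    have := S.cq; have := Sd.cq; fun_prop
  calc _ = ∫ q, ((Jt‡ - Z6‡) * (Jv * Z6‡ ^ Jk) -
      (Jt‡ - Z6‡) * (Jv * Jt‡ ^ Jk)) ∂ Jd := by
        congr 1; ext q; ring
    _ = ∫t ∫m (J6 * (Jv * Kf ^ Jk) -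
      J6 * Ek) := nq.fub hT
    _ ≤ ∫t ((∫m (δ * Zh +
      Z7 ^ 2 / δ)) + Yt * Kd) := by
        refine intervalIntegral.integral_mono_on_of_le_Ioo hT (nq.intT hT)
          ((nb.intT hT).add (i3.intervalIntegrable _ _)) fun t ht ↦ key t (Ioo_subset_Ioc_self ht)
    _ = (∫t ∫m (δ * Zh +
      Z7 ^ 2 / δ)) + ∫t Yt * Kd := by
        rw [iinad (nb.intT hT) (i3.intervalIntegrable _ _)]
    _ ≤ _ := by
        rw [← nb.fub hT]
        have hv : ∫ q, δ * (3 * (Zs‡ ^ 2 + Sd.v‡ ^ 2 + 16 * Jg ^ 2)) +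
            Em ^ 2 / δ ∂ Jd =
            δ * (3 * ((∫ q, Zs‡ ^ 2 ∂ Jd) + (∫ q, Sd.v‡ ^ 2 ∂ Jd) +
              32 * Jg ^ 2 * Ja)) + (∫ q, Em ^ 2 ∂ Jd) / δ := by
          have j1 := Ni
          have j2 := (Sd.nv.pow 2)
          have j3 := ((S.nX.sub Sd.nX).pow 2)
          simp_rw [div_eq_mul_inv]
          rw [Nice.iadd ((Nice.const _ δ).mul ((Nice.const _ 3).mul ((j1.add j2).add (Nice.const _ _))))
            (j3.mul (Nice.const _ _)), integral_const_mul, integral_const_mul,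
            Nice.iadd (j1.add j2) (Nice.const _ _), Nice.iadd j1 j2, Nice.iconst hT, integral_mul_const]
          ring
        rw [hv]
        have hx : ∫ q, Em ^ 2 ∂ Jd ≤ Ja * ε := by
          rw [☂.fub hT]
          calc _ ≤ ∫t ε := iinmoon hT
                  (☂.intT hT) J1 hX
            _ = _ := by simp
        have hq : ∫t Yt * Kd ≤
            (e + ep) * Uy := by
          rw [iinmuco, iinad
            ((S.cq.intervalIntegrable _ _).const_mul _) ((Sd.cq.intervalIntegrable _ _).const_mul _),
            iincomu, iincomu]
          have h1 := mul_le_mul_of_nonneg_left S.hq1 S.e0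
          have h2 := mul_le_mul_of_nonneg_left Sd.hq1 Sd.e0
          have := Uw
          nlinarith
        have := S.hv2
        have := Sd.hv2
        have hdd : (∫ q, Em ^ 2 ∂ Jd) / δ ≤ Ja * ε / δ := by gcongr
        nlinarith
end Approx
namespace Approx
variable {P : Par} {C e : ℝ} (S : Approx P C e)
lemma nu : Nice Ja (fun t m ↦ t ^ 2 * rlog (Zr)) :=
  (Nice.ofT Zn).mul S.nlog
lemma cts : Continuous (fun t ↦ t ^ 2 * Gl ^ 2) := by have := S.cs; fun_prop
lemma upair {ep : ℝ} (Sd : Approx P C ep) {K η : ℝ} (hK : 0 < K) (hη : 0 < η) :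
    ∫ q, |q.1 ^ 2 * rlog Jt‡ - q.1 ^ 2 * rlog Z6‡| ∂ Jd ≤
    8 * C / K + Ja ^ 2 * (η * (2 * Ja)) + Ja ^ 2 * Yk *
    ∫ q, Jv * ((Jt‡ - Z6‡) *
      (Z6‡ ^ Jk - Jt‡ ^ Jk)) ∂ Jd := by
  have hT := Zk
  have hα := Eo
  have hl := Gy
  have nq : Nice Ja (fun t m ↦ Jv * (J6 *
      Y3)) := by
    have : Nice Ja (fun t m ↦ J6 * (Jv * Kf ^ Jk) -
      J6 * Ek) :=
      (♫.mul Sd.nP).sub (♫.mul S.nP)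
    convert this using 3
    ring
  have n1 : Nice Ja (fun t _ ↦ 2 / K * Jj) := by
    have := S.cts; have := Sd.cts
    exact Nice.ofT Zn
  have n2 := (Nice.const Ja (Ja ^ 2 * η))
  have n3 := (Nice.const Ja (Ja ^ 2 * Yk)).mul nq
  refine (Nice.imono (S.nu.sub Sd.nu).abs ((n1.add n2).add n3) fun t ht m hm ↦ ?_).trans ?_
  · have lx := S.hls t m
    have ly := Sd.hls t m
    have hq0 : 0 ≤ J6 * Y3 := by
      have h0 := log_ineq hα P.hα1 Ep (Sd.p_pos t m)
        (lx.trans (le_max_left _ (Um t))) (ly.trans (le_max_right (Gl) _))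
      have h1 := (sq_nonneg _).trans h0
      have h2 : 0 < rexp (2 * max (Gl) (Um t)) / J3 := by positivity
      nlinarith [(mul_nonneg_iff_of_pos_left h2).1 h1]
    rw [← mul_sub, abs_mul, abs_of_nonneg Nx]
    have tT : t ^ 2 ≤ Ja ^ 2 := pow_le_pow_left₀ ht.1.le ht.2 2
    set d := rlog (Zr) - rlog (Kf) with hd
    have s1 := S.s1 t
    have s2 := Sd.s1 t
    by_cases hb : Yj t ≤ K ∧ Um t ≤ K
    · have h0 := log_ineq hα P.hα1 Ep (Sd.p_pos t m) (lx.trans hb.1) (ly.trans hb.2)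
      have y := young 1 |d| η hη
      rw [sq_abs] at y
      have h3 : t ^ 2 * |d| ≤ Ja ^ 2 * (η + (rexp Eh / J3 *
          (J6 * Y3)) / η) := by
        gcongr
        refine le_trans ?_ (add_le_add_right (div_le_div_of_nonneg_right h0 hη.le) η)
        linarith
      have h4 : 0 ≤ 2 / K * Jj := by positivity
      refine h3.trans ?_
      have h5 : Ja ^ 2 * (η + (rexp Eh / J3 *
          (J6 * Y3)) / η) =
        Ja ^ 2 * η + Ja ^ 2 * Yk * (Jv * (J6 *
        Y3)) := by
        field_simp
      rw [h5]; linarith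
    · have h4 : 0 ≤ Ja ^ 2 * η := by positivity
      have h5 : 0 ≤ Ja ^ 2 * Yk * (Jv * (J6 *
        Y3)) := by positivity
      have h6 : |d| ≤ Gl + Um t := ☁.trans (add_le_add lx ly)
      have h7 : Yj t + Um t ≤ 2 / K * (Gl ^ 2 + Um t ^ 2) := by
        rw [div_mul_eq_mul_div, le_div_iff₀ hK]
        rcases not_and_or.1 hb with h | h
        · nlinarith [sq_nonneg (Gl - Um t), not_le.1 h]
        · nlinarith [sq_nonneg (Gl - Um t), not_le.1 h]
      have h8 : t ^ 2 * |d| ≤ t ^ 2 * (2 / K * (Gl ^ 2 + Um t ^ 2)) := by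
        gcongr; exact h6.trans h7
      linarith [h8]
  · rw [Nice.iadd (n1.add n2) n3, Nice.iadd n1 n2, Nice.iconst hT, integral_const_mul (2 / K),
      integral_const_mul (Ja ^ 2 * Yk),
      Nice.iadd (Nice.ofT S.cts) (Nice.ofT Sd.cts), Nice.iofT hT S.cts, Nice.iofT hT Sd.cts]
    have h1 := S.hs2
    have h2 := Sd.hs2
    have : 2 / K * (2 * (∫t t ^ 2 * Gl ^ 2) +
        2 * (∫t t ^ 2 * Um t ^ 2)) ≤ 2 / K * (2 * C + 2 * C) := by gcongr
    have e8 : 2 / K * (2 * C + 2 * C) = 8 * C / K := by ring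
    rw [e8] at this
    linarith
lemma ppair {ep : ℝ} (Sd : Approx P C ep) {K t0 : ℝ} (hK : 0 < K) (ht0 : 0 < t0) (hT0 : t0 ≤ Ja) :
    ∫ q, |Jt‡ - Z6‡| ∂ Jd ≤
    2 * Je * t0 + 4 * Je * C / Z0 + rexp K / t0 ^ 2 *
      ∫ q, |q.1 ^ 2 * rlog Jt‡ - q.1 ^ 2 * rlog Z6‡| ∂ Jd := by
  have hT := Zk
  have hL := Uw
  have np := ♫.abs
  have nu := (S.nu.sub Sd.nu).abs
  have iF := np.intT hT
  have c1 := S.cts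
  have c2 := Sd.cts
  have cc : Continuous (fun t ↦ 2 * Je / Z0 * Jj) := by
    fun_prop
  have iG : IntervalIntegrable (fun t ↦ 2 * Je / Z0 * Jj
      + rexp K / t0 ^ 2 * ∫m |t ^ 2 * rlog (Zr) - t ^ 2 * rlog (Kf)|)
      volume 0 Ja := (cc.intervalIntegrable _ _).add ((nu.intT hT).const_mul _)
  rw [np.fub hT, ← iinadadin
    (ii_mono iF le_rfl ht0.le hT0) (ii_mono iF ht0.le hT0 le_rfl)]
  have a1 : ∫ t in Jc..t0, ∫m |Zr - Kf| ≤ 2 * Je * t0 := by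
    calc _ ≤ ∫ t in Jc..t0, 2 * Je := iinmoon ht0.le
            (ii_mono iF le_rfl ht0.le hT0) J1 fun t ht ↦ S.absζ Sd ⟨ht.1, ht.2.trans hT0⟩
      _ = _ := by simp; ring
  have a2 : ∫ t in t0..P.T, ∫m |Zr - Kf| ≤
      ∫ t in t0..P.T, (2 * Je / Z0 * Jj
      + rexp K / t0 ^ 2 * ∫m |t ^ 2 * rlog (Zr) - t ^ 2 * rlog (Kf)|) := by
    refine iinmoon hT0 (ii_mono iF ht0.le hT0 le_rfl)
      (ii_mono iG ht0.le hT0 le_rfl) fun t ht ↦ ?_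
    have htI : t ∈ Icc 0 Ja := ⟨ht0.le.trans ht.1, ht.2⟩
    have tt : t0 ^ 2 ≤ t ^ 2 := pow_le_pow_left₀ ht0.le ht.1 2
    have i0 : 0 ≤ ∫m |t ^ 2 * rlog (Zr) - t ^ 2 * rlog (Kf)| :=
      iinno zero_le_two fun _ _ ↦ abs_nonneg _
    have s1 := S.s1 t
    have s2 := Sd.s1 t
    by_cases hb : Yj t ≤ K ∧ Um t ≤ K
    · have : ∫m |Zr - Kf| ≤ ∫m rexp K / t0 ^ 2 *
          |t ^ 2 * rlog (Jt t m) - t ^ 2 * rlog (Z6 t m)| := by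
        refine iinmoon zero_le_two (np.intm htI)
          ((nu.intm htI).const_mul _) fun m hm ↦ ?_
        refine (sub_log Ep (Sd.p_pos t m) ((S.hls t m).trans hb.1)
          ((Sd.hls t m).trans hb.2)).trans ?_
        rw [← mul_sub, abs_mul, abs_of_nonneg Nx, div_mul_eq_mul_div, mul_div_assoc]
        gcongr
        rw [le_div_iff₀ Jh, mul_comm]
        gcongr
      rw [iincomu] at this
      have : 0 ≤ 2 * Je / Z0 * Jj := by positivity
      linarith
    · have h1 : 2 * Je ≤ 2 * Je / Z0 * Jj := by
        rw [div_mul_eq_mul_div, le_div_iff₀ Jh]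
        have : t0 ^ 2 * K ^ 2 ≤ t ^ 2 * Gl ^ 2 + t ^ 2 * Um t ^ 2 := by
          rcases not_and_or.1 hb with h | h
          · have := mul_le_mul tt (pow_le_pow_left₀ hK.le (not_le.1 h).le 2) Jh Jh
            nlinarith [sq_nonneg (t * Um t)]
          · have := mul_le_mul tt (pow_le_pow_left₀ hK.le (not_le.1 h).le 2) Jh Jh
            nlinarith [sq_nonneg (t * Gl)]
        gcongr
      have h2 := S.absζ Sd htI
      have : 0 ≤ rexp K / t0 ^ 2 *
        ∫m |t ^ 2 * rlog (Zr) - t ^ 2 * rlog (Kf)| := by positivity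
      linarith
  have a3 := int_sub_le iG ht0.le hT0 le_rfl (fun t ↦ by
    have : 0 ≤ ∫m |t ^ 2 * rlog (Zr) - t ^ 2 * rlog (Kf)| :=
      iinno zero_le_two fun _ _ ↦ abs_nonneg _
    positivity)
  rw [iinad (cc.intervalIntegrable _ _) ((nu.intT hT).const_mul _),
    iincomu, iincomu, ← nu.fub hT,
    iinad (c1.intervalIntegrable _ _) (c2.intervalIntegrable _ _)] at a3
  have h1 := S.hs2
  have h2 := Sd.hs2
  have a4 : 2 * Je / Z0 * ((∫t t ^ 2 * Gl ^ 2) +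
        (∫t t ^ 2 * Um t ^ 2)) ≤ 2 * Je / Z0 * (C + C) := by gcongr
  have e8 : 2 * Je / Z0 * (C + C) = 4 * Je * C / Z0 := by ring
  rw [e8] at a4
  linarith
end Approx
section
variable {P : Par} {C : ℝ} {e : ℕ → ℝ} (S : ∀ i, Approx P C (e i))
lemma small_mul {a ε : ℝ} (ha : 0 ≤ a) (hε : 0 < ε) : ∃ δ > 0, a * δ ≤ ε :=
  ⟨ε / (a + 1), by positivity, by
    rw [mul_div_assoc', div_le_iff₀ Jh]; nlinarith⟩
lemma quadCau (he : Tendsto e atTop Zx)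
    (hX : ∀ ε > 0, ∃ N, ∀ i ≥ N, ∀ j ≥ N, ∀ t ∈ Icc 0 Ja,
        ∫m (♪.X t m - ☃.X t m) ^ 2 ≤ ε) :
    Cau fun i j ↦ ∫ q, Jv * ((♪.p‡ - ☃.p‡) *
      (☃.p‡ ^ Jk - ♪.p‡ ^ Jk)) ∂ Jd := by
  intro ε hε
  have hC := (S 0).C0
  have hT := P.hT
  have hL := Uw
  obtain ⟨δ, hδ, h1⟩ := small_mul (a := 6 * C + 96 * Jg ^ 2 * Ja) (ε := ε / 3) Jh Jh
  obtain ⟨ε1, hε1, h2⟩ := small_mul (a := Ja / δ) (ε := ε / 3) Jh Jh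
  obtain ⟨ε2, hε2, h3⟩ := small_mul (a := 2 * Uy) (ε := ε / 3) Jh Jh
  obtain ⟨N1, hN1⟩ := hX ε1 hε1
  obtain ⟨N2, hN2⟩ := eventually_atTop.1 (he.eventually (ge_mem_nhds hε2))
  refine ⟨max N1 N2, fun i hi j hj ↦ ?_⟩
  have hi1 := le_of_max_le_left hi
  have hj1 := le_of_max_le_left hj
  have b := ♪.quad (S j) hδ (hN1 i hi1 j hj1)
  have b1 := hN2 i (le_of_max_le_right hi)
  have b2 := hN2 j (le_of_max_le_right hj)
  have b3 : (e i + e j) * Uy ≤ (ε2 + ε2) * Uy := by gcongr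
  have b4 : Ja * ε1 / δ = Ja / δ * ε1 := by ring
  rw [b4] at b
  linarith
lemma uCau (h : Cau fun i j ↦ ∫ q, Jv * ((♪.p‡ - ☃.p‡) *
      (☃.p‡ ^ Jk - ♪.p‡ ^ Jk)) ∂ Jd) :
    Cau fun i j ↦ ∫ q, |q.1 ^ 2 * rlog ♪.p‡ - q.1 ^ 2 * rlog ☃.p‡|
      ∂ Jd := by
  intro ε hε
  have hC := (S 0).C0
  have hT := P.hT
  have hL := Uw
  have hα := Eo
  have hl := Gy
  obtain ⟨δ, hδ, h1⟩ := small_mul (a := 8 * C) (ε := ε / 3) Jh Jh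
  obtain ⟨η, hη, h2⟩ := small_mul (a := Ja ^ 2 * (2 * Ja)) (ε := ε / 3) Jh Jh
  obtain ⟨ε1, hε1, h3⟩ := small_mul (a := Ja ^ 2 * (rexp (2 * δ⁻¹) / (J3 * Jv * η)))
    (ε := ε / 3) Jh Jh
  obtain ⟨N, hN⟩ := h ε1 hε1
  refine ⟨N, fun i hi j hj ↦ ?_⟩
  have b := ♪.upair (S j) (K := δ⁻¹) Jh hη
  have b3 := mul_le_mul_of_nonneg_left (Gs)
    (by positivity : 0 ≤ Ja ^ 2 * (rexp (2 * δ⁻¹) / (J3 * Jv * η)))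
  rw [div_inv_eq_mul] at b
  linarith
lemma pCau (h : Cau fun i j ↦ ∫ q, |q.1 ^ 2 * rlog ♪.p‡ -
      q.1 ^ 2 * rlog ☃.p‡| ∂ Jd) :
    Cau fun i j ↦ ∫ q, |♪.p‡ - ☃.p‡| ∂ Jd := by
  intro ε hε
  have hC := (S 0).C0
  have hT := P.hT
  have hL := Uw
  obtain ⟨t1, ht1, h1⟩ := small_mul (a := 2 * Je) (ε := ε / 3) Jh Jh
  set t0 := min t1 Ja with ht0d
  have ht0 : 0 < t0 := lt_min ht1 hT
  obtain ⟨η, hη, h2⟩ := small_mul (a := 4 * Je * C / t0 ^ 2) (ε := ε / 3) Jh Jh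
  set K := (rsqrt η)⁻¹ with hKd
  have hs : 0 < rsqrt η := rsqrtpos.2 hη
  obtain ⟨ε1, hε1, h3⟩ := small_mul (a := rexp K / t0 ^ 2)
    (ε := ε / 3) Jh Jh
  obtain ⟨N, hN⟩ := h ε1 hε1
  refine ⟨N, fun i hi j hj ↦ ?_⟩
  have b := ♪.ppair (S j) (K := K) (t0 := t0) Jh ht0 (min_le_right _ _)
  have b3 := mul_le_mul_of_nonneg_left (Gs)
    (by positivity : 0 ≤ rexp K / t0 ^ 2)
  have b4 : 2 * Je * t0 ≤ 2 * Je * t1 := by gcongr; exact min_le_left _ _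
  have b5 : 4 * Je * C / Z0 = 4 * Je * C / t0 ^ 2 * η := by
    rw [hKd, inv_pow, Real.sq_sqrt hη.le]; field_simp
  rw [b5] at b
  linarith
end
instance (T : ℝ) : IsFiniteMeasure Y5 := by unfold kap; infer_instance
theorem pLimit {P : Par} {C : ℝ} {e : ℕ → ℝ} (S : ∀ i, Approx P C (e i))
    (he : Tendsto e atTop Zx) :
    ∃ φ : ℕ → ℕ, StrictMono φ ∧
      (∀ ε > 0, ∃ N, ∀ i ≥ N, ∀ j ≥ N, ∀ t ∈ Icc 0 Ja, ∀ m ∈ Icc Jc 2,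
        |t * ☀.ψ t m - t * (S (φ j)).ψ t m| ≤ ε) ∧
      (∀ ε > 0, ∃ N, ∀ i ≥ N, ∀ j ≥ N, ∀ t ∈ Icc 0 Ja,
        ∫m (☀.X t m - (S (φ j)).X t m) ^ 2 ≤ ε) ∧
      ∃ p : ℝ → ℝ → ℝ, Measurable (fun q : ℝˣ ↦ p‡) ∧ (∀ t m, 0 < p t m) ∧
        (∀ t, IntervalIntegrable (p t) volume 0 2) ∧ (∀ t, ∫m p t m = Je) ∧
        Integrable (fun q : ℝˣ ↦ p‡) Jd ∧
        (∀q Tendsto (fun i ↦ ☀.p‡) atTop (𝓝 p‡)) ∧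
        Tendsto (fun i ↦ ∫ q, |☀.p‡ - p‡| ∂ Jd) atTop Zx ∧
        (∀ᵐ t ∂ Ny, ∀ m ∈ Icc Jc 2,
          Tendsto (fun i ↦ ☀.X t m) atTop (𝓝 (∫ n in Jc..m, p t n))) := by
  have hT := Zk
  have hL := Uw
  obtain ⟨φ1, hφ1, hψ, hX⟩ := unifCauchy S
  have hu := uCau _ (quadCau (fun i ↦ S (φ1 i)) (he.comp hφ1.tendsto_atTop) hX)
  have hp := pCau _ hu
  obtain ⟨g, gm, gi, hg⟩ := cauchyL1 _ (fun i ↦ (S (φ1 i)).nu.int) hu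
  obtain ⟨φ2, hφ2, hg2⟩ := aeSubseq (fun i (q : ℝˣ) ↦ q.1 ^ 2 * rlog (S (φ1 i)).p‡ - g q)
    (fun i ↦ (S (φ1 i)).nu.int.sub gi) hg
  obtain ⟨G, Gm, Gi, hG⟩ := cauchyL1 _ (fun i ↦ (S (φ1 i)).np.int) hp
  have hGp := hG.comp hφ2.tendsto_atTop
  obtain ⟨φ3, hφ3, hG3⟩ := aeSubseq (fun i (q : ℝˣ) ↦ ☎.p‡ - G q)
    (fun i ↦ ☎.np.int.sub Gi) hGp
  have hGpp := hGp.comp hφ3.tendsto_atTop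
  have Ii : ∀ k, Integrable (fun q : ℝˣ ↦ ☐.p‡ - G q) Jd :=
    fun k ↦ ☐.np.int.sub Gi
  obtain ⟨φ4, hφ4, hF⟩ := aeSubseq (μ := volume.restrict (Ioc 0 Ja))
    (fun i t ↦ ∫M |(S (φ1 (φ2 (φ3 i)))).p t m - G Kb|)
    (fun i ↦ (Ii _).abs.integral_prod_left) (by
      refine hGpp.congr fun i ↦ ?_
      have := integral_prod _ (Ii (φ1 (φ2 (φ3 i)))).abs
      refine this.trans (integral_congr_ae (Eventually.of_forall fun t ↦ ?_))
      simp only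
      rw [abs_of_nonneg (integral_nonneg fun _ ↦ abs_nonneg _)])
  -- the limit
  set pp : ℝ → ℝ → ℝ := fun t m ↦ rexp (g Kb / t ^ 2) with hpp
  have ppm : Measurable (fun q : ℝˣ ↦ pp‡) := by
    simp only [hpp]
    exact Real.measurable_exp.comp (gm.div (measurable_fst.pow_const 2))
  have t0 : ∀q 0 < q.1 := ae_kap fun t ht m hm ↦ ht.1
  have conv : ∀ᵐ q ∂ Jd,
      Tendsto (fun i ↦ ☎.p‡) atTop (𝓝 pp‡) := by
    filter_upwards [hg2, t0] with q h h0
    have h1 : Tendsto (fun i ↦ rexp ((q.1 ^ 2 * rlog (☎.p‡) - g q + g q) / q.1 ^ 2))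
        atTop (𝓝 (rexp ((0 + g q) / q.1 ^ 2))) :=
      (Real.continuous_exp.tendsto _).comp ((h.add_const _).div_const _)
    simp only [zero_add] at h1
    refine h1.congr fun i ↦ ?_
    rw [sub_add_cancel, mul_div_cancel_left₀ _ Jh, rexplog ((S _).p_pos _ _)]
  have Gpp : ∀q G q = pp‡ := by
    filter_upwards [hG3, conv] with q h1 h2
    have h3 := h1.add_const (G q)
    simp only [sub_add_cancel, zero_add] at h3
    exact tendsto_nhds_unique h3 (h2.comp hφ3.tendsto_atTop)
  set p : ℝ → ℝ → ℝ := fun t m ↦ open Classical in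
    if ∫⁻ n in Ioc Jc 2, ENNReal.ofReal (pp t n) = ENNReal.ofReal Je then pp t m else Je / 2 with hpd
  have good : ∀ᵐ t ∂ Ny,
      ∫⁻ n in Ioc Jc 2, ENNReal.ofReal (pp t n) = ENNReal.ofReal Je ∧
      (∀ᵐ m ∂(volume.restrict Ys), G Kb = pp t m) ∧
      Integrable (fun m ↦ G Kb) (volume.restrict Ys) := by
    filter_upwards [hF, Measure.ae_ae_of_ae_prod Gpp, Gi.prod_right_ae,
      ae_restrict_mem measurableSet_Ioc] with t h1 h2 h3 h4
    refine ⟨?_, h2, h3⟩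
    have htI : t ∈ Icc 0 Ja := Ioc_subset_Icc_self h4
    have i1 : ∀ k, Integrable (fun m ↦ ☐.p t m) (volume.restrict Ys) := fun k ↦ by
      have := ☐.np.intm htI
      rwa [intervalIntegrable_iff_integrableOn_Ioc_of_le zero_le_two] at this
    have h5 : Tendsto (fun i : ℕ ↦ |Je - ∫M G Kb|) atTop Zx := by
      refine squeeze_zero (fun _ ↦ abs_nonneg _) (fun i ↦ ?_) h1
      rw [← (S (φ1 (φ2 (φ3 (φ4 i))))).intp htI, iinofle zero_le_two,
        ← integral_sub (i1 _) h3]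
      exact abs_integral_le_integral_abs
    have h6 := tendsto_nhds_unique h5 tendsto_const_nhds
    have h7 : ∫M pp t m = Je := by
      rw [← integral_congr_ae h2]
      linarith [abs_eq_zero.1 h6.symm]
    rw [← ofReal_integral_eq_lintegral_ofReal (h3.congr h2) (Eventually.of_forall fun m ↦ (rexppos _).le),
      h7]
  have pae : ∀q p‡ = pp‡ := by
    have h := (Measure.quasiMeasurePreserving_fst (μ := volume.restrict (Ioc 0 Ja))
      (ν := volume.restrict Ys)).ae good
    filter_upwards [h] with q h
    simp only [hpd]; rw [if_pos h.1]
  have pG : ∀q G q = p‡ := by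
    filter_upwards [Gpp, pae] with q h1 h2
    rw [h1, h2]
  have ppos : ∀ t m, 0 < p t m := fun t m ↦ by
    simp only [hpd]; split_ifs
    · exact rexppos _
    · positivity
  have pint : ∀ t, IntegrableOn (p t) Ys ∧ ∫M p t m = Je := by
    intro t
    by_cases h : ∫⁻ n in Ioc Jc 2, ENNReal.ofReal (pp t n) = ENNReal.ofReal Je
    · have e1 : p t = pp t := by funext m; simp only [hpd]; rw [if_pos h]
      have am : Measurable (pp t) := ppm.comp measurable_prodMk_left
      have nn : ∀ m, 0 ≤ pp t m := fun m ↦ (rexppos _).le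
      rw [e1]
      refine ⟨⟨am.aestronglyMeasurable, ?_⟩, ?_⟩
      · rw [hasFiniteIntegral_iff_ofReal (Eventually.of_forall nn), h]; exact ENNReal.ofReal_lt_top
      · rw [integral_eq_lintegral_of_nonneg_ae (Eventually.of_forall nn) am.aestronglyMeasurable, h,
          ENNReal.toReal_ofReal hL.le]
    · have e1 : p t = fun _ ↦ Je / 2 := by funext m; simp only [hpd]; rw [if_neg h]
      rw [e1]
      simp
      ring
  have hpi : Integrable (fun q : ℝˣ ↦ p‡) Jd := Gi.congr pG
  refine ⟨fun i ↦ φ1 (φ2 (φ3 (φ4 i))), hφ1.comp (hφ2.comp (hφ3.comp hφ4)), ?_, ?_, p, ?_, ppos,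
    ?_, ?_, hpi, ?_, ?_, ?_⟩
  · intro ε hε
    obtain ⟨N, hN⟩ := hψ ε hε
    have m := (hφ2.comp (hφ3.comp hφ4)).id_le
    exact ⟨N, fun i hi j hj ↦ hN _ (hi.trans (m i)) _ (hj.trans (m j))⟩
  · intro ε hε
    obtain ⟨N, hN⟩ := hX ε hε
    have m := (hφ2.comp (hφ3.comp hφ4)).id_le
    exact ⟨N, fun i hi j hj ↦ hN _ (hi.trans (m i)) _ (hj.trans (m j))⟩
  · simp only [hpd]
    refine Measurable.ite ?_ ppm measurable_const
    have : Measurable (fun t ↦ ∫⁻ n in Ioc Jc 2, ENNReal.ofReal (pp t n)) :=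
      (ENNReal.measurable_ofReal.comp ppm).lintegral_prod_right'
    exact measurableSet_eq_fun (this.comp measurable_fst) measurable_const
  · intro t
    rw [intervalIntegrable_iff_integrableOn_Ioc_of_le zero_le_two]; exact (pint t).1
  · intro t
    rw [iinofle zero_le_two]; exact (pint t).2
  · filter_upwards [conv, pae] with q h1 h2
    rw [h2]; exact h1.comp (hφ3.comp hφ4).tendsto_atTop
  · refine (hGpp.comp hφ4.tendsto_atTop).congr fun i ↦ integral_congr_ae ?_
    filter_upwards [pG] with q h
    simp only [h]
  · filter_upwards [hF, Measure.ae_ae_of_ae_prod pG,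
      ae_restrict_mem measurableSet_Ioc] with t h1 h2 h4 m hm
    have htI : t ∈ Icc 0 Ja := Ioc_subset_Icc_self h4
    rw [tendsto_iff_norm_sub_tendsto_zero]
    refine squeeze_zero (fun _ ↦ norm_nonneg _) (fun i ↦ ?_) h1
    set k := φ1 (φ2 (φ3 (φ4 i)))
    have i1 := ☐.np.intm htI
    have i2 : IntervalIntegrable (p t) volume 0 2 := by
      rw [intervalIntegrable_iff_integrableOn_Ioc_of_le zero_le_two]; exact (pint t).1
    have e1 : ☐.X t m = ∫ n in Jc..m, ☐.p t n := by
      rw [(☐.dX t).ftc i1 le_rfl hm.1 hm.2, ☐.X0, sub_zero]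
    have j1 := ii_mono i1 le_rfl hm.1 hm.2
    have j2 := ii_mono i2 le_rfl hm.1 hm.2
    rw [rnoeqab, e1, ← iinsu j1 j2]
    refine (iabinleinab hm.1).trans ?_
    refine (int_sub_le (i1.sub i2).abs le_rfl hm.1 hm.2 (fun _ ↦ abs_nonneg _)).trans ?_
    rw [iinofle zero_le_two]
    refine (integral_congr_ae ?_).le
    filter_upwards [h2] with n hn
    simp only [hn]
lemma RD.mul {u up w wd : ℝ → ℝ} (hu : RD u up) (hw : RD w wd) :
    RD (fun m ↦ u m * w m) (fun m ↦ up m * w m + u m * wd m) :=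
  ⟨hu.1.mul hw.1, fun m hm ↦ (hu.2 m hm).mul (hw.2 m hm)⟩
lemma RD.sub {u up w wd : ℝ → ℝ} (hu : RD u up) (hw : RD w wd) :
    RD (fun m ↦ u m - w m) (fun m ↦ up m - wd m) :=
  ⟨hu.1.sub hw.1, fun m hm ↦ (hu.2 m hm).sub (hw.2 m hm)⟩
lemma TD.mul {T : ℝ} {u up w wd : ℝ → ℝ} (hu : TD T u up) (hw : TD T w wd) :
    TD T (fun m ↦ u m * w m) (fun m ↦ up m * w m + u m * wd m) :=
  ⟨hu.1.mul hw.1, fun m hm ↦ (hu.2 m hm).mul (hw.2 m hm)⟩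
lemma TD.sub {T : ℝ} {u up w wd : ℝ → ℝ} (hu : TD T u up) (hw : TD T w wd) :
    TD T (fun m ↦ u m - w m) (fun m ↦ up m - wd m) :=
  ⟨hu.1.sub hw.1, fun m hm ↦ (hu.2 m hm).sub (hw.2 m hm)⟩
namespace Approx
variable {P : Par} {C e : ℝ} (S : Approx P C e)
/-- the weight -/
noncomputable def θ (t m : ℝ) : ℝ := t ^ 3 * Jm Zb
lemma nθ : Nice Ja Ug := (Nice.ofT Zn).mul (S.nX.comp P.Wcont)
lemma nWp : Nice Ja (fun t m ↦ P.Wp Zb) := S.nX.comp P.hW'c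
lemma dθ (t : ℝ) : RD (Ug t) (fun m ↦ t ^ 3 * (P.Wp Zb * Zr)) :=
  ⟨continuous_const.mul (P.Wcont.comp Ed.1), fun m hm ↦
    ((P.hW _).comp_hasDerivWithinAt m (Ed.2 m hm)).const_mul _⟩
lemma tθ (m : ℝ) : TD Ja (fun t ↦ Ug t m)
    (fun t ↦ 3 * t ^ 2 * Jm Zb + t ^ 3 * (P.Wp Zb * Y2)) := by
  refine ⟨(continuous_id.pow 3).mul (P.Wcont.comp (S.tX m).1), fun t ht ↦ ?_⟩
  have h1 : HasDerivAt (fun t : ℝ ↦ t ^ 3) (3 * t ^ 2) t := by simpa using hasDerivAt_pow 3 t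
  exact h1.mul ((P.hW _).comp t ((S.tX m).2 t ht))
lemma Zid {ep : ℝ} (Sd : Approx P C ep) :
    ∫ q, Ug‡ * (Y7 * Zo -
      Y4 * J7) ∂ Jd =
    (∫ q, Z8 * (
      J9 *
        J7 + Ug‡ * G1 -
        q.1 ^ 3 * Kg * Zo) ∂ Jd) -
    ∫m Kh * Yl := by
  have hT := Zk
  have nψ := S.nψ.sub Sd.nψ
  have nr := S.nr.sub Sd.nr
  have nA := S.nA.sub Sd.nA
  have nG := S.nG.sub Sd.nG
  have nπ := S.nπ.sub Sd.nπ
  have nE := (S.nr.pow 2).sub (Sd.nr.pow 2)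
  have nEt : Nice Ja (fun t m ↦ 2 * Ux * S.rt t m - 2 * El * Sd.rt t m) :=
    ((((Nice.const _ 2).mul S.nr)).mul S.nrt).sub ((((Nice.const _ 2).mul Sd.nr)).mul Sd.nrt)
  have nθm : Nice Ja (fun t m ↦ t ^ 3 * (P.Wp Zb * Zr)) :=
    (Nice.ofT (φ := fun t ↦ t ^ 3) Zn).mul (S.nWp.mul S.np)
  have nθt : Nice Ja (fun t m ↦ 3 * t ^ 2 * Jm Zb + t ^ 3 * (P.Wp Zb * Y2)) :=
    ((Nice.ofT (φ := fun t ↦ 3 * t ^ 2) Zn).mul (S.nX.comp P.Wcont)).add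
    ((Nice.ofT (φ := fun t ↦ t ^ 3) Zn).mul (S.nWp.mul S.nv))
  have nGm : Nice Ja (fun t m ↦ (2 * Ux * S.rt t m - S.π t m) - (2 * El * Sd.rt t m - Sd.π t m)) :=
    ((((Nice.const _ 2).mul S.nr).mul S.nrt).sub S.nπ).sub ((((Nice.const _ 2).mul Sd.nr).mul Sd.nrt).sub Sd.nπ)
  -- first part
  have n1 := nr.mul (S.nθ.mul nG)
  have n2 := nψ.mul ((nθm.mul nG).add (S.nθ.mul nGm))
  have p1 : ∫ q, Y7 * (Ug‡ * Zo) ∂ Jd =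
      - ∫ q, Z8 * (q.1 ^ 3 * Kg *
        Zo + Ug‡ * ((2 * Zl‡ * S.rt‡ - S.π‡) -
        (2 * Ya‡ * Sd.rt‡ - Sd.π‡))) ∂ Jd := by
    rw [n1.fub hT, n2.fub hT, ← iinne]
    refine iincoz fun t ht ↦ ?_
    rw [uIcc_of_le hT] at ht
    have h := RD.parts ((S.dψ t).sub (Sd.dψ t)) ((S.dθ t).mul ((S.dG t).sub (Sd.dG t)))
      (nr.intm ht) (((nθm.mul nG).add (S.nθ.mul nGm)).intm ht)
    simp only [S.ψ0, Sd.ψ0, S.ψ2, Sd.ψ2, sub_self, zero_mul, zero_sub] at h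
    rw [h, neg_neg]
  -- second part
  have n3 := nA.mul (S.nθ.mul nE)
  have n4 := nψ.mul ((nθt.mul nE).add (S.nθ.mul nEt))
  have p2 : ∫ q, Y4 * (Ug‡ * J7) ∂ Jd =
      (∫m Kh * Yl) -
      ∫ q, Z8 *
        (J9 *
        J7 + Ug‡ *
        G2) ∂ Jd := by
    have hTI : Ja ∈ Icc 0 Ja := ⟨hT, le_rfl⟩
    have nbd := nψ.mul (S.nθ.mul nE)
    have i4 : IntervalIntegrable (fun m ↦ ∫t (N7 t m - Sd.ψ t m) *
        (Gg *
        (Ux ^ 2 - El ^ 2) + Ug t m *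
        (2 * Ux * S.rt t m - 2 * El * Sd.rt t m))) volume 0 2 := by
      rw [intervalIntegrable_iff_integrableOn_Ioc_of_le zero_le_two]
      have := n4.int.integral_prod_right
      simp_rw [iinofle Zk]
      exact this
    rw [n3.fubp hT, n4.fubp hT, ← iinsu (nbd.intm hTI) i4]
    refine iincoz fun m hm ↦ ?_
    rw [uIcc_of_le zero_le_two] at hm
    have tE : TD Ja (fun t ↦ Ux ^ 2 - El ^ 2)
        (fun t ↦ 2 * Ux * S.rt t m - 2 * El * Sd.rt t m) := by
      refine ⟨((S.tr m).1.pow 2).sub ((Sd.tr m).1.pow 2), fun t ht ↦ ?_⟩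
      have := (((S.tr m).2 t ht).pow 2).sub (((Sd.tr m).2 t ht).pow 2)
      exact this.congr_deriv J1
    have h := TD.parts ((S.tψ m).sub (Sd.tψ m)) ((S.tθ m).mul tE) (t0 := 0) ⟨le_rfl, hT⟩
      (nA.intt ⟨le_rfl, hT⟩ hm) (((nθt.mul nE).add (S.nθ.mul nEt)).intt ⟨le_rfl, hT⟩ hm)
    have z0 : Ug 0 m = 0 := by simp [θ]
    simp only [z0, zero_mul, mul_zero, sub_zero] at h
    linarith
  have e0 : ∫ q, Ug‡ * (Y7 * Zo -
      Y4 * J7) ∂ Jd =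
      (∫ q, Y7 * (Ug‡ * Zo) ∂ Jd) -
      ∫ q, Y4 * (Ug‡ * J7) ∂ Jd := by
    rw [← Nice.isub n1 n3]; congr 1; ext q; ring
  rw [e0, p1, p2]
  have e1 := Nice.isub n4 n2
  have e2 : ∀ q : ℝˣ, Z8 * (
      J9 *
        J7 + Ug‡ * G1 -
        q.1 ^ 3 * Kg * Zo) =
      Z8 *
        (J9 *
        J7 + Ug‡ *
        G2) -
      Z8 * (q.1 ^ 3 * Kg *
        Zo + Ug‡ * ((2 * Zl‡ * S.rt‡ - S.π‡) -
        (2 * Ya‡ * Sd.rt‡ - Sd.π‡))) := fun q ↦ by ring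
  simp_rw [e2]
  rw [e1]; ring
lemma r2 (t m : ℝ) : 0 ≤ Ux ^ 2 ∧ Zl t m ^ 2 ≤ 1 :=
  ⟨sq_nonneg _, pow_le_one₀ (S.r0 t m) (S.r1 t m)⟩
lemma Zbd {ep D : ℝ} (Sd : Approx P C ep) (hD : 0 ≤ D)
    (h : ∀ t ∈ Icc 0 Ja, ∀ m ∈ Icc Jc 2, |t * N7 t m - t * Sd.ψ t m| ≤ D) :
    |∫ q, Ug‡ * (Y7 * Zo -
      Y4 * J7) ∂ Jd| ≤
    D * (Jg * Zc) := by
  have hT := Zk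
  have hB := Y6
  have hC := S.C0
  have hL := P.hL.le
  rw [S.Zid Sd]
  refine ☁.trans ?_
  have ho : ∀ t ∈ Icc 0 Ja, ∀ m ∈ Icc Jc 2, t * |N7 t m - Sd.ψ t m| ≤ D := by
    intro t ht m hm
    have := h t ht m hm
    rwa [← mul_sub, abs_mul, abs_of_nonneg ht.1] at this
  have hE : ∀ t m, |Ux ^ 2 - El ^ 2| ≤ 1 := by
    intro t m
    have h1 := S.r2 t m
    have h2 := Sd.r2 t m
    rw [abs_le]; constructor <;> linarith
  have b1 : |∫m Kh * Yl| ≤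
      D * (Ja ^ 2 * Jg) * 2 := by
    have hTI : Ja ∈ Icc 0 Ja := ⟨hT, le_rfl⟩
    have := inoinleofnoleco (a := 0) (b := 2)
      (f := fun m ↦ Kh * Yl)
      (C := D * (Ja ^ 2 * Jg)) (fun m hm ↦ by
        rw [uIoc_of_le zero_le_two] at hm
        have hm := Ioc_subset_Icc_self hm
        rw [rnoeqab, θ, abs_mul, abs_mul, abs_mul, abs_of_nonneg (pow_nonneg hT 3)]
        have g1 := ho Ja hTI m hm
        have g2 := Gz _ (S.Xmem hTI hm)
        calc _ = Ja * |N7 Ja m - Sd.ψ Ja m| * (Ja ^ 2 * |Jm (Jo Ja m)|) *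
              |Zl Ja m ^ 2 - Ya Ja m ^ 2| := by ring
          _ ≤ D * (Ja ^ 2 * Jg) * 1 := by gcongr; exact hE _ _
          _ = _ := mul_one _)
    simpa using this
  have nbb : Nice Ja (fun t m ↦ D * (Jg * (3 * Ja + Ja ^ 2 * Er +
      t ^ 2 * Yf + Jj * G3))) := by
    have c1 := S.cts
    have c2 := Sd.cts
    exact (Nice.const _ D).mul ((Nice.const _ Jg).mul ((☒.add
      ((Nice.const _ (Ja ^ 2)).mul ((Nice.const _ 1).add Ni))).add
      ((Nice.ofT (φ := fun t ↦ t ^ 2) Zn).mul (S.nπ.abs.add Sd.nπ.abs)) |>.add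
      ((Nice.ofT (φ := fun t ↦ t ^ 2 * Gl ^ 2 + t ^ 2 * Um t ^ 2) Zn).mul
        ((Nice.const _ C).mul S.np))))
  have b2 : |∫ q, Z8 * (
      J9 *
        J7 + Ug‡ * G1 -
        q.1 ^ 3 * Kg * Zo) ∂ Jd| ≤
      ∫ q, D * (Jg * (3 * Ja + Ja ^ 2 * (1 + Zs‡ ^ 2) +
      q.1 ^ 2 * Nk + Yu *
        (C * Jt‡))) ∂ Jd := by
    rw [← rnoeqab]
    refine norm_integral_le_of_norm_le nbb.int (ae_kap fun t ht m hm ↦ ?_)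
    have ht := Ioc_subset_Icc_self ht
    have hm := Ioc_subset_Icc_self hm
    have t0 := ht.1
    have g1 := ho t ht m hm
    have g2 := Gz _ (S.Xmem ht hm)
    have g3 := P.hW'B Zb
    have hE := hE t m
    have p0 := S.p_pos t m
    rw [rnoeqab, abs_mul]
    simp only
    set w := N7 t m - Sd.ψ t m
    have s1 := S.s1 t
    have s2 := Sd.s1 t
    have f1 : |Gg *
        (Ux ^ 2 - El ^ 2)| ≤ t * (Jg * (3 * Ja + Ja ^ 2 * Er)) := by
      rw [abs_mul]
      have v1 : |Y2| ≤ 1 + Y2 ^ 2 := by rw [← sq_abs]; nlinarith [sq_nonneg (|Y2| - 1)]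
      calc _ ≤ (3 * t ^ 2 * Jg + t ^ 3 * (Jg * |Y2|)) * 1 := by
            gcongr
            refine ☾.trans (add_le_add ?_ ?_)
            · rw [abs_mul, abs_of_nonneg (by positivity : 0 ≤ 3 * t ^ 2)]; gcongr
            · rw [abs_mul, abs_mul, abs_of_nonneg (by positivity : 0 ≤ t ^ 3)]; gcongr
        _ = t * (Jg * (3 * t + t ^ 2 * |Y2|)) := by ring
        _ ≤ _ := by
            have := ht.2
            gcongr
    have f2 : |Ug t m * (S.π t m - Sd.π t m)| ≤ t * (Jg * (t ^ 2 * Yf)) := by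
      rw [abs_mul, θ, abs_mul, abs_of_nonneg (by positivity : 0 ≤ t ^ 3)]
      calc _ ≤ t ^ 3 * Jg * Yf := by gcongr; exact abs_sub _ _
        _ = _ := by ring
    have f3 : |t ^ 3 * (P.Wp Zb * Zr) * (S.G t m - Sd.G t m)| ≤
        t * (Jg * (Jj * G3)) := by
      rw [abs_mul, abs_mul, abs_mul, abs_of_nonneg (by positivity : 0 ≤ t ^ 3), abs_of_pos p0]
      have g : |S.G t m - Sd.G t m| ≤ C * Gl ^ 2 + C * Um t ^ 2 := by
        refine ☁.trans (add_le_add ((S.hG t m hm).trans ?_) ((Sd.hG t m hm).trans ?_))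
        · gcongr; nlinarith
        · gcongr; nlinarith
      calc _ ≤ t ^ 3 * (Jg * Zr) * (C * Gl ^ 2 + C * Um t ^ 2) := by gcongr
        _ = _ := by ring
    have f4 : ∀ x y z : ℝ, |x + y - z| ≤ |x| + |y| + |z| := fun x y z ↦
      ☁.trans (add_le_add (abs_add_le _ _) le_rfl)
    calc _ ≤ |w| * (t * (Jg * (3 * Ja + Ja ^ 2 * Er)) +
          t * (Jg * (t ^ 2 * Yf)) +
          t * (Jg * (Jj * G3))) := by
          gcongr
          exact (f4 _ _ _).trans (add_le_add (add_le_add f1 f2) f3)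
      _ = (t * |w|) * (Jg * (3 * Ja + Ja ^ 2 * Er +
      t ^ 2 * Yf + Jj * G3)) := by
          ring
      _ ≤ _ := by gcongr
  have nt2 : Nice Ja (fun t _ ↦ t ^ 2) := Nice.ofT Zn
  have n5 := nt2.mul S.nπ.abs
  have n6 := nt2.mul Sd.nπ.abs
  have b3 : ∫ q, D * (Jg * (3 * Ja + Ja ^ 2 * (1 + Zs‡ ^ 2) +
      q.1 ^ 2 * Nk + Yu *
        (C * Jt‡))) ∂ Jd ≤
      D * U5 := by
    have c1 := S.cts
    have c2 := Sd.cts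
    have n7 : Nice Ja (fun t m ↦ Jj * G3) :=
      (Nice.ofT (φ := fun t ↦ t ^ 2 * Gl ^ 2 + t ^ 2 * Um t ^ 2) Zn).mul
        ((Nice.const _ C).mul S.np)
    have n8 : Nice Ja (fun t m ↦ Ja ^ 2 * Er) :=
      (Nice.const _ (Ja ^ 2)).mul ((Nice.const _ 1).add Ni)
    have n9 := nt2.mul (S.nπ.abs.add Sd.nπ.abs)
    rw [integral_const_mul, integral_const_mul,
      Nice.iadd ((☒.add n8).add n9) n7, Nice.iadd (☒.add n8) n9,
      Nice.iadd (Nice.const _ (3 * Ja)) n8, Nice.iconst hT, integral_const_mul,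
      Nice.iadd Es Ni, Nice.iconst hT]
    have k1 : ∫ q, q.1 ^ 2 * Nk ∂ Jd ≤ C + C := by
      simp_rw [mul_add]
      rw [Nice.iadd n5 n6]
      exact add_le_add S.hπ Sd.hπ
    have k2 : ∫ q, Yu * (C * Jt‡) ∂ Jd ≤
        (C + C) * (C * Je) := by
      rw [n7.fub hT]
      have : ∀ t ∈ uIcc 0 Ja, ∫m Jj * G3 =
          Jj * (C * Je) := by
        intro t ht
        rw [uIcc_of_le hT] at ht
        rw [iincomu, iincomu, S.intp ht]
      rw [iincoz this, iinmuco,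
        iinad (c1.intervalIntegrable _ _) (c2.intervalIntegrable _ _)]
      gcongr
      · exact S.hs2
      · exact Sd.hs2
    have k3 := S.hv2
    have k4 : Ja ^ 2 * (2 * Ja * 1 + ∫ q, Zs‡ ^ 2 ∂ Jd) ≤ Ja ^ 2 * (2 * Ja + C) := by
      refine mul_le_mul_of_nonneg_left ?_ Jh; linarith
    refine mul_le_mul_of_nonneg_left (mul_le_mul_of_nonneg_left ?_ hB) hD
    nlinarith
  have : D * (Jg * Zc) =
    D * U5 +
    D * (Ja ^ 2 * Jg) * 2 := by ring
  linarith
end Approx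
lemma Cau.of_seq {F : ℕ → ℕ → ℝ} (h : ∀ a b : ℕ → ℕ, Tendsto a atTop atTop → Tendsto b atTop atTop →
    Tendsto (fun k ↦ F K7 K8) atTop Zx) : Cau F := by
  by_contra hc
  simp only [Cau, not_forall, not_exists, not_le] at hc
  obtain ⟨ε, hε, hc⟩ := hc
  choose a ha b hb hF using hc
  have h1 := h a b (tendsto_atTop_mono ha tendsto_id) (tendsto_atTop_mono hb tendsto_id)
  obtain ⟨k, hk⟩ := (h1.eventually_lt_const hε).exists
  exact absurd hk (not_lt.2 (hF k).le)
lemma quart {t T B : ℝ} (t0 : 0 ≤ t) (tT : t ≤ T) (hB : 0 ≤ B) {x y : ℝ} (x0 : 0 ≤ x) (x1 : x ≤ 1) (y0 : 0 ≤ y) (y1 : y ≤ 1)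
    {θ a ap G Gp A Ad : ℝ} (hθ : |θ| ≤ t ^ 3 * B) :
        θ * a * Uf ^ 4 ≤ -3 * G4 +
        6 * B * |t ^ 3 * (a - ap)| + 3 * (B * T) * ((t ^ 2 * |G - a * (x ^ 2 - 4 / 3 * x ^ 3)| +
        t ^ 2 * |A - a * (x - x ^ 2)|) + (t ^ 2 * |Gp - ap * Ki| +
        t ^ 2 * |Ad - ap * Et|)) := by
  set γ := G - a * (x ^ 2 - 4 / 3 * x ^ 3) with hγ
  set γp := Gp - ap * Ki with hγp
  set δ := A - a * (x - x ^ 2) with hδ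
  set δp := Ad - ap * Et with hδp
  have id : θ * a * Uf ^ 4 = -3 * G4 +
      3 * (θ * ((a - ap) * (Uf * Ki - Et * Uz) +
        Uf * (γ - γp) - (δ - δp) * Uz)) := by
    rw [hγ, hγp, hδ, hδp]; ring
  have d1 : |x - y| ≤ 1 := by rw [abs_le]; constructor <;> linarith
  have d2 : |x ^ 2 - y ^ 2| ≤ 1 := by rw [abs_le]; constructor <;> nlinarith
  have q1 : |y ^ 2 - 4 / 3 * y ^ 3| ≤ 1 := by
    have : 0 ≤ y ^ 2 := by positivity
    have : y ^ 3 ≤ y ^ 2 := by nlinarith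
    have : 0 ≤ y ^ 3 := by positivity
    rw [abs_le]; constructor <;> nlinarith
  have q2 : |y - y ^ 2| ≤ 1 := by rw [abs_le]; constructor <;> nlinarith
  have m1 : ∀ u w : ℝ, |w| ≤ 1 → |u * w| ≤ |u| := fun u w hw ↦ by
    rw [abs_mul]; exact mul_le_of_le_one_right Jy hw
  have m2 : ∀ u w : ℝ, |w| ≤ 1 → |w * u| ≤ |u| := fun u w hw ↦ by rw [mul_comm]; exact m1 u w hw
  have b : |(a - ap) * (Uf * Ki - Et * Uz) +
        Uf * (γ - γp) - (δ - δp) * Uz| ≤ |a - ap| * 2 + (|γ| + |γp|) + (|δ| + |δp|) := by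
    refine ☁.trans (add_le_add (☾.trans (add_le_add ?_ ?_)) ?_)
    · rw [abs_mul]
      refine mul_le_mul_of_nonneg_left (☁.trans ?_) Jy
      have := (m1 Uf _ q1).trans d1
      have := (m1 Et _ d2).trans q2
      linarith
    · exact (m2 _ _ d1).trans (abs_sub _ _)
    · exact (m1 _ _ d2).trans (abs_sub _ _)
  rw [id, add_assoc]
  refine add_le_add le_rfl ?_
  have e1 : |t ^ 3 * (a - ap)| = t ^ 3 * |a - ap| := by rw [abs_mul, abs_of_nonneg Jh]
  rw [e1]
  calc _ ≤ 3 * (t ^ 3 * B * (|a - ap| * 2 + (|γ| + |γp|) + (|δ| + |δp|))) := by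
        refine mul_le_mul_of_nonneg_left ?_ (by norm_num)
        exact (le_abs_self _).trans ((abs_mul _ _).le.trans (mul_le_mul hθ b Jy Jh))
    _ = 6 * B * (t ^ 3 * |a - ap|) + 3 * (B * t) * ((t ^ 2 * |γ| + t ^ 2 * |δ|) + (t ^ 2 * |γp| + t ^ 2 * |δp|)) := by ring
    _ ≤ _ := by gcongr
namespace Approx
variable {P : Par} {C e : ℝ} (S : Approx P C e)
noncomputable def a (t m : ℝ) : ℝ := Jm Zb / Zr
lemma a_le {t m : ℝ} (ht : t ∈ Nh Ja) (hm : m ∈ Kc) : |S.a t m| ≤ Jg * Yj t := by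
  rw [a, abs_div, abs_of_pos Ep, div_eq_mul_one_div]
  exact mul_le_mul (Gz _ (S.Xmem ht hm)) (S.hps t m) (by have := S.p_pos t m; positivity) Y6
lemma na : Nice Ja S.a :=
  Nice.of_le (g := fun t _ ↦ Jg * Gl) ((P.Wcont.measurable.comp S.nX.1).div S.np.1)
    (Nice.ofT (by have := S.cs; fun_prop)) fun _ ht _ hm ↦ S.a_le ht hm
lemma apair {ep D : ℝ} (Sd : Approx P C ep) (hD : 0 ≤ D)
    (h : ∀ t ∈ Icc 0 Ja, ∀ m ∈ Icc Jc 2, |t * N7 t m - t * Sd.ψ t m| ≤ D) :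
    ∫ q, Ug‡ * S.a‡ * Y7 ^ 4 ∂ Jd ≤
    3 * (D * (Jg * Zc))
     + 6 * Jg * (∫ q, |q.1 ^ 3 * (S.a‡ - Sd.a‡)| ∂ Jd) + 6 * G5 * (e + ep) := by
  have hT := Zk
  have hB := Y6
  have Z := (abs_le.1 (S.Zbd Sd hD h)).1
  have nt (n : ℕ) : Nice Ja (fun t _ ↦ t ^ n) := Nice.ofT Zn
  have nγ (epp : ℝ) (S : Approx P C epp) : Nice Ja (fun t m ↦ t ^ 2 * |S.G t m - S.a t m * (Ux ^ 2 - 4 / 3 * Ux ^ 3)|) :=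
    (nt 2).mul (S.nG.sub (S.na.mul ((S.nr.pow 2).sub ((Nice.const _ _).mul (S.nr.pow 3))))).abs
  have nα (epp : ℝ) (S : Approx P C epp) : Nice Ja (fun t m ↦ t ^ 2 * |S.A t m - S.a t m * (Ux - Ux ^ 2)|) :=
    (nt 2).mul (S.nA.sub (S.na.mul (S.nr.sub (S.nr.pow 2)))).abs
  have nE (epp : ℝ) (S : Approx P C epp) := (nγ epp S).add (nα epp S)
  have nZ : Nice Ja (fun t m ↦ Ug t m * ((Ux - El) * (S.G t m - Sd.G t m) -
      (S.A t m - Sd.A t m) * (Ux ^ 2 - El ^ 2))) :=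
    S.nθ.mul (((S.nr.sub Sd.nr).mul (S.nG.sub Sd.nG)).sub ((S.nA.sub Sd.nA).mul ((S.nr.pow 2).sub (Sd.nr.pow 2))))
  have nd : Nice Ja (fun t m ↦ |t ^ 3 * (S.a t m - Sd.a t m)|) := ((nt 3).mul (S.na.sub Sd.na)).abs
  have n1 := (Nice.const Ja (3 * G5)).mul ((nE e S).add (nE ep Sd))
  have n2 := (Nice.const Ja (6 * Jg)).mul nd
  have n3 := (Nice.const Ja (-3)).mul nZ
  refine (Nice.imono ((S.nθ.mul S.na).mul ((S.nr.sub Sd.nr).pow 4)) ((n3.add n2).add n1) ?_).trans ?_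
  · intro t ht m hm
    have ht := Ioc_subset_Icc_self ht
    have hm := Ioc_subset_Icc_self hm
    have t0 := ht.1
    have hθ : |Ug t m| ≤ t ^ 3 * Jg := by
      rw [θ, abs_mul, abs_of_nonneg Jh]
      exact mul_le_mul_of_nonneg_left (Gz _ (S.Xmem ht hm)) Jh
    exact quart t0 ht.2 hB (S.r0 t m) (S.r1 t m) (Sd.r0 t m) (Sd.r1 t m) hθ
  · rw [Nice.iadd (n3.add n2) n1, Nice.iadd n3 n2, integral_const_mul, integral_const_mul, integral_const_mul,
      Nice.iadd (nE e S) (nE ep Sd), Nice.iadd (nγ e S) (nα e S), Nice.iadd (nγ ep Sd) (nα ep Sd)]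
    have w1 := S.eA
    have w2 := S.eG
    have w3 := Sd.eA
    have w4 := Sd.eG
    have : 3 * G5 * ((∫ q, q.1 ^ 2 * |S.G‡ - S.a‡ * (Zl‡ ^ 2 - 4 / 3 * Zl‡ ^ 3)| ∂ Jd) +
       (∫ q, q.1 ^ 2 * |S.A‡ - S.a‡ * (Zl‡ - Zl‡ ^ 2)| ∂ Jd) +
       ((∫ q, q.1 ^ 2 * |Sd.G‡ - Sd.a‡ * (Ya‡ ^ 2 - 4 / 3 * Ya‡ ^ 3)| ∂ Jd) +
       (∫ q, q.1 ^ 2 * |Sd.A‡ - Sd.a‡ * (Ya‡ - Ya‡ ^ 2)| ∂ Jd))) ≤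
       3 * G5 * (e + e + (ep + ep)) := by
      refine mul_le_mul_of_nonneg_left (add_le_add (add_le_add w2 w1) (add_le_add w4 w3)) Jh
    linarith
end Approx
/-- A convergent sequence of approximations. -/
structure Sq (P : Par) (C : ℝ) where
  e : ℕ → ℝ
  S : ∀ i, Approx P C (e i)
  he : Tendsto e atTop Zx
  hψ : ∀ ε > 0, ∃ N, ∀ i ≥ N, ∀ j ≥ N, ∀ t ∈ Icc 0 Ja, ∀ m ∈ Icc Jc 2,
        |t * ♪.ψ t m - t * ☃.ψ t m| ≤ ε
  hX : ∀ ε > 0, ∃ N, ∀ i ≥ N, ∀ j ≥ N, ∀ t ∈ Icc 0 Ja,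
        ∫m (♪.X t m - ☃.X t m) ^ 2 ≤ ε
  p : ℝ → ℝ → ℝ
  pm : Measurable (fun q : ℝˣ ↦ p‡)
  p0 : ∀ t m, 0 < p t m
  pint : ∀ t, IntervalIntegrable (p t) volume 0 2
  pL : ∀ t, ∫m p t m = Je
  pI : Integrable (fun q : ℝˣ ↦ p‡) Jd
  pae : ∀q Tendsto (fun i ↦ ♪.p‡) atTop (𝓝 p‡)
  pL1 : Tendsto (fun i ↦ ∫ q, |♪.p‡ - p‡| ∂ Jd) atTop Zx
  Xae : ∀ᵐ t ∂ Ny, ∀ m ∈ Icc Jc 2,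
          Tendsto (fun i ↦ ♪.X t m) atTop (𝓝 (∫ n in Jc..m, p t n))
lemma exSq {P : Par} {C : ℝ} {e : ℕ → ℝ} (S : ∀ i, Approx P C (e i))
    (he : Tendsto e atTop Zx) : Nonempty (Sq P C) := by
  obtain ⟨φ, hφ, h1, h2, p, a1, a2, a3, a4, a5, a6, a7, a8⟩ := pLimit S he
  exact ⟨⟨e ∘ φ, fun i ↦ S Z3, he.comp hφ.tendsto_atTop, h1, h2, p, a1, a2, a3, a4, a5, a6, a7, a8⟩⟩
namespace Sq
variable {P : Par} {C : ℝ} (Q : Sq P C)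
def sub {φ : ℕ → ℕ} (hφ : StrictMono φ) : Sq P C where
  e := fun i ↦ Q.e Z3
  S := fun i ↦ Nl Z3
  he := Q.he.comp hφ.tendsto_atTop
  hψ := fun ε hε ↦ by
    obtain ⟨N, hN⟩ := Q.hψ ε hε
    exact ⟨N, fun i hi j hj ↦ hN _ Gw _ Gx⟩
  hX := fun ε hε ↦ by
    obtain ⟨N, hN⟩ := Q.hX ε hε
    exact ⟨N, fun i hi j hj ↦ hN _ Gw _ Gx⟩
  p := Zd
  pm := Q.pm
  p0 := Km
  pint := Q.pint
  pL := Q.pL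
  pI := Q.pI
  pae := Q.pae.mono fun _ h ↦ h.comp hφ.tendsto_atTop
  pL1 := Q.pL1.comp hφ.tendsto_atTop
  Xae := Q.Xae.mono fun _ h m hm ↦ (h m hm).comp hφ.tendsto_atTop
/-- limit of the flow maps -/
noncomputable def X (t m : ℝ) : ℝ := ∫ n in Ioc Jc 2, (Iic m).indicator (Zd t) n
lemma Xeq {t m : ℝ} (hm : m ∈ Kc) : Ze t m = ∫ n in Jc..m, Zd t n := by
  rw [X, setIntegral_indicator measurableSet_Iic, iinofle hm.1]
  congr 2; ext x; simp only [mem_inter_iff, mem_Ioc, mem_Iic]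
  constructor
  · rintro ⟨h1, h2⟩; exact ⟨h1.1, h2⟩
  · rintro ⟨h1, h2⟩; exact ⟨⟨h1, h2.trans hm.2⟩, h2⟩
lemma Xm : Measurable (fun q : ℝˣ ↦ Ze‡) := by
  have : StronglyMeasurable (fun z : (ℝˣ) × ℝ ↦ (Iic z.1.2).indicator (Zd z.1.1) z.2) := by
    refine Measurable.stronglyMeasurable ?_
    have : (fun z : (ℝˣ) × ℝ ↦ (Iic z.1.2).indicator (Zd z.1.1) z.2) =
      {z : (ℝˣ) × ℝ | z.2 ≤ z.1.2}.indicator (fun z ↦ Zd z.1.1 z.2) := by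
      ext z; simp [indicator]
    rw [this]
    refine Measurable.indicator ?_ (measurableSet_le Zn Zn)
    exact Q.pm.comp ((measurable_fst.comp measurable_fst).prodMk measurable_snd)
  exact this.integral_prod_right.measurable
lemma Xmem {t m : ℝ} (hm : m ∈ Kc) : Ze t m ∈ Icc 0 Je := by
  rw [Q.Xeq hm, ← Q.pL t]
  refine ⟨iinno hm.1 fun n _ ↦ (Km t n).le, ?_⟩
  exact iinmoin le_rfl hm.1 hm.2
    (Eventually.of_forall fun n ↦ (Km t n).le) (Q.pint t)
lemma Xaep : ∀q Tendsto (fun i ↦ ♠.X‡) atTop (𝓝 Ze‡) := by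
  have h1 : ∀q ∀ m ∈ Icc Jc 2,
      Tendsto (fun i ↦ ♠.X q.1 m) atTop (𝓝 (∫ n in Jc..m, Zd q.1 n)) :=
    Measure.quasiMeasurePreserving_fst.ae Q.Xae
  have h2 : ∀q q.2 ∈ Icc Jc 2 := ae_kap fun t _ m hm ↦ Ioc_subset_Icc_self hm
  filter_upwards [h1, h2] with q a b
  rw [Q.Xeq b]; exact a _ b
lemma aae : ∀q Tendsto (fun i ↦ ♠.a‡) atTop
    (𝓝 (Jm Ze‡ / Zd‡)) := by
  filter_upwards [Q.Xaep, Q.pae] with q h1 h2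
  exact ((P.Wcont.tendsto _).comp h1).div h2 (Km _ _).ne'
lemma aCau : Cau (fun i j ↦ ∫ q, |q.1 ^ 3 * (♠.a‡ - ♣.a‡)| ∂ Jd) := by
  refine Cau.of_seq fun a b ha hb ↦ ?_
  have nt : Nice Ja (fun t _ ↦ t ^ 3) := Nice.ofT Zn
  have n1 := fun i j ↦ nt.mul (♠.na.sub ♣.na)
  refine smallL1 _ (fun k ↦ (n1 K7 K8).int.aestronglyMeasurable)
    (2 * (Ja ^ 4 * Jg ^ 2) * (2 * C + 2 * C))
    (fun k ↦ ((n1 K7 K8).pow 2).int) (fun k ↦ ?_) ?_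
  · have c (i : ℕ) := ♠.cts
    have nn (i : ℕ) : Nice Ja (fun t _ ↦ t ^ 2 * ♠.s t ^ 2) := Nice.ofT (c i)
    refine (Nice.imono ((n1 K7 K8).pow 2) ((Nice.const _ (2 * (Ja ^ 4 * Jg ^ 2))).mul ((nn K7).add (nn K8))) ?_).trans ?_
    · intro t ht m hm
      have ht := Ioc_subset_Icc_self ht
      have hm := Ioc_subset_Icc_self hm
      have t0 := ht.1
      have tT := ht.2
      have h1 (i : ℕ) : ♠.a t m ^ 2 ≤ Jg ^ 2 * ♠.s t ^ 2 := by
        rw [← sq_abs, ← mul_pow]; exact pow_le_pow_left₀ Jy (♠.a_le ht hm) 2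
      calc _ ≤ t ^ 6 * (2 * ((Nl K7).a t m ^ 2 + (Nl K8).a t m ^ 2)) := by
            rw [mul_pow, ← pow_mul]
            refine mul_le_mul_of_nonneg_left ?_ Jh
            nlinarith [sq_nonneg ((Nl K7).a t m + (Nl K8).a t m)]
        _ ≤ t ^ 6 * (2 * (Jg ^ 2 * (Nl K7).s t ^ 2 + Jg ^ 2 * (Nl K8).s t ^ 2)) := by
            have := h1 K7
            have := h1 K8
            gcongr
        _ = 2 * (t ^ 4 * Jg ^ 2) * (t ^ 2 * (Nl K7).s t ^ 2 + t ^ 2 * (Nl K8).s t ^ 2) := by ring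
        _ ≤ _ := by gcongr
    · rw [integral_const_mul, Nice.iadd (nn _) (nn _), Nice.iofT Zk (c _), Nice.iofT Zk (c _)]
      have h1 (i : ℕ) := ♠.hs2
      refine mul_le_mul_of_nonneg_left ?_ (by have := Y6; positivity)
      linarith [h1 K7, h1 K8]
  · filter_upwards [Q.aae] with q h
    simpa using ((h.comp ha).sub (h.comp hb)).const_mul (q.1 ^ 3)
/-- truncated weight -/
noncomputable def κ (t m : ℝ) : ℝ := min (t ^ 3 * Jm Uh * (Jm Uh / Zd t m)) 1
lemma κm : Measurable (fun q : ℝˣ ↦ Yq‡) := by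
  have h := P.Wcont.measurable.comp Q.Xm
  exact (((measurable_fst.pow_const 3).mul h).mul (h.div Q.pm)).min measurable_const
lemma om0 {t m : ℝ} (ht : 0 ≤ t) {w p : ℝ} (hp : 0 < p) : 0 ≤ t ^ 3 * w * (w / p) := by
  have : t ^ 3 * w * (w / p) = t ^ 3 * w ^ 2 / p := by ring
  rw [this]; positivity
lemma κ0 {t m : ℝ} (ht : 0 ≤ t) : 0 ≤ Yq t m := le_min (om0 (m := m) ht (Km t m)) zero_le_one
lemma nκ : Nice Ja Yq := ⟨Q.κm, 1, fun t ht m _ ↦ by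
  rw [abs_of_nonneg (Q.κ0 ht.1)]; exact min_le_right _ _⟩
lemma κr : Cau (fun i j ↦ ∫ q, |Yq‡ * ♠.r‡ - Yq‡ * ♣.r‡| ∂ Jd) := by
  have hT := Zk
  have hB := Y6
  -- weight comparison
  have nω (i : ℕ) : Nice Ja (fun t m ↦ min Eu 1) :=
    (♠.nθ.mul ♠.na).comp (φ := fun x ↦ min x 1) Zn
  have nd (i : ℕ) := (Q.nκ.sub (nω i))
  have h1 : Tendsto (fun i ↦ ∫ q, |Yq‡ - min (♠.θ‡ * ♠.a‡) 1| ∂ Jd)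
      atTop Zx := by
    refine smallL1 _ (fun i ↦ (nd i).int.aestronglyMeasurable) (2 * Ja * 1) (fun i ↦ ((nd i).pow 2).int) (fun i ↦ ?_) ?_
    · rw [← Nice.iconst hT 1]
      refine Nice.imono ((nd i).pow 2) Es fun t ht m hm ↦ ?_
      have a1 := Q.κ0 (m := m) ht.1.le
      have a2 : Yq t m ≤ 1 := min_le_right _ _
      have a3 : 0 ≤ min Eu 1 :=
        le_min (om0 (m := m) ht.1.le (♠.p_pos t m)) zero_le_one
      have a4 : min Eu 1 ≤ 1 := min_le_right _ _
      rw [← sq_abs]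
      refine pow_le_one₀ Jy ?_
      rw [abs_le]; constructor <;> linarith
    · filter_upwards [Q.aae, Q.Xaep] with q h1 h2
      have h3 := (((P.Wcont.tendsto _).comp h2).const_mul (q.1 ^ 3)).mul h1
      have h4 := (h3.min (tendsto_const_nhds (x := Y1))).const_sub Yq‡
      rw [κ, sub_self] at h4
      exact h4
  intro ε hε
  obtain ⟨η, hη, hη1⟩ : ∃ η > 0, 2 * Ja * η ≤ ε / 3 := by
    refine ⟨ε / (6 * (Ja + 1)), by positivity, ?_⟩
    rw [← sub_nonneg]
    have : ε / 3 - 2 * Ja * (ε / (6 * (Ja + 1))) = ε / (3 * (Ja + 1)) := by field_simp; ring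
    rw [this]; positivity
  set K := Jg * Zc with hK
  have K0 : 0 ≤ K := by have := (Nl 0).C0; have := Uw; positivity
  set δ := ε * η ^ 3 / 9 with hδ
  have δ0 : 0 < δ := by positivity
  obtain ⟨N1, hN1⟩ := Q.hψ (δ / Ev) Jh
  obtain ⟨N2, hN2⟩ := Q.aCau (δ / (6 * G6)) Jh
  obtain ⟨N3, hN3⟩ := eventually_atTop.1 (Q.he.eventually_le_const (show Jc < δ / G7 by positivity))
  obtain ⟨N4, hN4⟩ := eventually_atTop.1 (h1.eventually_le_const (show Jc < ε * η ^ 3 / 3 by positivity))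
  refine ⟨max (max N1 N2) (max N3 N4), fun i hi j hj ↦ ?_⟩
  simp only [ge_iff_le, max_le_iff] at hi hj
  have J := ♠.apair (Nl j) (D := δ / Ev) Jh (hN1 i hi.1.1 j hj.1.1)
  have J2 : ∫ q, ♠.θ‡ * ♠.a‡ * G8 ^ 4 ∂ Jd ≤ 3 * δ := by
    rw [← hK] at J
    refine J.trans ?_
    have j1 : 3 * (δ / Ev * K) ≤ δ := by
      rw [show 3 * (δ / Ev * K) = δ * (K / (K + 1)) by field_simp]
      exact mul_le_of_le_one_right δ0.le ((div_le_one Jh).2 Js)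
    have j2 : 6 * Jg * (∫ q, |q.1 ^ 3 * (♠.a‡ - ♣.a‡)| ∂ Jd) ≤ δ := by
      calc _ ≤ 6 * Jg * (δ / (6 * G6)) := mul_le_mul_of_nonneg_left (hN2 i hi.1.2 j hj.1.2) Jh
        _ = δ * (Jg / G6) := by field_simp
        _ ≤ δ := mul_le_of_le_one_right δ0.le ((div_le_one Jh).2 Js)
    have j3 : 6 * G5 * (Q.e i + Q.e j) ≤ δ := by
      calc _ ≤ 6 * G5 * (δ / G7 + δ / G7) :=
            mul_le_mul_of_nonneg_left (add_le_add (hN3 i hi.2.1) (hN3 j hj.2.1)) Jh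
        _ = δ * (Jg * Ja / (Jg * Ja + 1)) := by field_simp; ring
        _ ≤ δ := mul_le_of_le_one_right δ0.le ((div_le_one Jh).2 Js)
    linarith
  have nq := (♠.nθ.mul ♠.na).mul ((♠.nr.sub ♣.nr).pow 4)
  have nc := (nd i).abs.add nq
  refine (Nice.imono ((Q.nκ.mul ♠.nr).sub (Q.nκ.mul ♣.nr)).abs ((Nice.const _ η).add ((Nice.const _ (1 / η ^ 3)).mul nc)) ?_).trans ?_
  · intro t ht m hm
    set d := ♠.r t m - ♣.r t m with hd
    have d1 : |d| ≤ 1 := by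
      have := ♠.r0 t m; have := ♠.r1 t m; have := ♣.r0 t m; have := ♣.r1 t m
      rw [abs_le]; constructor <;> linarith
    have a1 := Q.κ0 (m := m) ht.1.le
    have a2 : Yq t m ≤ 1 := min_le_right _ _
    have a3 := om0 (m := m) (w := Jm (♠.X t m)) ht.1.le (♠.p_pos t m)
    change 0 ≤ ♠.θ t m * ♠.a t m at a3
    set w := ♠.θ t m * ♠.a t m
    rw [← mul_sub, ← hd, abs_mul, abs_of_nonneg a1]
    have b1 : |d| ≤ η + d ^ 4 / η ^ 3 := by
      rcases le_total |d| η with h | h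
      · have : 0 ≤ d ^ 4 / η ^ 3 := by positivity
        linarith
      · have : |d| ≤ d ^ 4 / η ^ 3 := by
          rw [le_div_iff₀ Jh]
          calc |d| * η ^ 3 ≤ |d| * |d| ^ 3 := by gcongr
            _ = |d| ^ 4 := by ring
            _ = d ^ 4 := by rw [← abs_pow, abs_of_nonneg Jh]
        linarith
    have b2 : Yq t m * d ^ 4 ≤ |Yq t m - min w 1| + w * d ^ 4 := by
      have d4 : d ^ 4 ≤ 1 := by
        rw [← abs_of_nonneg (by positivity : 0 ≤ d ^ 4), abs_pow]; exact pow_le_one₀ Jy d1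
      have d40 : 0 ≤ d ^ 4 := by positivity
      calc Yq t m * d ^ 4 = (Yq t m - min w 1) * d ^ 4 + min w 1 * d ^ 4 := by ring
        _ ≤ |Yq t m - min w 1| * 1 + w * d ^ 4 := by
            refine add_le_add (mul_le_mul (le_abs_self _) d4 d40 Jy) ?_
            exact mul_le_mul_of_nonneg_right (min_le_left _ _) d40
        _ = _ := by ring
    calc Yq t m * |d| ≤ Yq t m * (η + d ^ 4 / η ^ 3) := by gcongr
      _ = Yq t m * η + 1 / η ^ 3 * (Yq t m * d ^ 4) := by ring
      _ ≤ 1 * η + 1 / η ^ 3 * (|Yq t m - min w 1| + w * d ^ 4) := by gcongr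
      _ = _ := by ring
  · rw [Nice.iadd (Nice.const _ η) ((Nice.const _ (1 / η ^ 3)).mul nc), Nice.iconst hT, integral_const_mul,
      Nice.iadd (nd i).abs nq]
    have : 1 / η ^ 3 * ((∫ q, |Yq‡ - min (♠.θ‡ * ♠.a‡) 1| ∂ Jd) +
        ∫ q, ♠.θ‡ * ♠.a‡ * G8 ^ 4 ∂ Jd) ≤
        1 / η ^ 3 * (ε * η ^ 3 / 3 + 3 * δ) :=
      mul_le_mul_of_nonneg_left (add_le_add (hN4 i hi.2.2) J2) Jh
    have e : 1 / η ^ 3 * (ε * η ^ 3 / 3 + 3 * δ) = 2 * (ε / 3) := by rw [hδ]; field_simp; ring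
    linarith
end Sq
lemma weakStrong {α : Type*} [MeasurableSpace α] {μ : Measure α} [IsFiniteMeasure μ] {w : ℕ → α → ℝ} {wd : α → ℝ}
    (hw : ∀ i, MemLp (w i) 2 μ) {C : ℝ} (hC : ∀ i, ∫ x, w i x ^ 2 ∂μ ≤ C) {U : Ultrafilter ℕ} (hU : (U : Filter ℕ) ≤ atTop)
    (hweak : ∀ h : α → ℝ, MemLp h 2 μ → Tendsto (fun i ↦ ∫ x, w i x * h x ∂μ) U (𝓝 (∫ x, wd x * h x ∂μ)))
    {g : ℕ → α → ℝ} {gp : α → ℝ} (gm : ∀ i, AEStronglyMeasurable (g i) μ) {K : ℝ}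
    (hK : ∀ i, ∀ᵐ x ∂μ, |g i x| ≤ K) (hg : ∀ᵐ x ∂μ, Tendsto (fun i ↦ g i x) atTop (𝓝 (gp x))) :
    Tendsto (fun i ↦ ∫ x, w i x * g i x ∂μ) U (𝓝 (∫ x, wd x * gp x ∂μ)) := by
  have gmp : AEStronglyMeasurable gp μ := aestronglyMeasurable_of_tendsto_ae atTop gm hg
  have hKp : ∀ᵐ x ∂μ, |gp x| ≤ K := by
    filter_upwards [hg, ae_all_iff.2 hK] with x h1 h2
    exact le_of_tendsto h1.abs (Eventually.of_forall h2)
  have m1 : ∀ i, MemLp (g i) 2 μ := fun i ↦ MemLp.of_bound (gm i) K (hK i)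
  have m2 : MemLp gp 2 μ := MemLp.of_bound gmp K hKp
  have m3 : ∀ i, MemLp (fun x ↦ g i x - gp x) 2 μ := fun i ↦ (m1 i).sub m2
  have h1 := hweak gp m2
  have h2 : Tendsto (fun i ↦ ∫ x, Un ^ 2 ∂μ) atTop Zx := by
    have := tendsto_integral_of_dominated_convergence (μ := μ) (F := fun i x ↦ Un ^ 2) (f := fun _ ↦ 0)
      (fun _ ↦ Eh ^ 2) (fun i ↦ (m3 i).integrable_sq.aestronglyMeasurable) (integrable_const _)
      (fun i ↦ by
        filter_upwards [hK i, hKp] with x a b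
        rw [rnoeqab, abs_of_nonneg (sq_nonneg _), ← sq_abs]
        exact pow_le_pow_left₀ Jy (☁.trans Js) 2)
      (by filter_upwards [hg] with x a; simpa using (a.sub_const (gp x)).pow 2)
    simpa using this
  have C0 : 0 ≤ C := (integral_nonneg fun x ↦ sq_nonneg _).trans (hC 0)
  have h3 : Tendsto (fun i ↦ ∫ x, w i x * Un ∂μ) atTop Zx := by
    rw [Metric.tendsto_atTop]
    intro ε hε
    obtain ⟨N, hN⟩ := (Metric.tendsto_atTop.1 h2) (ε / 2 * (ε / (2 * (C + 1)))) Jh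
    refine ⟨N, fun i hi ↦ ?_⟩
    have hN := hN i hi
    rw [dist_zero_right, rnoeqab] at hN ⊢
    have k := (le_abs_self _).trans_lt hN
    set δ := ε / (2 * (C + 1)) with hδ
    have δ0 : 0 < δ := by positivity
    calc |∫ x, w i x * Un ∂μ| ≤ ∫ x, (δ * w i x ^ 2 + (1 / δ) * Un ^ 2) ∂μ := by
          rw [← rnoeqab]
          refine norm_integral_le_of_norm_le (((hw i).integrable_sq.const_mul δ).add ((m3 i).integrable_sq.const_mul _))
            (Eventually.of_forall fun x ↦ ?_)
          rw [rnoeqab, abs_mul]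
          have := young |w i x| |g i x - gp x| δ δ0
          rw [sq_abs, sq_abs] at this
          rw [one_div_mul_eq_div]; exact this
      _ = δ * (∫ x, w i x ^ 2 ∂μ) + (1 / δ) * ∫ x, Un ^ 2 ∂μ := by
          rw [integral_add ((hw i).integrable_sq.const_mul δ) ((m3 i).integrable_sq.const_mul _),
            integral_const_mul, integral_const_mul]
      _ < δ * (C + 1) + (1 / δ) * (ε / 2 * δ) := by
          refine add_lt_add_of_le_of_lt (mul_le_mul_of_nonneg_left ((hC i).trans Js) δ0.le) ?_
          exact mul_lt_mul_of_pos_left k Jh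
      _ = ε := by rw [hδ]; field_simp; ring
  have h4 := h1.add (h3.mono_left hU)
  rw [add_zero] at h4
  refine h4.congr fun i ↦ ?_
  have := integral_add (f := fun x ↦ w i x * gp x) (g := fun x ↦ w i x * Un) ((hw i).integrable_mul m2)
    ((hw i).integrable_mul (m3 i))
  rw [← this]
  congr 1; ext x; ring
lemma weakNonneg {α : Type*} [MeasurableSpace α] {μ : Measure α} {g : α → ℝ} (hg : MemLp g 2 μ)
    (h : ∀ h : α → ℝ, MemLp h 2 μ → (∀ x, 0 ≤ h x) → 0 ≤ ∫ x, g x * h x ∂μ) : ∀ᵐ x ∂μ, 0 ≤ g x := by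
  have m : MemLp (fun x ↦ max Ew 0) 2 μ := hg.neg.pos_part
  have h1 := h _ m fun x ↦ le_max_right _ _
  have e : ∀ x, g x * max Ew 0 = - (max Ew 0) ^ 2 := fun x ↦ by
    rcases le_total Ew 0 with h | h
    · rw [max_eq_right h]; simp
    · rw [max_eq_left h]; ring
  simp_rw [e] at h1
  rw [integral_neg] at h1
  have h2 : ∫ x, (max Ew 0) ^ 2 ∂μ = 0 := le_antisymm Js (integral_nonneg fun x ↦ sq_nonneg _)
  rw [integral_eq_zero_iff_of_nonneg (fun x ↦ sq_nonneg _) m.integrable_sq] at h2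
  filter_upwards [h2] with x hx
  have : max Ew 0 = 0 := by simpa using hx
  have := le_max_left Ew 0
  linarith
namespace Sq
variable {P : Par} {C : ℝ} (Q : Sq P C)
lemma gdct {f : ℕ → ℝˣ → ℝ} {g : ℝˣ → ℝ} (fm : ∀ i, AEStronglyMeasurable Ee Jd) (K : ℝ)
    (hK : ∀ i, ∀q |f i q| ≤ K * (1 + ♠.p‡))
    (hg : ∀q Tendsto (fun i ↦ f i q) atTop (𝓝 (g q))) :
    Integrable g Jd ∧ Tendsto (fun i ↦ ∫ q, |f i q - g q| ∂ Jd) atTop Zx := by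
  have gm : AEStronglyMeasurable g Jd := aestronglyMeasurable_of_tendsto_ae atTop fm hg
  have gK : ∀q |g q| ≤ K * (1 + Zd‡) := by
    filter_upwards [hg, ae_all_iff.2 hK, Q.pae] with q h1 h2 h3
    exact le_of_tendsto_of_tendsto' h1.abs ((h3.const_add 1).const_mul K) h2
  have bi : Integrable (fun q : ℝˣ ↦ K * (1 + Zd‡)) Jd := ((integrable_const _).add Q.pI).const_mul K
  have bip (i : ℕ) : Integrable (fun q : ℝˣ ↦ K * (1 + ♠.p‡)) Jd :=
    ((integrable_const _).add ♠.np.int).const_mul K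
  have gi : Integrable g Jd := bi.mono' gm gK
  have fi (i : ℕ) : Integrable Ee Jd := (bip i).mono' (fm i) (hK i)
  refine ⟨gi, ?_⟩
  have h1 : Tendsto (fun i ↦ ∫ q, min |f i q - g q| (2 * Yi) ∂ Jd) atTop (𝓝 (∫ q, 0 ∂ Jd)) := by
    refine tendsto_integral_of_dominated_convergence (fun q ↦ 2 * Yi)
      (fun i ↦ ((fm i).sub gm).norm.inf (bi.const_mul 2).aestronglyMeasurable) (bi.const_mul 2) (fun i ↦ ?_) ?_
    · filter_upwards [gK] with q h
      have : 0 ≤ 2 * Yi := by linarith [abs_nonneg (g q)]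
      rw [rnoeqab, abs_of_nonneg (le_min Jy this)]
      exact min_le_right _ _
    · filter_upwards [gK, hg] with q h ho
      have h0 : 0 ≤ 2 * Yi := by linarith [abs_nonneg (g q)]
      have := ((ho.sub_const (g q)).abs).min (tendsto_const_nhds (x := 2 * Yi))
      rwa [sub_self, abs_zero, min_eq_left h0] at this
  have di (i : ℕ) : Integrable (fun q : ℝˣ ↦ |♠.p‡ - Zd‡|) Jd := (♠.np.int.sub Q.pI).abs
  have mi (i : ℕ) : Integrable (fun q : ℝˣ ↦ min |f i q - g q| (2 * Yi)) Jd :=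
    ((fi i).sub gi).abs.inf (bi.const_mul 2)
  have h2 := h1.add (Q.pL1.const_mul |K|)
  simp only [integral_zero, mul_zero, add_zero] at h2
  refine squeeze_zero (fun i ↦ integral_nonneg fun q ↦ abs_nonneg _) (fun i ↦ ?_) h2
  rw [← integral_const_mul, ← integral_add (mi i) ((di i).const_mul _)]
  refine integral_mono_ae ((fi i).sub gi).abs ((mi i).add ((di i).const_mul _)) ?_
  filter_upwards [hK i, gK] with q a b
  have h3 : |f i q - g q| ≤ 2 * Yi + |K| * |♠.p‡ - Zd‡| := by
    have : K * (♠.p‡ - Zd‡) ≤ |K| * |♠.p‡ - Zd‡| := by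
      rw [← abs_mul]; exact le_abs_self _
    have := abs_sub (f i q) (g q)
    nlinarith
  have h4 : 0 ≤ |K| * |♠.p‡ - Zd‡| := by positivity
  rcases le_total |f i q - g q| (2 * Yi) with h | h
  · rw [min_eq_left h]; linarith
  · rw [min_eq_right h]; linarith
/-- the strong and weak limits -/
structure Lim (Q : Sq P C) (U : Ultrafilter ℕ) (r v : ℝ → ℝ → ℝ) : Prop where
  rm : Measurable (fun q : ℝˣ ↦ r‡)
  vm : Measurable (fun q : ℝˣ ↦ v‡)
  r0 : ∀ t m, 0 ≤ Ka m
  r1 : ∀ t m, Ka m ≤ 1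
  v2 : MemLp (fun q : ℝˣ ↦ v‡) 2 Jd
  hr : ∀ h : ℝˣ → ℝ, MemLp h 2 Jd →
    Tendsto (fun i ↦ ∫ q, ♠.r‡ * h q ∂ Jd) U (𝓝 (∫ q, r‡ * h q ∂ Jd))
  hv : ∀ h : ℝˣ → ℝ, MemLp h 2 Jd →
    Tendsto (fun i ↦ ∫ q, ♠.v‡ * h q ∂ Jd) U (𝓝 (∫ q, v‡ * h q ∂ Jd))
  hA : ∀q Tendsto (fun i ↦ ♠.A‡ * ♠.p‡) atTop
    (𝓝 K9)
lemma rsq (i : ℕ) : ∫ q, ♠.r‡ ^ 2 ∂ Jd ≤ 2 * Ja * 1 := by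
  rw [← Nice.iconst Zk 1]
  exact Nice.imono (♠.nr.pow 2) Es fun t _ m _ ↦ (♠.r2 t m).2
theorem exLim (Q₀ : Sq P C) (U : Ultrafilter ℕ) (hU : (U : Filter ℕ) ≤ atTop) :
    ∃ (Q : Sq P C) (r v : ℝ → ℝ → ℝ), Lim Q U r v := by
  obtain ⟨g, gm, gi, hg⟩ := cauchyL1 _ (fun i ↦ (Q₀.nκ.mul ★.nr).int) Q₀.κr
  obtain ⟨φ, hφ, hae⟩ := aeSubseq (fun i (q : ℝˣ) ↦ Q₀.κ‡ * ★.r‡ - g q)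
    (fun i ↦ (Q₀.nκ.mul ★.nr).int.sub gi) hg
  have hg1 := hg.comp hφ.tendsto_atTop
  have nt : Nice Ja (fun t _ ↦ t ^ 2) := Nice.ofT Zn
  have nα (i : ℕ) : Nice Ja (fun t m ↦ t ^ 2 * |★.A t m - ★.a t m * (★.r t m - ★.r t m ^ 2)|) :=
    nt.mul (★.nA.sub (★.na.mul (★.nr.sub (★.nr.pow 2)))).abs
  obtain ⟨φp, hφp, hα⟩ := aeSubseq (fun i (q : ℝˣ) ↦ q.1 ^ 2 * |☚.A‡ - ☚.a‡ *
      (☚.r‡ - ☚.r‡ ^ 2)|) (fun i ↦ (nα Z3).int) (by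
    refine squeeze_zero (fun i ↦ integral_nonneg fun q ↦ abs_nonneg _) (fun i ↦ ?_) (Q₀.he.comp hφ.tendsto_atTop)
    refine le_trans (le_of_eq ?_) ☚.eA
    refine integral_congr_ae (Eventually.of_forall fun q ↦ ?_)
    simp only
    rw [abs_of_nonneg Jh]; rfl)
  set Q := Q₀.sub (hφ.comp hφp) with hQ
  have hκ : ∀q Tendsto (fun i ↦ Yq‡ * ♠.r‡) atTop (𝓝 (g q)) := by
    filter_upwards [hae] with q h
    have := (h.comp hφp.tendsto_atTop).add_const (g q)
    rw [zero_add] at this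
    exact this.congr fun i ↦ sub_add_cancel _ _
  have hαp : ∀q Tendsto (fun i ↦ q.1 ^ 2 * |♠.A‡ - ♠.a‡ *
      Y8|) atTop Zx := hα
  clear_value Q
  obtain ⟨r₀, r₀m, r₀2, hr⟩ := weakLim (fun i (q : ℝˣ) ↦ ♠.r‡) (fun i ↦ ♠.nr.memLp 2) _ Q.rsq U
  obtain ⟨v, vm, v2, hv⟩ := weakLim (fun i (q : ℝˣ) ↦ ♠.v‡) G9 _ (fun i ↦ ♠.hv2) U
  have p1 : ∀q 0 ≤ r₀ q := weakNonneg r₀2 fun h hh h0 ↦ by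
    refine ge_of_tendsto (hr h hh) (Eventually.of_forall fun i ↦ integral_nonneg fun q ↦ ?_)
    exact mul_nonneg (♠.r0 _ _) (h0 q)
  have p2 : ∀q 0 ≤ 1 - r₀ q := weakNonneg ((memLp_const 1).sub r₀2) fun h hh h0 ↦ by
    have h1 := (hr h hh).const_sub (∫ q, h q ∂ Jd)
    have e : ∫ q, (1 - r₀ q) * h q ∂ Jd = (∫ q, h q ∂ Jd) - ∫ q, r₀ q * h q ∂ Jd := by
      have := integral_sub (f := h) (g := fun q ↦ r₀ q * h q) (hh.integrable one_le_two) (r₀2.integrable_mul hh)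
      rw [← this]
      congr 1; ext q; ring
    change 0 ≤ ∫ q, (1 - r₀ q) * h q ∂ Jd
    rw [e]
    refine ge_of_tendsto h1 (Eventually.of_forall fun i ↦ sub_nonneg.2 ?_)
    refine integral_mono ((♠.nr.memLp 2).integrable_mul hh) (hh.integrable one_le_two) fun q ↦ ?_
    exact mul_le_of_le_one_left (h0 q) (♠.r1 _ _)
  set r : ℝ → ℝ → ℝ := fun t m ↦ max 0 (min (r₀ Kb) 1) with hrdef
  have rm : Measurable (fun q : ℝˣ ↦ r‡) := measurable_const.max (r₀m.min measurable_const)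
  have rr : ∀q r₀ q = r‡ := by
    filter_upwards [p1, p2] with q a b
    simp only [hrdef]
    rw [min_eq_left Js, max_eq_right a]
  have hrp : ∀ h : ℝˣ → ℝ, MemLp h 2 Jd →
      Tendsto (fun i ↦ ∫ q, ♠.r‡ * h q ∂ Jd) U (𝓝 (∫ q, r‡ * h q ∂ Jd)) := by
    intro h hh
    have := hr h hh
    rwa [integral_congr_ae (g := fun q ↦ r‡ * h q) (by filter_upwards [rr] with q a; rw [a])] at this
  have r0 : ∀ t m, 0 ≤ r t m := fun t m ↦ le_max_left _ _
  have r1 : ∀ t m, Ka m ≤ 1 := fun t m ↦ max_le zero_le_one (min_le_right _ _)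
  have nr : Nice Ja r := ⟨rm, 1, fun t _ m _ ↦ by rw [abs_of_nonneg (r0 t m)]; exact r1 t m⟩
  -- identification
  have κ1 (i : ℕ) : ∀q |Yq‡ * ♠.r‡| ≤ 1 := ae_kap fun t ht m hm ↦ by
    have a1 := Q.κ0 (m := m) ht.1.le
    have a2 : Yq t m ≤ 1 := min_le_right _ _
    rw [abs_of_nonneg (mul_nonneg a1 (♠.r0 t m))]
    exact mul_le_one₀ a2 (♠.r0 t m) (♠.r1 t m)
  have gid : g =ᵐ[kap Ja] fun q ↦ Yq‡ * r‡ := by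
    refine gi.ae_eq_of_forall_setIntegral_eq _ _ (Q.nκ.mul nr).int fun s hs _ ↦ ?_
    have l1 : Tendsto (fun i ↦ ∫ q in s, Yq‡ * ♠.r‡ ∂ Jd) atTop (𝓝 (∫ q in s, g q ∂ Jd)) :=
      tendsto_integral_of_dominated_convergence (fun _ ↦ 1) (fun i ↦ (Q.nκ.mul ♠.nr).int.aestronglyMeasurable.restrict)
        (integrable_const _) (fun i ↦ ae_restrict_of_ae (κ1 i)) (ae_restrict_of_ae hκ)
    have l2 := hrp (s.indicator (fun q ↦ Yq‡)) ((Q.nκ.memLp 2).indicator hs)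
    have ee : ∀ f : ℝˣ → ℝ, ∫ q, f q * s.indicator (fun q ↦ Yq‡) q ∂ Jd =
        ∫ q in s, Yq‡ * f q ∂ Jd := fun f ↦ by
      rw [← integral_indicator hs]
      congr 1; ext q
      by_cases h : q ∈ s <;> simp [h, mul_comm]
    simp_rw [ee] at l2
    exact tendsto_nhds_unique (l1.mono_left hU) l2
  refine ⟨Q, r, fun t m ↦ v Kb, rm, vm, r0, r1, v2, hrp, hv, ?_⟩
  have t0 : ∀q 0 < q.1 := ae_kap fun t ht m hm ↦ ht.1
  filter_upwards [t0, gid, hκ, hαp, Q.Xaep, Q.pae] with q h0 h1 h2 h3 h4 h5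
  set W := Jm Ze‡ with hW
  have hWi : Tendsto (fun i ↦ Jm ♠.X‡) atTop (𝓝 W) := (P.Wcont.tendsto _).comp h4
  have e1 : ∀ i, ♠.A‡ * ♠.p‡ = (♠.A‡ - ♠.a‡ *
      Y8) * ♠.p‡ + Jm ♠.X‡ *
      Y8 := fun i ↦ by
    have := (♠.p_pos‡).ne'
    rw [Approx.a]; field_simp; ring
  have z1 : Tendsto (fun i ↦ ♠.A‡ - ♠.a‡ *
      Y8) atTop Zx := by
    rw [tendsto_zero_iff_abs_tendsto_zero]
    have := h3.const_mul (1 / q.1 ^ 2)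
    rw [mul_zero] at this
    refine this.congr fun i ↦ ?_
    simp only [Function.comp]; field_simp
  have z2 : Tendsto (fun i ↦ Jm ♠.X‡ * Y8) atTop
      (𝓝 (W * Zz)) := by
    by_cases hW0 : W = 0
    · rw [hW0, zero_mul]
      rw [hW0] at hWi
      refine squeeze_zero_norm (fun i ↦ ?_) (tendsto_zero_iff_abs_tendsto_zero _ |>.1 hWi)
      rw [rnoeqab, abs_mul]
      refine mul_le_of_le_one_right Jy ?_
      have := ♠.r0‡; have := ♠.r1‡
      rw [abs_le]; constructor <;> nlinarith
    · have kp : 0 < Yq‡ := by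
        refine lt_min ?_ one_pos
        have : q.1 ^ 3 * Jm Ze‡ * (Jm Ze‡ / Zd‡) = q.1 ^ 3 * W ^ 2 / Zd‡ := by
          rw [← hW]; ring
        rw [this]
        have := Km‡
        positivity
      have hri : Tendsto (fun i ↦ ♠.r‡) atTop (𝓝 r‡) := by
        have := h2.div_const Yq‡
        rw [h1, mul_div_cancel_left₀ _ kp.ne'] at this
        exact this.congr fun i ↦ mul_div_cancel_left₀ _ kp.ne'
      exact hWi.mul (hri.sub (hri.pow 2))
  simp_rw [e1]
  simpa using (z1.mul h5).add z2
end Sq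
/-- test functions -/
structure Tst (T : ℝ) where
  f : ℝˣ → ℝ
  ft : ℝˣ → ℝ
  fx : ℝˣ → ℝ
  c : Continuous f
  ct : Continuous ft
  cx : Continuous fx
  d : ∀ z, HasFDerivAt f (ft z • ContinuousLinearMap.fst ℝ ℝ ℝ + fx z • ContinuousLinearMap.snd ℝ ℝ ℝ) z
  fT : ∀ x, f (T, x) = 0
lemma Tst.bd {T : ℝ} (F : Tst T) (L : ℝ) : ∃ K, 0 ≤ K ∧ ∀ t ∈ Icc 0 T, ∀ x ∈ Icc 0 L, |Z4 Zt| ≤ K ∧ |Ju Zt| ≤ K := by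
  have hc : IsCompact (Nh T ×ˢ Icc 0 L) := isCompact_Icc.prod isCompact_Icc
  obtain ⟨K1, h1⟩ := hc.exists_bound_of_continuousOn F.ct.continuousOn
  obtain ⟨K2, h2⟩ := hc.exists_bound_of_continuousOn F.cx.continuousOn
  refine ⟨max 0 (max K1 K2), le_max_left _ _, fun t ht x hx ↦ ⟨?_, ?_⟩⟩
  · exact (h1 Zt ⟨ht, hx⟩).trans J1
  · exact (h2 Zt ⟨ht, hx⟩).trans J1
lemma Tst.dx {T : ℝ} (F : Tst T) (t x : ℝ) : HasDerivAt (fun y ↦ Zf (t, y)) (Ju Zt) x := by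
  have := (F.d Zt).comp_hasDerivAt x ((hasDerivAt_const x t).prodMk (hasDerivAt_id x))
  exact this.congr_deriv J1
lemma Tst.dt {T : ℝ} (F : Tst T) (t x : ℝ) : HasDerivAt (fun y ↦ Zf (y, x)) (Z4 Zt) t := by
  have := (F.d Zt).comp_hasDerivAt t ((hasDerivAt_id t).prodMk (hasDerivAt_const t x))
  exact this.congr_deriv J1
namespace Approx
variable {P : Par} {C e : ℝ} (S : Approx P C e) (F : Tst Ja)
lemma dΦ (t : ℝ) : RD (fun m ↦ Zf Yx) (fun m ↦ Ju Yx * Zr) :=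
  ⟨F.c.comp (continuous_const.prodMk Ed.1), fun m hm ↦
    (F.dx t Zb).comp_hasDerivWithinAt m (Ed.2 m hm)⟩
lemma tΦ (m : ℝ) : TD Ja (fun t ↦ Zf Yx) (fun t ↦ Z4 Yx + Ju Yx * Y2) :=
  ⟨F.c.comp (continuous_id.prodMk (S.tX m).1), fun t ht ↦
    ((F.d Yx).comp_hasDerivAt t ((hasDerivAt_id t).prodMk ((S.tX m).2 t ht))).congr_deriv J1⟩
lemma nΦt : Nice Ja (fun t m ↦ Z4 Yx + Ju Yx * Y2) :=
  (S.nX.comp2 F.ct).add (☑.mul S.nv)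
lemma parts1 {u up : ℝ → ℝ → ℝ} (nu : Nice Ja u) (nup : Nice Ja up)
    (tu : ∀ m, TD Ja (fun t ↦ u t m) (fun t ↦ up t m)) :
    ∫ q, u‡ * Nz ∂ Jd =
      - (∫m u 0 m * Zf (0, Jo 0 m)) - ∫ q, up‡ * Zf Jw ∂ Jd := by
  have h0 : Jc ∈ Icc 0 Ja := ⟨le_rfl, Zk⟩
  have n1 := nup.mul Ud
  rw [(nu.mul (S.nΦt F)).fubp Zk, n1.fubp Zk, ← iinne,
    ← iinsu ((nu.mul Ud).neg.intm h0)]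
  · refine iincoz fun m hm ↦ ?_
    rw [uIcc_of_le zero_le_two] at hm
    have := (tu m).parts (S.tΦ F m) h0 (nup.intt h0 hm) ((S.nΦt F).intt h0 hm)
    simp only [this, F.fT]; ring
  · rw [intervalIntegrable_iff_integrableOn_Ioc_of_le zero_le_two]
    have := n1.int.integral_prod_right
    simp_rw [iinofle Zk]
    exact this
lemma parts2 {a ap : ℝ → ℝ → ℝ} (na : Nice Ja a) (nap : Nice Ja ap) (da : ∀ t, RD (a t) (ap t))
    (a0 : ∀ t, a t 0 = 0) (a2 : ∀ t, a t 2 = 0) {c : ℝ → ℝ} (hc : Continuous c) :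
    ∫ q, c q.1 * ap‡ * Zf Jw ∂ Jd =
      - ∫ q, c q.1 * a‡ * (Ju Jw * Jt‡) ∂ Jd := by
  have nc : Nice Ja (fun t _ ↦ c t) := Nice.ofT hc
  have n2 := ☑.mul S.np
  rw [((nc.mul nap).mul Ud).fub Zk, ((nc.mul na).mul n2).fub Zk, ← iinne]
  refine iincoz fun t ht ↦ ?_
  rw [uIcc_of_le Zk] at ht
  have := (S.dΦ F t).parts (da t) (n2.intm ht) (nap.intm ht)
  rw [a0, a2, mul_zero, mul_zero, sub_zero, zero_sub] at this
  simp only [mul_assoc, iincomu, ← mul_neg]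
  congr 1
  rw [← iinne] at this ⊢
  refine Eq.trans ?_ (this.trans ?_) <;> refine iincoz fun m _ ↦ ?_ <;> ring
/-- identity for one approximation -/
lemma ident1 : ∫ q, Zl‡ * Nz ∂ Jd -
    ∫ q, (S.A‡ * Jt‡) * Ju Jw ∂ Jd =
      - ∫m Zl 0 m * Zf (0, Jo 0 m) := by
  have h1 := S.parts1 F S.nr S.nrt S.tr
  have h2 := S.parts2 F S.nA S.nrt S.dA S.A0 S.A2 (continuous_const (y := Y1))
  simp only [one_mul] at h2
  rw [h1, h2]
  have : ∀ q : ℝˣ, (S.A‡ * Jt‡) * Ju Jw =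
    S.A‡ * (Ju Jw * Jt‡) := fun q ↦ by ring
  simp_rw [this]; ring
lemma ident2 : ∫ q, Nz ∂ Jd =
      - ∫m Zf (0, Jo 0 m) := by
  have h1 := S.parts1 F Es (Nice.const _ 0) (fun m ↦ ⟨continuous_const, fun t _ ↦ hasDerivAt_const _ _⟩)
  simpa using h1
/-- cutoff -/
noncomputable def chi (δ t : ℝ) : ℝ := 1 - rexp Ue
noncomputable def chip (δ t : ℝ) : ℝ := 2 * t / δ * rexp Ue
lemma chi_c (δ : ℝ) : Continuous (chi δ) := by unfold chi; fun_prop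
lemma chi'_c (δ : ℝ) : Continuous (chip δ) := by unfold chip; fun_prop
lemma chi_d (δ t : ℝ) : HasDerivAt (chi δ) (chip δ t) t := by
  have := ((((hasDerivAt_id t).pow 2).div_const δ).neg.exp).const_sub 1
  exact this.congr_deriv (by simp [chip]; ring)
lemma chi_0 {δ : ℝ} (hδ : 0 < δ) (t : ℝ) : 0 ≤ chi δ t := by
  have : rexp Ue ≤ 1 := Real.exp_le_one_iff.2 (neg_nonpos.2 Jh)
  unfold chi; linarith
lemma chi_1 (δ t : ℝ) : chi δ t ≤ 1 := by
  unfold chi; linarith [rexppos Ue]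
lemma chi_t {δ : ℝ} (t : ℝ) : chi δ t ≤ t ^ 2 / δ := by
  unfold chi; linarith [radonleex Ue]
lemma chi'_t {δ : ℝ} (hδ : 0 < δ) {t : ℝ} (ht : 0 ≤ t) : |chip δ t| ≤ 2 / δ * t := by
  have h1 := chi_0 hδ t
  unfold chi at h1
  unfold chip
  rw [abs_of_nonneg Jh]
  calc 2 * t / δ * rexp Ue ≤ 2 * t / δ * 1 := mul_le_mul_of_nonneg_left Js Jh
    _ = _ := by ring
lemma ident3 {ep : ℝ} (Sd : Approx P C ep) (δ : ℝ) :
    ∫ q, chi δ q.1 * Y7 * Nz ∂ Jd =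
    (∫ q, chi δ q.1 * Y4 * (Ju Jw * Jt‡) ∂ Jd) +
    ∫ q, chip δ q.1 * Z8 * (Ju Jw * Jt‡) ∂ Jd := by
  have nc : Nice Ja (fun t _ ↦ chi δ t) := Nice.ofT (chi_c δ)
  have ncp : Nice Ja (fun t _ ↦ chip δ t) := Nice.ofT (chi'_c δ)
  have n1 := ncp.mul (S.nr.sub Sd.nr)
  have n2 := nc.mul (S.nrt.sub Sd.nrt)
  have h1 := S.parts1 F (nc.mul (S.nr.sub Sd.nr)) (n1.add n2) (fun m ↦
    TD.mul (u := chi δ) (up := chip δ) ⟨chi_c δ, fun t _ ↦ chi_d δ t⟩ ((S.tr m).sub (Sd.tr m)))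
  have h2 := S.parts2 F (S.nA.sub Sd.nA) (S.nrt.sub Sd.nrt) (fun t ↦ (S.dA t).sub (Sd.dA t)) (fun t ↦ by rw [S.A0, Sd.A0, sub_zero])
    (fun t ↦ by rw [S.A2, Sd.A2, sub_zero]) (chi_c δ)
  have h3 := S.parts2 F (S.nψ.sub Sd.nψ) (S.nr.sub Sd.nr) (fun t ↦ (S.dψ t).sub (Sd.dψ t)) (fun t ↦ by rw [S.ψ0, Sd.ψ0, sub_zero])
    (fun t ↦ by rw [S.ψ2, Sd.ψ2, sub_self]) (chi'_c δ)
  have e0 : chi δ 0 = 0 := by simp [chi]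
  have e1 := Nice.iadd (n1.mul Ud) (n2.mul Ud)
  have e2 : ∀ q : ℝˣ, (chip δ q.1 * Y7 + chi δ q.1 * (S.rt‡ - Sd.rt‡)) *
      Zf Jw = chip δ q.1 * Y7 * Zf Jw +
      chi δ q.1 * (S.rt‡ - Sd.rt‡) * Zf Jw := fun q ↦ by ring
  rw [h1]
  simp_rw [e2]
  rw [e1, h2, h3, e0]
  simp only [zero_mul, intervalIntegral.integral_zero]; ring
end Approx
lemma Cau.of_lim {α : Type*} [MeasurableSpace α] {μ : Measure α} {f : ℕ → α → ℝ} {g : α → ℝ} (fi : ∀ i, Integrable Ee μ)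
    (gi : Integrable g μ) (h : Tendsto (fun i ↦ ∫ x, |Yc - g x| ∂μ) atTop Zx) :
    Cau (fun i j ↦ ∫ x, |Yc - f j x| ∂μ) := fun ε hε ↦ by
  obtain ⟨N, hN⟩ := (Metric.tendsto_atTop.1 h) (ε / 2) Jh
  have k : ∀ i ≥ N, ∫ x, |Yc - g x| ∂μ ≤ ε / 2 := fun i hi ↦ by
    have := (hN i hi).le
    rw [dist_zero_right, rnoeqab] at this
    exact (le_abs_self _).trans this
  refine ⟨N, fun i hi j hj ↦ ?_⟩
  have a := ((fi i).sub gi).abs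
  have b := ((fi j).sub gi).abs
  calc ∫ x, |Yc - f j x| ∂μ ≤ ∫ x, (|Yc - g x| + |f j x - g x|) ∂μ :=
        integral_mono ((fi i).sub (fi j)).abs (a.add b) fun x ↦ by
          have := abs_sub_le (Yc) (g x) (f j x)
          rwa [abs_sub_comm (g x)] at this
    _ = _ := integral_add a b
    _ ≤ ε := by linarith [k i hi, k j hj]
lemma realA {χ τ s C A Ad p pd η δ : ℝ} (hχ0 : 0 ≤ χ) (hχ1 : χ ≤ 1) (hχ : χ ≤ τ / δ) (hδ : 0 < δ) (hη : 0 < η)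
    (hp : 0 < p) (hpz : 0 < pd) (hA : |Ad| ≤ C * s) :
    χ * |A - Ad| * p ≤ |A * p - Ad * pd| + (η * C ^ 2 / δ * (τ * s ^ 2 * p) + η * C ^ 2 / δ * (τ * s ^ 2 * pd)
      + 1 / η * |pd - p|) := by
  have h1 : |A - Ad| * p ≤ |A * p - Ad * pd| + |Ad| * |pd - p| := by
    rw [← abs_mul, ← abs_of_pos hp, ← abs_mul, abs_of_pos hp]
    calc |(A - Ad) * p| = |(A * p - Ad * pd) + Ad * (pd - p)| := by congr 1; ring
      _ ≤ _ := abs_add_le _ _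
  have h2 : χ * |Ad| ≤ η * C ^ 2 / δ * Ex + 1 / η := by
    have a1 := young |Ad| 1 η hη
    have a2 : |Ad| ^ 2 ≤ (C * s) ^ 2 := pow_le_pow_left₀ Jy hA 2
    calc χ * |Ad| = χ * (|Ad| * 1) := by ring
      _ ≤ χ * (η * |Ad| ^ 2 + 1 ^ 2 / η) := mul_le_mul_of_nonneg_left a1 hχ0
      _ = χ * (η * |Ad| ^ 2) + χ * (1 / η) := by ring
      _ ≤ (τ / δ) * (η * (C * s) ^ 2) + 1 * (1 / η) := add_le_add
          (mul_le_mul hχ (mul_le_mul_of_nonneg_left a2 hη.le) Jh (hχ0.trans hχ))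
          (mul_le_mul_of_nonneg_right hχ1 Jh)
      _ = _ := by ring
  have h3 : |pd - p| ≤ p + pd := by rw [abs_le]; constructor <;> linarith
  have τ0 : 0 ≤ τ := by
    by_contra h
    have : τ / δ < 0 := div_neg_of_neg_of_pos (not_le.1 h) hδ
    linarith
  calc χ * |A - Ad| * p = χ * (|A - Ad| * p) := by ring
    _ ≤ χ * (|A * p - Ad * pd| + |Ad| * |pd - p|) := mul_le_mul_of_nonneg_left h1 hχ0
    _ = χ * |A * p - Ad * pd| + (χ * |Ad|) * |pd - p| := by ring
    _ ≤ 1 * |A * p - Ad * pd| + (η * C ^ 2 / δ * Ex + 1 / η) * |pd - p| := add_le_add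
        (mul_le_mul_of_nonneg_right hχ1 Jy) (mul_le_mul_of_nonneg_right h2 Jy)
    _ = |A * p - Ad * pd| + (η * C ^ 2 / δ * Ex * |pd - p| + 1 / η * |pd - p|) := by ring
    _ ≤ |A * p - Ad * pd| + (η * C ^ 2 / δ * Ex * (p + pd) + 1 / η * |pd - p|) := by
        have := mul_le_mul_of_nonneg_left h3 (show 0 ≤ η * C ^ 2 / δ * Ex by positivity)
        linarith
    _ = _ := by ring
namespace Approx
variable {P : Par} {C e : ℝ} (S : Approx P C e)
lemma tsp {ep : ℝ} (Sd : Approx P C ep) : ∫ q, q.1 ^ 2 * Um q.1 ^ 2 * Jt‡ ∂ Jd ≤ Je * C := by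
  have n : Nice Ja (fun t _ ↦ t ^ 2 * Um t ^ 2) := Nice.ofT (by have := Sd.cs; fun_prop)
  rw [(n.mul S.np).fub Zk]
  have : ∀ t ∈ uIcc 0 Ja, (∫m t ^ 2 * Um t ^ 2 * Zr) = Je * (t ^ 2 * Um t ^ 2) := fun t ht ↦ by
    rw [uIcc_of_le Zk] at ht
    rw [iincomu, S.intp ht, mul_comm]
  rw [iincoz this, iincomu]
  exact mul_le_mul_of_nonneg_left Sd.hs2 P.hL.le
lemma pT : ∫ q, Jt‡ ∂ Jd = Ja * Je := by
  rw [S.np.fub Zk, iincoz (g := fun _ ↦ Je), iinco]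
  · simp
  · intro t ht
    rw [uIcc_of_le Zk] at ht
    exact S.intp ht
end Approx
namespace Sq
variable {P : Par} {C : ℝ} {Q : Sq P C} {U : Ultrafilter ℕ} {r v : ℝ → ℝ → ℝ}
lemma Lim.nr (H : Lim Q U r v) : Nice Ja r := ⟨H.rm, 1, fun t _ m _ ↦ by rw [abs_of_nonneg (H.r0 t m)]; exact H.r1 t m⟩
lemma Lim.ApC (H : Lim Q U r v) : Integrable (fun q : ℝˣ ↦ Jm Ze‡ * Zz) Jd ∧
    Tendsto (fun i ↦ ∫ q, |♠.A‡ * ♠.p‡ - Jm Ze‡ * Zz| ∂ Jd)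
      atTop Zx := by
  refine Q.gdct (fun i ↦ ☏.int.aestronglyMeasurable) C (fun i ↦ ae_kap fun t ht m hm ↦ ?_) H.hA
  have := ♠.p_pos t m
  refine (♠.hAp t m K4).trans ?_
  have := ♠.C0
  nlinarith
lemma Lim.Acau (H : Lim Q U r v) {δ : ℝ} (hδ : 0 < δ) : Cau (fun i j ↦ ∫ q, Approx.chi δ q.1 *
    |♠.A‡ - ♣.A‡| * ♠.p‡ ∂ Jd) := fun ε hε => by
  have c1 := Cau.of_lim (fun i ↦ ☏.int) H.ApC.1 H.ApC.2
  have c2 := Cau.of_lim (fun i ↦ ♠.np.int) Q.pI Q.pL1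
  have C0 := (Nl 0).C0
  have L0 := Uw
  obtain ⟨η, hη, hηp⟩ := small_mul (a := C ^ 2 / δ * Ha + C ^ 2 / δ * Ha) (ε := ε / 3) Jh Jh
  obtain ⟨N1, h1⟩ := c1 (ε / 3) Jh
  obtain ⟨N2, h2⟩ := c2 (η * (ε / 3)) Jh
  refine ⟨max N1 N2, fun i hi j hj ↦ ?_⟩
  have h1 := h1 i (le_of_max_le_left hi) j (le_of_max_le_left hj)
  have h2 := h2 j (le_of_max_le_right hj) i (le_of_max_le_right hi)
  have nc : Nice Ja Hb := Nice.ofT (Approx.chi_c δ)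
  have nk : Nice Ja (fun _ _ ↦ η * C ^ 2 / δ) := Nice.const _ _
  have nη : Nice Ja (fun _ _ ↦ 1 / η) := Nice.const _ _
  have ns : Nice Ja (fun t _ ↦ t ^ 2 * ♣.s t ^ 2) := Nice.ofT (by have := ♣.cs; fun_prop)
  have m1 := (☏.sub (♣.nA.mul ♣.np)).abs
  have m2 := nk.mul (ns.mul ♠.np)
  have m3 := nk.mul (ns.mul ♣.np)
  have m4 := nη.mul (♣.np.sub ♠.np).abs
  have k1 := ♠.tsp (Nl j)
  have k2 := ♣.tsp (Nl j)
  refine (Nice.imono ((nc.mul (♠.nA.sub ♣.nA).abs).mul ♠.np) (m1.add ((m2.add m3).add m4)) fun t ht m hm ↦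
    realA (Approx.chi_0 hδ t) (Approx.chi_1 δ t) (Approx.chi_t t) hδ hη (♠.p_pos t m) (♣.p_pos t m)
      (♣.hA t m K4)).trans ?_
  rw [Nice.iadd m1 ((m2.add m3).add m4), Nice.iadd (m2.add m3) m4, Nice.iadd m2 m3, integral_const_mul, integral_const_mul,
    integral_const_mul]
  have h2d := mul_le_mul_of_nonneg_left h2 (show 0 ≤ 1 / η by positivity)
  rw [show 1 / η * (η * (ε / 3)) = ε / 3 by field_simp] at h2d
  have k1p := mul_le_mul_of_nonneg_left k1 (show 0 ≤ η * C ^ 2 / δ by positivity)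
  have k2p := mul_le_mul_of_nonneg_left k2 (show 0 ≤ η * C ^ 2 / δ by positivity)
  have : η * C ^ 2 / δ * Ha + η * C ^ 2 / δ * Ha = (C ^ 2 / δ * Ha + C ^ 2 / δ * Ha) * η := by ring
  linarith
lemma comp_ae {g : ℝˣ → ℝ} (hg : Continuous g) : ∀q Tendsto (fun i ↦ g Jn) atTop
    (𝓝 (g Jb)) := Q.Xaep.mono fun _ h ↦ (hg.tendsto _).comp (tendsto_const_nhds.prodMk_nhds h)
lemma comp_m {g : ℝˣ → ℝ} (hg : Continuous g) : Measurable (fun q : ℝˣ ↦ g Jb) :=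
  hg.measurable.comp (measurable_fst.prodMk Q.Xm)
lemma bdX {g : ℝˣ → ℝ} {K : ℝ} (hK : ∀ t ∈ Icc 0 Ja, ∀ x ∈ Icc 0 Je, |g Zt| ≤ K) (i : ℕ) :
    ∀q |g Jn| ≤ K := ae_kap fun t ht m hm ↦
  hK t Nw _ (♠.Xmem Nw K4)
lemma bdXp {g : ℝˣ → ℝ} {K : ℝ} (hK : ∀ t ∈ Icc 0 Ja, ∀ x ∈ Icc 0 Je, |g Zt| ≤ K) :
    ∀q |g Jb| ≤ K := ae_kap fun t ht m hm ↦
  hK t Nw _ (Q.Xmem K4)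
/-- `∫∫ c (ft(X_i) + fx(X_i) v_i)` converges, `c` bounded -/
lemma Lim.lin (H : Lim Q U r v) (hU : (U : Filter ℕ) ≤ atTop) (F : Tst Ja) {c : ℝ → ℝ → ℝ} (nc : Nice Ja c) :
    Tendsto (fun i ↦ ∫ q, c‡ * (Z4 Jn + Ju Jn * ♠.v‡) ∂ Jd) U
      (𝓝 (∫ q, c‡ * Yy ∂ Jd)) := by
  obtain ⟨K, K0, hK⟩ := F.bd Je
  obtain ⟨M, hM⟩ := nc.2
  have hMp : ∀q |c‡| ≤ M := ae_kap fun t ht m hm ↦ hM t Nw m K4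
  have bt (i : ℕ) := bdX (Q := Q) Yg i
  have bx (i : ℕ) := bdX (Q := Q) Z1 i
  have btp := bdXp (Q := Q) Yg
  have bxp := bdXp (Q := Q) Z1
  have n1 (i : ℕ) := nc.mul (♠.nX.comp2 F.ct)
  have n2 (i : ℕ) := nc.mul (♠.nX.comp2 Kj)
  have l1 : Tendsto (fun i ↦ ∫ q, c‡ * Z4 Jn ∂ Jd) atTop
      (𝓝 (∫ q, c‡ * Z4 Jb ∂ Jd)) := by
    refine tendsto_integral_of_dominated_convergence (fun _ ↦ M * K) (fun i ↦ (n1 i).int.aestronglyMeasurable) (integrable_const _)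
      (fun i ↦ ?_) ((comp_ae F.ct).mono fun q h ↦ h.const_mul _)
    filter_upwards [hMp, bt i] with q a b
    rw [rnoeqab, abs_mul]
    exact mul_le_mul a b Jy (☆.trans a)
  have l2 := weakStrong (w := fun i q ↦ ♠.v‡) G9 (fun i ↦ ♠.hv2) hU H.hv
    (g := fun i q ↦ c‡ * Ju Jn) (gp := fun q ↦ c‡ * Na)
    (fun i ↦ (n2 i).int.aestronglyMeasurable) (K := M * K) (fun i ↦ by
      filter_upwards [hMp, bx i] with q a b
      rw [abs_mul]
      exact mul_le_mul a b Jy (☆.trans a)) ((comp_ae Kj).mono fun q h ↦ h.const_mul _)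
  have vi : Integrable (fun q : ℝˣ ↦ v‡) Jd := H.v2.integrable one_le_two
  have m1 : Measurable (fun q : ℝˣ ↦ c‡ * Z4 Jb) := nc.1.mul (comp_m F.ct)
  have m2 : Measurable (fun q : ℝˣ ↦ c‡ * Na) := nc.1.mul (comp_m Kj)
  have := (l1.mono_left hU).add l2
  have ep := integral_add (μ := kap Ja) (f := fun q : ℝˣ ↦ c‡ * Z4 Jb)
    (g := fun q ↦ v‡ * (c‡ * Na))
    (Integrable.of_bound m1.aestronglyMeasurable (M * K) (by
      filter_upwards [hMp, btp] with q a b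
      rw [rnoeqab, abs_mul]
      exact mul_le_mul a b Jy (☆.trans a)))
    (vi.mul_bdd (c := M * K) m2.aestronglyMeasurable (by
      filter_upwards [hMp, bxp] with q a b
      rw [rnoeqab, abs_mul]
      exact mul_le_mul a b Jy (☆.trans a)))
  rw [← ep] at this
  convert this using 2
  · rename_i i
    rw [← Nice.iadd (n1 i) (♠.nv.mul (n2 i))]
    congr 1; ext q; ring
  · congr 1; ext q; ring
end Sq
namespace Sq
variable {P : Par} {C : ℝ} {Q : Sq P C} {U : Ultrafilter ℕ} {r v : ℝ → ℝ → ℝ}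
lemma Lim.rcau (H : Lim Q U r v) (F : Tst Ja) {δ : ℝ} (hδ : 0 < δ) : Cau (fun i j ↦ |∫ q, Approx.chi δ q.1 *
    G8 * (Z4 Jn +
      Ju Jn * ♠.v‡) ∂ Jd|) := fun ε hε ↦ by
  obtain ⟨K, K0, hK⟩ := F.bd Je
  have T0 := P.hT; have L0 := Uw
  obtain ⟨η, hη, hηp⟩ := small_mul (a := K) (ε := ε / 2) K0 Jh
  obtain ⟨ξ, hξ, hξp⟩ := small_mul (a := 2 / δ * K * (Ja * Je)) (ε := ε / 2) Jh Jh
  obtain ⟨N1, h1⟩ := H.Acau hδ η hη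
  obtain ⟨N2, h2⟩ := Q.hψ ξ hξ
  refine ⟨max N1 N2, fun i hi j hj ↦ ?_⟩
  have h1 := h1 i (le_of_max_le_left hi) j (le_of_max_le_left hj)
  have h2 := h2 i (le_of_max_le_right hi) j (le_of_max_le_right hj)
  have nc : Nice Ja Hb := Nice.ofT (Approx.chi_c δ)
  beta_reduce at h1 ⊢
  rw [♠.ident3 F]
  refine ☾.trans ?_
  have b1 : |∫ q, Approx.chi δ q.1 * (♠.A‡ - ♣.A‡) * (Ju Jn *
      ♠.p‡) ∂ Jd| ≤ K * η := by
    refine le_trans ?_ (mul_le_mul_of_nonneg_left h1 K0)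
    rw [← integral_const_mul, ← rnoeqab]
    refine norm_integral_le_of_norm_le (((nc.mul (♠.nA.sub ♣.nA).abs).mul ♠.np).int.const_mul K) ?_
    refine ae_kap fun t ht m hm ↦ ?_
    have a1 := (hK t Nw _ (♠.Xmem Nw K4)).2
    have a2 := Approx.chi_0 hδ t
    have a3 := ♠.p_pos t m
    rw [rnoeqab, abs_mul, abs_mul, abs_mul, abs_of_nonneg a2, abs_of_pos a3]
    calc _ = |Ju (t, ♠.X t m)| * (Approx.chi δ t * |♠.A t m - ♣.A t m| * ♠.p t m) := by ring
      _ ≤ _ := mul_le_mul_of_nonneg_right a1 Jh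
  have b2 : |∫ q, Approx.chip δ q.1 * (♠.ψ‡ - ♣.ψ‡) * (Ju Jn *
      ♠.p‡) ∂ Jd| ≤ 2 / δ * K * (Ja * Je) * ξ := by
    rw [show 2 / δ * K * (Ja * Je) * ξ = (2 / δ * K * ξ) * (Ja * Je) by ring, ← ♠.pT, ← integral_const_mul, ← rnoeqab]
    refine norm_integral_le_of_norm_le (♠.np.int.const_mul _) ?_
    refine ae_kap fun t ht m hm ↦ ?_
    have a1 := (hK t Nw _ (♠.Xmem Nw K4)).2
    have a2 := Approx.chi'_t hδ ht.1.le
    have a3 := ♠.p_pos t m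
    have a4 := h2 t Nw m K4
    rw [← mul_sub, abs_mul, abs_of_pos ht.1] at a4
    rw [rnoeqab, abs_mul, abs_mul, abs_mul, abs_of_pos a3, ← mul_assoc]
    refine mul_le_mul_of_nonneg_right ?_ a3.le
    calc |Approx.chip δ t| * |♠.ψ t m - ♣.ψ t m| * |Ju (t, ♠.X t m)|
        ≤ (2 / δ * t) * |♠.ψ t m - ♣.ψ t m| * K := mul_le_mul (mul_le_mul_of_nonneg_right a2 Jy) a1
          Jy (by have := ht.1; positivity)
      _ = 2 / δ * K * (t * |♠.ψ t m - ♣.ψ t m|) := by ring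
      _ ≤ _ := mul_le_mul_of_nonneg_left a4 Jh
  linarith
lemma Lim.limB (H : Lim Q U r v) (hU : (U : Filter ℕ) ≤ atTop) (F : Tst Ja) {δ : ℝ} (hδ : 0 < δ) :
    Tendsto (fun i ↦ ∫ q, Approx.chi δ q.1 * ♠.r‡ * (Z4 Jn +
      Ju Jn * ♠.v‡) ∂ Jd) U
      (𝓝 (∫ q, Approx.chi δ q.1 * r‡ * Yy ∂ Jd)) := by
  have nc : Nice Ja Hb := Nice.ofT (Approx.chi_c δ)
  have l1 := H.lin hU F (nc.mul H.nr)
  have nf (i j : ℕ) := (nc.mul ♣.nr).mul (♠.nΦt F)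
  have l2 : Tendsto (fun i ↦ (∫ q, Approx.chi δ q.1 * ♠.r‡ * (Z4 Jn +
      Ju Jn * ♠.v‡) ∂ Jd) - ∫ q, Approx.chi δ q.1 * r‡ *
      (Z4 Jn + Ju Jn * ♠.v‡) ∂ Jd) atTop Zx := by
    rw [Metric.tendsto_atTop]
    intro ε hε
    obtain ⟨N, hN⟩ := H.rcau F hδ (ε / 2) Jh
    refine ⟨N, fun i hi ↦ ?_⟩
    rw [dist_zero_right, rnoeqab]
    refine lt_of_le_of_lt ?_ (half_lt_self hε)
    have h1 := H.hr (fun q ↦ Approx.chi δ q.1 * (Z4 Jn +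
      Ju Jn * ♠.v‡)) ((nc.mul (♠.nΦt F)).memLp 2)
    have e0 : ∀ (u χ w : ℝ), u * (χ * w) = χ * u * w := fun u χ w ↦ by ring
    simp only [e0] at h1
    refine le_of_tendsto (h1.const_sub _).abs ?_
    filter_upwards [hU (eventually_ge_atTop N)] with j hj
    rw [← Nice.isub (nf i i) (nf i j)]
    refine le_trans (le_of_eq ?_) (Gs)
    congr 1; congr 1; ext q; ring
  simpa using (l2.mono_left hU).add l1
lemma v_young {K c w η : ℝ} (K0 : 0 ≤ K) (c0 : 0 ≤ c) (c1 : c ≤ 1) (hη : 0 < η) {ft fx r : ℝ} (r0 : 0 ≤ r) (r1 : r ≤ 1)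
    (ht : |ft| ≤ K) (hx : |fx| ≤ K) : |c * (r * (ft + fx * w))| ≤ K * Ey * c + K * η * w ^ 2 := by
  have a := young |w| 1 η hη
  rw [sq_abs, mul_one, one_pow] at a
  have b : |ft + fx * w| ≤ K + K * |w| := ☾.trans (by
    rw [abs_mul]; exact add_le_add ht (mul_le_mul_of_nonneg_right hx Jy))
  rw [abs_mul, abs_mul, abs_of_nonneg c0, abs_of_nonneg r0]
  calc c * (r * |ft + fx * w|) ≤ c * (1 * (K + K * |w|)) := mul_le_mul_of_nonneg_left
        (mul_le_mul r1 b Jy zero_le_one) c0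
    _ ≤ c * (1 * (K + K * (η * w ^ 2 + 1 / η))) := by
        refine mul_le_mul_of_nonneg_left ?_ c0
        have := mul_le_mul_of_nonneg_left a K0
        linarith
    _ = K * Ey * c + c * (K * η * w ^ 2) := by ring
    _ ≤ _ := by
        have := mul_le_mul_of_nonneg_right c1 (show 0 ≤ K * η * w ^ 2 by positivity)
        linarith
lemma chi_lim : Tendsto (fun n : ℕ ↦ ∫ q, (1 - Approx.chi (1 / Ez) q.1) ∂ Jd) atTop Zx := by
  have := tendsto_integral_of_dominated_convergence (μ := kap Ja) (F := fun (n : ℕ) q ↦ 1 - Approx.chi (1 / Ez) q.1)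
    (f := fun _ ↦ 0) (fun _ ↦ 1) (fun n ↦ (((Approx.chi_c _).measurable.comp measurable_fst).const_sub 1).aestronglyMeasurable)
    (integrable_const _) (fun n ↦ ae_kap fun t ht m hm ↦ ?_) (ae_kap fun t ht m hm ↦ ?_)
  · simpa using this
  · have h1 := Approx.chi_0 (δ := 1 / Ez) Jh t
    have h2 := Approx.chi_1 (1 / Ez) t
    rw [rnoeqab, abs_le]; constructor <;> simp only <;> linarith
  · have e : ∀ n : ℕ, 1 - Approx.chi (1 / Ez) t = rexp (-(t ^ 2 * Ez)) := fun n ↦ by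
      rw [Approx.chi]; simp
    simp only [e]
    refine Real.tendsto_exp_neg_atTop_nhds_zero.comp (Tendsto.const_mul_atTop (pow_pos ht.1 2) ?_)
    exact tendsto_atTop_add_const_right _ _ tendsto_natCast_atTop_atTop
lemma Lim.vi (H : Lim Q U r v) : Integrable (fun q : ℝˣ ↦ v‡) Jd := H.v2.integrable one_le_two
lemma Lim.iΦ (H : Lim Q U r v) (F : Tst Ja) : Integrable (fun q : ℝˣ ↦ Z4 Jb +
    Ju Jb * v‡) Jd := by
  obtain ⟨K, K0, hK⟩ := F.bd Je
  have b1 := bdXp (Q := Q) Yg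
  have b2 := bdXp (Q := Q) Z1
  exact (Integrable.of_bound (comp_m F.ct).aestronglyMeasurable K b1).add (H.vi.bdd_mul (comp_m Kj).aestronglyMeasurable b2)
lemma split {χ f : ℝˣ → ℝ} (hf : Integrable f Jd) (hχ : Measurable χ) (h0 : ∀ q, 0 ≤ χ q) (h1 : ∀ q, χ q ≤ 1) :
    ∫ q, f q ∂ Jd = ∫ q, χ q * f q ∂ Jd + ∫ q, (1 - χ q) * f q ∂ Jd := by
  have a : Integrable (fun q ↦ χ q * f q) Jd := hf.bdd_mul (c := 1) hχ.aestronglyMeasurable (Eventually.of_forall fun q ↦ by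
    rw [rnoeqab, abs_of_nonneg (h0 q)]; exact h1 q)
  have b : Integrable (fun q ↦ (1 - χ q) * f q) Jd := hf.bdd_mul (c := 1) (hχ.const_sub 1).aestronglyMeasurable
    (Eventually.of_forall fun q ↦ by
    rw [rnoeqab, abs_of_nonneg (by linarith [h1 q])]; linarith [h0 q])
  rw [← integral_add a b]; congr 1; ext q; ring
lemma Lim.limG (H : Lim Q U r v) (hU : (U : Filter ℕ) ≤ atTop) (F : Tst Ja) :
    Tendsto (fun i ↦ ∫ q, ♠.r‡ * (Z4 Jn +
      Ju Jn * ♠.v‡) ∂ Jd) U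
      (𝓝 (∫ q, r‡ * Yy ∂ Jd)) := by
  obtain ⟨K, K0, hK⟩ := F.bd Je
  have C0 := (Nl 0).C0
  set Cp := C + ∫ q, v‡ ^ 2 ∂ Jd with hCp
  have v20 : 0 ≤ ∫ q, v‡ ^ 2 ∂ Jd := integral_nonneg fun q ↦ sq_nonneg _
  have bt (i : ℕ) := bdX (Q := Q) Yg i
  have bx (i : ℕ) := bdX (Q := Q) Z1 i
  have btp := bdXp (Q := Q) Yg
  have bxp := bdXp (Q := Q) Z1
  rw [Metric.tendsto_nhds]
  intro ε hε
  obtain ⟨η, hη, hηp⟩ := small_mul (a := K * Cp) (ε := ε / 8) Jh Jh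
  obtain ⟨ξ, hξ, hξp⟩ := small_mul (a := K * Ey) (ε := ε / 8) Jh Jh
  obtain ⟨n, hn⟩ := ((chi_lim (P := P)).eventually (eventually_le_nhds hξ)).exists
  set δ : ℝ := 1 / Ez with hδd
  have hδ : 0 < δ := by positivity
  have χm : Measurable (fun q : ℝˣ ↦ Approx.chi δ q.1) := (Approx.chi_c _).measurable.comp measurable_fst
  have χi : Integrable (fun q : ℝˣ ↦ 1 - Approx.chi δ q.1) Jd := (Nice.ofT (T := Ja) (continuous_const.sub (Approx.chi_c δ))).int
  -- remainder
  have rem : ∀ (ρ : ℝ → ℝ → ℝ) (g : ℝˣ → ℝ) (gp w : ℝˣ → ℝ), (∀ t m, 0 ≤ ρ t m) → (∀ t m, ρ t m ≤ 1) →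
      (∀q |g q| ≤ K) → (∀q |gp q| ≤ K) → MemLp w 2 Jd → (∫ q, w q ^ 2 ∂ Jd) ≤ Cp →
      |∫ q, (1 - Approx.chi δ q.1) * (ρ‡ * (g q + gp q * w q)) ∂ Jd| ≤ ε / 4 := by
    intro ρ g gp w ρ0 ρ1 hg hgp hw hwC
    have i1 := χi.const_mul (K * Ey)
    have i2 := hw.integrable_sq.const_mul (K * η)
    have := norm_integral_le_of_norm_le (i1.add i2) (f := fun q ↦ (1 - Approx.chi δ q.1) * (ρ‡ * (g q + gp q * w q))) (by
      filter_upwards [hg, hgp] with q a b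
      exact v_young K0 (sub_nonneg.2 (Approx.chi_1 _ _)) (by linarith [Approx.chi_0 hδ q.1]) hη (ρ0 _ _) (ρ1 _ _) a b)
    rw [rnoeqab] at this
    refine this.trans ?_
    rw [integral_add' i1 i2, integral_const_mul, integral_const_mul]
    have a1 := mul_le_mul_of_nonneg_left hn (show 0 ≤ K * Ey by positivity)
    have a2 := mul_le_mul_of_nonneg_left hwC (show 0 ≤ K * η by positivity)
    have : K * η * Cp = K * Cp * η := by ring
    linarith
  have R (i : ℕ) := rem ♠.r _ _ (fun q ↦ ♠.v‡) ♠.r0 ♠.r1 (bt i) (bx i) (♠.nv.memLp 2)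
    (♠.hv2.trans Js)
  have Rp := rem r _ _ (fun q ↦ v‡) H.r0 H.r1 btp bxp H.v2 Js
  have s1 (i : ℕ) := split (P := P) ((♠.nr.mul (♠.nΦt F)).int) χm (fun q ↦ Approx.chi_0 hδ q.1) (fun q ↦ Approx.chi_1 δ q.1)
  have s2 := split (P := P) ((H.iΦ F).bdd_mul (c := 1) H.rm.aestronglyMeasurable (Eventually.of_forall fun q ↦ by
    rw [rnoeqab, abs_of_nonneg (H.r0 _ _)]; exact H.r1 _ _)) χm (fun q ↦ Approx.chi_0 hδ q.1) (fun q ↦ Approx.chi_1 δ q.1)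
  filter_upwards [(Metric.tendsto_nhds.1 (H.limB hU F hδ)) (ε / 4) Jh] with i hi
  simp only [mul_assoc] at hi
  have R1 := R i
  rw [s1 i, s2, rdisteq]
  rw [rdisteq] at hi
  rw [abs_le] at R1 Rp
  rw [abs_lt] at hi ⊢
  constructor <;> linarith
end Sq
namespace Sq
variable {P : Par} {C : ℝ} {Q : Sq P C} {U : Ultrafilter ℕ} {r v : ℝ → ℝ → ℝ}
lemma Lim.limL (_ : Lim Q U r v) (hU : (U : Filter ℕ) ≤ atTop) {a : ℕ → ℝ} {b K : ℝ} (h : ∀ i, |a i - b| ≤ Q.e i * K) :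
    Tendsto a U (𝓝 b) := by
  have : Tendsto a atTop (𝓝 b) := by
    rw [tendsto_iff_norm_sub_tendsto_zero]
    refine squeeze_zero (fun i ↦ norm_nonneg _) h ?_
    simpa using Q.he.mul_const K
  exact this.mono_left hU
lemma bddJ {g : ℝ → ℝ} (hg : Continuous g) (L : ℝ) : ∃ K, ∀ x ∈ Icc 0 L, |g x| ≤ K :=
  isCompact_Icc.exists_bound_of_continuousOn hg.continuousOn
lemma Lim.lip (F : Tst Ja) : ∃ K, ∀ x ∈ Icc 0 Je, ∀ y ∈ Icc 0 Je, |Zf Yh - Zf (0, y)| ≤ K * |x - y| := by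
  obtain ⟨K, K0, hK⟩ := F.bd Je
  refine ⟨K, fun x hx y hy ↦ ?_⟩
  exact (convex_Icc 0 Je).norm_image_sub_le_of_norm_hasDerivWithin_le (fun z _ ↦ (F.dx 0 z).hasDerivWithinAt)
    (fun z hz ↦ (hK 0 ⟨le_rfl, Zk⟩ z hz).2) hy hx
lemma Lim.E1 (H : Lim Q U r v) (hU : (U : Filter ℕ) ≤ atTop) (F : Tst Ja) :
    ∫ q, r‡ * Yy ∂ Jd -
    ∫ q, K9 * Na ∂ Jd =
      - ∫ x in Ioo 0 Je, P.ρ1 x * Zf Yh := by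
  obtain ⟨K, hK⟩ := Lim.lip F
  obtain ⟨Kp, K0p, hKp⟩ := F.bd Je
  have l1 := H.limG hU F
  have bx (i : ℕ) := bdX (Q := Q) (fun t ht x hx ↦ (hKp t ht x hx).2) i
  have l2 : Tendsto (fun i ↦ ∫ q, (♠.A‡ * ♠.p‡) * Ju Jn ∂ Jd) atTop
      (𝓝 (∫ q, K9 * Na ∂ Jd)) := by
    refine tendsto_integral_of_dominated_convergence (fun _ ↦ C * Kp)
      (fun i ↦ (☏.mul (♠.nX.comp2 Kj)).int.aestronglyMeasurable) (integrable_const _) (fun i ↦ ?_) ?_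
    · have := ae_kap (T := Ja) (P := fun q ↦ |♠.A‡ * ♠.p‡| ≤ C) fun t ht m hm ↦
        ♠.hAp t m K4
      filter_upwards [this, bx i] with q a b
      rw [rnoeqab, abs_mul _ (Ju _)]
      exact mul_le_mul a b Jy ♠.C0
    · filter_upwards [H.hA, comp_ae Kj] with q a b
      exact a.mul b
  have l3 := l1.sub (l2.mono_left hU)
  refine tendsto_nhds_unique l3 ?_
  have l4 := (H.limL hU (a := fun i ↦ ∫m ♠.r 0 m * Zf (0, ♠.X 0 m))
    (fun i ↦ ♠.i1 (fun x ↦ Zf Yh) K (by have := Nm; fun_prop) hK)).neg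
  exact l4.congr fun i ↦ (♠.ident1 F).symm
lemma Lim.E2 (H : Lim Q U r v) (hU : (U : Filter ℕ) ≤ atTop) (F : Tst Ja) :
    ∫ q, Yy ∂ Jd =
      - ∫ x in Ioo 0 Je, Uu * Zf Yh := by
  obtain ⟨K, hK⟩ := Lim.lip F
  have l1 := H.lin hU F Es
  simp only [one_mul] at l1
  refine tendsto_nhds_unique l1 ?_
  have l4 := (H.limL hU (a := fun i ↦ ∫m Zf (0, ♠.X 0 m))
    (fun i ↦ ♠.i2 (fun x ↦ Zf Yh) K (by have := Nm; fun_prop) hK)).neg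
  exact l4.congr fun i ↦ (♠.ident2 F).symm
lemma rpow_b {α x : ℝ} (h0 : 0 < α) (h1 : α ≤ 1) (hx : 0 < x) : x * x ^ Ei ≤ 1 + x := by
  have e : x * x ^ Ei = x ^ (1 + -α) := by rw [Real.rpow_add hx, rrpowone]
  rw [e]
  rcases le_total x 1 with h | h
  · exact (Real.rpow_le_one hx.le h Js).trans Js
  · have := Real.rpow_le_rpow_of_exponent_le h (show 1 + -α ≤ 1 by linarith)
    rw [rrpowone] at this; linarith
lemma limP (F : Tst Ja) :
    Tendsto (fun i ↦ ∫ q, Ju Jn * (♠.p‡ * (Jv * ♠.p‡ ^ Jk)) ∂ Jd)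
      atTop (𝓝 (∫ q, Na * Y9 ∂ Jd)) := by
  obtain ⟨K, K0, hK⟩ := F.bd Je
  have bx (i : ℕ) := bdX (Q := Q) Z1 i
  have nl (i : ℕ) : Nice Ja (fun t m ↦ Ju (t, ♠.X t m) * (♠.p t m * (Jv * ♠.p t m ^ Jk))) :=
    (♠.nX.comp2 Kj).mul (♠.np.mul ♠.nP)
  obtain ⟨li, l1⟩ := Q.gdct (fun i ↦ (nl i).int.aestronglyMeasurable) (K * Jv) (fun i ↦ by
      filter_upwards [bx i] with q a
      have p0 := ♠.p_pos‡
      have h2 := rpow_b Eo P.hα1 p0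
      have h3 := Gy
      have h4 : 0 ≤ ♠.p‡ * ♠.p‡ ^ Jk := by positivity
      rw [abs_mul, show ♠.p‡ * (Jv * ♠.p‡ ^ Jk) = Jv * (♠.p‡ * ♠.p‡ ^ Jk)
        by ring, abs_of_nonneg (mul_nonneg h3.le h4), mul_assoc]
      exact mul_le_mul a (mul_le_mul_of_nonneg_left h2 h3.le) Jh K0)
    (g := fun q ↦ Na * Y9) (by
      filter_upwards [comp_ae Kj, Q.pae] with q a b
      exact a.mul (b.mul ((b.rpow_const (N9 (Km‡).ne')).const_mul _)))
  rw [tendsto_iff_norm_sub_tendsto_zero]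
  refine squeeze_zero (fun i ↦ norm_nonneg _) (fun i ↦ ?_) l1
  rw [← integral_sub (nl i).int li]
  exact norm_integral_le_integral_norm _
lemma _root_.CD.Approx.estQ {P : Par} {C e : ℝ} (S : Approx P C e) (F : Tst Ja) (F0 : ∀ t, Zf (t, 0) = 0) (FL : ∀ t, Zf (t, Je) = 0) {K : ℝ} (K0 : 0 ≤ K)
    (hK : ∀ t ∈ Icc 0 Ja, ∀ x ∈ Icc 0 Je, |Ju Zt| ≤ K) :
    |(∫ q, Ju Jw * (Jt‡ * (Jv * Jt‡ ^ Jk)) ∂ Jd) -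
      ((∫ q, Zs‡ * Zf Jw ∂ Jd) + (∫ q, Zq Jo‡ * Zf Jw ∂ Jd) +
      ∫ q, Zl‡ * (Jm Jo‡ * Zf Jw) ∂ Jd) - 0| ≤ e * (K * Je * (C + Ja)) := by
  have nl : Nice Ja (fun t m ↦ Ju Yx * (Zr * Ek)) :=
    ☑.mul (S.np.mul S.nP)
  have nW := S.nX.comp2 (φ := fun z ↦ Jm z.2 * Zf z) E4
  have nB := S.nX.comp2 (φ := fun z ↦ Zq z.2 * Zf z) E5
  have n1 := S.nv.mul Ud
  have n3 := S.nr.mul nW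
  have e0 := S.e0
  rw [sub_zero, ← Nice.iadd n1 nB, ← Nice.iadd (n1.add nB) n3, ← Nice.isub nl ((n1.add nB).add n3),
    (nl.sub ((n1.add nB).add n3)).fub Zk]
  have cq := S.cq
  calc _ ≤ ∫t e * (K * Je) * S.q t := by
        rw [← rnoeqab]
        refine intervalIntegral.norm_integral_le_of_norm_le Zk (Eventually.of_forall fun t ht ↦ ?_)
          (by apply cin; fun_prop)
        have htp := Ioc_subset_Icc_self ht
        have n5 := ☑.mul S.np
        have h := S.hQ t ht _ _ (S.dΦ F t) (n5.intm htp) (by rw [S.X0]; exact F0 t)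
          (by rw [S.X2]; exact FL t)
        rw [iinsu (nl.intm htp) (((n1.add nB).add n3).intm htp), rnoeqab]
        have hb : ∫m |Ju Yx * Zr| ≤ K * Je := by
          rw [← S.intp htp, ← iincomu]
          refine iinmoon zero_le_two (n5.abs.intm htp) ((S.np.intm htp).const_mul K) fun m hm ↦ ?_
          rw [abs_mul, abs_of_pos Ep]
          exact mul_le_mul_of_nonneg_right (hK t htp _ (S.Xmem htp hm)) (S.p_pos t m).le
        refine le_trans (le_of_eq ?_) (h.trans ((mul_le_mul_of_nonneg_left hb (mul_nonneg e0 (S.q0 t))).trans (le_of_eq (by ring))))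
        congr 2
        · congr 1; ext m; ring
        · congr 1; ext m; ring
    _ = e * (K * Je) * ∫t S.q t := iincomu _ _
    _ ≤ e * (K * Je) * (C + Ja) := mul_le_mul_of_nonneg_left S.hq1 (by have := Uw; positivity)
    _ = _ := by ring
lemma bdK {g : ℝˣ → ℝ} (hg : Continuous g) (a b : ℝ) : ∃ K, ∀ t ∈ Icc 0 a, ∀ x ∈ Icc 0 b, |g Zt| ≤ K := by
  obtain ⟨K, h⟩ := ((isCompact_Icc (a := 0) (b := a)).prod (isCompact_Icc (a := 0) (b := b))).exists_bound_of_continuousOn hg.continuousOn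
  exact ⟨K, fun t ht x hx ↦ h Zt ⟨ht, hx⟩⟩
lemma Lim.wv (H : Lim Q U r v) (hU : (U : Filter ℕ) ≤ atTop) {g : ℝˣ → ℝ} (hg : Continuous g) :
    Tendsto (fun i ↦ ∫ q, ♠.v‡ * g Jn ∂ Jd) U
      (𝓝 (∫ q, v‡ * g Jb ∂ Jd)) ∧
    Integrable (fun q : ℝˣ ↦ v‡ * g Jb) Jd := by
  obtain ⟨K, hK⟩ := bdK hg Ja Je
  exact ⟨weakStrong (w := fun i (q : ℝˣ) ↦ ♠.v‡) G9 (fun i ↦ ♠.hv2) hU H.hv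
    (g := fun i (q : ℝˣ) ↦ g Jn) Ks (bdX hK) (comp_ae hg),
    H.vi.mul_bdd (c := K) (comp_m hg).aestronglyMeasurable (bdXp hK)⟩
lemma Lim.wr (H : Lim Q U r v) (hU : (U : Filter ℕ) ≤ atTop) {g : ℝˣ → ℝ} (hg : Continuous g) :
    Tendsto (fun i ↦ ∫ q, ♠.r‡ * g Jn ∂ Jd) U
      (𝓝 (∫ q, r‡ * g Jb ∂ Jd)) ∧
    Integrable (fun q : ℝˣ ↦ r‡ * g Jb) Jd := by
  obtain ⟨K, hK⟩ := bdK hg Ja Je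
  exact ⟨weakStrong (w := fun i (q : ℝˣ) ↦ ♠.r‡) (fun i ↦ ♠.nr.memLp 2) Q.rsq hU H.hr
    (g := fun i (q : ℝˣ) ↦ g Jn) Ks (bdX hK) (comp_ae hg),
    H.nr.int.mul_bdd (c := K) (comp_m hg).aestronglyMeasurable (bdXp hK)⟩
lemma Lim.wc (_ : Lim Q U r v) (hU : (U : Filter ℕ) ≤ atTop) {g : ℝˣ → ℝ} (hg : Continuous g) :
    Tendsto (fun i ↦ ∫ q, g Jn ∂ Jd) U
      (𝓝 (∫ q, g Jb ∂ Jd)) ∧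
    Integrable (fun q : ℝˣ ↦ g Jb) Jd := by
  obtain ⟨K, hK⟩ := bdK hg Ja Je
  exact ⟨(tendsto_integral_of_dominated_convergence (fun _ ↦ K) Ks
    (integrable_const _) (bdX hK) (comp_ae hg)).mono_left hU, Integrable.of_bound (comp_m hg).aestronglyMeasurable _ (bdXp hK)⟩
lemma Lim.E3 (H : Lim Q U r v) (hU : (U : Filter ℕ) ≤ atTop) (F : Tst Ja) (F0 : ∀ t, Zf (t, 0) = 0) (FL : ∀ t, Zf (t, Je) = 0) :
    ∫ q, Na * Y9 ∂ Jd =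
      ∫ q, Uo * Zf Jb ∂ Jd := by
  obtain ⟨K, K0, hK⟩ := F.bd Je
  obtain ⟨w1, i1⟩ := H.wv hU Nm
  obtain ⟨w2, i2⟩ := H.wc hU (g := fun z ↦ Zq z.2 * Zf z) E5
  obtain ⟨w3, i3⟩ := H.wr hU (g := fun z ↦ Jm z.2 * Zf z) E4
  have ee : (∫ q, Uo * Zf Jb ∂ Jd) =
      (∫ q, v‡ * Zf Jb ∂ Jd) + (∫ q, Zq Ze‡ * Zf Jb ∂ Jd) +
      ∫ q, r‡ * (Jm Ze‡ * Zf Jb) ∂ Jd := by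
    have e1 := integral_add i1 i2
    have e2 := integral_add' (i1.add i2) i3
    simp only [Pi.add_apply] at e1 e2
    rw [← e1, ← e2]
    congr 1; ext q; ring
  rw [ee]
  refine tendsto_nhds_unique ((limP F).mono_left hU) ?_
  have h := (H.limL hU fun i ↦ ♠.estQ F F0 FL K0 fun t ht x hx ↦ (hK t ht x hx).2).add ((w1.add w2).add w3)
  rw [zero_add] at h
  refine h.congr fun i ↦ ?_
  ring
end Sq
lemma mono_int {p : ℝ → ℝ} (p0 : ∀ m, 0 < p m) (pi : IntervalIntegrable p volume 0 2) {X : ℝ → ℝ}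
    (hX : ∀ m ∈ Icc Jc 2, X m = ∫ n in Jc..m, p n) : StrictMonoOn X (Nh 2) := by
  intro a ha b hb hab
  have i1 : IntervalIntegrable p volume 0 a := pi.mono_set (by rw [uIcc_of_le ha.1, uIcc_of_le zero_le_two]; exact Icc_subset_Icc_right ha.2)
  have i2 : IntervalIntegrable p volume a b := pi.mono_set (by rw [uIcc_of_le hab.le, uIcc_of_le zero_le_two]; exact Icc_subset_Icc ha.1 hb.2)
  rw [hX a ha, hX b hb, ← iinadadin i1 i2]
  have := intervalIntegral.intervalIntegral_pos_of_pos i2 p0 hab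
  linarith
lemma map_int {p : ℝ → ℝ} (p0 : ∀ m, 0 < p m) (pi : IntervalIntegrable p volume 0 2) {X : ℝ → ℝ} (Xm : Measurable X)
    (hX : ∀ m ∈ Icc Jc 2, X m = ∫ n in Jc..m, p n) :
    ((volume.restrict Ys).withDensity (fun m ↦ ENNReal.ofReal (p m))).map X = volume.restrict (Ioc 0 (X 2)) := by
  have hm := mono_int p0 pi hX
  have X0 : X 0 = 0 := by rw [hX 0 J1]; simp
  have hc : ContinuousOn X (Nh 2) := by
    refine (intervalIntegral.continuousOn_primitive_interval' (a := 0) pi J1).congr ?_ |>.mono (uIcc_of_le zero_le_two).symm.subset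
    intro m hm; exact hX m (by rwa [uIcc_of_le zero_le_two] at hm)
  have Li : ∫⁻ m in Ioc Jc 2, ENNReal.ofReal (p m) = ENNReal.ofReal (X 2) := by
    rw [hX 2 J1, iinofle zero_le_two, ofReal_integral_eq_lintegral_ofReal pi.1 (Eventually.of_forall fun m ↦ (p0 m).le)]
  have : IsFiniteMeasure Up :=
    ⟨by rw [withDensity_apply _ MeasurableSet.univ, Measure.restrict_univ, Li]; exact ENNReal.ofReal_lt_top⟩
  have key : ∀ m₀ ∈ Icc Jc 2, ∀ a, (X m₀ = a ∨ (m₀ = 2 ∧ X 2 ≤ a)) →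
      Up (X ⁻¹' Iic a) = ENNReal.ofReal (X m₀) := by
    intro m₀ h₀ a ha
    rw [withDensity_apply _ (Xm measurableSet_Iic), Measure.restrict_restrict (Xm measurableSet_Iic)]
    have : X ⁻¹' Iic a ∩ Ioc Jc 2 = Ioc 0 m₀ := by
      ext m
      simp only [mem_inter_iff, mem_preimage, mem_Iic, mem_Ioc]
      rcases ha with ha | ⟨h2, ha⟩
      · constructor
        · rintro ⟨h1, h2, h3⟩
          exact ⟨h2, by rwa [← ha, hm.le_iff_le ⟨h2.le, h3⟩ h₀] at h1⟩
        · rintro ⟨h1, h2⟩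
          exact ⟨by rwa [← ha, hm.le_iff_le ⟨h1.le, h2.trans h₀.2⟩ h₀], h1, h2.trans h₀.2⟩
      · subst h2
        exact ⟨fun h ↦ h.2, fun h ↦ ⟨(hm.monotoneOn ⟨h.1.le, h.2⟩ h₀ h.2).trans ha, h⟩⟩
    rw [this, hX m₀ h₀, iinofle h₀.1, ofReal_integral_eq_lintegral_ofReal
      (pi.1.mono_set (Ioc_subset_Ioc_right h₀.2)) (Eventually.of_forall fun m ↦ (p0 m).le)]
  refine Measure.ext_of_Iic _ _ fun a ↦ ?_
  rw [Measure.map_apply Xm measurableSet_Iic, Measure.restrict_apply measurableSet_Iic]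
  have X2 : 0 ≤ X 2 := X0 ▸ hm.monotoneOn J1 J1 zero_le_two
  rcases lt_or_ge a 0 with h | h
  · have : Up (X ⁻¹' Iic a) ≤ 0 := by
      refine (measure_mono (preimage_mono (Iic_subset_Iic.2 h.le))).trans ?_
      rw [key 0 J1 0 (N9 X0), X0]; simp
    rw [le_antisymm this bot_le, show Iic a ∩ Ioc 0 (X 2) = ∅ by
      ext x; simp only [mem_inter_iff, mem_Iic, mem_Ioc, mem_empty_iff_false, iff_false]; rintro ⟨h1, h2, h3⟩; linarith]
    simp
  rcases lt_or_ge a (X 2) with ho | ho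
  · obtain ⟨m₀, h₀, rfl⟩ := intermediate_value_Icc zero_le_two hc (show a ∈ Icc (X 0) (X 2) from ⟨X0.symm ▸ h, ho.le⟩)
    rw [key m₀ h₀ _ (N9 rfl), inter_comm, Ioc_inter_Iic, min_eq_right ho.le, rvoIo, sub_zero]
  · rw [key 2 J1 a (Or.inr ⟨rfl, ho⟩), inter_comm, Ioc_inter_Iic, min_eq_left ho, rvoIo, sub_zero]
namespace Sq
variable {P : Par} {C : ℝ} (Q : Sq P C)
lemma Xmt (t : ℝ) : Measurable (Ze t) := Q.Xm.comp Nb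
lemma pmt (t : ℝ) : Measurable (Zd t) := Q.pm.comp Nb
lemma X2 (t : ℝ) : Ze t 2 = Je := by rw [Q.Xeq J1, Q.pL]
/-- inverse of `X t` -/
noncomputable def Y (t x : ℝ) : ℝ := (volume {m | m ∈ Ioc Jc 2 ∧ Ze t m ≤ x}).toReal
lemma Ym : Measurable (fun q : ℝˣ ↦ Q.Y‡) := by
  unfold Y
  have hs : MeasurableSet {z : (ℝˣ) × ℝ | z.2 ∈ Ioc Jc 2 ∧ Ze z.1.1 z.2 ≤ z.1.2} := by
    refine (measurable_snd measurableSet_Ioc).inter (measurableSet_le ?_ (measurable_snd.comp measurable_fst))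
    exact Q.Xm.comp ((measurable_fst.comp measurable_fst).prodMk measurable_snd)
  exact (measurable_measure_prodMk_left hs).ennreal_toReal
lemma YX {t m : ℝ} (h : m ∈ Ioc Jc 2) : Q.Y t Uh = m := by
  have hm := mono_int (Km t) (Q.pint t) (X := Ze t) fun m hm ↦ Q.Xeq hm
  have : {n | n ∈ Ioc Jc 2 ∧ Ze t n ≤ Ze t m} = Ioc 0 m := by
    ext n
    constructor
    · rintro ⟨h1, h2⟩
      exact ⟨h1.1, (hm.le_iff_le ⟨h1.1.le, h1.2⟩ ⟨h.1.le, h.2⟩).1 h2⟩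
    · rintro ⟨h1, h2⟩
      exact ⟨⟨h1, h2.trans h.2⟩, (hm.le_iff_le ⟨h1.le, h2.trans h.2⟩ ⟨h.1.le, h.2⟩).2 h2⟩
  rw [Y, this, rvoIo, sub_zero, ENNReal.toReal_ofReal h.1.le]
lemma mapX (t : ℝ) : ((volume.restrict Ys).withDensity (fun m ↦ ENNReal.ofReal (Zd t m))).map (Ze t) =
    volume.restrict (Ioo 0 Je) := by
  rw [map_int (Km t) (Q.pint t) (Q.Xmt t) fun m hm ↦ Q.Xeq hm, Q.X2]
  exact Measure.restrict_congr_set Ioo_ae_eq_Ioc.symm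
/-- Eulerian version of `c`, with density -/
noncomputable def eu (c : ℝ → ℝ → ℝ) (t x : ℝ) : ℝ := c t Nc / Zd t Nc
lemma euM {c : ℝ → ℝ → ℝ} (hc : Measurable (fun q : ℝ × ℝ ↦ c q.1 q.2)) : Measurable (fun q : ℝ × ℝ ↦ Q.eu c q.1 q.2) := by
  have := measurable_fst.prodMk Q.Ym
  exact (hc.comp this).div (Q.pm.comp this)
lemma cov (t : ℝ) {G : ℝ → ℝ} (hG : Measurable G) :
    ∫ x in Ioo 0 Je, G x = ∫M G Uh * Zd t m := by
  rw [← Q.mapX t, integral_map (Q.Xmt t).aemeasurable hG.aestronglyMeasurable,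
    integral_withDensity_eq_integral_toReal_smul₀ (Q.pmt t).ennreal_ofReal.aemeasurable (Eventually.of_forall fun _ ↦ ENNReal.ofReal_lt_top)]
  refine integral_congr_ae (Eventually.of_forall fun m ↦ ?_)
  simp only [ENNReal.toReal_ofReal (Km t m).le, smul_eq_mul]; ring
lemma covL (t : ℝ) {G : ℝ → ENNReal} (hG : Measurable G) :
    ∫⁻ x in Ioo 0 Je, G x = ∫⁻ m in Ioc Jc 2, G Uh * ENNReal.ofReal (Zd t m) := by
  have h : Measurable (fun m ↦ G Uh) := hG.comp (Q.Xmt t)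
  rw [← Q.mapX t, lintegral_map hG (Q.Xmt t), lintegral_withDensity_eq_lintegral_mul _ (Q.pmt t).ennreal_ofReal h]
  refine lintegral_congr fun m ↦ ?_
  simp only [Pi.mul_apply]; ring
/-- main change of variables -/
lemma eul {c : ℝ → ℝ → ℝ} (hc : Measurable (fun q : ℝˣ ↦ c‡)) {g : ℝˣ → ℝ} (hg : Measurable g)
    {D : ℝ → ℝ → ℝ} (hD : ∀ t ∈ Ioc 0 Ja, ∀ x ∈ Ioo 0 Je, D t x = Hc c t x * g Zt)
    (hi : Integrable (fun q : ℝˣ ↦ c‡ * g Jb) Jd) :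
    ∫ t in Ioc 0 Ja, ∫ x in Ioo 0 Je, D t x = ∫ q, c‡ * g Jb ∂ Jd := by
  rw [integral_prod _ hi]
  refine setIntegral_congr_fun measurableSet_Ioc fun t ht ↦ ?_
  have hmt : Measurable (fun x ↦ Hc c t x * g Zt) :=
    ((Q.euM hc).comp Nb).mul (hg.comp Nb)
  calc _ = ∫ x in Ioo 0 Je, Hc c t x * g Zt := setIntegral_congr_fun measurableSet_Ioo (hD t ht)
    _ = _ := Q.cov t hmt
    _ = _ := setIntegral_congr_fun measurableSet_Ioc fun m hm ↦ by
      simp only [eu, Q.YX hm]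
      have := (Km t m).ne'
      field_simp
lemma euMt {c : ℝ → ℝ → ℝ} (hc : Measurable (fun q : ℝˣ ↦ c‡)) (t : ℝ) : Measurable (fun x ↦ Hc c t x) :=
  (Q.euM hc).comp Nb
lemma eu_enorm {c : ℝ → ℝ → ℝ} (hc : Measurable (fun q : ℝˣ ↦ c‡)) (t : ℝ) :
    ∫⁻ x in Ioo 0 Je, ‖Hc c t x‖ₑ = ∫⁻ m in Ioc Jc 2, ‖c t m‖ₑ := by
  rw [Q.covL t (Q.euMt hc t).enorm]
  refine setLIntegral_congr_fun measurableSet_Ioc fun m hm ↦ ?_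
  simp only [eu, Q.YX hm]
  rw [← ofReal_norm, ← ofReal_norm, ← ENNReal.ofReal_mul (norm_nonneg _), norm_div, rnoeqab (Zd t m), abs_of_pos (Km t m)]
  have := (Km t m).ne'
  congr 1; field_simp
lemma eu_int {c : ℝ → ℝ → ℝ} (hc : Measurable (fun q : ℝˣ ↦ c‡)) (hi : Integrable (fun q : ℝˣ ↦ c‡) Jd) :
    IntegrableOn (fun q : ℝ × ℝ ↦ Q.eu c q.1 q.2) (Ioc 0 P.T ×ˢ Ioo 0 P.L) := by
  refine ⟨(Q.euM hc).aestronglyMeasurable, ?_⟩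
  have h2 := hi.2
  rw [hasFiniteIntegral_iff_enorm] at h2 ⊢
  rw [lintegral_prod _ hc.enorm.aemeasurable] at h2
  rw [Measure.volume_eq_prod, ← Measure.prod_restrict, lintegral_prod _ (Q.euM hc).enorm.aemeasurable]
  refine lt_of_le_of_lt (lintegral_mono fun t ↦ ?_) h2
  exact (Q.eu_enorm hc t).le
lemma eu_prob {c : ℝ → ℝ → ℝ} (hc : Measurable (fun q : ℝˣ ↦ c‡)) (h0 : ∀ t m, 0 ≤ c t m) (h1 : ∀ t m, c t m ≤ 1) {t : ℝ}
    (h : ∫M c t m = 1) : IsProbDensity Je (Hc c t) := by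
  refine ⟨fun x _ ↦ div_nonneg (h0 _ _) (Km _ _).le, ⟨(Q.euMt hc t).aestronglyMeasurable, ?_⟩, ?_⟩
  · rw [hasFiniteIntegral_iff_enorm, Q.eu_enorm hc t]
    have : IntegrableOn (c t) Ys := by
      refine Measure.integrableOn_of_bounded (M := 1) J1 (hc.comp Nb).aestronglyMeasurable
        (Eventually.of_forall fun m ↦ ?_)
      rw [rnoeqab, abs_of_nonneg (h0 _ _)]; exact h1 _ _
    exact this.2
  · rw [Q.cov t (Q.euMt hc t), ← h]
    refine setIntegral_congr_fun measurableSet_Ioc fun m hm ↦ ?_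
    simp only [eu, Q.YX hm]
    have := (Km t m).ne'
    field_simp
lemma XY {t x : ℝ} (hx : x ∈ Ioo 0 Je) : Ze t Nc = x := by
  have hc : ContinuousOn (Ze t) (Nh 2) := by
    refine (intervalIntegral.continuousOn_primitive_interval' (a := 0) (Q.pint t) J1).congr ?_ |>.mono (uIcc_of_le zero_le_two).symm.subset
    intro m hm; exact Q.Xeq (by rwa [uIcc_of_le zero_le_two] at hm)
  have X0 : Ze t 0 = 0 := by rw [Q.Xeq J1]; simp
  obtain ⟨m, hm, rfl⟩ := intermediate_value_Icc zero_le_two hc (show x ∈ Icc (Ze t 0) (Ze t 2) by rw [X0, Q.X2]; exact Ioo_subset_Icc_self hx)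
  rcases hm.1.eq_or_lt with h | h
  · subst h; rw [X0] at hx; exact absurd hx.1 (lt_irrefl 0)
  · rw [Q.YX ⟨h, hm.2⟩]
variable {Q}
lemma Lim.mass {U : Ultrafilter ℕ} {r v : ℝ → ℝ → ℝ} (H : Lim Q U r v) :
    ∀ᵐ t ∂ Ny, ∫M r t m = 1 := by
  set R : ℝ → ℝ := fun t ↦ (∫M r t m) - 1 with hR
  have Rm : Measurable R := (H.rm.stronglyMeasurable.integral_prod_right (ν := volume.restrict Ys)).measurable.sub_const 1
  have ir (t : ℝ) : IntegrableOn (Ka) Ys := by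
    refine Measure.integrableOn_of_bounded (M := 1) J1 (H.rm.comp Nb).aestronglyMeasurable
        (Eventually.of_forall fun m ↦ ?_)
    rw [rnoeqab, abs_of_nonneg (H.r0 _ _)]; exact H.r1 _ _
  have Rb (t : ℝ) : |R t| ≤ 1 := by
    have h0 : 0 ≤ ∫M r t m := integral_nonneg fun m ↦ H.r0 t m
    have h1 : ∫M r t m ≤ 2 := by
      calc _ ≤ ∫M Y1 := integral_mono (ir t) J1 fun m ↦ H.r1 t m
        _ = 2 := by simp
    rw [abs_le]; constructor <;> simp only [hR] <;> linarith
  have nR : Nice Ja (fun t _ ↦ R t) := ⟨Rm.comp measurable_fst, 1, fun t _ _ _ ↦ Rb t⟩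
  have l := H.hr (fun q ↦ R q.1) (nR.memLp 2)
  have e1 (i : ℕ) : ∫ q, ♠.r‡ * R q.1 ∂ Jd = ∫t R t := by
    rw [(♠.nr.mul nR).fub Zk]
    refine iincoz fun t ht ↦ ?_
    rw [uIcc_of_le Zk] at ht
    simp only [iinmuco]
    rw [(♠.dψ t).ftc (♠.nr.intm ht) J1 J1 J1, ♠.ψ0, ♠.ψ2]; ring
  simp only [e1] at l
  have e2 := tendsto_nhds_unique l tendsto_const_nhds
  have e3 : ∫ q, r‡ * R q.1 ∂ Jd = ∫t (R t + R t ^ 2) := by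
    rw [(H.nr.mul nR).fub Zk]
    refine iincoz fun t ht ↦ ?_
    simp only [iinmuco]
    rw [iinofle zero_le_two, hR]; ring
  have iR : IntervalIntegrable R volume 0 Ja := nR.intt (m := 1) ⟨le_rfl, Zk⟩ J1
  have iR2 : IntervalIntegrable (fun t ↦ R t ^ 2) volume 0 Ja := (nR.pow 2).intt (m := 1) ⟨le_rfl, Zk⟩ J1
  rw [e3, iinad iR iR2] at e2
  have e4 : ∫ t in Ioc 0 Ja, R t ^ 2 = 0 := by rw [← iinofle Zk]; linarith
  rw [integral_eq_zero_iff_of_nonneg (fun t ↦ sq_nonneg _) iR2.1] at e4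
  filter_upwards [e4] with t ht
  have : R t = 0 := by simpa using ht
  simp only [hR] at this; linarith
end Sq
lemma mkTst {T : ℝ} {φ : ℝˣ → ℝ} (h : ContDiff ℝ 1 φ) (hT : ∀ x, φ (T, x) = 0) : ∃ F : Tst T, Zf = φ := by
  have hd := h.continuous_fderiv one_ne_zero
  refine ⟨⟨φ, fun z ↦ fderiv ℝ φ z (1, 0), fun z ↦ fderiv ℝ φ z (0, 1), h.continuous, hd.clm_apply continuous_const,
    hd.clm_apply continuous_const, fun z ↦ ?_, hT⟩, rfl⟩
  have := (h.differentiable one_ne_zero z).hasFDerivAt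
  have e : fderiv ℝ φ z (1, 0) • ContinuousLinearMap.fst ℝ ℝ ℝ + fderiv ℝ φ z (0, 1) • ContinuousLinearMap.snd ℝ ℝ ℝ = fderiv ℝ φ z := by
    ext <;> simp
  rw [e]; exact this
namespace Sq
variable {P : Par} {C : ℝ} {Q : Sq P C} {U : Ultrafilter ℕ} {r v : ℝ → ℝ → ℝ}
/-- `r v g(X)` etc are integrable -/
lemma Lim.irv (H : Lim Q U r v) {g : ℝˣ → ℝ} (hg : Continuous g) :
    Integrable (fun q : ℝˣ ↦ r‡ * v‡ * g Jb) Jd ∧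
    Integrable (fun q : ℝˣ ↦ v‡ * g Jb) Jd ∧
    Integrable (fun q : ℝˣ ↦ r‡ * g Jb) Jd ∧
    Integrable (fun q : ℝˣ ↦ r‡ ^ 2 * g Jb) Jd ∧
    Integrable (fun q : ℝˣ ↦ g Jb) Jd := by
  obtain ⟨K, hK⟩ := bdK hg Ja Je
  have rb : ∀q ‖r‡‖ ≤ 1 := Eventually.of_forall fun q ↦ by
    rw [rnoeqab, abs_of_nonneg (H.r0 _ _)]; exact H.r1 _ _
  have hb := bdXp (Q := Q) hK
  have hm := (comp_m (Q := Q) hg).aestronglyMeasurable (μ := kap Ja)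
  refine ⟨(H.vi.bdd_mul (c := 1) H.rm.aestronglyMeasurable rb).mul_bdd (c := K) hm hb, H.vi.mul_bdd (c := K) hm hb,
    H.nr.int.mul_bdd (c := K) hm hb, (H.nr.pow 2).int.mul_bdd (c := K) hm hb, Integrable.of_bound hm _ hb⟩
variable (Q) in
lemma sumρ (r : ℝ → ℝ → ℝ) (t x : ℝ) : Hc r t x + Hc (fun t m ↦ 1 - Ka m) t x = 1 / Zd t Nc := by
  simp only [eu]; ring
lemma pgx (F : Tst Ja) (F0 : ∀ t, Zf (t, 0) = 0) (FL : ∀ t, Zf (t, Je) = 0) :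
    Integrable (fun q : ℝˣ ↦ Zd‡ * Na) Jd ∧
    ∫ q, Zd‡ * Na ∂ Jd = 0 := by
  obtain ⟨K, hK⟩ := bdK Kj Ja Je
  have hi : Integrable (fun q : ℝˣ ↦ Zd‡ * Na) Jd :=
    Q.pI.mul_bdd (c := K) (comp_m Kj).aestronglyMeasurable (bdXp hK)
  refine ⟨hi, ?_⟩
  rw [← Q.eul (D := fun t x ↦ Ju Zt) Q.pm F.cx.measurable (fun t _ x _ ↦ by
    have := (Km t Nc).ne'
    simp only [eu]; field_simp) hi]
  have : ∀ t, ∫ x in Ioo 0 Je, Ju Zt = 0 := fun t ↦ by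
    rw [← integral_Ioc_eq_integral_Ioo, ← iinofle P.hL.le,
      iineqsuofha (fun x _ ↦ F.dx t x) (by
        apply cin; exact F.cx.comp Zn), F0, FL, sub_zero]
  simp [this]
lemma Lim.part2 (H : Lim Q U r v) (hU : (U : Filter ℕ) ≤ atTop) (F : Tst Ja) (F0 : ∀ t, Zf (t, 0) = 0) (FL : ∀ t, Zf (t, Je) = 0) :
    Integrable (fun q : ℝˣ ↦ Nn * Na) Jd ∧
    ∫ q, Nn * Na ∂ Jd =
      ∫ q, Uo * Zf Jb ∂ Jd := by
  obtain ⟨K, hK⟩ := bdK Kj Ja Je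
  obtain ⟨j1, j2⟩ := pgx (Q := Q) F F0 FL
  have j3 : Integrable (fun q : ℝˣ ↦ Na * Y9) Jd := by
    refine Integrable.bdd_mul (c := K) ?_ (comp_m Kj).aestronglyMeasurable (bdXp hK)
    refine Integrable.mono' (((integrable_const Y1).add Q.pI).const_mul Jv)
      (Q.pm.mul ((Q.pm.pow_const _).const_mul _)).aestronglyMeasurable (Eventually.of_forall fun q ↦ ?_)
    have p0 := Km‡
    have h2 := rpow_b Eo P.hα1 p0
    have h3 := Gy
    have h4 : 0 ≤ Zd‡ * Zd‡ ^ Jk := by positivity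
    rw [show Zd‡ * (Jv * Zd‡ ^ Jk) = Jv * (Zd‡ * Zd‡ ^ Jk) by ring, rnoeqab,
      abs_of_nonneg (mul_nonneg h3.le h4)]
    exact mul_le_mul_of_nonneg_left h2 h3.le
  have j4 := j3.sub (j1.const_mul Jv)
  have e : (fun q : ℝˣ ↦ Nn * Na) =
    (fun q : ℝˣ ↦ Na * Y9) -
      fun q : ℝˣ ↦ Jv * (Zd‡ * Na) := by ext q; simp only [Pi.sub_apply]; ring
  rw [e]
  refine ⟨j4, ?_⟩
  rw [integral_sub' j3 (j1.const_mul Jv), integral_const_mul, j2, mul_zero, sub_zero, H.E3 hU F F0 FL]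
/-- species 1 -/
lemma Lim.part3 (H : Lim Q U r v) (hU : (U : Filter ℕ) ≤ atTop) (F : Tst Ja) :
    Integrable (fun q : ℝˣ ↦ r‡ * Z4 Jb) Jd ∧
    Integrable (fun q : ℝˣ ↦ Jx * Na) Jd ∧
    (∫ x in Ioo 0 Je, P.ρ1 x * Zf Yh) + ∫ q, r‡ * Z4 Jb ∂ Jd =
    ∫ q, Jx * Na ∂ Jd := by
  have a := H.irv F.ct
  have b := H.irv Kj
  have c := H.irv (g := fun z ↦ Jm z.2 * Ju z) ((P.Wcont.comp continuous_snd).mul Kj)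
  have h1 := H.E1 hU F
  have i1 := a.2.2.1
  have i2 := b.1
  have i3 := c.2.2.1.sub c.2.2.2.1
  have e1 : (fun q : ℝˣ ↦ r‡ * Yy) =
    (fun q : ℝˣ ↦ r‡ * Z4 Jb) + fun q : ℝˣ ↦ r‡ * v‡ * Ju Jb := by
    ext q; simp only [Pi.add_apply]; ring
  have e3 : (fun q : ℝˣ ↦ K9 * Na) =
    (fun q : ℝˣ ↦ r‡ * (Jm Ze‡ * Na)) -
      fun q : ℝˣ ↦ r‡ ^ 2 * (Jm Ze‡ * Na) := by
    ext q; simp only [Pi.sub_apply]; ring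
  have e2 : (fun q : ℝˣ ↦ Jx * Na) =
    (fun q : ℝˣ ↦ K9 * Na) -
      (fun q : ℝˣ ↦ r‡ * v‡ * Na) := by ext q; simp only [Pi.sub_apply]; ring
  have i4 : Integrable (fun q : ℝˣ ↦ K9 * Na) Jd := by
    rw [e3]; exact i3
  rw [e2]
  refine ⟨i1, i4.sub i2, ?_⟩
  rw [e1, integral_add' i1 i2] at h1
  rw [integral_sub' i4 i2]; linarith
/-- total density -/
lemma Lim.part4 (H : Lim Q U r v) (hU : (U : Filter ℕ) ≤ atTop) (F : Tst Ja) :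
    Integrable (fun q : ℝˣ ↦ (1 - r‡) * Z4 Jb) Jd ∧
    Integrable (fun q : ℝˣ ↦ (- v‡ - Jx) * Na) Jd ∧
    (∫ x in Ioo 0 Je, P.ρ2 x * Zf Yh) + ∫ q, (1 - r‡) * Z4 Jb ∂ Jd =
    ∫ q, (- v‡ - Jx) * Na ∂ Jd := by
  obtain ⟨k1, k2, k3⟩ := H.part3 hU F
  have h2 := H.E2 hU F
  have i1 := (H.irv F.ct).2.2.2.2
  have i2 := (H.irv Kj).2.1
  have e1 : (fun q : ℝˣ ↦ Yy) =
    (fun q : ℝˣ ↦ Z4 Jb) + fun q : ℝˣ ↦ v‡ * Ju Jb := by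
    ext q; simp only [Pi.add_apply]; ring
  rw [e1, integral_add' i1 i2] at h2
  have e2 : (fun q : ℝˣ ↦ (1 - r‡) * Z4 Jb) = (fun q : ℝˣ ↦ Z4 Jb) -
    fun q : ℝˣ ↦ r‡ * Z4 Jb := by ext q; simp only [Pi.sub_apply]; ring
  have e3 : (fun q : ℝˣ ↦ (- v‡ - Jx) * Na) =
    -(fun q : ℝˣ ↦ v‡ * Na) - (fun q : ℝˣ ↦ Jx * Na) := by
    ext q; simp only [Pi.sub_apply, Pi.neg_apply]; ring
  rw [e2, e3]
  refine ⟨i1.sub k1, i2.neg.sub k2, ?_⟩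
  rw [integral_sub' i1 k1, integral_sub' i2.neg k2, integral_neg']
  have hc : ContinuousOn (fun x ↦ Zf Yh) (Nh Je) := by have := Nm; fun_prop
  have j1 : Integrable (fun x ↦ P.ρ1 x * Zf Yh) (volume.restrict (Ioo 0 Je)) := by
    obtain ⟨K, hK⟩ := bddJ (g := fun x ↦ Zf Yh) (by have := Nm; fun_prop) Je
    exact P.h1i.mul_bdd (c := K) (by have := Nm; apply Continuous.aestronglyMeasurable; fun_prop)
      ((ae_restrict_iff' measurableSet_Ioo).2 (Eventually.of_forall fun x hx ↦ hK x (Ioo_subset_Icc_self hx)))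
  have j2 : Integrable (fun x ↦ P.ρ2 x * Zf Yh) (volume.restrict (Ioo 0 Je)) := by
    obtain ⟨K, hK⟩ := bddJ (g := fun x ↦ Zf Yh) (by have := Nm; fun_prop) Je
    exact P.h2i.mul_bdd (c := K) (by have := Nm; apply Continuous.aestronglyMeasurable; fun_prop)
      ((ae_restrict_iff' measurableSet_Ioo).2 (Eventually.of_forall fun x hx ↦ hK x (Ioo_subset_Icc_self hx)))
  have j3 := integral_add j1 j2
  have j4 : ∫ x in Ioo 0 Je, Uu * Zf Yh = ∫ x in Ioo 0 Je, (P.ρ1 x * Zf Yh + P.ρ2 x * Zf Yh) := by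
    congr 1; ext x; ring
  rw [j4, j3] at h2
  linarith
theorem Lim.final (H : Lim Q U r v) (hU : (U : Filter ℕ) ≤ atTop) {gf d1 d2 : ℝ → ℝ}
    (hgf : ∀ s, 0 < s → gf s = Jv * (s ^ J3 - 1)) (h1 : ∀ x ∈ Ioo 0 Je, d1 x = Zq x + Jm x) (h2 : ∀ x ∈ Ioo 0 Je, d2 x = Zq x) :
    ∃ ρ1 ρ2 : ℝ → ℝ → ℝ,
      Measurable (fun q : ℝˣ ↦ ρ1‡) ∧
      Measurable (fun q : ℝˣ ↦ ρ2‡) ∧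
      (∀ t x, 0 ≤ ρ1 t x) ∧ (∀ t x, 0 ≤ ρ2 t x) ∧
      (∀ᵐ t ∂(volume.restrict (Nh Ja)),
        IsProbDensity Je (ρ1 t) ∧ IsProbDensity Je (ρ2 t)) ∧
      ∃ h : ℝ → ℝ → ℝ,
        IntegrableOn (fun q : ℝˣ ↦ h‡) (Ioc 0 Ja ×ˢ Ioo 0 Je) ∧
        (∀ ψ : ℝˣ → ℝ, ContDiff ℝ (⊤ : ℕ∞) ψ → HasCompactSupport ψ →
          tsupport ψ ⊆ Ioo 0 Ja ×ˢ Ioo 0 Je →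
          (∫ t in Ioc 0 Ja, ∫ x in Ioo 0 Je,
              gf (ρ1 t x + ρ2 t x) * deriv (fun y ↦ ψ (t, y)) x) =
            -(∫ t in Ioc 0 Ja, ∫ x in Ioo 0 Je, h t x * ψ Zt)) ∧
        (∀ φ : ℝˣ → ℝ, ContDiff ℝ 1 φ →
          (∃ t0, t0 < Ja ∧ ∀ t x : ℝ, t0 ≤ t → φ Zt = 0) →
          ((∫ x in Ioo 0 Je, P.ρ1 x * φ Yh) +
              (∫ t in Ioc 0 Ja, ∫ x in Ioo 0 Je,
                ρ1 t x * deriv (fun τ ↦ φ (τ, x)) t) =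
            ∫ t in Ioc 0 Ja, ∫ x in Ioo 0 Je,
              ((if ρ1 t x + ρ2 t x = 0 then 0
                  else ρ1 t x / (ρ1 t x + ρ2 t x)) * h t x +
                ρ1 t x * d1 x) * deriv (fun y ↦ φ (t, y)) x) ∧
          ((∫ x in Ioo 0 Je, P.ρ2 x * φ Yh) +
              (∫ t in Ioc 0 Ja, ∫ x in Ioo 0 Je,
                ρ2 t x * deriv (fun τ ↦ φ (τ, x)) t) =
            ∫ t in Ioc 0 Ja, ∫ x in Ioo 0 Je,
              ((if ρ1 t x + ρ2 t x = 0 then 0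
                  else ρ2 t x / (ρ1 t x + ρ2 t x)) * h t x +
                ρ2 t x * d2 x) * deriv (fun y ↦ φ (t, y)) x)) := by
  have mrp : Measurable (fun q : ℝˣ ↦ 1 - r‡) := H.rm.const_sub 1
  have mX := Q.Xm
  have mb : Measurable (fun q : ℝˣ ↦ Zq Ze‡) := P.bcont.measurable.comp mX
  have mW : Measurable (fun q : ℝˣ ↦ Jm Ze‡) := P.Wcont.measurable.comp mX
  have mq : Measurable (fun q : ℝˣ ↦ -Uo) :=
    ((H.vm.add mb).add (H.rm.mul mW)).neg
  have pp (t x : ℝ) := Km t Nc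
  have c1 := H.irv (g := fun z ↦ Zq z.2) (P.bcont.comp continuous_snd)
  have c2 := H.irv (g := fun z ↦ Jm z.2) (P.Wcont.comp continuous_snd)
  refine ⟨Hc r, Hc (fun t m ↦ 1 - Ka m), Q.euM H.rm, Q.euM mrp, fun t x ↦ div_nonneg (H.r0 _ _) (pp t x).le,
    fun t x ↦ div_nonneg (sub_nonneg.2 (H.r1 _ _)) (pp t x).le, ?_,
    Hc fun t m ↦ -(v t m + Zq Uh + Ka m * Jm Uh), Q.eu_int mq (((H.vi.add c1.2.2.2.2).add c2.2.2.1).neg), ?_, ?_⟩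
  · rw [← Measure.restrict_congr_set (Ioc_ae_eq_Icc (μ := volume) (a := 0) (b := Ja))]
    filter_upwards [H.mass] with t ht
    refine ⟨Q.eu_prob H.rm H.r0 H.r1 ht, Q.eu_prob mrp (fun t m ↦ sub_nonneg.2 (H.r1 _ _)) (fun t m ↦ sub_le_self 1 (H.r0 t m)) ?_⟩
    have ir : IntegrableOn (Ka) Ys := by
      by_contra hc
      rw [integral_undef hc] at ht; exact zero_ne_one ht
    rw [integral_sub J1 ir, ht]; simp; norm_num
  · intro ψ hψ _ hs
    have hz : ∀ t x, Zt ∉ Ioo 0 Ja ×ˢ Ioo 0 Je → ψ Zt = 0 := fun t x h ↦ image_eq_zero_of_notMem_tsupport fun ho ↦ h (hs ho)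
    obtain ⟨F, rfl⟩ := mkTst (T := Ja) (φ := ψ) (hψ.of_le (by exact_mod_cast le_top)) fun x ↦ hz _ _ fun h ↦ lt_irrefl _ h.1.2
    obtain ⟨k1, k2⟩ := H.part2 hU F (fun t ↦ hz _ _ fun h ↦ lt_irrefl _ h.2.1) (fun t ↦ hz _ _ fun h ↦ lt_irrefl _ h.2.2)
    rw [Q.eul (g := Ju) (c := fun t m ↦ Zd t m * (Jv * Zd t m ^ Jk - Jv)) (Q.pm.mul (((Q.pm.pow_const _).const_mul _).sub_const _)) F.cx.measurable ?_ k1, k2,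
      Q.eul (g := Zf) (c := fun t m ↦ -(v t m + Zq Uh + Ka m * Jm Uh)) mq F.c.measurable (fun _ _ _ _ ↦ rfl), ← integral_neg]
    · congr 1; ext q; ring
    · have c3 := H.irv (g := fun z ↦ Zq z.2 * Zf z) E5
      have c4 := H.irv (g := fun z ↦ Jm z.2 * Zf z) E4
      refine ((((H.irv Nm).2.1).add c3.2.2.2.2).add c4.2.2.1).neg.congr (Eventually.of_forall fun q ↦ ?_)
      simp only [Pi.neg_apply, Pi.add_apply]; ring
    · intro t _ x _
      have h3 := pp t x
      rw [(F.dx t x).deriv, Q.sumρ, hgf _ Jh, one_div, Real.inv_rpow h3.le, ← Real.rpow_neg h3.le]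
      simp only [eu]; field_simp
  · rintro φ hφ ⟨t0, ht0, h0⟩
    obtain ⟨F, rfl⟩ := mkTst (T := Ja) hφ fun x ↦ h0 _ _ ht0.le
    obtain ⟨k1, k2, k3⟩ := H.part3 hU F
    obtain ⟨l1, l2, l3⟩ := H.part4 hU F
    have mr2 : Measurable (fun q : ℝˣ ↦ -(r‡ * v‡) + Zz * Jm Ze‡) :=
      (H.rm.mul H.vm).neg.add ((H.rm.sub (H.rm.pow_const 2)).mul mW)
    have mr3 := H.vm.neg.sub mr2
    constructor
    · rw [Q.eul (g := Z4) H.rm F.ct.measurable Hd k1,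
        Q.eul (g := Ju) (c := fun t m ↦ -(Ka m * v t m) + (Ka m - Ka m ^ 2) * Jm Uh) mr2 F.cx.measurable (fun t _ x hx ↦ ?_) k2, k3]
      have h3 := pp t x
      rw [(F.dx t x).deriv, Q.sumρ, if_neg Jh, h1 x hx]
      simp only [eu, Q.XY hx]; field_simp; ring
    · rw [Q.eul (g := Z4) (c := fun t m ↦ 1 - Ka m) mrp F.ct.measurable Hd l1,
        Q.eul (g := Ju) (c := fun t m ↦ -v t m - (-(Ka m * v t m) + (Ka m - Ka m ^ 2) * Jm Uh)) mr3 F.cx.measurable (fun t _ x hx ↦ ?_) l2, l3]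
      have h3 := pp t x
      rw [(F.dx t x).deriv, Q.sumρ, if_neg Jh, h2 x hx]
      simp only [eu, Q.XY hx]; field_simp; ring
end Sq
end
section
open Real Finset
lemma ex_eps {α : ℝ} (h0 : 0 < α) (h1 : α ≤ 1) {ε : ℝ} (hε : 0 < ε) : ∃ c, 0 ≤ c ∧ ∀ a, exp Ui ≤ ε * exp a + c := by
  refine ⟨exp U0, (exp_pos _).le, fun a ↦ ?_⟩
  have := convexOn_exp.2 (mem_univ (a + log ε)) (mem_univ U0) He h0.le (by ring)
  simp only [smul_eq_mul] at this
  have e : Zg * (a + log ε) + α * -(Zg * log ε / α) = Zg * a := by field_simp; ring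
  rw [e, exp_add, exp_log hε] at this
  have a1 := exp_pos a
  have a2 := exp_pos U0
  have a3 : Zg * (exp a * ε) ≤ exp a * ε := mul_le_of_le_one_left Jh Js
  have a4 : α * exp U0 ≤ exp U0 := mul_le_of_le_one_left a2.le h1
  linarith
lemma exA {α a b : ℝ} (h0 : 0 < α) (h1 : α ≤ 1) (h : b ≤ a) :
    α * (exp a - exp b) ≤ Yv * exp Ui ∧
    exp a - exp b ≤ Yd * exp (-Ui) := by
  have c := convexOn_exp.2 (mem_univ a) (mem_univ b) He h0.le (by ring)
  simp only [smul_eq_mul] at c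
  constructor
  · rw [sub_mul, ← exp_add, ← exp_add, show α * a + Zg * a = a by ring, show α * b + Zg * a = Zg * a + α * b by ring]
    linarith
  · rw [sub_mul, ← exp_add, ← exp_add, show Hf * a + -Ui = a by ring]
    have : exp (Hf * b + -Ui) ≤ exp b := exp_le_exp.2 (by nlinarith)
    linarith
lemma exD1 {α a b : ℝ} (h0 : 0 < α) (h1 : α ≤ 1) :
    α * (exp a - exp b) ^ 2 ≤ Yd * Yv := by
  wlog h : b ≤ a generalizing a b
  · have := this (le_of_not_ge h); nlinarith
  obtain ⟨h2, h3⟩ := exA h0 h1 h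
  have h4 : 0 ≤ exp a - exp b := sub_nonneg.2 (exp_le_exp.2 h)
  have h5 := mul_le_mul h2 h3 h4 (le_trans (mul_nonneg h0.le h4) h2)
  rw [show Yv * exp Ui * (Yd * exp (-Ui)) =
    Yd * Yv * (exp Ui * exp (-Ui)) by ring,
    ← exp_add, add_neg_cancel, exp_zero, mul_one] at h5
  linarith [sq (exp a - exp b)]
lemma exD2 {α a b : ℝ} (h0 : 0 < α) : α * Za ^ 2 * exp (α * min a b) ≤ Za * Yv := by
  wlog h : b ≤ a generalizing a b
  · have := this (le_of_not_ge h); rw [min_comm] at this; nlinarith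
  rw [min_eq_right h]
  have h2 := add_one_le_exp (α * a - α * b)
  have h3 := mul_le_mul_of_nonneg_right h2 (exp_pos (α * b)).le
  rw [← exp_add, sub_add_cancel] at h3
  nlinarith [mul_le_mul_of_nonneg_left h3 Gu]
lemma exC {α a b : ℝ} (h0 : 0 < α) (h1 : α ≤ 1) :
    |exp (Hf * a) - exp (Hf * b)| ≤ 2 * |exp a - exp b| * exp (Zg * max a b) := by
  wlog h : b ≤ a generalizing a b
  · have := this (le_of_not_ge h); rwa [abs_sub_comm, max_comm, abs_sub_comm (exp a)]
  have h4 : 0 ≤ exp a - exp b := sub_nonneg.2 (exp_le_exp.2 h)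
  rw [max_eq_left h, abs_of_nonneg h4, abs_of_nonneg (sub_nonneg.2 (exp_le_exp.2 (by nlinarith)))]
  have e1 : exp (Hf * a) = exp a * exp Ui := by rw [← exp_add]; ring_nf
  have e2 : exp (Hf * b) = exp Ui * (exp b * exp (-(Zg * Za))) := by rw [← exp_add, ← exp_add]; ring_nf
  have e3 : exp (-Za) ≤ exp (-(Zg * Za)) := exp_le_exp.2 (by nlinarith)
  have e4 : exp b = exp a * exp (-Za) := by rw [← exp_add]; ring_nf
  have e5 : exp (-Za) ≤ 1 := exp_le_one_iff.2 Js
  have e6 : exp b * exp (-Za) ≤ exp b * exp (-(Zg * Za)) := mul_le_mul_of_nonneg_left e3 (exp_pos b).le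
  have e7 : exp b * exp (-Za) ≥ 2 * exp b - exp a := by
    rw [e4]; nlinarith [exp_pos a, mul_nonneg (exp_pos a).le (sq_nonneg (1 - exp (-Za)))]
  rw [e1, e2]
  nlinarith [exp_pos Ui]
/-- nodal sum over interior nodes -/
lemma csum {N : ℕ} (x : ℕ → ℝ) : (∑ j ∈ range N, |x j|) ^ 2 ≤ N * ∑ j ∈ range N, x j ^ 2 := by
  have := sq_sum_le_card_mul_sum_sq (s := range N) (f := fun j ↦ |x j|)
  simpa using this
lemma tele {N : ℕ} (x : ℕ → ℝ) {k l : ℕ} (hk : k ≤ N) (hl : l ≤ N) : |x k - x l| ≤ ∑ j ∈ range N, |x Ji - x j| := by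
  wlog h : l ≤ k generalizing k l
  · rw [abs_sub_comm]; exact this hl hk (le_of_not_ge h)
  have : x k - x l = ∑ j ∈ Finset.Ico l k, (x Ji - x j) := (sum_Ico_sub x h).symm
  rw [this]
  refine (abs_sum_le_sum_abs _ _).trans (sum_le_sum_of_subset_of_nonneg (fun j hj ↦ ?_) fun _ _ _ ↦ abs_nonneg _)
  rw [fmera]; exact (Finset.mem_Ico.1 hj).2.trans_le hk
noncomputable def gE (P : Par) (z : ℝ) : ℝ := z ^ E6 - log z
noncomputable def pr (P : Par) (z : ℝ) : ℝ := Jv * z ^ Jk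
noncomputable def TV (n : ℕ) (p : ℕ → ℝ) : ℝ := ∑ j ∈ range J8, |1 / p Ji - 1 / p j|
noncomputable def TL (n : ℕ) (p : ℕ → ℝ) : ℝ := ∑ j ∈ range J8, |log Ua - log Yr|
noncomputable def Ds (P : Par) (n : ℕ) (p : ℕ → ℝ) : ℝ :=
  n * ∑ j ∈ range J8, Zu * (U3 Ua - U3 Yr)
noncomputable def Par.c1 (P : Par) : ℝ := 2 * (1 + Je) / (J3 * Jv)
noncomputable def Par.c2 (P : Par) : ℝ := 1 + 2 / Je + |log (Je / 2)|
lemma TV0 (n p) : 0 ≤ TV n p := sum_nonneg fun _ _ ↦ abs_nonneg _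
lemma TL0 (n p) : 0 ≤ TL n p := sum_nonneg fun _ _ ↦ abs_nonneg _
section
variable {P : Par}
lemma Par.c1p : 0 < Hg := by have := Uw; have := Eo; have := Gy; unfold Par.c1; positivity
lemma Par.c2p : 1 ≤ P.c2 := by have := Uw; unfold Par.c2; linarith [abs_nonneg Gn, div_nonneg zero_le_two this.le]
lemma rpe {z : ℝ} (hz : 0 < z) (a : ℝ) : z ^ (-a) = exp (a * -log z) := by rw [rpow_def_of_pos hz]; ring_nf
lemma oe {z : ℝ} (hz : 0 < z) : 1 / z = exp (-log z) := by rw [exp_neg, exp_log hz, one_div]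
lemma pt1 {x y : ℝ} (hx : 0 < x) (hy : 0 < y) :
    J3 * Jv * (1 / y - 1 / x) ^ 2 ≤ (gE P y - gE P x) * (U3 y - U3 x) ∧
    J3 * Jv * (log y - log x) ^ 2 ≤ (1 + x + y) * ((gE P y - gE P x) * (U3 y - U3 x)) := by
  have h0 := Eo; have h1 := P.hα1; have h2 := Gy
  set a := -log y with ha
  set b := -log x with hb
  have e1 := exD1 (a := a) (b := b) h0 h1
  have e2 := exD2 (a := a) (b := b) h0
  have e3 : (gE P y - gE P x) * (U3 y - U3 x) = Jv * ((exp (Yw * a) - exp (Yw * b)) * Uq + Za * Uq) := by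
    simp only [gE, pr, rpe hx, rpe hy, ha, hb]; ring
  have e4 : 0 ≤ Za * Uq := le_trans Jh e2
  have e5 : 0 ≤ (exp (Yw * a) - exp (Yw * b)) * Uq := le_trans Jh e1
  constructor
  · rw [e3, oe hx, oe hy, ← ha, ← hb]; nlinarith
  · have e6 : 1 ≤ (1 + x + y) * exp (J3 * min a b) := by
      have : (1 + x + y) * exp (J3 * min a b) ≥ exp (-(J3 * min a b)) * exp (J3 * min a b) := by
        refine mul_le_mul_of_nonneg_right ?_ (exp_pos _).le
        have k1 : ∀ z : ℝ, 0 < z → exp (-(J3 * -log z)) ≤ 1 + z := fun z hz ↦ by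
          have := rpow_le_rpow_of_exponent_le (x := 1 + z) Js h1
          have h3 := rpow_le_rpow hz.le (show z ≤ 1 + z by linarith) h0.le
          rw [rpow_one] at this
          rw [rpow_def_of_pos hz] at h3
          refine le_trans (le_of_eq ?_) (h3.trans this); ring_nf
        rcases min_choice a b with h | h <;> rw [h]
        · linarith [k1 y hy]
        · linarith [k1 x hx]
      rw [← exp_add, neg_add_cancel, exp_zero] at this; exact this
    have e7 : (log y - log x) ^ 2 = Za ^ 2 := by rw [ha, hb]; ring
    rw [e3, e7]
    have e8 := mul_le_mul_of_nonneg_left e2 (show 0 ≤ 1 + x + y by linarith)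
    have e9 := mul_le_mul_of_nonneg_left e6 (show 0 ≤ J3 * Za ^ 2 by positivity)
    have e10 := mul_nonneg (show 0 ≤ 1 + x + y by linarith) e5
    nlinarith
lemma cs2 {N : ℕ} {f g h : ℕ → ℝ} {c : ℝ} (hc : 0 ≤ c) (hg : ∀ j < N, 0 ≤ g j) (hh : ∀ j < N, 0 ≤ h j) (hf : ∀ j < N, c * f j ^ 2 ≤ g j * h j) :
    c * (∑ j ∈ range N, |f j|) ^ 2 ≤ (∑ j ∈ range N, g j) * ∑ j ∈ range N, h j := by
  have := sum_sq_le_sum_mul_sum_of_sq_le_mul (range N) (r := fun j ↦ √c * |f j|) (f := g) (g := h) (fun j hj ↦ hg j Hh) (fun j hj ↦ hh j Hh)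
    (fun j hj ↦ by rw [mul_pow, sq_sqrt hc, sq_abs]; exact hf j Hh)
  rwa [← mul_sum, mul_pow, sq_sqrt hc] at this
structure Sp (P : Par) (n : ℕ) (p : ℕ → ℝ) : Prop where
  hn : 1 ≤ n
  hp : ∀ k < 2 * n, 0 < p k
  hs : ∑ k ∈ range Jz, p k = n * Je
namespace Sp
variable {n : ℕ} {p : ℕ → ℝ}
lemma Ds_nn (H : Sp P n p) : ∀ j < 2 * n - 1, 0 ≤ Zu * (U3 Ua - U3 Yr) := fun j hj ↦
  le_trans (by have := Eo; have := Gy; positivity) Kt.1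
lemma Ds0 (H : Sp P n p) : 0 ≤ Ds P n p := mul_nonneg n.cast_nonneg (sum_nonneg fun j hj ↦ H.Ds_nn j Hh)
lemma sq12 (H : Sp P n p) : TV n p ^ 2 ≤ Hg * N0 ∧ TL n p ^ 2 ≤ Hg * Ds P n p := by
  have hn := H.hn
  have hal : 0 < J3 * Jv := mul_pos Eo Gy
  have hL := Uw
  have hnp : Y1 ≤ n := by exact_mod_cast H.hn
  have k1 := cs2 (N := 2 * n - 1) (f := fun j ↦ 1 / p Ji - 1 / p j) (g := fun _ ↦ 1) hal.le (fun _ _ ↦ zero_le_one) (H.Ds_nn)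
    (fun j hj ↦ by rw [one_mul]; exact Kt.1)
  have k2 := cs2 (N := 2 * n - 1) (f := fun j ↦ log Ua - log Yr) (g := fun j ↦ 1 + p j + p Ji) hal.le
    (fun j hj ↦ by linarith [H.hp j J5, H.hp Ji J5]) (H.Ds_nn)
    (fun j hj ↦ Kt.2)
  have k3 : ∑ j ∈ range J8, (1 + p j + p Ji) ≤ 2 * n * (1 + Je) := by
    have a1 : ∑ j ∈ range J8, p j ≤ n * Je := by
      rw [← H.hs]; exact sum_le_sum_of_subset_of_nonneg (range_subset_range.2 J5) fun i hi _ ↦ (H.hp i (fmera.1 hi)).le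
    have a2 : ∑ j ∈ range J8, p Ji ≤ n * Je := by
      have := sum_range_succ' p J8
      rw [show 2 * n - 1 + 1 = 2 * n by omega, H.hs] at this
      linarith [H.hp 0 J5]
    rw [sum_add_distrib, sum_add_distrib]
    have a3 : ((2 * n - 1 : ℕ) : ℝ) ≤ 2 * n := by exact_mod_cast Nat.sub_le _ _
    simp only [sum_const, card_range, nsmul_eq_mul, mul_one]
    linarith
  have k4 : ∑ j ∈ range J8, Y1 ≤ 2 * n * (1 + Je) := by
    have a3 : ((2 * n - 1 : ℕ) : ℝ) ≤ 2 * n := by exact_mod_cast Nat.sub_le _ _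
    simp only [sum_const, card_range, nsmul_eq_mul, mul_one]
    nlinarith
  have S0 := sum_nonneg fun j hj ↦ H.Ds_nn j Hh
  have fin : ∀ x y z : ℝ, J3 * Jv * x ≤ z * y → 0 ≤ y → z ≤ 2 * n * (1 + Je) → x ≤ Hg * (n * y) := fun x y z h hy hz ↦ by
    unfold Par.c1
    rw [div_mul_eq_mul_div, le_div_iff₀ hal]
    nlinarith [mul_le_mul_of_nonneg_right hz hy]
  exact ⟨fin _ _ _ k1 S0 k4, fin _ _ _ k2 S0 k3⟩
lemma ex_k0 (H : Sp P n p) : ∃ k < 2 * n, Je / 2 ≤ p k := by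
  have hn := H.hn
  by_contra! h
  have := sum_lt_sum_of_nonempty (s := range Jz) (by simp; omega) (fun i hi ↦ h i (fmera.1 hi))
  rw [H.hs] at this; simp at this; linarith
lemma ex_k1 (H : Sp P n p) : ∃ k < 2 * n, p k ≤ Je / 2 := by
  have hn := H.hn
  by_contra! h
  have := sum_lt_sum_of_nonempty (s := range Jz) (by simp; omega) (fun i hi ↦ h i (fmera.1 hi))
  rw [H.hs] at this; simp at this; linarith
lemma ip_le (H : Sp P n p) {k : ℕ} (hk : k < 2 * n) : 1 / p k ≤ 2 / Je + TV n p ∧ |log (p k)| ≤ |log (Je / 2)| + TL n p := by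
  have hn := H.hn
  have hL := Uw
  obtain ⟨k0, h0, h0p⟩ := H.ex_k0
  obtain ⟨k1, h1, h1d⟩ := H.ex_k1
  constructor
  · have := tele (N := 2 * n - 1) (fun k ↦ 1 / p k) (show k ≤ _ by omega) (show k0 ≤ _ by omega)
    have h3 : 1 / p k0 ≤ 2 / Je := by
      rw [div_le_div_iff₀ (H.hp _ h0) hL]; linarith
    have := (abs_le.1 this).2
    unfold TV; linarith
  · have h2 := tele (N := 2 * n - 1) (fun k ↦ log (p k)) (show k ≤ _ by omega) (show k0 ≤ _ by omega)
    have h3 := tele (N := 2 * n - 1) (fun k ↦ log (p k)) (show k ≤ _ by omega) (show k1 ≤ _ by omega)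
    have h4 := log_le_log Js h0p
    have h5 := log_le_log (H.hp _ h1) h1d
    have h6 := (abs_le.1 h2).1
    have h7 := (abs_le.1 h3).2
    unfold TL
    rw [abs_le]; constructor
    · linarith [neg_abs_le Gn]
    · linarith [le_abs_self Gn]
end Sp
end
lemma lin_le {a x c D : ℝ} (hc : 0 < c) (h : x ^ 2 ≤ c * D) : a * x ≤ D / 8 + 2 * c * a ^ 2 := by
  have : 0 ≤ (x - 4 * c * a) ^ 2 := sq_nonneg _
  nlinarith
lemma Sp.gsum (P : Par) : ∃ C, 0 ≤ C ∧ ∀ n p, Sp P n p →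
    2 * Jg * ∑ j ∈ range J8, |gE P Ua - gE P Yr| ≤ N0 / 2 + C := by
  have hB := Y6
  have hL := Uw
  have hc := P.c1p
  set ε := 1 / (32 * G6 * Hg) with hε
  have ε0 : 0 < ε := by positivity
  obtain ⟨c, c0, hcc⟩ := ex_eps Eo P.hα1 ε0
  refine ⟨2 * Hg * (4 * Jg * (ε * (2 / Je) + c)) ^ 2 + 2 * Hg * (2 * Jg) ^ 2, by positivity, fun n p H ↦ ?_⟩
  obtain ⟨q1, q2⟩ := H.sq12
  have t1 := lin_le (a := 4 * Jg * (ε * (2 / Je) + c)) hc q1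
  have t2 := lin_le (a := 2 * Jg) hc q2
  have V0 := TV0 n p
  have S : ∑ j ∈ range J8, |gE P Ua - gE P Yr| ≤ 2 * (ε * (2 / Je + TV n p) + c) * TV n p + TL n p := by
    rw [TL]; conv_rhs => enter [1, 2]; rw [TV]
    rw [mul_sum, ← sum_add_distrib]
    refine sum_le_sum fun j hj ↦ ?_
    rw [fmera] at hj
    have h1 := H.hp j J5
    have h2 := H.hp Ji J5
    have e := exC (a := -log Ua) (b := -log Yr) Eo P.hα1
    rw [← oe h1, ← oe h2, ← rpe h1, ← rpe h2] at e
    have m1 : exp (No * max (-log Ua) (-log Yr)) ≤ ε * (2 / Je + TV n p) + c := by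
      refine (hcc _).trans ?_
      have : exp (max (-log Ua) (-log Yr)) ≤ 2 / Je + TV n p := by
        rcases max_choice (-log Ua) (-log Yr) with h | h <;> rw [h]
        · rw [← oe h2]; exact (H.ip_le J5).1
        · rw [← oe h1]; exact (H.ip_le J5).1
      linarith [mul_le_mul_of_nonneg_left this ε0.le]
    have m2 : |gE P Ua - gE P Yr| ≤ |p Ji ^ E6 - p j ^ E6| + |log Ua - log Yr| := by
      rw [gE, gE, show p Ji ^ E6 - log Ua - (p j ^ E6 - log Yr) = (p Ji ^ E6 - p j ^ E6) - (log Ua - log Yr) by ring]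
      exact abs_sub _ _
    have m3 := mul_le_mul_of_nonneg_left m1 (show 0 ≤ 2 * |1 / p Ji - 1 / p j| by positivity)
    linarith
  have S2 := mul_le_mul_of_nonneg_left S (show 0 ≤ 2 * Jg by linarith)
  have k : 4 * Jg * ε * TV n p ^ 2 ≤ N0 / 8 := by
    have a1 : 4 * Jg * ε * TV n p ^ 2 ≤ 4 * Jg * ε * (Hg * N0) := mul_le_mul_of_nonneg_left q1 Jh
    have a2 : 4 * Jg * ε * (Hg * N0) = (Jg / G6) * (N0 / 8) := by rw [hε]; field_simp; ring
    have a3 : Jg / G6 ≤ 1 := by rw [div_le_one Js]; linarith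
    have a4 := mul_le_mul_of_nonneg_right a3 (show 0 ≤ N0 / 8 by linarith [H.Ds0])
    linarith
  have := H.Ds0
  nlinarith
/-- dissipation from energy -/
lemma Sp.diss (P : Par) : ∃ C, 0 ≤ C ∧ ∀ n p, Sp P n p → ∀ w : ℕ → ℝ, (∀ j, |w j| ≤ 2 * Jg) →
    ∑ j ∈ range J8, Zu * (-n * (U3 Ua - U3 Yr) - w Ji) ≤ C - N0 / 2 := by
  obtain ⟨C, C0, h⟩ := Sp.gsum P
  refine ⟨C, C0, fun n p H w hw ↦ ?_⟩
  have h1 := h n p H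
  have : ∑ j ∈ range J8, Zu * (-n * (U3 Ua - U3 Yr) - w Ji) ≤
      - N0 + 2 * Jg * ∑ j ∈ range J8, |gE P Ua - gE P Yr| := by
    rw [Ds, mul_sum, mul_sum, ← sum_neg_distrib, ← sum_add_distrib]
    refine sum_le_sum fun j _ ↦ ?_
    have := neg_abs_le (Zu * w Ji)
    rw [abs_mul] at this
    have h3 := mul_le_mul_of_nonneg_left (hw Ji) (abs_nonneg Zu)
    nlinarith
  linarith
end
section
open Real
/-- primitive `∫_z^1 g` -/
noncomputable def prim (g : ℝ → ℝ) (z : ℝ) : ℝ := ∫ y in z..1, g y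
lemma ioi_uIcc {z : ℝ} (hz : 0 < z) : uIcc z 1 ⊆ Ioi Jc := fun y hy ↦ lt_of_lt_of_le (lt_min hz one_pos) hy.1
lemma prim_i {g : ℝ → ℝ} (hg : ContinuousOn g Ur) {z : ℝ} (hz : 0 < z) : IntervalIntegrable g volume z 1 :=
  (hg.mono (ioi_uIcc hz)).intervalIntegrable
lemma prim_d {g : ℝ → ℝ} (hg : ContinuousOn g Ur) {z : ℝ} (hz : 0 < z) : HasDerivAt (prim g) (-g z) z :=
  intervalIntegral.integral_hasDerivAt_left (prim_i hg hz)
    (hg.stronglyMeasurableAtFilter isOpen_Ioi z hz) (hg.continuousAt (Ioi_mem_nhds hz))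
lemma prim_le {g F Fp : ℝ → ℝ} (hg : ContinuousOn g Ur) {z : ℝ} (hz : 0 < z) (h1 : z ≤ 1)
    (hF : ∀ y, 0 < y → HasDerivAt F (Fp y) y) (hc : ContinuousOn Fp Ur) (hl : ∀ y, 0 < y → y ≤ 1 → g y ≤ Fp y) : prim g z ≤ F 1 - F z := by
  rw [← iineqsuofha (fun y hy ↦ hF y (ioi_uIcc hz hy)) (prim_i hc hz)]
  exact iinmoon h1 (prim_i hg hz) (prim_i hc hz) fun y hy ↦ hl y (hz.trans_le hy.1) hy.2
lemma le_prim {g F Fp : ℝ → ℝ} (hg : ContinuousOn g Ur) {z : ℝ} (hz : 0 < z) (h1 : z ≤ 1)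
    (hF : ∀ y, 0 < y → HasDerivAt F (Fp y) y) (hc : ContinuousOn Fp Ur) (hl : ∀ y, 0 < y → y ≤ 1 → Fp y ≤ g y) : F 1 - F z ≤ prim g z := by
  rw [← iineqsuofha (fun y hy ↦ hF y (ioi_uIcc hz hy)) (prim_i hc hz)]
  exact iinmoon h1 (prim_i hc hz) (prim_i hg hz) fun y hy ↦ hl y (hz.trans_le hy.1) hy.2
lemma prim_gt {g : ℝ → ℝ} (hg : ContinuousOn g Ur) {z a : ℝ} (h1 : 1 ≤ z) (hl : ∀ y, 1 ≤ y → y ≤ z → a ≤ g y) : prim g z ≤ a * (1 - z) := by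
  have : ∫ y in Y1..z, a ≤ ∫ y in Y1..z, g y := iinmoon h1 J1 (prim_i hg Js).symm fun y hy ↦ hl y hy.1 hy.2
  rw [prim, intervalIntegral.integral_symm]
  simp at this; linarith
lemma prim_gt' {g : ℝ → ℝ} (hg : ContinuousOn g Ur) {z a : ℝ} (h1 : 1 ≤ z) (hl : ∀ y, 1 ≤ y → y ≤ z → g y ≤ a) : a * (1 - z) ≤ prim g z := by
  have : ∫ y in Y1..z, g y ≤ ∫ y in Y1..z, a := iinmoon h1 (prim_i hg Js).symm J1 fun y hy ↦ hl y hy.1 hy.2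
  rw [prim, intervalIntegral.integral_symm]
  simp at this; linarith
variable (P : Par)
lemma gEc : ContinuousOn Us Ur := by
  refine ContinuousOn.sub (fun z hz ↦ (continuousAt_rpow_const _ _ (N9 (ne_of_gt hz))).continuousWithinAt) Nq
lemma prc : ContinuousOn (U3) Ur :=
  continuousOn_const.mul (fun z hz ↦ (continuousAt_rpow_const _ _ (N9 (ne_of_gt hz))).continuousWithinAt)
lemma gE_bd {z : ℝ} (hz : 0 < z) (h1 : z ≤ 1) : z⁻¹ ≤ gE P z ∧ gE P z ≤ 2 * (z ^ 2)⁻¹ := by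
  have h2 := Eo; have h3 := P.hα1
  have l1 := log_nonpos hz.le h1
  have l2 : -log z ≤ z⁻¹ := by have := log_le_sub_one_of_pos (inv_pos.2 hz); rw [log_inv] at this; linarith
  have l3 : z⁻¹ ≤ (z ^ 2)⁻¹ := inv_anti₀ Jh (by nlinarith)
  have r1 := rpow_le_rpow_of_exponent_ge hz h1 (show -Yw ≤ -1 by linarith)
  have r2 := rpow_le_rpow_of_exponent_ge hz h1 (show -2 ≤ -Yw by linarith)
  rw [rpow_neg_one] at r1
  rw [rpow_neg hz.le 2, rpow_two] at r2
  unfold gE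
  constructor <;> linarith
lemma gE_big {z : ℝ} (h1 : 1 ≤ z) : -log z ≤ gE P z ∧ gE P z ≤ 1 := by
  have h2 := Eo; have h3 := P.hα1
  have l1 := log_nonneg h1
  have r1 : z ^ E6 ≤ 1 := rpow_le_one_of_one_le_of_nonpos h1 Js
  have r2 : 0 ≤ z ^ E6 := rpow_nonneg Js _
  unfold gE
  constructor <;> linarith
lemma ΦE_log {z : ℝ} (hz : 0 < z) (h1 : z ≤ 1) : -log z ≤ prim Us z := by
  have := le_prim Go hz h1 (F := log) (Fp := fun y ↦ y⁻¹) (fun y hy ↦ hasDerivAt_log hy.ne')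
    (fun y hy ↦ (continuousAt_inv₀ (ne_of_gt hy)).continuousWithinAt) (fun y h0 h1 ↦ (gE_bd P h0 h1).1)
  simpa using this
lemma ΦE_lo {z : ℝ} (hz : 0 < z) : 1 - z ≤ prim Us z := by
  rcases le_total z 1 with h1 | h1
  · refine le_trans ?_ (ΦE_log P hz h1)
    linarith [log_le_sub_one_of_pos hz]
  · have := prim_gt' Go h1 (a := 1) (fun y h _ ↦ (gE_big P h).2)
    linarith
lemma ΦE_up {z : ℝ} (hz : 0 < z) : prim Us z ≤ 2 / z + z * |log z| := by
  rcases le_total z 1 with h1 | h1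
  · have := prim_le Go hz h1 (F := fun y ↦ -(2 * y⁻¹)) (Fp := fun y ↦ 2 * (y ^ 2)⁻¹) (fun y hy ↦ ((hasDerivAt_inv hy.ne').const_mul 2).neg.congr_deriv (by ring))
      (fun y (hy : 0 < y) ↦ (ContinuousAt.mul continuousAt_const ((continuousAt_id.pow 2).inv₀ (by simp; exact hy.ne'))).continuousWithinAt) (fun y h0 h1 ↦ (gE_bd P h0 h1).2)
    have h2 : 0 ≤ z * |log z| := by positivity
    rw [div_eq_mul_inv]; norm_num at this; linarith
  · have := prim_gt Go h1 (a := -log z) (fun y h ho ↦ (gE_big P h).1.trans' (neg_le_neg (log_le_log Js ho)))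
    have h2 := log_nonneg h1
    have h3 : 0 ≤ 2 / z := by positivity
    rw [abs_of_nonneg h2]; nlinarith
lemma abel (g V : ℕ → ℝ) (N : ℕ) : ∑ k ∈ frange (N + 1), g k * (V Jf - V k) =
    g N * V (N + 1) - g 0 * V 0 - ∑ j ∈ frange N, (g Ji - g j) * V Ji := by
  induction N with
  | zero => simp; ring
  | succ N ih => rw [fsurasu, ih, fsurasu]; ring
def pp (n : ℕ) (X : ℕ → ℝ) (k : ℕ) : ℝ := n * (X Jf - X k)
lemma abel0 (g V : ℕ → ℝ) {n : ℕ} (hn : 1 ≤ n) (h0 : V 0 = 0) (h2 : V Jz = 0) : ∑k g k * (V Jf - V k) =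
    - ∑ j ∈ frange J8, (g Ji - g j) * V Ji := by
  have := abel g V J8
  rw [show 2 * n - 1 + 1 = 2 * n by omega, h0, h2] at this
  rw [this]; ring
noncomputable def En (g : ℝ → ℝ) (n : ℕ) (X : ℕ → ℝ) : ℝ := Jl⁻¹ * ∑k prim g (Kk X k)
lemma En_d {g : ℝ → ℝ} (hg : ContinuousOn g Ur) {n : ℕ} (hn : 1 ≤ n) {X : ℝ → ℕ → ℝ} {V : ℕ → ℝ} {t : ℝ}
    (hX : ∀ j, HasDerivAt Gq (V j) t) (h0 : V 0 = 0) (h2 : V Jz = 0) (hp : ∀ k < 2 * n, 0 < Kk Zj k) :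
    HasDerivAt (fun t ↦ En g n Zj) (∑ j ∈ frange J8, (g (Kk Zj Ji) - g (Kk Zj j)) * V Ji) t := by
  have h : HasDerivAt (fun t ↦ ∑k prim g (Kk Zj k)) (∑k -g (Kk Zj k) * (n * (V Jf - V k))) t :=
    HasDerivAt.fun_sum fun k hk ↦ HasDerivAt.comp t (prim_d hg (hp k Ye)) (((hX Jf).sub (hX k)).const_mul Jl)
  refine (h.const_mul Jl⁻¹).congr_deriv ?_
  have := abel0 (fun k ↦ g (Kk Zj k)) V hn h0 h2
  have hnp : Jl ≠ 0 := by positivity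
  rw [eq_neg_iff_add_eq_zero, add_comm, ← eq_neg_iff_add_eq_zero] at this
  rw [this, fmulsum, ← Finset.sum_neg_distrib]
  refine fsuco rfl fun k _ ↦ ?_
  field_simp
lemma En_c {g : ℝ → ℝ} (hg : ContinuousOn g Ur) {n : ℕ} {X : ℝ → ℕ → ℝ} {s : Set ℝ}
    (hX : ∀ j, ContinuousOn Gq s) (hp : ∀ t ∈ s, ∀ k < 2 * n, 0 < Kk Zj k) : ContinuousOn (fun t ↦ En g n Zj) s := by
  refine continuousOn_const.mul (continuousOn_finsetSum _ fun k hk t ht ↦ ?_)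
  exact ContinuousAt.comp_continuousWithinAt (f := fun t ↦ Kk Zj k) (prim_d hg (hp t ht k Ye)).continuousAt
    ((continuousOn_const.mul ((hX Jf).sub (hX k))) t ht)
/-- Lipschitz with respect to the sup norm -/
def Lp (f : Nr → ℝ) : Prop := ∃ C, ∀ y z d, (∀ i, |y i - z i| ≤ d) → |f y - f z| ≤ C * d
def BL (f : Nr → ℝ) : Prop := Lp f ∧ ∃ M, ∀ y, |f y| ≤ M
lemma Lp.at (j : ℕ) : Lp (fun y ↦ y j) := ⟨1, fun y z d h ↦ by rw [one_mul]; exact h j⟩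
lemma Lp.comp {f} {φ : ℝ → ℝ} (hf : Lp f) {K : ℝ} (hK : 0 ≤ K) (hφ : ∀ a b : ℝ, |φ a - φ b| ≤ K * |a - b|) : Lp (fun y ↦ φ (f y)) := by
  obtain ⟨C, h⟩ := hf
  exact ⟨K * C, fun y z d hd ↦ (hφ _ _).trans (by rw [mul_assoc]; exact mul_le_mul_of_nonneg_left (h y z d hd) hK)⟩
lemma Lp.sub {f g} (hf : Lp f) (hg : Lp g) : Lp (fun y ↦ f y - g y) := by
  obtain ⟨C, h⟩ := hf; obtain ⟨Cp, ho⟩ := hg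
  refine ⟨C + Cp, fun y z d hd ↦ ?_⟩
  rw [show f y - g y - (f z - g z) = (f y - f z) - (g y - g z) by ring]
  linarith [abs_sub (f y - f z) (g y - g z), h y z d hd, ho y z d hd]
lemma Lp.smul {f} (c : ℝ) (hf : Lp f) : Lp (fun y ↦ c * f y) :=
  hf.comp (abs_nonneg c) (fun a b ↦ by rw [← mul_sub, abs_mul])
lemma Lp.max {f g} (hf : Lp f) (hg : Lp g) : Lp (fun y ↦ max (f y) (g y)) := by
  obtain ⟨C, h⟩ := hf; obtain ⟨Cp, ho⟩ := hg
  refine ⟨Max.max C Cp, fun y z d hd ↦ (abs_max_sub_max_le_max _ _ _ _).trans ?_⟩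
  have d0 : 0 ≤ d := ☆.trans (hd 0)
  exact max_le ((h y z d hd).trans (mul_le_mul_of_nonneg_right (le_max_left _ _) d0)) ((ho y z d hd).trans (mul_le_mul_of_nonneg_right Ku d0))
lemma BL.const (c : ℝ) : BL (fun _ ↦ c) := ⟨⟨0, fun y z d _ ↦ by simp⟩, |c|, fun _ ↦ le_rfl⟩
lemma BL.sub {f g} (hf : BL f) (hg : BL g) : BL (fun y ↦ f y - g y) := by
  refine ⟨hf.1.sub hg.1, ?_⟩
  obtain ⟨M, h⟩ := hf.2; obtain ⟨Mp, ho⟩ := hg.2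
  exact ⟨M + Mp, fun y ↦ ☁.trans (add_le_add (h y) (ho y))⟩
lemma BL.mul {f g} (hf : BL f) (hg : BL g) : BL (fun y ↦ f y * g y) := by
  obtain ⟨⟨C, h⟩, M, hM⟩ := hf; obtain ⟨⟨Cp, ho⟩, Mp, hMp⟩ := hg
  refine ⟨⟨M * Cp + Mp * C, fun y z d hd ↦ ?_⟩, M * Mp, fun y ↦ ?_⟩
  · rw [show f y * g y - f z * g z = f y * (g y - g z) + g z * (f y - f z) by ring]
    refine ☾.trans ?_
    rw [abs_mul, abs_mul, add_mul, mul_assoc, mul_assoc]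
    exact add_le_add (mul_le_mul (hM y) (ho y z d hd) Jy (☆.trans (hM y)))
      (mul_le_mul (hMp z) (h y z d hd) Jy (☆.trans (hMp z)))
  · rw [abs_mul]; exact mul_le_mul (hM y) (hMp y) Jy (☆.trans (hM y))
lemma Lp.bl {f} {φ : ℝ → ℝ} (hf : Lp f) {K M : ℝ} (hK : 0 ≤ K) (hφ : ∀ a b : ℝ, |φ a - φ b| ≤ K * |a - b|) (hM : ∀ a, |φ a| ≤ M) : BL (fun y ↦ φ (f y)) :=
  ⟨hf.comp hK hφ, M, fun _ ↦ hM _⟩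
open BoundedContinuousFunction in
theorem ode {F : ℕ → Nr → ℝ} {N : ℕ} (hF : ∀ j, BL (F j)) (hN : ∀ j y, N ≤ j → F j y = 0)
    (y0 : ℕ → ℝ) {M0 : ℝ} (h0 : ∀ j, |y0 j| ≤ M0) {T : ℝ} (hT : 0 ≤ T) :
    ∃ y : ℝ → ℕ → ℝ, y 0 = y0 ∧ (∀ j, Continuous fun t ↦ y t j) ∧ (∀ t, ∃ s ∈ Icc 0 T, y t = y s) ∧
      ∀ j, ∀ t ∈ Ioo 0 T, HasDerivAt (fun t ↦ y t j) (F j (y t)) t := by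
  choose C hC using fun j ↦ (hF j).1
  choose M hM using fun j ↦ (hF j).2
  have M0 : ∀ j, 0 ≤ M j := fun j ↦ ☆.trans (hM j y0)
  have C0 : ∀ j, 0 ≤ C j := fun j ↦ by simpa using ☆.trans (hC j y0 y0 1 (fun i ↦ by simp))
  set Mb := ∑ j ∈ frange N, M j with hMb
  set Cb := ∑ j ∈ frange N, C j with hCb
  have Mb0 : 0 ≤ Mb := fsuno fun j _ ↦ M0 j
  have Cb0 : 0 ≤ Cb := fsuno fun j _ ↦ C0 j
  have bd : ∀ j y, |F j y| ≤ Mb := fun j y ↦ by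
    rcases le_or_gt N j with h | h
    · rw [hN j y h, abs_zero]; exact Mb0
    · exact (hM j y).trans (fsilesu (f := M) (fun j _ ↦ M0 j) (fmera.2 h))
  have lp : ∀ j y z d, (∀ i, |y i - z i| ≤ d) → |F j y - F j z| ≤ Cb * d := fun j y z d hd ↦ by
    have d0 : 0 ≤ d := ☆.trans (hd 0)
    rcases le_or_gt N j with h | h
    · rw [hN j y h, hN j z h, sub_self, abs_zero]; positivity
    · exact (hC j y z d hd).trans (mul_le_mul_of_nonneg_right (fsilesu (f := C) (fun j _ ↦ C0 j) (fmera.2 h)) d0)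
  let Fb : (ℕ →ᵇ ℝ) → (ℕ →ᵇ ℝ) := fun y ↦ ofNormedAddCommGroupDiscrete (fun j ↦ F j y) Mb (fun j ↦ bd j y)
  let x0 : ℕ →ᵇ ℝ := ofNormedAddCommGroupDiscrete y0 _ h0
  have hl : LipschitzWith ⟨Cb, Cb0⟩ Fb := LipschitzWith.of_dist_le_mul fun y z ↦ by
    refine (dist_le (mul_nonneg Cb0 dist_nonneg)).2 ?_
    intro j; exact lp j y z _ (fun i ↦ dist_coe_le_dist (f := y) (g := z) i)
  have pl := IsPicardLindelof.of_time_independent (f := Fb) (t₀ := (⟨0, le_rfl, hT⟩ : Icc 0 T)) (x₀ := x0) (a := ⟨Mb * T, by positivity⟩) (r := 0) (L := ⟨Mb, Mb0⟩)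
    (fun x _ ↦ (norm_le Mb0).2 fun j ↦ bd j x) (hl.lipschitzOnWith) (by
      change Mb * max (T - 0) (0 - 0) ≤ Mb * T - 0
      simp [hT])
  obtain ⟨y, hy0, hy⟩ := pl.exists_eq_forall_mem_Icc_hasDerivWithinAt₀
  have hy0p : y 0 = x0 := hy0
  have ev : ∀ j, ∀ t ∈ Icc 0 T, HasDerivWithinAt (fun t ↦ y t j) (F j (y t)) (Nh T) t := fun j t ht ↦
    ((evalCLM ℝ (β := ℝ) j).hasFDerivAt.comp_hasDerivWithinAt t (hy t ht))
  refine ⟨fun t ↦ y (projIcc 0 T hT t), ?_, fun j ↦ ?_, fun t ↦ ⟨projIcc 0 T hT t, (projIcc 0 T hT t).2, by simp⟩, fun j t ht ↦ ?_⟩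
  · simp [hy0p]; rfl
  · have : ContinuousOn (fun t ↦ y t j) (Nh T) := fun t ht ↦ (ev j t ht).continuousWithinAt
    exact (continuousOn_iff_continuous_domRestrict.1 this).comp continuous_projIcc
  · have h1 := (ev j t (Ioo_subset_Icc_self ht)).hasDerivAt (Icc_mem_nhds ht.1 ht.2)
    beta_reduce
    rw [projIcc_of_mem hT (Ioo_subset_Icc_self ht)]
    refine h1.congr_of_eventuallyEq ?_
    filter_upwards [Icc_mem_nhds ht.1 ht.2] with s hs
    rw [projIcc_of_mem hT hs]
/-- barrier -/
lemma barrier {y yp : ℝ → ℝ} {T : ℝ} (hc : Continuous y) (hd : ∀ t ∈ Ioo 0 T, HasDerivAt y (yp t) t) (h0 : 0 ≤ y 0)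
    (hb : ∀ t ∈ Ioo 0 T, y t ≤ 0 → 0 ≤ yp t) {t : ℝ} (ht : t ∈ Nh T) : 0 ≤ y t := by
  by_contra! hn
  have cl : IsClosed ({s | 0 ≤ y s} ∩ Icc 0 t) := (isClosed_le continuous_const hc).inter isClosed_Icc
  have cpt : IsCompact ({s | 0 ≤ y s} ∩ Icc 0 t) := isCompact_Icc.of_isClosed_subset cl inter_subset_right
  obtain ⟨s, hs, hm⟩ := cpt.exists_isGreatest ⟨0, h0, left_mem_Icc.2 ht.1⟩
  have neg : ∀ u ∈ Ioc s t, y u < 0 := fun u hu ↦ by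
    by_contra! h
    exact absurd (hm ⟨h, hs.2.1.trans hu.1.le, hu.2⟩) (not_le.2 hu.1)
  have mono : MonotoneOn y (Icc s t) := by
    refine monotoneOn_of_deriv_nonneg (convex_Icc _ _) hc.continuousOn ?_ ?_ <;> rw [interior_Icc] <;> intro u hu <;>
      have hup : u ∈ Ioo 0 T := ⟨hs.2.1.trans_lt hu.1, hu.2.trans_le ht.2⟩
    · exact (hd u hup).differentiableAt.differentiableWithinAt
    · rw [(hd u hup).deriv]; exact hb u hup (neg u ⟨hu.1, hu.2.le⟩).le
  have := mono (left_mem_Icc.2 hs.2.2) (right_mem_Icc.2 hs.2.2) hs.2.2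
  linarith [show 0 ≤ y s from hs.1]
def cl (L x : ℝ) : ℝ := max 0 (min L x)
lemma cl_mem {L : ℝ} (hL : 0 ≤ L) (x : ℝ) : cl L x ∈ Icc 0 L := ⟨le_max_left _ _, max_le hL (min_le_left _ _)⟩
lemma cl_of {L x : ℝ} (h : x ∈ Nh L) : cl L x = x := by rw [cl, min_eq_right h.2, max_eq_right h.1]
lemma cl_lip (L a b : ℝ) : |cl L a - cl L b| ≤ |a - b| := by
  have h1 := abs_max_sub_max_le_abs (min L a) (min L b) 0
  have h2 := abs_min_sub_min_le_max L a L b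
  rw [max_comm _ Jc, max_comm _ Jc] at h1
  refine h1.trans (h2.trans ?_)
  simp
noncomputable def kn (P : Par) (n : ℕ) (y : ℝ) : ℝ := max (-Jl) (min n (Uv y))
noncomputable def bn (P : Par) (n : ℕ) (x : ℝ) : ℝ := Zq 0 + ∫y kn P n y
noncomputable def en (P : Par) (n : ℕ) : ℝ := ∫ y, |Uv y - kn P n y|
variable (P : Par) (n : ℕ)
lemma kn_le (y : ℝ) : |kn P n y| ≤ |Uv y| ∧ |kn P n y| ≤ n := by
  have hn : Jc ≤ n := n.cast_nonneg
  unfold kn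
  rcases le_total Jl (Uv y) with h | h
  · rw [min_eq_left h, max_eq_right Js, abs_of_nonneg hn]; exact ⟨h.trans (le_abs_self _), le_rfl⟩
  · rw [min_eq_right h]
    rcases le_total (-Jl) (Uv y) with ho | ho
    · rw [max_eq_right ho]; exact ⟨le_rfl, abs_le.2 ⟨ho, h⟩⟩
    · rw [max_eq_left ho, abs_neg, abs_of_nonneg hn]; exact ⟨by linarith [neg_abs_le (Uv y)], le_rfl⟩
lemma kn_m : AEStronglyMeasurable (kn P n) volume := by
  have : Continuous fun z : ℝ ↦ max (-Jl) (min n z) := by fun_prop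
  exact this.comp_aestronglyMeasurable P.hk.aestronglyMeasurable
lemma kn_i : Integrable (kn P n) := P.hk.mono (kn_m P n) (Eventually.of_forall fun y ↦ (kn_le P n y).1)
lemma bn_B (x : ℝ) : |Ea x| ≤ Jg := by
  refine ☾.trans (le_trans ?_ P.hbB)
  refine add_le_add le_rfl ?_
  rw [← rnoeqab]
  refine (inoinleinnouI).trans ?_
  refine (integral_mono (kn_i P n).norm.restrict P.hk.norm.restrict fun y ↦ (kn_le P n y).1).trans ?_
  exact setIntegral_le_integral P.hk.norm (Eventually.of_forall fun y ↦ norm_nonneg _)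
lemma bn_lip (x y : ℝ) : |Ea x - Ea y| ≤ n * |x - y| := by
  have : bn P n x - Ea y = ∫ z in y..x, kn P n z := by
    rw [bn, bn, ← iinadadin (a := 0) (b := y) (c := x) (kn_i P n).intervalIntegrable (kn_i P n).intervalIntegrable]; ring
  rw [this, ← rnoeqab]
  exact inoinleofnoleco fun z _ ↦ (kn_le P n z).2
lemma bn_b (x : ℝ) : |Ea x - Zq x| ≤ en P n := by
  have : bn P n x - Zq x = -∫ z in Jc..x, (Uv z - kn P n z) := by
    rw [bn, P.hb x, iinsu P.hk.intervalIntegrable (kn_i P n).intervalIntegrable]; ring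
  rw [this, abs_neg, ← rnoeqab]
  refine (inoinleinnouI).trans ?_
  exact setIntegral_le_integral (P.hk.sub (kn_i P n)).norm (Eventually.of_forall fun y ↦ norm_nonneg _)
lemma en_0 : 0 ≤ en P n := integral_nonneg fun _ ↦ abs_nonneg _
lemma en_lim : Tendsto (en P) atTop Zx := by
  have := tendsto_integral_of_dominated_convergence (μ := volume) (F := fun (n : ℕ) y ↦ |Uv y - kn P n y|) (f := fun _ ↦ 0) (fun y ↦ 2 * |Uv y|)
    (fun n ↦ (P.hk.sub (kn_i P n)).norm.aestronglyMeasurable) (P.hk.norm.const_mul 2)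
    (fun n ↦ Eventually.of_forall fun y ↦ by
      rw [rnoeqab, abs_abs]; linarith [abs_sub (Uv y) (kn P n y), (kn_le P n y).1])
    (Eventually.of_forall fun y ↦ by
      obtain ⟨N, hN⟩ := exists_nat_ge |Uv y|
      refine tendsto_const_nhds.congr' ?_
      filter_upwards [eventually_ge_atTop N] with n hn
      have h1 : |Uv y| ≤ n := hN.trans (by exact_mod_cast hn)
      rw [abs_le] at h1
      rw [kn, min_eq_right h1.2, max_eq_right h1.1, sub_self, abs_zero])
  rw [integral_zero] at this; exact this
noncomputable def Vn (p x r : ℕ → ℝ) (j : ℕ) : ℝ :=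
  if 0 < j ∧ j < 2 * n then -n * (U3 Yr - U3 (p J0)) - (Ea N5 + r j * Jm N5) else 0
noncomputable def An (p x r : ℕ → ℝ) (j : ℕ) : ℝ :=
  if 0 < j ∧ j < 2 * n then (max (p J0) Yr)⁻¹ *
    (max (Jm N5) 0 * (r j * (1 - r J0)) - max (-Jm N5) 0 * (r J0 * (1 - r j))) else 0
lemma VA_congr {p x r pd xp rd : ℕ → ℝ} (hp : ∀ k < 2 * n, p k = pd k) (hx : ∀ k < 2 * n, x k = xp k) (hr : ∀ k < 2 * n, r k = rd k) :
    Vn P n p x r = Vn P n pd xp rd ∧ An P n p x r = An P n pd xp rd := by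
  constructor <;> funext j <;> [unfold Vn; unfold An] <;> split_ifs with h
  · rw [hp j h.2, hp J0 J5, hx j h.2, hr j h.2]
  · rfl
  · rw [hp j h.2, hp J0 J5, hx j h.2, hr j h.2, hr J0 J5]
  · rfl
lemma dlip {g gp : ℝ → ℝ} {c K : ℝ} (hd : ∀ z, c ≤ z → HasDerivAt g (gp z) z) (hK : ∀ z, c ≤ z → |gp z| ≤ K) (a b : ℝ) :
    |g (max a c) - g (max b c)| ≤ K * |a - b| := by
  have h1 := (convex_Ici c).norm_image_sub_le_of_norm_hasDerivWithin_le (fun z hz ↦ (hd z hz).hasDerivWithinAt) hK (le_max_right b c) (le_max_right a c)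
  have h2 := abs_max_sub_max_le_abs a b c
  exact h1.trans (mul_le_mul_of_nonneg_left h2 (☆.trans (hK c le_rfl)))
lemma pr_lip {c : ℝ} (hc : 0 < c) : ∃ K, 0 ≤ K ∧ (∀ a b, |U3 (max a c) - U3 (max b c)| ≤ K * |a - b|) ∧ ∀ a, |U3 (max a c)| ≤ pr P c := by
  have hl := Gy; have ha := Eo
  refine ⟨Jv * (J3 * c ^ Hi), by positivity, dlip (gp := fun z ↦ Jv * (-J3 * z ^ Hi)) (fun z hz ↦ ?_) (fun z hz ↦ ?_), fun a ↦ ?_⟩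
  · exact (hasDerivAt_rpow_const (N9 Js)).const_mul _
  · have : z ^ Hi ≤ c ^ Hi := rpow_le_rpow_of_nonpos hc hz Js
    have h0 : 0 ≤ z ^ Hi := rpow_nonneg Js _
    rw [abs_mul, abs_mul, abs_neg, abs_of_pos hl, abs_of_pos ha, abs_of_nonneg h0]
    gcongr
  · have : max a c ^ Jk ≤ c ^ Jk := rpow_le_rpow_of_nonpos hc Ku Js
    have h0 : 0 ≤ max a c ^ Jk := rpow_nonneg (hc.le.trans Ku) _
    unfold pr
    rw [abs_mul, abs_of_pos hl, abs_of_nonneg h0]; gcongr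
lemma inv_lip {c : ℝ} (hc : 0 < c) : (∀ a b, |(max a c)⁻¹ - (max b c)⁻¹| ≤ (c ^ 2)⁻¹ * |a - b|) ∧ ∀ a, |(max a c)⁻¹| ≤ c⁻¹ := by
  refine ⟨dlip (g := fun z ↦ z⁻¹) (gp := fun z ↦ -(z ^ 2)⁻¹) (fun z hz ↦ hasDerivAt_inv Js) (fun z hz ↦ ?_), fun a ↦ ?_⟩
  · rw [abs_neg, abs_of_nonneg Jh]; exact inv_anti₀ Jh (by gcongr)
  · have := le_max_right a c
    rw [abs_of_nonneg (inv_nonneg.2 Js)]; exact inv_anti₀ hc this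
lemma W_lip (x y : ℝ) : |Jm x - Jm y| ≤ Jg * |x - y| :=
  convex_univ.norm_image_sub_le_of_norm_hasDerivWithin_le (fun z _ ↦ (P.hW z).hasDerivWithinAt) (fun z _ ↦ P.hW'B z) (mem_univ y) (mem_univ x)
noncomputable def Fr (P : Par) (n : ℕ) (p x r : ℕ → ℝ) (k : ℕ) : ℝ := if k < 2 * n then n * (An P n p x r Jf - An P n p x r k) else 0
noncomputable def pc (n : ℕ) (c : ℝ) (X : ℕ → ℝ) (k : ℕ) : ℝ := max (Kk X k) c
variable {P : Par} {n : ℕ}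
section
variable {c : ℝ} {X r : Nr → ℕ → ℝ}
lemma bl_r (hr : ∀ j, Lp fun y ↦ r y j) (j : ℕ) : BL fun y ↦ cl 1 (r y j) :=
  (hr j).bl (K := 1) (M := 1) zero_le_one (fun a b ↦ by rw [one_mul]; exact cl_lip 1 a b)
    fun a ↦ by have := cl_mem zero_le_one a; rw [abs_of_nonneg this.1]; exact this.2
lemma bl_W (hX : ∀ j, Lp fun y ↦ X y j) (j : ℕ) : BL fun y ↦ Jm (cl Je (X y j)) :=
  (hX j).bl (φ := fun z ↦ Jm (cl Je z)) Y6 (fun a b ↦ (W_lip P _ _).trans (mul_le_mul_of_nonneg_left (cl_lip _ a b) Y6))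
    fun a ↦ Gz _ (cl_mem P.hL.le a)
lemma bl_max {f : Nr → ℝ} (hf : BL f) : BL fun y ↦ max (f y) 0 := by
  refine ⟨hf.1.max (BL.const 0).1, ?_⟩
  obtain ⟨M, h⟩ := hf.2
  refine ⟨M, fun y ↦ ?_⟩
  rw [abs_of_nonneg Ku]
  exact max_le ((le_abs_self _).trans (h y)) (☆.trans (h y))
lemma lp_p (hX : ∀ j, Lp fun y ↦ X y j) (j : ℕ) : Lp fun y ↦ Kk (X y) j := ((hX Ji).sub (hX j)).smul n
lemma bl_V (hc : 0 < c) (hX : ∀ j, Lp fun y ↦ X y j) (hr : ∀ j, Lp fun y ↦ r y j) (j : ℕ) :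
    BL fun y ↦ Vn P n Kw Uj Uk j := by
  obtain ⟨K, hK, h1, h2⟩ := pr_lip P hc
  have hp : ∀ j, BL fun y ↦ U3 (pc n c (X y) j) := fun j ↦ (lp_p hX j).bl (φ := fun z ↦ U3 (max z c)) hK h1 h2
  have hb : BL fun y ↦ Ea (cl Je (X y j)) := (hX j).bl (φ := fun z ↦ Ea (cl Je z)) n.cast_nonneg
    (fun a b ↦ (bn_lip P n _ _).trans (mul_le_mul_of_nonneg_left (cl_lip _ a b) n.cast_nonneg)) fun a ↦ bn_B P n _
  unfold Vn
  split_ifs with h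
  · have := (((BL.const (-n)).mul ((hp j).sub (hp J0))).sub hb).sub ((bl_r hr j).mul (bl_W (P := P) hX j))
    simpa only [sub_sub] using this
  · exact BL.const 0
lemma bl_A (hc : 0 < c) (hX : ∀ j, Lp fun y ↦ X y j) (hr : ∀ j, Lp fun y ↦ r y j) (j : ℕ) :
    BL fun y ↦ An P n Kw Uj Uk j := by
  unfold An
  split_ifs with h
  · have h1 : BL fun y ↦ (max (pc n c (X y) J0) (pc n c (X y) j))⁻¹ := by
      have := ((lp_p (n := n) hX J0).max (lp_p (n := n) hX j)).bl (φ := fun z ↦ (max z c)⁻¹) Jh (inv_lip hc).1 (inv_lip hc).2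
      unfold pc
      simpa only [max_max_max_comm _ c _ c, max_self] using this
    have hW := bl_W (P := P) hX j
    have hWp : BL fun y ↦ -Jm (cl Je (X y j)) := by simpa using (BL.const 0).sub hW
    have o := BL.const 1
    have a := bl_r hr j
    have b := bl_r hr J0
    exact h1.mul (((bl_max hW).mul (a.mul (o.sub b))).sub ((bl_max hWp).mul (b.mul (o.sub a))))
  · exact BL.const 0
lemma bl_F (hc : 0 < c) (hX : ∀ j, Lp fun y ↦ X y j) (hr : ∀ j, Lp fun y ↦ r y j) (j : ℕ) :
    BL fun y ↦ Fr P n Kw Uj Uk j := by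
  unfold Fr
  split_ifs with h
  · exact (BL.const n).mul ((bl_A hc hX hr Ji).sub (bl_A hc hX hr j))
  · exact BL.const 0
end
lemma pre {c : ℝ} (hc : 0 < c) (x0 r0 : ℕ → ℝ) {M : ℝ} (hx0 : ∀ j, |x0 j| ≤ M) (hr0 : ∀ j, |r0 j| ≤ M) :
    ∃ X r : ℝ → ℕ → ℝ, X 0 = x0 ∧ r 0 = r0 ∧ (∀ j, Continuous fun t ↦ X t j) ∧ (∀ j, Continuous fun t ↦ Ka j) ∧
      (∀ t, ∃ s ∈ Icc 0 Ja, X t = X s ∧ r t = r s) ∧ ∀ t ∈ Ioo 0 Ja,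
      (∀ j, HasDerivAt Gq (Vn P n (pc n c Zj) Ko Nd j) t) ∧
      ∀ j, HasDerivAt (fun t ↦ Ka j) (Fr P n (pc n c Zj) Ko Nd j) t := by
  let X : Nr → ℕ → ℝ := fun y j ↦ y (2 * j)
  let r : Nr → ℕ → ℝ := fun y j ↦ y (2 * j + 1)
  have hX : ∀ j, Lp fun y ↦ X y j := fun j ↦ Lp.at _
  have hr : ∀ j, Lp fun y ↦ r y j := fun j ↦ Lp.at _
  let F : ℕ → Nr → ℝ := fun i y ↦ if i % 2 = 0 then Vn P n Kw Uj Uk (i / 2)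
    else Fr P n Kw Uj Uk (i / 2)
  have hF : ∀ i, BL (F i) := fun i ↦ by
    simp only [F]; split_ifs
    · exact bl_V hc hX hr _
    · exact bl_F hc hX hr _
  have hN : ∀ i y, 4 * n + 2 ≤ i → F i y = 0 := fun i y hi ↦ by
    simp only [F, Vn, Fr]
    rw [if_neg (by omega : ¬(0 < i / 2 ∧ i / 2 < 2 * n)), if_neg (by omega : ¬(i / 2 < 2 * n)), ite_self]
  obtain ⟨y, h1, h2, h3, h4⟩ := ode hF hN (fun i ↦ if i % 2 = 0 then x0 (i / 2) else r0 (i / 2)) (M0 := M)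
    (fun i ↦ by split_ifs <;> [exact hx0 _; exact hr0 _]) Zk
  have d1 : ∀ j, (2 * j + 1) / 2 = j := fun j ↦ by omega
  refine ⟨fun t ↦ X (y t), fun t ↦ r (y t), ?_, ?_, fun j ↦ h2 _, fun j ↦ h2 _, fun t ↦ ?_, fun t ht ↦ ⟨fun j ↦ ?_, fun j ↦ ?_⟩⟩
  · funext j; simp [X, h1]
  · funext j; simp [r, h1, d1]
  · obtain ⟨s, hs, e⟩ := h3 t; exact ⟨s, hs, congrArg X e, congrArg r e⟩
  · have := h4 (2 * j) t ht
    simpa [F] using this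
  · have := h4 (2 * j + 1) t ht
    simpa [F, d1] using this
lemma grow {f fp : ℝ → ℝ} {a b C : ℝ} (hab : a ≤ b) (hc : ContinuousOn f (Icc a b)) (hd : ∀ t ∈ Ioo a b, HasDerivAt f (fp t) t)
    (hC : ∀ t ∈ Ioo a b, fp t ≤ C) : f b ≤ f a + C * (b - a) := by
  have := (convex_Icc a b).image_sub_le_mul_sub_of_deriv_le (f := f) (C := C) hc
    (by rw [interior_Icc]; exact fun t ht ↦ (hd t ht).differentiableAt.differentiableWithinAt)
    (by rw [interior_Icc]; exact fun t ht ↦ by rw [(hd t ht).deriv]; exact hC t ht) a (left_mem_Icc.2 hab) b (right_mem_Icc.2 hab) hab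
  linarith
lemma const_of {f : ℝ → ℝ} {T : ℝ} (hc : Continuous f) (hd : ∀ t ∈ Ioo 0 T, HasDerivAt f 0 t) {t : ℝ} (ht : t ∈ Nh T) : f t = f 0 := by
  have h1 := grow ht.1 hc.continuousOn (fun s hs ↦ hd s ⟨hs.1, hs.2.trans_le ht.2⟩) (fun _ _ ↦ le_rfl)
  have h2 := grow ht.1 hc.neg.continuousOn (fun s hs ↦ (hd s ⟨hs.1, hs.2.trans_le ht.2⟩).neg) (fun _ _ ↦ neg_zero.le)
  simp at h1 h2; linarith
noncomputable def Par.R1 (P : Par) : ℝ → ℝ := (Ioo 0 Je).indicator P.ρ1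
noncomputable def Par.R2 (P : Par) : ℝ → ℝ := (Ioo 0 Je).indicator P.ρ2
structure Ini (P : Par) (n : ℕ) where
  x : ℕ → ℝ
  r : ℕ → ℝ
  hn : 1 ≤ n
  x0 : x 0 = 0
  x2 : x Jz = Je
  mono : ∀ k < 2 * n, x k < x Jf
  xm : ∀ k, x k ∈ Nh Je
  r01 : ∀ k, r k ∈ Ns
  hσ : ∀ k < 2 * n, ∫ y in x k..x Jf, (E7 y + P.R2 y) = 1 / n
  hr : ∀ k < 2 * n, ∫ y in x k..x Jf, E7 y = r k / n
structure Dsc (P : Par) (n : ℕ) (I : Ini P n) where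
  X : ℝ → ℕ → ℝ
  r : ℝ → ℕ → ℝ
  cX : ∀ j, Continuous fun t ↦ X t j
  cr : ∀ j, Continuous fun t ↦ Ka j
  X0 : ∀ t, X t 0 = 0
  X2 : ∀ t, X t Jz = Je
  pos : ∀ t, ∀ k < 2 * n, 0 < Kk Zj k
  r01 : ∀ t k, Ka k ∈ Ns
  dX : ∀ t ∈ Ioo 0 Ja, ∀ j, HasDerivAt Gq (Vn P n (Kk Zj) Zj (Ka) j) t
  dr : ∀ t ∈ Ioo 0 Ja, ∀ j, HasDerivAt (fun t ↦ Ka j) (Fr P n (Kk Zj) Zj (Ka) j) t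
  iX : X 0 = Yb
  ir : r 0 = I.r
variable {P : Par} {n : ℕ}
lemma sum_pp {X : ℕ → ℝ} (h0 : X 0 = 0) (h2 : X Jz = Je) : ∑k pp n X k = n * Je := by
  unfold pp; rw [← fmulsum, fsurasuz, h0, h2, sub_zero]
lemma X_mem {X : ℕ → ℝ} (h0 : X 0 = 0) (h2 : X Jz = Je) (hn : 1 ≤ n) (hp : ∀ k < 2 * n, 0 < Kk X k) : ∀ k ≤ 2 * n, X k ∈ Icc 0 Je := by
  have m : ∀ k < 2 * n, X k ≤ X Jf := fun k hk ↦ by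
    have := hp k hk
    have hnp : Jc < n := by exact_mod_cast hn
    have := pos_of_mul_pos_right this hnp.le
    linarith
  have mm : ∀ a b, a ≤ b → b ≤ 2 * n → X a ≤ X b := fun a b hab ↦ by
    induction b, hab using Nat.le_induction with
    | base => exact fun _ => le_rfl
    | succ b _ ih => exact fun h => (ih J5).trans (m b J5)
  exact fun k hk ↦ ⟨h0 ▸ mm 0 k J5 hk, h2 ▸ mm k _ hk le_rfl⟩
lemma En_pt {X : ℕ → ℝ} (H : Sp P n (Kk X)) {Y : ℝ} (hY : En Us n X ≤ Y) {k : ℕ} (hk : k < 2 * n) : prim Us (Kk X k) ≤ n * (Y + Je) := by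
  have hnp : Jc < n := by exact_mod_cast H.hn
  have h1 : ∑ i ∈ frange Jz, (prim Us (Kk X i) + Kk X i) ≤ n * (Y + Je) := by
    rw [fsuaddi, H.hs]
    rw [En, inv_mul_le_iff₀ hnp] at hY
    linarith
  have h2 := fsilesu (f := fun i ↦ prim Us (Kk X i) + Kk X i) (s := frange Jz)
    (fun i hi ↦ by linarith [ΦE_lo P (H.hp i (fmera.1 hi))]) (fmera.2 hk)
  have := H.hp k hk
  beta_reduce at h2; linarith
lemma VE_le : ∃ C, 0 ≤ C ∧ ∀ (n : ℕ) (p : ℕ → ℝ), Sp P n p → ∀ x r : ℕ → ℝ, (∀ j < 2 * n, x j ∈ Nh Je) → (∀ j < 2 * n, r j ∈ Ns) →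
    ∑ j ∈ frange J8, Zu * Vn P n p x r Ji ≤ C - N0 / 2 := by
  obtain ⟨C, C0, h⟩ := Sp.diss P
  refine ⟨C, C0, fun n p H x r hx hr ↦ ?_⟩
  refine le_trans (le_of_eq (fsuco rfl fun j hj ↦ ?_)) (h n p H (fun j ↦ if j < 2 * n then bn P n N5 + r j * Jm N5 else 0) fun j ↦ ?_)
  · rw [fmera] at hj
    simp only [Vn]
    rw [if_pos J5, if_pos J5, Nat.add_sub_cancel]
  · have := Y6
    split_ifs with hj
    · refine ☾.trans ?_
      have h1 := bn_B P n N5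
      have h2 := Gz _ (hx j hj)
      have h3 := hr j hj
      rw [abs_mul, abs_of_nonneg h3.1]
      have := mul_le_of_le_one_left (abs_nonneg (Jm N5)) h3.2
      linarith
    · simp; linarith
lemma Fr_sign {p x r : ℕ → ℝ} {c : ℝ} (hc : 0 < c) (hp : ∀ k, c ≤ p k) (hr : ∀ k, r k ∈ Ns) (k : ℕ) :
    (r k = 0 → 0 ≤ Fr P n p x r k) ∧ (r k = 1 → Fr P n p x r k ≤ 0) := by
  have ip : ∀ j, 0 ≤ (max (p J0) Yr)⁻¹ := fun j ↦ inv_nonneg.2 (hc.le.trans ((hp j).trans Ku))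
  have nn : Jc ≤ n := n.cast_nonneg
  have wp : ∀ j, 0 ≤ max (Jm N5) 0 := fun j ↦ le_max_right _ _
  have wm : ∀ j, 0 ≤ max (-Jm N5) 0 := fun j ↦ le_max_right _ _
  have rp : ∀ j, 0 ≤ r j := fun j ↦ (hr j).1
  have rm : ∀ j, 0 ≤ 1 - r j := fun j ↦ sub_nonneg.2 (hr j).2
  unfold Fr
  constructor <;> intro h <;> split_ifs with hk <;> try rfl
  · refine mul_nonneg nn (sub_nonneg.2 (le_trans (b := 0) ?_ ?_)) <;> unfold An <;> split_ifs <;> try rfl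
    · rw [h]
      have := mul_nonneg (ip k) (mul_nonneg (wm k) (rp (k - 1)))
      simp; linarith
    · rw [Nat.add_sub_cancel, h]
      have := mul_nonneg (ip Jf) (mul_nonneg (wp Jf) (rp Jf))
      simp at this ⊢; exact this
  · refine mul_nonpos_of_nonneg_of_nonpos nn (sub_nonpos.2 (le_trans (b := 0) ?_ ?_)) <;> unfold An <;> split_ifs <;> try rfl
    · rw [Nat.add_sub_cancel, h]
      have := mul_nonneg (ip Jf) (mul_nonneg (wm Jf) (rm Jf))
      simp at this ⊢; linarith
    · rw [h]
      have := mul_nonneg (ip k) (mul_nonneg (wp k) (rm (k - 1)))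
      simp; linarith
variable {P : Par} {n : ℕ}
lemma exDsc (I : Ini P n) : Nonempty (Dsc P n I) := by
  have hnp : Jc < n := by exact_mod_cast Zp
  obtain ⟨C, C0, hC⟩ := VE_le (P := P)
  obtain ⟨Mp, hM⟩ : ∃ Mp, Mp = n * (En Us n Yb + C * Ja + Je) := ⟨_, rfl⟩
  obtain ⟨c, hce⟩ : ∃ c, c = exp (-(|Mp| + 1)) := ⟨_, rfl⟩
  have c0 : 0 < c := hce ▸ exp_pos _
  have c1 : c ≤ 1 := by rw [hce, exp_le_one_iff]; linarith [abs_nonneg Mp]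
  obtain ⟨X, r, X0, r0, cX, cr, hs, hd⟩ := pre (P := P) (n := n) c0 Yb I.r (M := Je + 1)
    (fun j ↦ by have := I.xm j; rw [abs_of_nonneg this.1]; linarith [this.2])
    (fun j ↦ by have := I.r01 j; rw [abs_of_nonneg this.1]; linarith [this.2, Uw])
  have e0 : ∀ t ∈ Icc 0 Ja, X t 0 = 0 := fun t ht ↦ by
    have := const_of (cX 0) (T := Ja) (fun s hs ↦ ((hd s hs).1 0).congr_deriv (by simp [Vn])) ht
    rw [this, X0, I.x0]
  have e2 : ∀ t ∈ Icc 0 Ja, X t Jz = Je := fun t ht ↦ by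
    have := const_of (cX Jz) (T := Ja) (fun s hs ↦ ((hd s hs).1 Jz).congr_deriv (by simp [Vn])) ht
    rw [this, X0, I.x2]
  have hpc : ∀ t k, c ≤ pc n c Zj k := fun t k ↦ le_max_right _ _
  have hcl : ∀ t k, cl 1 (Ka k) ∈ Icc Jc 1 := fun t k ↦ cl_mem zero_le_one _
  have er : ∀ t ∈ Icc 0 Ja, ∀ k, Ka k ∈ Icc Jc 1 := fun t ht k ↦ by
    constructor
    · refine barrier (cr k) (fun s hs ↦ (hd s hs).2 k) (by rw [r0]; exact (I.r01 k).1) (fun s hs h ↦ ?_) ht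
      refine (Fr_sign c0 (hpc s) (hcl s) k).1 ?_
      rw [cl, min_eq_right (h.trans zero_le_one), max_eq_left h]
    · have := barrier (y := fun s ↦ 1 - r s k) (continuous_const.sub (cr k)) (fun s hs ↦ ((hd s hs).2 k).const_sub 1) (by rw [r0]; linarith [(I.r01 k).2]) (fun s hs h ↦ ?_) ht
      · linarith
      · refine neg_nonneg.2 ((Fr_sign c0 (hpc s) (hcl s) k).2 ?_)
        rw [cl, min_eq_left Js, max_eq_right zero_le_one]
  have cp : ∀ k, Continuous fun t ↦ pp n Zj k := fun k ↦ continuous_const.mul ((cX Jf).sub (cX k))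
  have key : ∀ t ∈ Icc 0 Ja, (∀ k < 2 * n, 0 < Kk Zj k) → Sp P n (Kk Zj) := fun t ht h ↦ ⟨Zp, h, sum_pp (e0 t ht) (e2 t ht)⟩
  have uncl : ∀ t ∈ Icc 0 Ja, (∀ k < 2 * n, c < Kk Zj k) → Vn P n (pc n c Zj) Ko Nd = Vn P n (Kk Zj) Zj (Ka)
      ∧ An P n (pc n c Zj) Ko Nd = An P n (Kk Zj) Zj (Ka) := fun t ht h ↦
    VA_congr P n (fun k hk ↦ max_eq_left (h k hk).le)
      (fun k hk ↦ cl_of (X_mem (e0 t ht) (e2 t ht) Zp (fun k hk ↦ c0.trans (h k hk)) k hk.le)) (fun k hk ↦ cl_of (er t ht k))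
  have good : ∀ t ∈ Icc 0 Ja, ∀ k < 2 * n, c < pp n Zj k := by
    by_contra! hbad
    have cpt : IsCompact (Nh Ja ∩ ⋃ k ∈ frange Jz, {t | Kk Zj k ≤ c}) :=
      isCompact_Icc.inter_right (isClosed_biUnion_finset fun k _ ↦ isClosed_le (cp k) continuous_const)
    obtain ⟨t1, ht1, k1, hk1, hb1⟩ := hbad
    obtain ⟨t0, ⟨ht0, hb0⟩, hmin⟩ := cpt.exists_isLeast ⟨t1, ht1, mem_biUnion (Finset.mem_coe.2 (fmera.2 hk1)) hb1⟩
    simp only [mem_iUnion, fmera, mem_ofPred_eq, exists_prop] at hb0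
    obtain ⟨k0, hk0, hb0⟩ := hb0
    have bef : ∀ t, 0 ≤ t → t < t0 → ∀ k < 2 * n, c < pp n Zj k := fun t h1 h2 k hk ↦ by
      by_contra! h
      exact absurd (hmin ⟨⟨h1, h2.le.trans ht0.2⟩, mem_biUnion (Finset.mem_coe.2 (fmera.2 hk)) h⟩) (not_le.2 h2)
    have pz : ∀ k < 2 * n, 0 < Kk (X t0) k := fun k hk ↦ by
      rcases ht0.1.eq_or_lt with h | h
      · rw [← h, X0]; exact mul_pos hnp (sub_pos.2 (I.mono k hk))
      · refine c0.trans_le (ge_of_tendsto (((cp k).continuousAt (x := t0)).tendsto.mono_left (nhdsWithin_le_nhds (s := Iio t0))) ?_)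
        filter_upwards [Ioo_mem_nhdsLT h] with s hs using (bef s hs.1.le hs.2 k hk).le
    have pa : ∀ t ∈ Icc 0 t0, ∀ k < 2 * n, 0 < pp n Zj k := fun t ht k hk ↦ by
      rcases ht.2.eq_or_lt with h | h
      · rw [h]; exact pz k hk
      · exact c0.trans (bef t ht.1 h k hk)
    have g := grow (f := fun t ↦ En Us n Zj) (C := C) ht0.1 (En_c Go (fun j ↦ (cX j).continuousOn) pa)
      (fun t ht ↦ En_d Go Zp (hd t ⟨ht.1, ht.2.trans_le ht0.2⟩).1 (by simp [Vn]) (by simp [Vn]) (pa t (Ioo_subset_Icc_self ht)))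
      (fun t ht ↦ by
        have htT : t ∈ Icc 0 Ja := ⟨ht.1.le, ht.2.le.trans ht0.2⟩
        have S := key t htT (pa t (Ioo_subset_Icc_self ht))
        rw [(uncl t htT (bef t ht.1.le ht.2)).1]
        have := hC n _ S Zj (Ka) (fun j hj ↦ X_mem (n := n) (e0 t htT) (e2 t htT) Zp (pa t (Ioo_subset_Icc_self ht)) j hj.le) (fun j _ ↦ er t htT j)
        have := S.Ds0; linarith)
    beta_reduce at g
    have h1 : En Us n (X t0) ≤ En Us n Yb + C * Ja := by
      rw [X0] at g; have := mul_le_mul_of_nonneg_left ht0.2 C0; linarith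
    have h2 := En_pt (key t0 ht0 pz) h1 hk0
    rw [← hM] at h2
    have h3 := ΦE_log P (pz k0 hk0) (hb0.trans c1)
    have h4 := log_le_log (pz k0 hk0) hb0
    rw [hce, log_exp] at h4
    linarith [le_abs_self Mp]
  refine ⟨⟨X, r, cX, cr, fun t ↦ ?_, fun t ↦ ?_, fun t ↦ ?_, fun t ↦ ?_, fun t ht j ↦ ?_, fun t ht j ↦ ?_, X0, r0⟩⟩
  · obtain ⟨s, hs, h, _⟩ := hs t; rw [h]; exact e0 s hs
  · obtain ⟨s, hs, h, _⟩ := hs t; rw [h]; exact e2 s hs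
  · obtain ⟨s, hs, h, _⟩ := hs t; rw [h]; exact fun k hk ↦ c0.trans (good s hs k hk)
  · obtain ⟨s, hs, _, h⟩ := hs t; rw [h]; exact er s hs
  · have h := Ioo_subset_Icc_self ht; have := (hd t ht).1 j; rw [(uncl t h (good t h)).1] at this; exact this
  · have h := Ioo_subset_Icc_self ht; have := (hd t ht).2 j; unfold Fr at this ⊢; rw [(uncl t h (good t h)).2] at this; exact this
variable (P : Par)
lemma Rs : Integrable E7 ∧ Integrable P.R2 ∧ (∀ x, 0 ≤ E7 x) ∧ (∀ x, 0 ≤ P.R2 x) ∧ ∫ x in Jc..P.L, E7 x = 1 ∧ ∫ x in Jc..P.L, P.R2 x = 1 := by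
  refine ⟨P.h1i.integrable_indicator measurableSet_Ioo, P.h2i.integrable_indicator measurableSet_Ioo, indicator_nonneg P.h1p, indicator_nonneg P.h2p, ?_, ?_⟩
  · rw [iinofle P.hL.le, integral_Ioc_eq_integral_Ioo, ← P.h1]
    exact setIntegral_congr_fun measurableSet_Ioo fun x hx ↦ indicator_of_mem hx _
  · rw [iinofle P.hL.le, integral_Ioc_eq_integral_Ioo, ← P.h2]
    exact setIntegral_congr_fun measurableSet_Ioo fun x hx ↦ indicator_of_mem hx _
lemma exIni {n : ℕ} (hn : 1 ≤ n) : Nonempty (Ini P n) := by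
  obtain ⟨i1, i2, p1, p2, e1, e2⟩ := Rs P
  have hnp : Jc < n := by exact_mod_cast hn
  have ii : Integrable fun x ↦ E7 x + P.R2 x := i1.add i2
  obtain ⟨F, hF⟩ : ∃ F : ℝ → ℝ, ∀ x, F x = ∫y (E7 y + P.R2 y) := ⟨_, fun _ ↦ rfl⟩
  have Fc : Continuous F := by
    rw [funext hF]; exact icopr (fun a b ↦ ii.intervalIntegrable) 0
  have F0 : F 0 = 0 := by rw [hF]; simp
  have FL : F Je = 2 := by
    rw [hF, iinad i1.intervalIntegrable i2.intervalIntegrable, e1, e2]; norm_num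
  have Fs : ∀ x y, ∫ z in x..y, (E7 z + P.R2 z) = F y - F x := fun x y ↦ by
    rw [hF, hF, intervalIntegral.integral_interval_sub_left ii.intervalIntegrable ii.intervalIntegrable]
  have Fm : ∀ x y, x ≤ y → F x ≤ F y := fun x y h ↦ by
    rw [← sub_nonneg, ← Fs]; exact iinno h fun z _ ↦ add_nonneg (p1 z) (p2 z)
  have hx : ∀ k : ℕ, ∃ x ∈ Icc 0 Je, (k = 0 → x = 0) ∧ (2 * n ≤ k → x = Je) ∧ (k ≤ 2 * n → F x = k / n) := fun k ↦ by
    rcases Nat.eq_zero_or_pos k with h | h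
    · exact ⟨0, ⟨le_rfl, P.hL.le⟩, fun _ ↦ rfl, fun _ ↦ by omega, fun _ ↦ by rw [F0, h]; simp⟩
    · rcases le_or_gt Jz k with h2 | h2
      · refine ⟨Je, ⟨P.hL.le, le_rfl⟩, fun _ ↦ by omega, fun _ ↦ rfl, fun h3 ↦ ?_⟩
        rw [FL, le_antisymm h3 h2]; push_cast; field_simp
      · obtain ⟨x, hx, e⟩ := intermediate_value_Icc P.hL.le Fc.continuousOn (show Hj / n ∈ Icc (F 0) (F Je) from by
          rw [F0, FL]; refine ⟨by positivity, (div_le_iff₀ hnp).2 (by exact_mod_cast h2.le)⟩)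
        exact ⟨x, hx, fun _ ↦ by omega, fun _ ↦ by omega, fun _ ↦ e⟩
  choose x xm x0 x2 xF using hx
  have xs : ∀ k < 2 * n, ∫ y in x k..x Jf, (E7 y + P.R2 y) = 1 / n := fun k hk ↦ by
    rw [Fs, xF _ J5, xF _ hk.le]; push_cast; ring
  have mono : ∀ k < 2 * n, x k < x Jf := fun k hk ↦ by
    by_contra! h
    have h1 := Fm _ _ h
    have h2 := xs k hk
    rw [Fs] at h2
    have : Jc < 1 / n := by positivity
    linarith
  refine ⟨⟨x, fun k ↦ if k < 2 * n then n * ∫ y in x k..x Jf, E7 y else 0, hn, x0 0 rfl, x2 _ le_rfl, mono, xm, fun k ↦ ?_, xs, fun k hk ↦ ?_⟩⟩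
  · split_ifs with hk
    · refine ⟨mul_nonneg hnp.le (iinno (mono k hk).le fun z _ ↦ p1 z), ?_⟩
      have := intervalIntegral.integral_mono (mono k hk).le i1.intervalIntegrable ii.intervalIntegrable (fun z ↦ le_add_of_nonneg_right (p2 z))
      rw [xs k hk] at this
      calc _ ≤ Jl * (1 / n) := mul_le_mul_of_nonneg_left this hnp.le
        _ = 1 := by field_simp
    · simp
  · rw [if_pos hk]; field_simp
lemma grow_int {f fp h : ℝ → ℝ} {a b C : ℝ} (hab : a ≤ b) (hc : ContinuousOn f (Icc a b)) (hd : ∀ t ∈ Ioo a b, HasDerivAt f (fp t) t)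
    (hh : Continuous h) (hC : ∀ t ∈ Ioo a b, fp t ≤ C - h t) : ∫ t in a..b, h t ≤ f a - f b + C * (b - a) := by
  have := grow (f := fun t ↦ Nv + ∫ s in a..t, h s) hab (hc.add (icopr (fun _ _ ↦ hh.intervalIntegrable _ _) a).continuousOn)
    (fun t ht ↦ (hd t ht).add (intervalIntegral.integral_hasDerivAt_right (hh.intervalIntegrable _ _) (hh.stronglyMeasurableAtFilter _ _) hh.continuousAt))
    (C := C) (fun t ht ↦ by linarith [hC t ht])
  simp at this; linarith
variable {P : Par} {n : ℕ} {I : Ini P n}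
lemma ci : ContinuousOn (fun z : ℝ ↦ 1 / z) Ur := fun z hz ↦ ContinuousAt.continuousWithinAt (by have : z ≠ 0 := (mem_Ioi.1 hz).ne'; fun_prop (disch := assumption))
namespace Dsc
def p (D : Dsc P n I) (t : ℝ) (k : ℕ) : ℝ := Kk Zy k
noncomputable def v (D : Dsc P n I) (t : ℝ) (k : ℕ) : ℝ := Vn P n U6 Zy (Yz) k
noncomputable def A (D : Dsc P n I) (t : ℝ) (k : ℕ) : ℝ := An P n U6 Zy (Yz) k
noncomputable def s (D : Dsc P n I) (t : ℝ) : ℝ := P.c2 + TV n U6 + TL n U6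
variable (D : Dsc P n I)
lemma sp (t : ℝ) : Sp P n U6 := ⟨Zp, Ul t, sum_pp (D.X0 t) (D.X2 t)⟩
lemma xm (t : ℝ) : ∀ k ≤ 2 * n, Gh k ∈ Icc 0 Je := X_mem (D.X0 t) (D.X2 t) Zp (Ul t)
lemma cp (k : ℕ) : Continuous fun t ↦ Jr t k := continuous_const.mul ((Eb Jf).sub (Eb k))
lemma cg {g : ℝ → ℝ} (hg : ContinuousOn g Ur) {k : ℕ} (hk : k < 2 * n) : Continuous fun t ↦ g (Kx) :=
  hg.comp_continuous (D.cp k) fun t ↦ Ul t k hk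
lemma cv (k : ℕ) : Continuous fun t ↦ Zm t k := by
  unfold v Vn
  split_ifs with h
  · have hb : Continuous (Ea) := (LipschitzWith.of_dist_le_mul (K := n) fun x y ↦ bn_lip P n x y).continuous
    exact (continuous_const.mul ((D.cg N6 h.2).sub (D.cg N6 J5))).sub ((hb.comp (Eb k)).add ((Ne k).mul (P.Wcont.comp (Eb k))))
  · exact continuous_const
lemma cA (k : ℕ) : Continuous fun t ↦ Y0 t k := by
  unfold A An
  split_ifs with h
  · have hw := P.Wcont.comp (Eb k)
    refine Continuous.mul Kv ?_
    exact ((hw.max continuous_const).mul ((Ne k).mul (continuous_const.sub (Ne _)))).sub ((hw.neg.max continuous_const).mul ((Ne _).mul (continuous_const.sub (Ne k))))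
  · exact continuous_const
lemma cs : Continuous Zv := by
  unfold s TV TL
  refine (continuous_const.add ?_).add ?_ <;> refine continuous_finsetSum _ fun j hj ↦ Continuous.abs ?_ <;> rw [fmera] at hj
  · exact (D.cg (g := fun z ↦ 1 / z) ci J5).sub
      (D.cg (g := fun z ↦ 1 / z) ci J5)
  · exact (D.cg (g := log) Nq J5).sub (D.cg (g := log) Nq J5)
lemma s1 (t : ℝ) : 1 ≤ Zv t := by unfold s; linarith [P.c2p, TV0 n U6, TL0 n U6]
lemma hps (t : ℝ) {k : ℕ} (hk : k < 2 * n) : 1 / Kx ≤ Zv t ∧ |log (Kx)| ≤ Zv t := by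
  have h := (D.sp t).ip_le hk
  have := TV0 n U6; have := TL0 n U6; have := abs_nonneg Gn; have := div_nonneg zero_le_two P.hL.le
  unfold s Par.c2; constructor <;> linarith [h.1, h.2]
lemma sDs (t : ℝ) : Zv t ^ 2 ≤ (3 * P.c2 ^ 2 + 6 * Hg) * (1 + Ds P n U6) := by
  have h := (D.sp t).sq12
  have h0 := (D.sp t).Ds0
  have := P.c1p
  have : 0 ≤ P.c2 ^ 2 * Ds P n U6 := by positivity
  unfold s
  nlinarith [sq_nonneg (P.c2 - TV n U6), sq_nonneg (P.c2 - TL n U6), sq_nonneg (TV n U6 - TL n U6), h.1, h.2]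
lemma Ylo (t : ℝ) : 2 - Je ≤ En Us n Zy := by
  have hnp : Jc < n := by exact_mod_cast Zp
  have h := fsulesu fun k (hk : k ∈ frange Jz) ↦ ΦE_lo P (Ul t k Ye)
  rw [fsusudi, sum_pp (D.X0 t) (D.X2 t)] at h
  simp at h
  rw [En, ← div_eq_inv_mul, le_div_iff₀ hnp]; linarith
lemma Yup (t : ℝ) : En Us n Zy ≤ (4 + Je) * Zv t := by
  have hnp : Jc < n := by exact_mod_cast Zp
  have h := fsulesu (g := fun k ↦ 2 * Zv t + Kx * Zv t) fun k (hk : k ∈ frange Jz) ↦ (ΦE_up P (Ul t k Ye)).trans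
    (by
      have h1 := D.hps t Ye
      have h2 := mul_le_mul_of_nonneg_left h1.2 (Ul t k Ye).le
      have : 2 / Kx = 2 * (1 / Kx) := by ring
      change 2 / Kx + Kx * |log (Kx)| ≤ _
      change Jr t k * |log (Kx)| ≤ Kx * Zv t at h2
      linarith [h1.1])
  rw [fsuaddi, ← Finset.sum_mul (f := fun k ↦ Kx), (D.sp t).hs] at h
  simp at h
  rw [En, ← div_eq_inv_mul, div_le_iff₀ hnp]; linarith
lemma Enp {g : ℝ → ℝ} (hg : ContinuousOn g Ur) {t : ℝ} (ht : t ∈ Ioo 0 Ja) :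
    HasDerivAt (fun t ↦ En g n Zy) (∑ j ∈ frange J8, (g (Z2 Ji) - g E8) * U4 Ji) t :=
  En_d hg Zp (D.dX t ht) (V := U4) (by simp [v, Vn]) (by simp [v, Vn]) (Ul t)
end Dsc
lemma e_ts {t T s S Q K C D Y y : ℝ} (hT : 0 ≤ t) (htT : t ≤ T) (hC : 0 ≤ C) (hQ : 0 < Q) (hs : s ^ 2 ≤ Q * (1 + D)) (hY : Y ≤ K * s) (hy : y ≤ C - D / 2) (hS : S = t ^ 2 * s ^ 2) :
    2 * t * Y + t ^ 2 * y ≤ (C * T ^ 2 + T ^ 2 / 2 + 4 * Q * K ^ 2) - S / Hk := by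
  have h1 : 2 * t * Y ≤ 2 * t * (K * s) := mul_le_mul_of_nonneg_left hY Js
  have h2 : t ^ 2 * y ≤ t ^ 2 * (C - D / 2) := mul_le_mul_of_nonneg_left hy Nx
  have h3 : s ^ 2 / Q ≤ 1 + D := by rw [div_le_iff₀ hQ]; linarith
  have h4 : t ^ 2 * (s ^ 2 / Q) ≤ t ^ 2 * (1 + D) := mul_le_mul_of_nonneg_left h3 Nx
  have h5 : t ^ 2 ≤ T ^ 2 := pow_le_pow_left₀ hT htT 2
  have h6 : 2 * t * (K * s) ≤ S / Hk + 4 * Q * K ^ 2 := by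
    rw [hS, ← sub_nonneg]
    have : t ^ 2 * s ^ 2 / Hk + 4 * Q * K ^ 2 - 2 * t * (K * s) = (t * s - 4 * Q * K) ^ 2 / Hk := by field_simp; ring
    rw [this]; positivity
  have h7 : t ^ 2 * (s ^ 2 / Q) = 4 * (S / Hk) := by rw [hS]; field_simp
  have := mul_le_mul_of_nonneg_left h5 hC
  linarith
lemma exS2 (P : Par) : ∃ C, ∀ n (I : Ini P n) (D : Dsc P n I), ∫t t ^ 2 * Zv t ^ 2 ≤ C := by
  obtain ⟨C, C0, hC⟩ := VE_le (P := P)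
  obtain ⟨Q, hQ⟩ : ∃ Q, Q = 3 * P.c2 ^ 2 + 6 * Hg := ⟨_, rfl⟩
  have Q0 : 0 < Q := by rw [hQ]; have := P.c1p; positivity
  refine ⟨4 * Q * (Ja ^ 2 * Je + (C * Ja ^ 2 + Ja ^ 2 / 2 + 4 * Q * (4 + Je) ^ 2) * Ja), fun n I D ↦ ?_⟩
  have hc := D.cs
  have := grow_int (f := fun t ↦ t ^ 2 * En Us n Zy) (h := fun t ↦ t ^ 2 * Zv t ^ 2 / Hk) Zk
    ((continuous_pow 2).continuousOn.mul (En_c Go (fun j ↦ (Eb j).continuousOn) fun t _ ↦ Ul t))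
    (fun t ht ↦ (hasDerivAt_pow 2 t).mul (D.Enp Go ht)) Zn (C := C * Ja ^ 2 + Ja ^ 2 / 2 + 4 * Q * (4 + Je) ^ 2)
    (fun t ht ↦ by
      have := e_ts ht.1.le ht.2.le C0 Q0 (hQ ▸ D.sDs t) (D.Yup t) (hC n _ (D.sp t) Zy (Yz) (fun j hj ↦ D.xm t j hj.le) fun j _ ↦ U7 t j) rfl
      simpa [Dsc.v] using this)
  rw [intervalIntegral.integral_div, div_le_iff₀ Jh] at this
  refine this.trans ?_
  rw [mul_comm]
  refine mul_le_mul_of_nonneg_left ?_ Jh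
  have h := mul_le_mul_of_nonneg_left (D.Ylo Ja) (sq_nonneg Ja)
  have := sq_nonneg Ja
  simp; linarith
variable {P : Par}
lemma jen {σ c : ℝ} (hσ : 0 ≤ σ) (hc : 0 < c) : σ * log c + σ - c ≤ σ * log σ := by
  rcases hσ.eq_or_lt with h | h
  · rw [← h]; simp [hc.le]
  · have h1 := log_le_sub_one_of_pos (div_pos hc h)
    rw [log_div hc.ne' h.ne'] at h1
    have h2 := mul_le_mul_of_nonneg_left h1 hσ
    have : σ * (c / σ - 1) = c - σ := by field_simp
    linarith
lemma Y1_lo {z : ℝ} (hz : 0 < z) : Jv * (1 - z) ≤ prim (U3) z := by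
  have hl := P.hlam.le
  have ha := P.hα0.le
  rcases le_total z 1 with h1 | h1
  · have := le_prim N6 hz h1 (F := fun y ↦ Jv * y) (Fp := fun y ↦ Jv) (fun y hy ↦ by simpa using (hasDerivAt_id y).const_mul Jv)
      continuousOn_const (fun y h0 h1 ↦ le_mul_of_one_le_right hl (one_le_rpow_of_pos_of_le_one_of_nonpos h0 h1 Js))
    linarith
  · exact prim_gt' N6 h1 (fun y h _ ↦ mul_le_of_le_one_right hl (rpow_le_one_of_one_le_of_nonpos h Js))
lemma Y1_up (h : J3 < 1) {z : ℝ} (hz : 0 < z) : prim (U3) z ≤ Jv / No := by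
  have hl := P.hlam.le
  have ho : 0 < 1 - J3 := by linarith
  rcases le_total z 1 with h1 | h1
  · have := prim_le N6 hz h1 (F := fun y ↦ Jv / No * y ^ No) (Fp := U3) (fun y hy ↦ ((hasDerivAt_rpow_const (p := 1 - J3) (N9 hy.ne')).const_mul _).congr_deriv (by
      unfold pr; rw [show 1 - J3 - 1 = -J3 by ring]; field_simp)) N6 (fun y _ _ ↦ le_rfl)
    rw [one_rpow, mul_one] at this
    have : 0 ≤ Jv / No * z ^ No := by positivity
    linarith
  · have := prim_gt N6 h1 (a := 0) (fun y h _ ↦ by unfold pr; positivity)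
    have : 0 ≤ Jv / No := by positivity
    linarith
lemma Y1_log (h : J3 = 1) {z : ℝ} (hz : 0 < z) : prim (U3) z = -Jv * log z := by
  unfold prim
  rw [iineqsuofha (f := fun y ↦ Jv * log y) (fun y hy ↦ ((hasDerivAt_log (ioi_uIcc hz hy).ne').const_mul _).congr_deriv (by
    rw [pr, h, rpow_neg_one])) (prim_i N6 hz)]
  simp
lemma Y1_0 (P : Par) : ∃ C, ∀ n (I : Ini P n), En (U3) n Yb ≤ C := by
  have pos : ∀ n (I : Ini P n), ∀ k < 2 * n, 0 < pp n Yb k := fun n I k hk ↦ mul_pos (by exact_mod_cast Zp) (sub_pos.2 (I.mono k hk))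
  rcases P.hα1.lt_or_eq with h | h
  · refine ⟨2 * (Jv / No), fun n I ↦ ?_⟩
    have hnp : Jc < n := by exact_mod_cast Zp
    have h := fsulesu fun k (hk : k ∈ frange Jz) ↦ Y1_up h (pos n I k Ye)
    simp at h
    rw [En, ← div_eq_inv_mul, div_le_iff₀ hnp]; linarith
  · obtain ⟨i1, i2, p1, p2, e1, e2⟩ := Rs P
    have fi : Integrable fun x ↦ Z9 * log Z9 := by
      have : (fun x ↦ Z9 * log Z9) = (Ioo 0 Je).indicator (fun x ↦ Uu * log Uu) := by
        funext x; unfold Par.R1 Par.R2; by_cases hx : x ∈ Ioo 0 Je <;> simp [indicator, hx]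
      rw [this]; exact (P.hent h).integrable_indicator measurableSet_Ioo
    refine ⟨Jv * ∫ x in Jc..P.L, Z9 * log Z9, fun n I ↦ ?_⟩
    have hnp : Jc < n := by exact_mod_cast Zp
    have s := isuinadin (μ := volume) (a := Yb) (n := 2 * n) fun k _ ↦ fi.intervalIntegrable (a := Yb k) (b := Yb Jf)
    rw [I.x0, I.x2] at s
    rw [← s, fmulsum, En, fmulsum]
    refine fsulesu fun k hk ↦ ?_
    rw [fmera] at hk
    have hp := pos n I k hk
    rw [Y1_log h hp]
    have m := intervalIntegral.integral_mono (μ := volume) (I.mono k hk).le (f := fun x ↦ Z9 * log (1 / Kk Yb k) + Z9 - 1 / Kk Yb k)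
      ((((i1.add i2).mul_const _).add (i1.add i2)).intervalIntegrable.sub intervalIntegrable_const) fi.intervalIntegrable (fun x ↦ jen (add_nonneg (p1 x) (p2 x)) Jh)
    have ii : IntervalIntegrable (fun x ↦ E7 x + P.R2 x) volume Gr (Yb Jf) := (i1.add i2).intervalIntegrable
    rw [iinsu ((ii.mul_const _).add ii) intervalIntegrable_const, iinad (ii.mul_const _) ii, iinmuco, I.hσ k hk,
      iinco, one_div (Kk Yb k), log_inv] at m
    have e : (Yb Jf - Yb k) • (Kk Yb k)⁻¹ = 1 / n := by
      have := sub_pos.2 (I.mono k hk)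
      rw [pp, smul_eq_mul]; field_simp
    rw [e] at m
    have mp := mul_le_mul_of_nonneg_left m P.hlam.le
    refine le_trans (le_of_eq ?_) mp
    ring
variable {n : ℕ} {I : Ini P n}
noncomputable def Dsc.vv (D : Dsc P n I) (t : ℝ) : ℝ := Jl⁻¹ * ∑k Zm t k ^ 2
lemma Dsc.cvv (D : Dsc P n I) : Continuous Ky := continuous_const.mul (continuous_finsetSum _ fun k _ ↦ (D.cv k).pow 2)
lemma Dsc.Y1d (D : Dsc P n I) (t : ℝ) : ∑ j ∈ frange J8, (U3 (Z2 Ji) - U3 E8) * U4 Ji ≤ 4 * Jg ^ 2 - Ky t / 2 := by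
  have hn := Zp
  have hnp : Jc < n := by exact_mod_cast Zp
  have e : Ky t = Jl⁻¹ * ∑ j ∈ frange J8, U4 Ji ^ 2 := by
    rw [vv, show 2 * n = 2 * n - 1 + 1 by omega, Finset.sum_range_succ']; simp [v, Vn]
  have h := fsulesu (s := frange J8) (f := fun j ↦ (U3 (Z2 Ji) - U3 E8) * U4 Ji) (g := fun j ↦ Jl⁻¹ * (2 * Jg ^ 2) - Jl⁻¹ * U4 Ji ^ 2 / 2) fun j hj ↦ by
    rw [fmera] at hj
    obtain ⟨w, hw⟩ : ∃ w, w = Ea (Gh Ji) + Yz Ji * Jm (Gh Ji) := ⟨_, rfl⟩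
    have wB : |w| ≤ 2 * Jg := by
      rw [hw]
      refine ☾.trans ?_
      have h1 := bn_B P n (Gh Ji)
      have h2 := Gz _ (D.xm t Ji J5)
      have h3 := U7 t Ji
      rw [abs_mul, abs_of_nonneg h3.1]
      have := mul_le_of_le_one_left (abs_nonneg (Jm (Gh Ji))) h3.2
      linarith
    have w2 : w ^ 2 ≤ 4 * Jg ^ 2 := by have := abs_le.1 wB; nlinarith [this.1, this.2]
    have hv : Zm t Ji = -n * (U3 (Z2 Ji) - U3 E8) - w := by
      rw [v, Vn, if_pos J5, Nat.add_sub_cancel, hw]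
    have : pr P (Z2 Ji) - U3 E8 = -(Jl⁻¹ * (U4 Ji + w)) := by rw [hv]; field_simp; ring
    beta_reduce
    rw [this]
    have := mul_nonneg (inv_nonneg.2 hnp.le) (by nlinarith [sq_nonneg (U4 Ji + w)] : 0 ≤ 2 * Jg ^ 2 - U4 Ji ^ 2 / 2 + (U4 Ji + w) * U4 Ji)
    linarith
  refine h.trans ?_
  rw [fsusudi, ← fsumdiv, ← fmulsum _ (fun j ↦ U4 Ji ^ 2), ← e]
  have : ((2 * n - 1 : ℕ) : ℝ) ≤ 2 * n := by exact_mod_cast Nat.sub_le _ _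
  have := mul_le_mul_of_nonneg_right this (by positivity : 0 ≤ Jl⁻¹ * (2 * Jg ^ 2))
  have e2 : 2 * Jl * (Jl⁻¹ * (2 * Jg ^ 2)) = 4 * Jg ^ 2 := by field_simp; ring
  rw [fsucoz, fcara, nsmul_eq_mul]
  linarith
lemma exV2 (P : Par) : ∃ C, ∀ n (I : Ini P n) (D : Dsc P n I), ∫t Ky t ≤ C := by
  obtain ⟨C, hC⟩ := Y1_0 P
  refine ⟨2 * (C + Jv * Je + 4 * Jg ^ 2 * Ja), fun n I D ↦ ?_⟩
  have hnp : Jc < n := by exact_mod_cast Zp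
  have := grow_int (f := fun t ↦ En (U3) n Zy) (h := fun t ↦ Ky t / 2) Zk (En_c N6 (fun j ↦ (Eb j).continuousOn) fun t _ ↦ Ul t)
    (fun t ht ↦ D.Enp N6 ht) (D.cvv.div_const 2) (fun t _ ↦ D.Y1d t)
  rw [intervalIntegral.integral_div, D.iX] at this
  have h := fsulesu fun k (hk : k ∈ frange Jz) ↦ Y1_lo (P := P) (Ul Ja k Ye)
  rw [← fmulsum, fsusudi, sum_pp (D.X0 Ja) (D.X2 Ja)] at h
  have h2 : Jv * (2 - Je) ≤ En (U3) n (Jq Ja) := by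
    rw [En, ← div_eq_inv_mul, le_div_iff₀ hnp]; simp at h; linarith
  have := hC n I
  have := Gy
  linarith
noncomputable def om (x : ℝ) : ℝ := x ^ 2 - 2 / 3 * x ^ 3
lemma om_01 {x : ℝ} (hx : x ∈ Ns) : 0 ≤ om x ∧ om x ≤ 1 := by
  obtain ⟨h0, h1⟩ := hx
  unfold om
  constructor
  · nlinarith [mul_nonneg (sq_nonneg x) He]
  · nlinarith [pow_le_one₀ h0 h1 (n := 2), pow_nonneg h0 3]
lemma om_lip {x y : ℝ} (hx : x ∈ Ns) (hy : y ∈ Ns) : |om x - om y| ≤ |x - y| := by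
  have : om x - om y = Uf * ((x + y) - 2 / 3 * (x ^ 2 + x * y + y ^ 2)) := by unfold om; ring
  rw [this, abs_mul]
  refine mul_le_of_le_one_right Jy (abs_le.2 ?_)
  obtain ⟨h0, h1⟩ := hx
  obtain ⟨h2, h3⟩ := hy
  constructor <;> nlinarith [mul_nonneg h0 He, mul_nonneg h2 (sub_nonneg.2 h3), mul_nonneg h0 (sub_nonneg.2 h3), mul_nonneg He (sub_nonneg.2 h3), mul_nonneg h0 h2, sq_nonneg Uf]
lemma ab {a D x : ℝ} (hx : |x| ≤ D) : |a * x| ≤ |a| * D := by rw [abs_mul]; exact mul_le_mul_of_nonneg_left hx (abs_nonneg a)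
lemma up1 {S W x y A a : ℝ} (hS : 0 ≤ S) (hx : x ∈ Ns) (hy : y ∈ Ns) (hA : A = S * (max W 0 * (y * (1 - x)) - max (-W) 0 * (x * (1 - y)))) (ha : a = S * W) :
    |a| * Yn ^ 2 / 3 ≤ 2 * (Yn * A - a * (om y - om x) / 2) ∧ |A| ≤ |a| ∧ ∀ r, r = x ∨ r = y → |A - a * Yo| ≤ |a| * |y - x| := by
  have hxp := hx; have hyp := hy
  obtain ⟨h0, h1⟩ := hx
  obtain ⟨h2, h3⟩ := hy
  have k1 : |y * (1 - x)| ≤ 1 := by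
    rw [abs_of_nonneg (mul_nonneg h2 Js)]; nlinarith [mul_nonneg h2 h0]
  have k2 : |x * (1 - y)| ≤ 1 := by
    rw [abs_of_nonneg (mul_nonneg h0 Js)]; nlinarith [mul_nonneg h2 h0]
  have l : ∀ c, c ∈ Ns → |Yn * c| ≤ |y - x| := fun c hc ↦ by
    rw [abs_mul, abs_of_nonneg hc.1]; exact mul_le_of_le_one_right Jy hc.2
  have hx1 : 1 - x ∈ Icc Jc 1 := ⟨by linarith, by linarith⟩
  have hy1 : 1 - y ∈ Icc Jc 1 := ⟨by linarith, by linarith⟩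
  rcases le_total 0 W with h | h
  · have e : A = a * (y * (1 - x)) := by rw [hA, ha, max_eq_left h, max_eq_right Js]; ring
    have a0 : 0 ≤ a := ha ▸ mul_nonneg hS h
    refine ⟨?_, ?_, fun r hr ↦ ?_⟩
    · rw [abs_of_nonneg a0, e]
      have : 2 * (Yn * (a * (y * (1 - x))) - a * (om y - om x) / 2) - a * Yn ^ 2 / 3 = a * (Yn ^ 2 * (2 / 3 * (1 + Yn))) := by unfold om; ring
      have := mul_nonneg a0 (mul_nonneg (sq_nonneg Yn) (by linarith : 0 ≤ 2 / 3 * (1 + Yn)))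
      linarith
    · rw [e]; simpa using ab (a := a) k1
    · rcases hr with rfl | rfl
      · rw [e, show a * (y * (1 - r)) - a * Yo = a * ((y - r) * (1 - r)) by ring]; exact ab (l _ hx1)
      · rw [e, show a * (r * (1 - x)) - a * Yo = a * ((r - x) * r) by ring]; exact ab (l _ hyp)
  · have e : A = a * (x * (1 - y)) := by rw [hA, ha, max_eq_right h, max_eq_left Js]; ring
    have a0 : a ≤ 0 := ha ▸ mul_nonpos_of_nonneg_of_nonpos hS h
    refine ⟨?_, ?_, fun r hr ↦ ?_⟩
    · rw [abs_of_nonpos a0, e]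
      have : 2 * (Yn * (a * (x * (1 - y))) - a * (om y - om x) / 2) - -a * Yn ^ 2 / 3 = -a * (Yn ^ 2 * (2 / 3 * (1 - Yn))) := by unfold om; ring
      have := mul_nonneg (neg_nonneg.2 a0) (mul_nonneg (sq_nonneg Yn) (by linarith : 0 ≤ 2 / 3 * (1 - Yn)))
      linarith
    · rw [e]; simpa using ab (a := a) k2
    · rcases hr with rfl | rfl
      · rw [e, show a * (r * (1 - y)) - a * Yo = -a * ((y - r) * r) by ring, ← abs_neg a]; exact ab (l _ hxp)
      · rw [e, show a * (x * (1 - r)) - a * Yo = -a * ((r - x) * (1 - r)) by ring, ← abs_neg a]; exact ab (l _ hy1)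
lemma up2 {x y A a r : ℝ} (hx : x ∈ Ns) (hy : y ∈ Ns) (hr : r = x ∨ r = y) (h1 : |A| ≤ |a|) (h2 : |A - a * Yo| ≤ |a| * |y - x|) :
    |(x + y) * A - a * E9 / 2 - a * (r ^ 2 - 4 / 3 * r ^ 3)| ≤ 4 * (|a| * |y - x|) := by
  have r01 : r ∈ Icc Jc 1 := by rcases hr with rfl | rfl <;> assumption
  have e1 : (x + y) * A - a * E9 / 2 - a * (r ^ 2 - 4 / 3 * r ^ 3) = A * (x + y - 2 * r) + 2 * r * Ga - a * (E9 / 2 - om r) := by unfold om; ring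
  have k1 : |x + y - 2 * r| ≤ |y - x| := by
    rcases hr with rfl | rfl
    · rw [show r + y - 2 * r = y - r by ring]
    · rw [show x + r - 2 * r = x - r by ring, abs_sub_comm]
  have k2 : |E9 / 2 - om r| ≤ |y - x| := by
    have := om_lip hy hx
    have := abs_nonneg (om y - om x)
    rcases hr with rfl | rfl
    · rw [show (om r + om y) / 2 - om r = (om y - om r) / 2 by ring, abs_div, abs_two]; linarith
    · rw [show (om x + om r) / 2 - om r = -((om r - om x) / 2) by ring, abs_neg, abs_div, abs_two]; linarith
  have m1 := ab (a := A) k1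
  have m2 := ab (a := a) k2
  have m3 : |2 * r * Ga| ≤ 2 * (|a| * |y - x|) := by
    rw [abs_mul, abs_of_nonneg (by linarith [r01.1])]
    have := abs_nonneg Ga
    exact mul_le_mul (by linarith [r01.2]) h2 this (by norm_num)
  have m4 := mul_le_mul_of_nonneg_right h1 (abs_nonneg Yn)
  rw [e1]
  have := abs_sub (A * (x + y - 2 * r) + 2 * r * Ga) (a * (E9 / 2 - om r))
  have := abs_add_le (A * (x + y - 2 * r)) (2 * r * Ga)
  linarith
lemma up3 {a D d h K : ℝ} (hh : 0 < h) (ha : |a| ≤ K) (hd : |a| * D ^ 2 / 3 ≤ d) : 4 * (|a| * |D|) ≤ 2 * h * K + 6 / h * d := by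
  have h1 : 2 * |D| ≤ h + D ^ 2 / h := by
    rw [← sub_nonneg, ← sq_abs D, show h + |D| ^ 2 / h - 2 * |D| = (h - |D|) ^ 2 / h by field_simp; ring]; positivity
  have h2 := mul_le_mul_of_nonneg_left h1 (abs_nonneg a)
  have h3 := mul_le_mul_of_nonneg_left hd (by positivity : 0 ≤ 6 / h)
  have h4 := mul_le_mul_of_nonneg_left ha hh.le
  have : 6 / h * (|a| * D ^ 2 / 3) = 2 * (|a| * (D ^ 2 / h)) := by field_simp; ring
  nlinarith
namespace Dsc
variable {P : Par} {n : ℕ} {I : Ini P n} (D : Dsc P n I) (t : ℝ)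
noncomputable def a (j : ℕ) : ℝ := if 0 < j ∧ j < 2 * n then (max (Z2 J0) E8)⁻¹ * Jm (Gh j) else 0
noncomputable def G (j : ℕ) : ℝ := (Yz J0 + Yz j) * Y0 t j - Uc * (om (Yz J0) + om (Yz j)) / 2
noncomputable def dd (j : ℕ) : ℝ := 2 * ((Yz j - Yz J0) * Y0 t j - Uc * (om (Yz j) - om (Yz J0)) / 2)
noncomputable def e (j : ℕ) : ℝ := if 0 < j ∧ j < 2 * n then |1 / Z2 j - 1 / Z2 J0| else Zv t
noncomputable def pk (k : ℕ) : ℝ := n * (2 * Yz k * Kz - (D.G t Jf - D.G t k))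
noncomputable def cc (h : ℝ) (j : ℕ) : ℝ := 2 * h * (Jg * Zv t) + 6 / h * Gj t j + Jg * U8 t j + Jg * h ^ 2
variable {D t}
lemma bd {j : ℕ} (h : ¬(0 < j ∧ j < 2 * n)) : Y0 t j = 0 ∧ Zw t j = 0 := by simp [A, An, a, h]
lemma bdp {j : ℕ} (h : ¬(0 < j ∧ j < 2 * n)) : D.G t j = 0 ∧ Gj t j = 0 := by simp [G, dd, bd h]
lemma pm {j : ℕ} (hj : 0 < j ∧ j < 2 * n) : 0 < Z2 J0 ∧ 0 < Jr t j := ⟨Ul t _ J5, Ul t _ hj.2⟩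
lemma U1 (j : ℕ) : |Uc| * (Yz j - Yz J0) ^ 2 / 3 ≤ Gj t j ∧ |Y0 t j| ≤ |Uc| ∧
    ∀ k, k = j - 1 ∨ k = j → |Y0 t j - Uc * (Yz k - Yz k ^ 2)| ≤ |Uc| * |Yz j - Yz J0| := by
  by_cases h : 0 < j ∧ j < 2 * n
  · have := up1 (S := (max (Z2 J0) E8)⁻¹) (W := Jm (Gh j)) (inv_nonneg.2 ((pm h).2.le.trans Ku)) (U7 t J0) (U7 t j) (A := Y0 t j) (a := Uc)
      (by rw [A, An, if_pos h]) (by rw [a, if_pos h])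
    exact ⟨this.1, this.2.1, fun k hk ↦ this.2.2 _ (hk.imp (congrArg _) (congrArg _))⟩
  · simp [bd h, bdp h]
lemma dd0 (j : ℕ) : 0 ≤ Gj t j := le_trans Jh (U1 j).1
lemma s0 : 0 ≤ Zv t := zero_le_one.trans (D.s1 t)
lemma a_p {k j : ℕ} (hk : k < 2 * n) (hj : j = k ∨ j = k + 1) : |Uc * Kx| ≤ Jg := by
  have hp := Ul t k hk
  by_cases h : 0 < j ∧ j < 2 * n
  · rw [a, if_pos h]
    have h1 : Jr t k ≤ max (Z2 J0) E8 := by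
      rcases hj with rfl | rfl
      · exact le_max_right _ _
      · exact le_max_left _ _
    have h0 := (pm (t := t) (D := D) h).2.trans_le (le_max_right (Z2 J0) _)
    rw [mul_right_comm, abs_mul, abs_of_nonneg (by change 0 < Kx at hp; positivity)]
    refine (mul_le_of_le_one_left Jy ?_).trans (Gz _ (D.xm t j h.2.le))
    rw [← div_eq_inv_mul]; exact div_le_one_of_le₀ h1 h0.le
  · simp [bd h, Y6]
lemma a_s (j : ℕ) : |Uc| ≤ Jg * Zv t := by
  by_cases h : 0 < j ∧ j < 2 * n
  · have h1 := a_p (D := D) (t := t) h.2 (N9 rfl)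
    have hp := (pm (t := t) (D := D) h).2
    rw [abs_mul, abs_of_pos hp, ← le_div_iff₀ hp] at h1
    refine h1.trans ?_
    rw [div_eq_mul_one_div]; exact mul_le_mul_of_nonneg_left (D.hps t h.2).1 Y6
  · rw [(bd h).2, abs_zero]; exact mul_nonneg Y6 s0
lemma e0 (j : ℕ) : 0 ≤ U8 t j := by unfold e; split_ifs; exacts [abs_nonneg _, s0]
lemma a_e {k j : ℕ} (hk : k < 2 * n) (hj : j = k ∨ j = k + 1) : |Uc - 1 / Kx * Jm (Gh j)| ≤ Jg * U8 t j := by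
  have hW := Gz _ (D.xm t j J5)
  have hp : 0 < Jr t k := Ul t k hk
  rw [mul_comm Jg]
  by_cases h : 0 < j ∧ j < 2 * n
  · obtain ⟨p1, p2⟩ := pm (t := t) (D := D) h
    rw [a, e, if_pos h, if_pos h, ← sub_mul, abs_mul]
    refine mul_le_mul ?_ hW Jy Jy
    have hj : k = j - 1 ∨ k = j := by omega
    rcases le_total (Z2 J0) E8 with l | l <;> [rw [max_eq_right l]; rw [max_eq_left l]] <;> rcases hj with e | e <;> rw [e, ← one_div]
    · simp
    · simp
    · rw [abs_sub_comm]
  · rw [(bd h).2, e, if_neg h, zero_sub, abs_neg, abs_mul, abs_of_pos (by positivity : 0 < 1 / Kx)]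
    exact mul_le_mul (D.hps t hk).1 hW Jy s0
lemma X_z {k j : ℕ} (hk : k < 2 * n) (hj : j = k ∨ j = k + 1) {z : ℝ} (hz : z ∈ Icc Z5 (Gh Jf)) :
    |1 / Jr t k * Jm (Jq t j) - 1 / Jr t k * Jm z| ≤ Jg * Jl⁻¹ := by
  have hp : 0 < Jr t k := Ul t k hk
  have hnp : Jc < n := by exact_mod_cast Zp
  rw [← mul_sub, abs_mul, abs_of_pos Jh]
  have h1 : |Gh j - z| ≤ Kx * Jl⁻¹ := by
    rw [p, pp, show Jl * U2 * Jl⁻¹ = Gh Jf - Gh k by field_simp, abs_le]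
    rcases hj with rfl | rfl <;> constructor <;> linarith [hz.1, hz.2]
  have h2 := (W_lip P (Gh j) z).trans (mul_le_mul_of_nonneg_left h1 Y6)
  refine (mul_le_mul_of_nonneg_left h2 Jh).trans (le_of_eq ?_)
  field_simp
lemma cell {h : ℝ} (hh : 0 < h) (hn : Jl⁻¹ = h ^ 2) {k j : ℕ} (hk : k < 2 * n) (hj : j = k ∨ j = k + 1) {z : ℝ} (hz : z ∈ Icc Z5 (Gh Jf)) :
    |Y0 t j - Jm z / Jr t k * (J4 t k - J4 t k ^ 2)| ≤ D.cc t h j ∧ |D.G t j - Jm z / Jr t k * (J4 t k ^ 2 - 4 / 3 * J4 t k ^ 3)| ≤ D.cc t h j := by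
  have r0 := (U7 t k).1
  have r1 := (U7 t k).2
  have u := U1 (D := D) (t := t) j
  have u3 := u.2.2 k J5
  have u4 := up2 (r := Yz k) (U7 t J0) (U7 t j) (by rcases (by omega : k = j - 1 ∨ k = j) with h | h <;> simp [h]) u.2.1 u3
  have u5 := up3 hh (a_s (D := D) (t := t) j) u.1
  have w1 : |Uc - Jm z / Kx| ≤ Jg * U8 t j + Jg * h ^ 2 := by
    have h1 := a_e (D := D) (t := t) hk hj
    have h2 := X_z (D := D) (t := t) hk hj hz
    rw [hn] at h2
    have := abs_sub_le (Uc) (1 / Kx * Jm (Gh j)) (1 / Kx * Jm z)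
    rw [show 1 / Kx * Jm z = Jm z / Kx by ring] at *
    linarith
  have fin : ∀ {F c K : ℝ}, |c| ≤ 1 → |F - Uc * c| ≤ 4 * (|Uc| * |Yz j - Yz J0|) → |F - Jm z / Kx * c| ≤ D.cc t h j := fun {F c K} hc hF ↦ by
    have h1 : |(Uc - Jm z / Kx) * c| ≤ |Uc - Jm z / Kx| := by rw [abs_mul]; exact mul_le_of_le_one_right Jy hc
    have h2 := abs_add_le (F - Uc * c) ((Uc - Jm z / Kx) * c)
    rw [show F - Uc * c + (Uc - Jm z / Kx) * c = F - Jm z / Kx * c by ring] at h2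
    unfold cc; linarith
  constructor
  · refine fin (K := 0) (abs_le.2 ⟨by nlinarith, by nlinarith⟩) (u3.trans ?_)
    have : 0 ≤ |Uc| * |Yz j - Yz J0| := by positivity
    linarith
  · have := pow_le_one₀ r0 r1 (n := 3)
    have := pow_le_one₀ r0 r1 (n := 2)
    have := pow_nonneg r0 3
    have := pow_nonneg r0 2
    have h3 : J4 t k ^ 3 ≤ Yz k ^ 2 := pow_le_pow_of_le_one r0 r1 (by norm_num)
    exact fin (K := 0) (abs_le.2 ⟨by linarith, by linarith⟩) u4
end Dsc
lemma sh2 {n : ℕ} (f : ℕ → ℝ) : ∑k f Jf = ∑k f k + f Jz - f 0 := by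
  have := fsurasuz f Jz
  rw [fsusudi] at this; linarith
namespace Dsc
variable {P : Par} {n : ℕ} {I : Ini P n} (D : Dsc P n I) (t : ℝ)
noncomputable def SD : ℝ := ∑k Gj t k
lemma SDp : ∑k Gj t Jf = Gk t := by
  rw [sh2, (bdp (j := 2 * n) J1).2, (bdp (j := 0) J1).2, SD]; ring
lemma Se : ∑k U8 t k ≤ 2 * Zv t ∧ ∑k U8 t Jf ≤ 2 * Zv t := by
  have hn := Zp
  have e0 : U8 t 0 = Zv t := by simp [e]
  have e2 : U8 t Jz = Zv t := by simp [e]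
  have h : ∑k U8 t Jf ≤ 2 * Zv t := by
    have : ∑k U8 t Jf = TV n U6 + Zv t := by
      rw [show frange Jz = frange (2 * n - 1 + 1) by congr 1; omega, fsurasu, show 2 * n - 1 + 1 = 2 * n by omega, e2, TV]
      congr 1
      refine fsuco rfl fun j hj ↦ ?_
      rw [fmera] at hj
      rw [e, if_pos J5, Nat.add_sub_cancel]
    rw [this, s]
    linarith [P.c2p, TV0 n U6, TL0 n U6]
  refine ⟨?_, h⟩
  rw [sh2, e0, e2] at h; linarith
lemma Sa : ∑k |Zw t Jf - Zw t k| ≤ 6 * Jg * Zv t := by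
  have hnp : Jc < n := by exact_mod_cast Zp
  have h := fsulesu (f := fun k ↦ |Zw t Jf - Zw t k|) (g := fun k ↦ Jg * U8 t Jf + Jg * U8 t k + Jg * Jl⁻¹) fun k (hk : k ∈ frange Jz) ↦ by
    rw [fmera] at hk
    have h1 := a_e (D := D) (t := t) hk (N9 rfl)
    have h2 := a_e (D := D) (t := t) hk (Or.inr rfl)
    have hp : 0 < n * U2 := Ul t k hk
    have h3 := X_z (D := D) (t := t) hk (Or.inr rfl) (z := Gh k) ⟨le_rfl, by have := pos_of_mul_pos_right hp hnp.le; linarith⟩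
    have : |Zw t Jf - Zw t k| ≤ Jg * U8 t Jf + Jg * U8 t k + Jg * Jl⁻¹ := by
      rw [abs_le] at *; constructor <;> linarith [h1.1, h1.2, h2.1, h2.2, h3.1, h3.2]
    exact this
  rw [fsuaddi, fsuaddi, ← fmulsum, ← fmulsum, fsucoz, fcara, nsmul_eq_mul] at h
  have e1 : ((2 * n : ℕ) : ℝ) * (Jg * Jl⁻¹) = 2 * Jg := by push_cast; field_simp
  rw [e1] at h
  have h1 := mul_le_mul_of_nonneg_left (D.Se t).1 Y6
  have h2 := mul_le_mul_of_nonneg_left (D.Se t).2 Y6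
  have h3 := mul_le_mul_of_nonneg_left (D.s1 t) Y6
  linarith
lemma pk_eq (k : ℕ) : D.pk t k = n * (om (Yz k) * (Zw t Jf - Zw t k) - (Gj t k + Gj t Jf) / 2) := by
  unfold pk G dd; rw [Nat.add_sub_cancel]; ring
lemma om_a (k : ℕ) : |om (Yz k) * (Zw t Jf - Zw t k)| ≤ |Zw t Jf - Zw t k| := by
  have := om_01 (U7 t k)
  rw [abs_mul, abs_of_nonneg this.1]; exact mul_le_of_le_one_left Jy this.2
lemma Spk : Jl⁻¹ * ∑k |D.pk t k| ≤ 6 * Jg * Zv t + Gk t := by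
  have hnp : Jc < n := by exact_mod_cast Zp
  have h := fsulesu (f := fun k ↦ Jl⁻¹ * |D.pk t k|) (g := fun k ↦ |Zw t Jf - Zw t k| + Gj t k / 2 + Gj t Jf / 2) fun k (hk : k ∈ frange Jz) ↦ by
    rw [pk_eq, abs_mul, abs_of_pos hnp, inv_mul_cancel_left₀ hnp.ne']
    have h1 := D.om_a t k
    have h2 := dd0 (D := D) (t := t) k
    have h3 := dd0 (D := D) (t := t) Jf
    rw [abs_le] at *; constructor <;> linarith [h1.1, h1.2]
  rw [← fmulsum, fsuaddi, fsuaddi, ← fsumdiv, ← fsumdiv, SDp] at h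
  have := D.Sa t
  rw [← SD] at h
  linarith
lemma SrA : ∑k 2 * Yz k * Kz ≤ 6 * Jg * Zv t - Gk t := by
  have hnp : Jc < n := by exact_mod_cast Zp
  have e1 : ∀ k ∈ frange Jz, 2 * Yz k * Kz ≤ |Zw t Jf - Zw t k| - Gj t k / 2 - Gj t Jf / 2 + (D.G t Jf - D.G t k) := fun k _ ↦ by
    have h := D.pk_eq t k
    rw [pk] at h
    have h := mul_left_cancel₀ hnp.ne' h
    linarith [(abs_le.1 (D.om_a t k)).2]
  have h := fsulesu e1
  rw [fsuaddi, fsusudi, fsusudi, ← fsumdiv, ← fsumdiv, SDp, fsurasuz, (bdp (j := 2 * n) J1).1, (bdp (j := 0) J1).1] at h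
  have := D.Sa t
  rw [← SD] at h
  linarith
lemma Scc {h : ℝ} (hh : 0 < h) (h1 : h ≤ 1) (hn : Jl⁻¹ = h ^ 2) : Jl⁻¹ * ∑k Nt ≤ h * (16 * Jg * Zv t + 12 * Gk t) := by
  have hnp : Jc < n := by exact_mod_cast Zp
  have e2 : Jl * h ^ 2 = 1 := by rw [← hn]; field_simp
  have e1 : ∑k Nt = 2 * n * U9 + 12 / h * Gk t + Jg * Gb := by
    unfold cc
    simp only [fsuaddi, ← fmulsum, SDp, fsucoz, fcara, nsmul_eq_mul]
    rw [← SD]; push_cast; ring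
  have hB := Y6
  have hs := D.s1 t
  have k1 := mul_le_mul_of_nonneg_left (add_le_add (D.Se t).1 (D.Se t).2) hB
  have k2 : h ^ 2 ≤ h := by nlinarith
  rw [e1, hn]
  have e3 : h ^ 2 * (2 * n * U9 + 12 / h * Gk t + Jg * Gb)
      = 2 * (n * h ^ 2) * U9 + 12 * h * Gk t + h ^ 2 * (Jg * Gb) := by field_simp
  rw [e3, e2]
  have k3 := mul_le_mul_of_nonneg_left k1 (sq_nonneg h)
  have k4 := mul_le_mul_of_nonneg_right k2 (mul_nonneg hB (by linarith : 0 ≤ Zv t))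
  have k5 := mul_le_mul_of_nonneg_left k2 hB
  have k6 := mul_le_mul_of_nonneg_left hs (mul_nonneg hB hh.le)
  nlinarith
variable {t}
lemma ca (k : ℕ) : Continuous fun t ↦ Zw t k := by
  unfold a
  split_ifs with h
  · exact Continuous.mul Kv (P.Wcont.comp (Eb k))
  · exact continuous_const
lemma cSD : Continuous fun t ↦ Gk t := by
  unfold SD dd om
  have := D.cA; have := D.ca; have := Ne
  fun_prop
end Dsc
lemma exD (P : Par) : ∃ C, 0 ≤ C ∧ ∀ n (I : Ini P n) (D : Dsc P n I), ∫t t ^ 2 * Ub ≤ C := by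
  obtain ⟨C, hC⟩ := exS2 P
  have T0 := Zk
  refine ⟨max 0 (4 * Ja ^ 2 + Gc * C), le_max_left _ _, fun n I D ↦ le_trans ?_ Ku⟩
  have hnp : Jc < n := by exact_mod_cast Zp
  have hc := D.cs
  have hD := D.cSD
  have cr := Ne
  have q0 : ∀ t, 0 ≤ Jl⁻¹ * ∑k J4 t k ^ 2 := fun t ↦ by positivity
  have q1 : ∀ t, Jl⁻¹ * ∑k J4 t k ^ 2 ≤ 2 := fun t ↦ by
    have := fsulesu fun k (_ : k ∈ frange Jz) ↦ pow_le_one₀ (n := 2) (U7 t k).1 (U7 t k).2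
    simp at this
    rw [← div_eq_inv_mul, div_le_iff₀ hnp]; linarith
  have := grow_int (f := fun t ↦ t ^ 2 * (Jl⁻¹ * ∑k J4 t k ^ 2)) (h := fun t ↦ t ^ 2 * Ub - Gc * (t ^ 2 * Zv t ^ 2)) (C := 4 * Ja) T0
    Zn (fun t ht ↦ (hasDerivAt_pow 2 t).mul ((HasDerivAt.fun_sum fun k _ ↦ (D.dr t ht k).pow 2).const_mul _)) Zn (fun t ht ↦ by
      have h1 : Jl⁻¹ * ∑k ((2:ℕ):ℝ) * Yz k ^ (2 - 1) * Fr P n (Kk Zy) Zy (Yz) k = ∑k 2 * Yz k * Kz := by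
        rw [fmulsum]
        refine fsuco rfl fun k hk ↦ ?_
        rw [Fr, if_pos Ye]
        change _ * (_ * (n * Kz)) = _
        field_simp; norm_num; ring
      rw [h1]
      have h2 := mul_le_mul_of_nonneg_left (D.SrA t) Nx
      have h3 : Zv t ≤ Zv t ^ 2 := by have := D.s1 t; nlinarith
      have h4 := mul_le_mul_of_nonneg_left h3 (mul_nonneg (by have := Y6; linarith : 0 ≤ 6 * Jg + 1) Nx)
      have h5 := mul_le_mul (mul_le_mul_of_nonneg_left ht.2.le zero_le_two) (q1 t) (q0 t) Js
      norm_num at h5 ⊢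
      linarith)
  rw [iinsu (cin Zn _ _) (cin Zn _ _), iincomu] at this
  have h1 := mul_le_mul_of_nonneg_left (hC n I D) (by have := Y6; linarith : 0 ≤ 6 * Jg + 1)
  have h2 := mul_nonneg (sq_nonneg Ja) (q0 Ja)
  beta_reduce at this
  linarith
noncomputable def itp (n : ℕ) (f : ℕ → ℝ) (j : ℕ) (m : ℝ) : ℝ := f 0 + ∑k Nf * cl 1 (n * m - k) ^ j
noncomputable def ix (n : ℕ) (m : ℝ) : ℕ := min ⌊n * m⌋₊ J8
section
variable {n : ℕ} (hn : 1 ≤ n) {f : ℕ → ℝ} {m : ℝ}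
lemma ix_lt (hn : 1 ≤ n) (m : ℝ) : ix n m < 2 * n := by unfold ix; omega
lemma ix_m (hn : 1 ≤ n) (hm : m ∈ Kc) : (ix n m : ℝ) ≤ n * m ∧ n * m ≤ ix n m + 1 ∧ (m < 2 → n * m < ix n m + 1) := by
  have hnp : Jc < n := by exact_mod_cast hn
  have h0 : 0 ≤ n * m := mul_nonneg hnp.le hm.1
  have h1 := Nat.floor_le h0
  have h2 := Nat.lt_floor_add_one (n * m)
  have h3 : (ix n m : ℝ) ≤ (⌊n * m⌋₊ : ℝ) := by exact_mod_cast min_le_left _ _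
  refine ⟨h3.trans h1, ?_⟩
  have key : m < 2 → n * m < ix n m + 1 := fun h ↦ by
    have h4 : ⌊n * m⌋₊ < 2 * n := by rw [Nat.floor_lt h0]; push_cast; nlinarith
    rwa [ix, min_eq_left J5]
  refine ⟨?_, key⟩
  rcases hm.2.lt_or_eq with h | h
  · exact (key h).le
  · have : (2 * n : ℕ) ≤ ⌊n * m⌋₊ := by rw [Nat.le_floor_iff h0, h]; push_cast; linarith
    have e : ix n m + 1 = 2 * n := by unfold ix; omega
    have ep : (ix n m : ℝ) + 1 = 2 * n := by exact_mod_cast e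
    rw [ep, h]; linarith
lemma ix_of {k : ℕ} (hk : k < 2 * n) (h1 : Hj ≤ n * m) (h2 : n * m < k + 1) : ix n m = k := by
  have : ⌊n * m⌋₊ = k := by
    rw [Nat.floor_eq_iff (le_trans (Nat.cast_nonneg k) h1)]; exact ⟨h1, h2⟩
  rw [ix, this]; omega
lemma itp_sum (x : ℝ) (k j N : ℕ) (hj : j ≠ 0) (h1 : Hj ≤ x) (h2 : x ≤ k + 1) :
    (N ≤ k → f 0 + ∑ i ∈ frange N, (f (i + 1) - f i) * cl 1 (x - i) ^ j = f N) ∧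
    (k < N → f 0 + ∑ i ∈ frange N, (f (i + 1) - f i) * cl 1 (x - i) ^ j = f k + (x - k) ^ j * Nf) := by
  induction N with
  | zero => simp
  | succ N ih =>
    rw [fsurasu, ← add_assoc]
    constructor <;> intro h
    · rw [ih.1 J5]
      have : (N:ℝ) + 1 ≤ k := by exact_mod_cast h
      rw [cl, min_eq_left Js, max_eq_right zero_le_one]; ring
    · rcases (Nat.lt_succ_iff.1 h).lt_or_eq with h | h
      · rw [ih.2 h]
        have : Hj + 1 ≤ N := by exact_mod_cast h
        rw [cl, max_eq_left ((min_le_right _ _).trans Js), zero_pow hj]; ring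
      · subst h
        rw [ih.1 le_rfl, cl_of ⟨by linarith, by linarith⟩]; ring
lemma itp_at {j : ℕ} (hj : j ≠ 0) {k : ℕ} (hk : k < 2 * n) (h1 : Hj ≤ n * m) (h2 : n * m ≤ k + 1) :
    itp n f j m = f k + (n * m - k) ^ j * Nf := (itp_sum (n * m) k j Jz hj h1 h2).2 hk
lemma itp_c (j : ℕ) : Continuous (Nu f j) := by unfold itp cl; fun_prop
lemma itp_ix (hn : 1 ≤ n) (hm : m ∈ Kc) : ∃ θ ∈ Icc Jc 1, θ = n * m - ix n m ∧ ∀ f j, j ≠ 0 → itp n f j m = f Jp + θ ^ j * (f Yp - f Jp) := by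
  have h := ix_m hn hm
  exact ⟨_, ⟨by linarith, by linarith⟩, rfl, fun f j hj ↦ itp_at hj Kl h.1 h.2.1⟩
lemma itp_0 (hn : 1 ≤ n) : itp n f 1 0 = f 0 := by
  rw [itp_at (k := 0) one_ne_zero J5 J1 J1]; simp
lemma itp_2 {j : ℕ} (hn : 1 ≤ n) (hj : j ≠ 0) : itp n f j 2 = f Jz := by
  have : ((2 * n - 1 : ℕ) : ℝ) = 2 * n - 1 := by rw [Nat.cast_sub J5]; simp
  rw [itp_at (k := 2 * n - 1) hj J5 (by rw [this]; linarith) (by rw [this]; linarith), this, show 2 * n - 1 + 1 = 2 * n by omega]; ring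
lemma itp_RD' (hn : 1 ≤ n) {j : ℕ} (hj : j ≠ 0) : RD (Nu f j) (fun m ↦ (j * (n * m - ix n m) ^ J0 * n) * (f Yp - f Jp)) := by
  have hnp : Jc < n := by exact_mod_cast hn
  refine ⟨itp_c j, fun m hm ↦ ?_⟩
  have h := ix_m hn ⟨hm.1, hm.2.le⟩
  have h3 := h.2.2 hm.2
  set k := ix n m
  have d : HasDerivAt (fun x : ℝ ↦ f k + (n * x - k) ^ j * Nf) ((j * (n * m - k) ^ J0 * n) * Nf) m := by
    have := ((((hasDerivAt_id m).const_mul Jl).sub_const Hj).pow j).mul_const Nf |>.const_add (f k)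
    exact this.congr_deriv J1
  refine d.hasDerivWithinAt.congr_of_eventuallyEq ?_ (itp_at hj Kl h.1 h.2.1)
  have : m < Jf / n := by rw [lt_div_iff₀ hnp]; linarith
  filter_upwards [Ioo_mem_nhdsGT this] with x hx
  have e1 : n * m ≤ n * x := mul_le_mul_of_nonneg_left hx.1.le hnp.le
  have e2 := (lt_div_iff₀ hnp).1 hx.2
  exact itp_at hj Kl Js Js
lemma itp_RD (hn : 1 ≤ n) {g : ℝ → ℝ} (hg : ∀ m, g m = n * (f Yp - f Jp)) : RD (Nu f 1) g := by
  convert itp_RD' hn one_ne_zero using 2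
  rw [hg]; simp
lemma itp_TD {T : ℝ} {F Fp : ℝ → ℕ → ℝ} (hc : ∀ k, Continuous fun t ↦ F t k) (hd : ∀ t ∈ Ioo 0 T, ∀ k ≤ 2 * n, HasDerivAt (fun t ↦ F t k) (Fp t k) t) (m : ℝ) :
    TD T (fun t ↦ Nu (F t) 1 m) (fun t ↦ Nu (Fp t) 1 m) := by
  unfold itp
  refine ⟨by fun_prop, fun t ht ↦ (hd t ht 0 J5).add (HasDerivAt.fun_sum fun k hk ↦ ?_)⟩
  rw [fmera] at hk
  exact ((hd t ht Jf J5).sub (hd t ht k J5)).mul_const _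
lemma Nice.ofc {T : ℝ} {f : ℝ → ℝ → ℝ} (h : Continuous fun q : ℝˣ ↦ f‡) : Nice T f := by
  obtain ⟨M, hM⟩ := (isCompact_Icc.prod isCompact_Icc).exists_bound_of_continuousOn (s := Nh T ×ˢ Icc Jc 2) h.continuousOn
  exact ⟨h.measurable, M, fun t ht m hm ↦ hM Kb ⟨ht, hm⟩⟩
lemma itp_N (T : ℝ) {F : ℝ → ℕ → ℝ} (hc : ∀ k, Continuous fun t ↦ F t k) (j : ℕ) : Nice T fun t m ↦ Nu (F t) j m := by
  refine Nice.ofc ?_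
  unfold itp cl
  have h : ∀ k, Continuous fun q : ℝˣ ↦ F q.1 k := fun k ↦ (hc k).comp continuous_fst
  have h0 := h 0
  fun_prop
lemma ix_meas : Measurable (ix n) := by
  unfold ix
  exact (Nat.measurable_floor.comp (measurable_const.mul measurable_id)).min measurable_const
lemma ix_N (hn : 1 ≤ n) (T : ℝ) {F : ℝ → ℕ → ℝ} (hc : ∀ k < 2 * n, Continuous fun t ↦ F t k) : Nice T fun t m ↦ F t Jp := by
  have h : ∀ k < 2 * n, ∃ M, ∀ t ∈ Icc 0 T, |F t k| ≤ M := fun k hk ↦ isCompact_Icc.exists_bound_of_continuousOn (hc k hk).continuousOn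
  choose! M hM using h
  have e : (fun q : ℝˣ ↦ F q.1 Gd) = fun q ↦ ∑k (ix n ⁻¹' {k}).indicator (fun _ ↦ Y1) q.2 * F q.1 k := by
    funext q
    rw [Finset.sum_eq_single Gd]
    · simp
    · intro k _ hk
      rw [indicator_of_notMem, zero_mul]
      simpa using hk.symm
    · intro h; exact absurd (fmera.2 (ix_lt hn _)) h
  refine ⟨?_, ∑k |M k|, fun t ht m _ ↦ ?_⟩
  · beta_reduce
    rw [e]
    refine Finset.measurable_fun_sum _ fun k hk ↦ Measurable.mul ?_ ((hc k Ye).measurable.comp measurable_fst)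
    exact (measurable_const.indicator (ix_meas (measurableSet_singleton k))).comp measurable_snd
  · have := ix_lt hn m
    exact (hM _ this t ht).trans ((le_abs_self _).trans (fsilesu (f := fun k ↦ |M k|) (fun k _ ↦ abs_nonneg _) (fmera.2 this)))
lemma ix_ii (hn : 1 ≤ n) (β : ℕ → ℝ) : IntervalIntegrable (fun m ↦ β Jp) volume 0 2 :=
  (ix_N hn 0 (F := fun _ ↦ β) fun _ _ ↦ continuous_const).intm (t := 0) J1
lemma ix_int (hn : 1 ≤ n) (β : ℕ → ℝ) : ∫m β Jp = Jl⁻¹ * ∑k β k := by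
  have hnp : Jc < n := by exact_mod_cast hn
  have := (itp_RD hn (f := fun k ↦ Jl⁻¹ * ∑ i ∈ frange k, β i) (g := fun m ↦ β Jp) fun m ↦ by rw [fsurasu]; field_simp; ring).ftc (ix_ii hn β) le_rfl zero_le_two le_rfl
  rw [this, itp_0 hn, itp_2 hn one_ne_zero]; simp
lemma ix_le (hn : 1 ≤ n) {F : ℝ → ℝ} (hF : IntervalIntegrable F volume 0 2) (β : ℕ → ℝ) (h : ∀ m ∈ Icc Jc 2, F m ≤ β Jp) : ∫m F m ≤ Jl⁻¹ * ∑k β k := by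
  rw [← ix_int hn]
  exact iinmoon zero_le_two hF (ix_ii hn β) h
end
lemma kapI {T : ℝ} (hT : 0 ≤ T) {n : ℕ} (hn : 1 ≤ n) {f : ℝ → ℝ → ℝ} (hf : Nice T f) (β : ℝ → ℕ → ℝ) {g : ℝ → ℝ} (hg : Continuous g)
    (h : ∀ t, ∀ m ∈ Icc Jc 2, Nv m ≤ β t Jp) (hb : ∀ t, Jl⁻¹ * ∑k β t k ≤ g t) :
    ∫ q, f‡ ∂ Y5 ≤ ∫ t in Jc..T, g t := by
  rw [hf.fub hT]
  exact iinmoon hT (hf.intT hT) (hg.intervalIntegrable _ _) fun t ht ↦ (ix_le hn (hf.intm ht) (β t) (h t)).trans (hb t)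
lemma cvx {a b c θ α β : ℝ} (hθ : θ ∈ Ns) (ha : |a - c| ≤ α) (hb : |b - c| ≤ β) : |a + θ ^ 1 * (b - a) - c| ≤ α + β := by
  have e : a + θ ^ 1 * (b - a) - c = (1 - θ) * (a - c) + θ * (b - c) := by ring
  rw [e]
  refine ☾.trans ?_
  rw [abs_mul, abs_mul, abs_of_nonneg hθ.1, abs_of_nonneg (by linarith [hθ.2] : 0 ≤ 1 - θ)]
  have h1 := mul_le_of_le_one_left (abs_nonneg (a - c)) (by linarith [hθ.1] : 1 - θ ≤ 1)
  have h2 := mul_le_of_le_one_left (abs_nonneg (b - c)) hθ.2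
  linarith
lemma cvxp {a b θ α : ℝ} (hθ : θ ∈ Ns) {j : ℕ} (ha : |a| ≤ α) (hb : |b| ≤ α) : |a + θ ^ j * (b - a)| ≤ α := by
  have h0 : 0 ≤ θ ^ j := pow_nonneg hθ.1 j
  have h1 : θ ^ j ≤ 1 := pow_le_one₀ hθ.1 hθ.2
  rw [abs_le] at *
  constructor <;> nlinarith
namespace Dsc
variable {P : Par} {n : ℕ} {I : Ini P n}
lemma SFr (D : Dsc P n I) (t : ℝ) {k : ℕ} (hk : k ≤ 2 * n) : Jl⁻¹ * ∑ i ∈ frange k, Fr P n (Kk Zy) Zy (Yz) i = Y0 t k := by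
  have hnp : Jc < n := by exact_mod_cast Zp
  have : ∀ i ∈ frange k, Fr P n (Kk Zy) Zy (Yz) i = n * (Y0 t (i + 1) - Y0 t i) := fun i hi ↦ by
    rw [fmera] at hi
    rw [Fr, if_pos J5]; rfl
  rw [fsuco rfl this, ← fmulsum, fsurasuz, (bd (j := 0) J1).1]
  field_simp; ring
lemma exM (D : Dsc P n I) : ∃ Dp : Dsc P n I, ∀ t, Jl⁻¹ * ∑k Dp.r t k = 1 := by
  have hnp : Jc < n := by exact_mod_cast Zp
  have hc : Continuous (cl Ja) := by unfold cl; fun_prop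
  have hl : ∀ t ∈ Ioo 0 Ja, ∀ f : ℝ → ℝ, (fun s ↦ f (cl Ja s)) =ᶠ[𝓝 t] f := fun t ht f ↦ by
    filter_upwards [Ioo_mem_nhds ht.1 ht.2] with s hs
    rw [cl_of ⟨hs.1.le, hs.2.le⟩]
  have c0 : cl Ja 0 = 0 := cl_of ⟨le_rfl, Zk⟩
  refine ⟨⟨fun t ↦ Jq (cl Ja t), fun t ↦ J4 (cl Ja t), fun j ↦ (Eb j).comp hc, fun j ↦ (Ne j).comp hc, fun t ↦ D.X0 _, fun t ↦ D.X2 _, fun t ↦ Ul _, fun t ↦ U7 _,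
    fun t ht j ↦ ?_, fun t ht j ↦ ?_, by rw [c0, D.iX], by rw [c0, D.ir]⟩, fun t ↦ ?_⟩
  · rw [cl_of ⟨ht.1.le, ht.2.le⟩]
    exact (D.dX t ht j).congr_of_eventuallyEq (hl t ht fun t ↦ Gh j)
  · rw [cl_of ⟨ht.1.le, ht.2.le⟩]
    exact (D.dr t ht j).congr_of_eventuallyEq (hl t ht fun t ↦ Yz j)
  · have h := const_of (f := fun t ↦ Jl⁻¹ * ∑k J4 t k) (T := Ja) (by have := Ne; fun_prop) (fun t ht ↦ by
      have := (HasDerivAt.fun_sum fun k (_ : k ∈ frange Jz) ↦ D.dr t ht k).const_mul Jl⁻¹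
      rwa [SFr D t le_rfl, (bd J1).1] at this) (cl_mem Zk t)
    refine h.trans ?_
    beta_reduce
    obtain ⟨i1, i2, p1, p2, e1, e2⟩ := Rs P
    rw [D.ir, fmulsum, ← e1, ← I.x0, ← I.x2, ← isuinadin fun k _ ↦ i1.intervalIntegrable]
    exact fsuco rfl fun k hk ↦ by rw [I.hr k Ye]; field_simp
variable (D : Dsc P n I)
lemma cG (k : ℕ) : Continuous fun t ↦ D.G t k := by
  unfold G om
  have := D.cA; have := D.ca; have := Ne
  fun_prop
lemma cpk (k : ℕ) : Continuous fun t ↦ D.pk t k := by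
  unfold pk
  have := D.cA; have := D.cG; have := Ne
  fun_prop
lemma AG (t : ℝ) (j : ℕ) : |Y0 t j| ≤ Jg * Zv t ∧ |D.G t j| ≤ 3 * (Jg * Zv t) := by
  have h1 := a_s (D := D) (t := t) j
  have h2 := (U1 (D := D) (t := t) j).2.1
  refine ⟨h2.trans h1, ?_⟩
  have o1 := om_01 (U7 t j)
  have o2 := om_01 (U7 t J0)
  have r1 := U7 t j
  have r2 := U7 t J0
  have e1 : |(Yz J0 + Yz j) * Y0 t j| ≤ 2 * |Uc| := by
    rw [abs_mul, abs_of_nonneg (add_nonneg r2.1 r1.1)]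
    exact mul_le_mul (by linarith [r1.2, r2.2]) h2 Jy zero_le_two
  have e2 : |Uc * (om (Yz J0) + om (Yz j)) / 2| ≤ |Uc| := by
    rw [mul_div_assoc, abs_mul]
    exact mul_le_of_le_one_right Jy (by rw [abs_of_nonneg Js]; linarith)
  unfold G
  refine ☁.trans ?_
  linarith
lemma Ap (t : ℝ) {k j : ℕ} (hk : k < 2 * n) (hj : j = k ∨ j = k + 1) : |Y0 t j * Kx| ≤ Jg := by
  refine le_trans ?_ (a_p (D := D) (t := t) hk hj)
  rw [abs_mul, abs_mul]; exact mul_le_mul_of_nonneg_right (U1 j).2.1 Jy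
lemma hv2 : ∫ q, Nu (Zm q.1) 1 q.2 ^ 2 ∂ Jd ≤ 2 * ∫t Ky t := by
  have hnp : Jc < n := by exact_mod_cast Zp
  rw [← iincomu]
  refine kapI Zk Zp ((itp_N Ja D.cv 1).pow 2) (fun t k ↦ U4 k ^ 2 + U4 Jf ^ 2) (continuous_const.mul D.cvv) (fun t m hm ↦ ?_) fun t ↦ ?_
  · obtain ⟨θ, h1, -, h2⟩ := itp_ix Zp hm
    rw [h2 _ 1 one_ne_zero, pow_one]
    nlinarith [h1.1, h1.2, mul_nonneg h1.1 (sub_nonneg.2 h1.2), sq_nonneg (U4 Jp - U4 Yp), mul_nonneg (mul_nonneg h1.1 (sub_nonneg.2 h1.2)) (sq_nonneg (U4 Jp - U4 Yp)), mul_nonneg h1.1 (sq_nonneg (U4 Jp)), mul_nonneg (sub_nonneg.2 h1.2) (sq_nonneg (U4 Yp))]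
  · rw [fsuaddi, sh2 fun k ↦ U4 k ^ 2, vv]
    have : Zm t 0 = 0 ∧ Zm t Jz = 0 := by simp [v, Vn]
    rw [this.1, this.2]; apply le_of_eq; ring
lemma hpi : ∫ q, q.1 ^ 2 * |D.pk q.1 Gd| ∂ Jd ≤ Gc * ∫t t ^ 2 * Ub := by
  rw [← iincomu]
  have hs := D.cs; have hd := D.cSD
  refine kapI Zk Zp (f := fun t m ↦ t ^ 2 * |D.pk t Jp|) ((Nice.ofT Zn).mul (ix_N Zp Ja fun k _ ↦ D.cpk k).abs) (fun t k ↦ t ^ 2 * |D.pk t k|) Zn (fun t m hm ↦ le_rfl) fun t ↦ ?_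
  rw [← fmulsum, mul_left_comm, mul_left_comm Gc]
  refine mul_le_mul_of_nonneg_left ((D.Spk t).trans ?_) Nx
  have : 0 ≤ Gk t := fsuno fun k _ ↦ dd0 k
  have := D.s1 t
  have := mul_nonneg Y6 ‹0 ≤ Gk t›
  nlinarith
lemma hAG {h : ℝ} (hh : 0 < h) (h1 : h ≤ 1) (hn : Jl⁻¹ = h ^ 2) (F : ℝ → ℕ → ℝ) (Φ : ℝ → ℝ) (hΦ : Continuous Φ) (hF : ∀ j, Continuous fun t ↦ F t j)
    (hc : ∀ t k j z, k < 2 * n → (j = k ∨ j = k + 1) → z ∈ Icc Z5 (Gh Jf) → |F t j - Jm z / Kx * Φ (Yz k)| ≤ D.cc t h j) :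
    ∫ q, q.1 ^ 2 * |Nu (F q.1) 1 q.2 - Jm (Nu (Jq q.1) 1 q.2) / Jr q.1 Gd * Φ (J4 q.1 Gd)| ∂ Jd
      ≤ h * K3 := by
  rw [← iincomu, ← iincomu]
  have hs := D.cs; have hd := D.cSD
  have Np : Nice Ja fun t m ↦ (Z2 Jp)⁻¹ := ix_N (F := fun t k ↦ (Kx)⁻¹) Zp Ja fun k hk ↦ (D.cp k).inv₀ fun t ↦ (Ul t k hk).ne'
  refine kapI Zk Zp (f := fun t m ↦ t ^ 2 * |Nu (F t) 1 m - Jm Hl / Z2 Jp * Φ (Yz Jp)|)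
    ((Nice.ofT Zn).mul (((itp_N Ja hF 1).sub ((((itp_N Ja Eb 1).comp P.Wcont).mul Np).mul ((ix_N Zp Ja fun k _ ↦ Ne k).comp hΦ))).abs))
    (fun t k ↦ t ^ 2 * Nt) Zn (fun t m hm ↦ ?_) fun t ↦ ?_
  · refine mul_le_mul_of_nonneg_left ?_ Nx
    obtain ⟨θ, h1, -, h2⟩ := itp_ix Zp hm
    have hk := ix_lt Zp m
    have hnp : Jc < n := by exact_mod_cast Zp
    have hx := pos_of_mul_pos_right (show 0 < n * (Gh Yp - Gh Jp) from Ul t _ hk) hnp.le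
    rw [h2 _ 1 one_ne_zero]
    have hz : itp n Zy 1 m ∈ Icc (Gh Jp) (Gh Yp) := by
      rw [h2 _ 1 one_ne_zero, pow_one]
      constructor <;> nlinarith [h1.1, h1.2]
    exact cvx h1 (hc t _ _ _ hk (N9 rfl) hz) (hc t _ _ _ hk (Or.inr rfl) hz)
  · rw [← fmulsum, mul_left_comm]
    have k1 := mul_le_mul_of_nonneg_left (D.Scc t hh h1 hn) Nx
    refine k1.trans ?_
    have : 0 ≤ Gk t := fsuno fun k _ ↦ dd0 k
    have h2 := mul_nonneg Y6 this
    have := D.s1 t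
    have h3 : 16 * Jg * Zv t + 12 * Gk t ≤ (16 * Jg + 12) * Ub := by nlinarith
    have := mul_le_mul_of_nonneg_left h3 (mul_nonneg Nx hh.le)
    linarith
end Dsc
lemma abs_ii {f : ℝ → ℝ} {a b : ℝ} (hab : a ≤ b) : |∫ m in a..b, f m| ≤ ∫ m in a..b, |f m| :=
  intervalIntegral.norm_integral_le_integral_norm (f := f) (μ := volume) hab
section
variable {n : ℕ}
lemma nd (hn : 1 ≤ n) {k : ℕ} (hk : k < 2 * n) : Jc ≤ k / n ∧ (k / n : ℝ) ≤ (k + 1 : ℕ) / n ∧ ((k + 1 : ℕ) / n : ℝ) ≤ 2 := by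
  have hnp : Jc < n := by exact_mod_cast hn
  refine ⟨by positivity, by gcongr; omega, ?_⟩
  rw [div_le_iff₀ hnp]; exact_mod_cast hk
lemma ii_sub {w : ℝ → ℝ} (hw : IntervalIntegrable w volume 0 2) {a b : ℝ} (h0 : 0 ≤ a) (h1 : a ≤ b) (h2 : b ≤ 2) : IntervalIntegrable w volume a b := by
  refine hw.mono_set ?_
  rw [uIcc_of_le h1, uIcc_of_le zero_le_two]
  exact Icc_subset_Icc h0 h2
lemma ix_sum (hn : 1 ≤ n) {w : ℝ → ℝ} (hw : IntervalIntegrable w volume 0 2) (g : ℕ → ℝ) :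
    IntervalIntegrable (fun m ↦ g Jp * w m) volume 0 2 ∧ ∫m g Jp * w m = ∑k g k * ∫ m in (k / n : ℝ)..((k + 1 : ℕ) / n : ℝ), w m := by
  have hnp : Jc < n := by exact_mod_cast hn
  have hcell : ∀ k < 2 * n, ∀ m ∈ Ioo (k / n : ℝ) ((k + 1 : ℕ) / n : ℝ), g Jp * w m = g k * w m := fun k hk m hm ↦ by
    have h1 := (div_lt_iff₀ hnp).1 hm.1
    have h2 := (lt_div_iff₀ hnp).1 hm.2
    push_cast at h2
    rw [ix_of hk Js Js]
  have hi : ∀ k < 2 * n, IntervalIntegrable (fun m ↦ g Jp * w m) volume (k / n : ℝ) ((k + 1 : ℕ) / n : ℝ) := fun k hk ↦ by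
    have h := nd hn hk
    have h1 := (ii_sub hw h.1 h.2.1 h.2.2).const_mul (g k)
    refine h1.congr_ae ?_
    rw [uIoc_of_le h.2.1, ← restrict_Ioo_eq_restrict_Ioc]
    exact (ae_restrict_iff' measurableSet_Ioo).2 (Eventually.of_forall fun m hm ↦ (hcell k hk m hm).symm)
  have h0 : ((0:ℕ) / n : ℝ) = 0 := by simp
  have h2 : ((2 * n : ℕ) / n : ℝ) = 2 := by push_cast; field_simp
  have := isuinadin (a := fun k : ℕ ↦ (k / n : ℝ)) (n := 2 * n) hi
  have ii := IntervalIntegrable.trans_iterate (a := fun k : ℕ ↦ (k / n : ℝ)) (n := 2 * n) hi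
  beta_reduce at this ii
  rw [h0, h2] at this ii
  refine ⟨ii, this.symm.trans (fsuco rfl fun k hk ↦ ?_)⟩
  rw [← iincomu]
  have h := nd hn Ye
  rw [iinofle h.2.1, iinofle h.2.1, integral_Ioc_eq_integral_Ioo, integral_Ioc_eq_integral_Ioo]
  exact setIntegral_congr_fun measurableSet_Ioo fun m hm ↦ hcell k Ye m hm
lemma z_cell (hn : 1 ≤ n) {ζ ζp : ℝ → ℝ} (h : RD ζ ζp) (hi : IntervalIntegrable ζp volume 0 2) {m : ℝ} (hm : m ∈ Kc) :
    |ζ Ge - ζ m| ≤ ∫ x in (ix n m / n : ℝ)..((ix n m + 1 : ℕ) / n : ℝ), |ζp x| := by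
  have hnp : Jc < n := by exact_mod_cast hn
  have hk := ix_lt hn m
  have h1 := nd hn hk
  have h2 := ix_m hn hm
  have a1 : (ix n m / n : ℝ) ≤ m := by rw [div_le_iff₀ hnp]; linarith
  have a2 : m ≤ ((ix n m + 1 : ℕ) / n : ℝ) := by rw [le_div_iff₀ hnp]; push_cast; linarith
  rw [abs_sub_comm, ← h.ftc hi h1.1 a1 hm.2]
  refine (abs_ii a1).trans ?_
  have i1 := (ii_sub hi h1.1 a1 hm.2).abs
  have i2 := (ii_sub hi hm.1 a2 h1.2.2).abs
  rw [← iinadadin i1 i2]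
  linarith [iinno (μ := volume) a2 fun x (_ : x ∈ Icc m _) ↦ abs_nonneg (ζp x)]
lemma z_sup {ζ ζp : ℝ → ℝ} (h : RD ζ ζp) (hi : IntervalIntegrable ζp volume 0 2) (h0 : ζ 0 = 0) {m : ℝ} (hm : m ∈ Kc) : |ζ m| ≤ ∫ x in Jc..2, |ζp x| := by
  have e := h.ftc hi le_rfl hm.1 hm.2
  rw [h0, sub_zero] at e
  rw [← e]
  refine (abs_ii hm.1).trans ?_
  rw [← iinadadin (ii_sub hi le_rfl hm.1 hm.2).abs (ii_sub hi hm.1 hm.2 le_rfl).abs]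
  linarith [iinno (μ := volume) hm.2 fun x (_ : x ∈ Icc m _) ↦ abs_nonneg (ζp x)]
lemma vZ (hn : 1 ≤ n) {v : ℕ → ℝ} {M : ℝ} (hM : ∀ k ≤ 2 * n, |v k| ≤ M) {ζ ζp : ℝ → ℝ} (h : RD ζ ζp) (hi : IntervalIntegrable ζp volume 0 2) (h0 : ζ 0 = 0) (h2 : ζ 2 = 0) :
    |∫m (itp n v 1 m - v Jp) * ζ m| ≤ Jl⁻¹ * M / 2 * ∫ x in Jc..2, |ζp x| := by
  have hnp : Jc < n := by exact_mod_cast hn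
  obtain ⟨Z, hZ⟩ : ∃ Z : ℝ → ℝ, ∀ m, Z m = (2 * Jl)⁻¹ * itp n v 2 m := ⟨_, fun _ ↦ rfl⟩
  have hR := itp_RD' (f := v) hn two_ne_zero
  have RZ : RD Z fun m ↦ Nu v 1 m - v Jp := by
    refine ⟨by rw [funext hZ]; exact continuous_const.mul hR.1, fun m hm ↦ ?_⟩
    rw [funext hZ]
    refine ((hR.2 m hm).const_mul (2 * Jl)⁻¹).congr_deriv ?_
    obtain ⟨θ, k1, k2, k3⟩ := itp_ix hn ⟨hm.1, hm.2.le⟩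
    beta_reduce
    rw [k3 v 1 one_ne_zero, k2]
    field_simp; norm_num; ring
  have Zi : IntervalIntegrable (fun m ↦ Nu v 1 m - v Jp) volume 0 2 := ((itp_c 1).intervalIntegrable _ _).sub (ix_ii hn v)
  have e := h.parts RZ hi Zi
  rw [h0, h2] at e
  simp_rw [mul_comm _ (ζ _)]
  rw [e, zero_mul, zero_mul, sub_zero, zero_sub, abs_neg, ← iincomu]
  refine (abs_ii zero_le_two).trans ?_
  refine iinmoon zero_le_two (hi.mul_continuousOn RZ.1.continuousOn).abs (hi.abs.const_mul _) fun m hm ↦ ?_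
  obtain ⟨θ, k1, k2, k3⟩ := itp_ix hn hm
  have hk := ix_lt hn m
  have := cvxp k1 (j := 2) (hM _ hk.le) (hM _ hk)
  rw [← k3 v 2 two_ne_zero] at this
  rw [abs_mul, mul_comm, hZ, abs_mul, abs_of_pos (by positivity : 0 < (2 * Jl)⁻¹)]
  refine mul_le_mul_of_nonneg_right ?_ Jy
  have := mul_le_mul_of_nonneg_left this (by positivity : 0 ≤ (2 * Jl)⁻¹)
  refine this.trans (le_of_eq ?_)
  field_simp
end
lemma e_Q {h q E B L M S : ℝ} (hM : h * M = q) (h1 : 0 ≤ h) (h2 : h ≤ 1) (hq : 0 ≤ q) (hE : 0 ≤ E) (hB : 0 ≤ B) (hL : 0 ≤ L) (hS : 0 ≤ S) :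
    h ^ 2 * ((M + 2 * B) * S) + S * (2 * E + h ^ 2 * (B + B * L)) + h ^ 2 * M / 2 * S ≤ (2 * E + h * (2 + 3 * B + B * L)) * (1 + q) * S := by
  have e : h ^ 2 * M = h * q := by rw [← hM]; ring
  have e2 : h ^ 2 ≤ h := by nlinarith
  have e3 := mul_le_mul_of_nonneg_right e2 hB
  have e4 := mul_le_mul_of_nonneg_right e2 (mul_nonneg hB hL)
  have e5 : h ^ 2 * ((M + 2 * B) * S) + S * (2 * E + h ^ 2 * (B + B * L)) + h ^ 2 * M / 2 * S = (3 / 2 * (h ^ 2 * M) + 3 * (h ^ 2 * B) + h ^ 2 * (B * L) + 2 * E) * S := by ring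
  rw [e5, e]
  refine mul_le_mul_of_nonneg_right ?_ hS
  have := mul_nonneg h1 hq
  have := mul_nonneg hE hq
  have := mul_nonneg (mul_nonneg h1 hq) hB
  have := mul_nonneg (mul_nonneg h1 hq) (mul_nonneg hB hL)
  nlinarith
namespace Dsc
variable {P : Par} {n : ℕ} {I : Ini P n} (D : Dsc P n I)
lemma dXp (t : ℝ) {k : ℕ} (hk : k < 2 * n) : Jq t k < Jq t Jf := by
  have hnp : Jc < n := by exact_mod_cast Zp
  have := pos_of_mul_pos_right (show 0 < n * U2 from Ul t k hk) hnp.le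
  linarith
lemma Xix (t : ℝ) {m : ℝ} (hm : m ∈ Kc) : itp n Zy 1 m ∈ Icc (Gh Jp) (Gh Yp) := by
  obtain ⟨θ, h1, -, h2⟩ := itp_ix Zp hm
  have := D.dXp t (ix_lt Zp m)
  rw [h2 _ 1 one_ne_zero, pow_one]
  constructor <;> nlinarith [h1.1, h1.2]
lemma vM {h : ℝ} (hh : 0 < h) (hn : Jl⁻¹ = h ^ 2) (t : ℝ) (k : ℕ) (hk : k ≤ 2 * n) : |U4 k| ≤ h⁻¹ * √(Ky t) := by
  have hv : Ky t = h ^ 2 * ∑k Zm t k ^ 2 := by rw [vv, hn]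
  rcases hk.lt_or_eq with hk | rfl
  · have := fsilesu (f := fun k ↦ U4 k ^ 2) (fun k _ ↦ sq_nonneg _) (fmera.2 hk)
    rw [hv, sqrt_mul (sq_nonneg h), sqrt_sq hh.le, inv_mul_cancel_left₀ hh.ne']
    exact abs_le_sqrt this
  · have : Zm t Jz = 0 := by simp [v, Vn]
    rw [this, abs_zero]; positivity
noncomputable def c (t : ℝ) (k : ℕ) : ℝ := U4 k + Ea Z5 + Yz k * Jm Z5
lemma Q1 (t : ℝ) {ζ ζp : ℝ → ℝ} (h : RD ζ ζp) (hi : IntervalIntegrable ζp volume 0 2) (h0 : ζ 0 = 0) (h2 : ζ 2 = 0) :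
    ∫m ζp m * (Jv * Z2 Jp ^ Jk) = ∫m D.c t Jp * ζ Ge := by
  have hn := Zp
  have hnp : Jc < n := by exact_mod_cast Zp
  have e := (ix_sum hn hi fun k ↦ U3 (Kx)).2
  simp_rw [mul_comm (ζp _)]
  change ∫m pr P (Z2 Jp) * ζp m = _
  rw [e, ix_int hn fun k ↦ D.c t k * ζ Gf]
  have e1 : ∀ k ∈ frange Jz, U3 (Kx) * ∫ m in (k / n : ℝ)..((k + 1 : ℕ) / n : ℝ), ζp m = U3 (Kx) * (ζ ((k + 1 : ℕ) / n) - ζ Gf) := fun k hk ↦ by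
    have := nd hn Ye
    rw [h.ftc hi this.1 this.2.1 this.2.2]
  rw [fsuco rfl e1, abel0 (fun k ↦ U3 (Kx)) (fun k ↦ ζ Gf) hn (by simpa using h0) (by push_cast; rw [mul_div_cancel_right₀ _ hnp.ne']; exact h2)]
  rw [show frange Jz = frange (2 * n - 1 + 1) by congr 1; omega, Finset.sum_range_succ']
  rw [Nat.cast_zero, zero_div, h0, mul_zero, add_zero, fmulsum, ← Finset.sum_neg_distrib]
  refine fsuco rfl fun j hj ↦ ?_
  rw [fmera] at hj
  rw [c, v, Vn, if_pos J5, Nat.add_sub_cancel]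
  field_simp; ring
lemma bk {x y z : ℝ} (h1 : x ≤ z) (h2 : z ≤ y) : |Zq x - Zq z| ≤ ∫ s in x..y, |Uv s| := by
  have e : Zq z - Zq x = ∫ s in x..z, Uv s := by
    rw [P.hb z, P.hb x, ← iinadadin (a := 0) (b := x) (c := z) P.hk.intervalIntegrable P.hk.intervalIntegrable]; ring
  rw [abs_sub_comm, e]
  refine (abs_ii h1).trans ?_
  rw [← iinadadin (a := x) (b := z) (c := y) P.hk.abs.intervalIntegrable P.hk.abs.intervalIntegrable]
  linarith [iinno (μ := volume) h2 fun s _ ↦ abs_nonneg (Uv s)]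
lemma hQ {h : ℝ} (hh : 0 < h) (h1 : h ≤ 1) (hn : Jl⁻¹ = h ^ 2) {t : ℝ} (ht : t ∈ Ioc 0 Ja) {ζ ζp : ℝ → ℝ} (hζ : RD ζ ζp) (hi : IntervalIntegrable ζp volume 0 2)
    (h0 : ζ 0 = 0) (h2 : ζ 2 = 0) :
    |(∫m ζp m * (Jv * Jr t Jp ^ Jk)) -
      ∫m (Nu (U4) 1 m + Zq Hl + Yz Jp * Jm Hl) * ζ m| ≤
      (2 * en P n + h * Hm) * (1 + √(Ky t)) * ∫m |ζp m| := by
  have hn1 := Zp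
  obtain ⟨S, hS⟩ : ∃ S, S = ∫m |ζp m| := ⟨_, rfl⟩
  have S0 : 0 ≤ S := hS ▸ iinno (μ := volume) zero_le_two fun s _ ↦ abs_nonneg (ζp s)
  have hM := D.vM hh hn t
  obtain ⟨M, eM⟩ : ∃ M, M = h⁻¹ * √(Ky t) := ⟨_, rfl⟩
  rw [← eM] at hM
  have hMq : h * M = √(Ky t) := by rw [eM]; field_simp
  obtain ⟨w, hw⟩ : ∃ w : ℝ → ℝ, ∀ m, w m = Nu (U4) 1 m + Zq Hl + Yz Jp * Jm Hl := ⟨_, fun _ ↦ rfl⟩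
  obtain ⟨z, hz⟩ : ∃ z : ℕ → ℝ, ∀ k : ℕ, z k = ∫ x in (k / n : ℝ)..((k + 1 : ℕ) / n : ℝ), |ζp x| := ⟨_, fun _ ↦ rfl⟩
  have zs : ∑k z k = S := by
    have := (ix_sum hn1 hi.abs fun _ ↦ 1).2
    simp only [one_mul] at this
    rw [hS, this]; exact fsuco rfl fun k _ ↦ hz k
  have wi : IntervalIntegrable (fun m ↦ w m * ζ m) volume 0 2 := by
    refine IntervalIntegrable.mul_continuousOn ?_ hζ.1.continuousOn
    rw [funext hw]
    exact (((itp_N Ja D.cv 1).add ((itp_N Ja Eb 1).comp P.bcont)).add ((ix_N hn1 Ja fun k _ ↦ Ne k).mul ((itp_N Ja Eb 1).comp P.Wcont))).intm ⟨ht.1.le, ht.2⟩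
  have ci := ix_ii hn1 fun k ↦ D.c t k * ζ Gf
  have vi : IntervalIntegrable (fun m ↦ Kq * ζ m) volume 0 2 :=
    (((itp_c 1).intervalIntegrable _ _).sub (ix_ii hn1 _)).mul_continuousOn hζ.1.continuousOn
  have key := vZ hn1 hM hζ hi h0 h2
  rw [D.Q1 t hζ hi h0 h2]
  simp_rw [← hw]
  have e1 : (∫m D.c t Jp * ζ Ge) - ∫m w m * ζ m =
      (∫m (D.c t Jp * ζ Ge - w m * ζ m + Kq * ζ m)) - ∫m Kq * ζ m := by
    rw [iinad (ci.sub wi) vi, iinsu ci wi]; ring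
  rw [e1]
  refine ☁.trans ?_
  have b1 := abs_ii (f := fun m ↦ D.c t Jp * ζ Ge - w m * ζ m + Kq * ζ m) (zero_le_two (α := ℝ))
  have b2 := ix_le hn1 ((ci.sub wi).add vi).abs (fun k ↦ (M + 2 * Jg) * z k + S * (en P n + (∫ s in Jq t k..D.X t Jf, |Uv s|) + Jg * U2)) fun m hm ↦ by
    have hk := ix_lt hn1 m
    set k := ix n m with hkdef
    have x1 := D.Xix t hm
    rw [← hkdef] at x1
    set x := Nu Zy 1 m
    have xk := D.xm t k hk.le
    have r01 := U7 t k
    have c1 : |D.c t k| ≤ M + 2 * Jg := by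
      unfold c
      have a1 := hM k hk.le
      have a2 := bn_B P n Z5
      have a3 := Gz _ xk
      have a4 : |Yz k * Jm Z5| ≤ Jg := by
        rw [abs_mul, abs_of_nonneg r01.1]; exact (mul_le_of_le_one_left Jy r01.2).trans a3
      have := abs_add_three (U4 k) (Ea Z5) (Yz k * Jm Z5)
      linarith
    have z1 := z_cell hn1 hζ hi hm
    rw [← hkdef, ← hz] at z1
    have z2 := z_sup hζ hi h0 hm
    rw [← hS] at z2
    have d1 := bn_b P n Z5
    have d2 := bk (P := P) x1.1 x1.2
    have d3 : |Yz k * (Jm Z5 - Jm x)| ≤ Jg * U2 := by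
      rw [abs_mul, abs_of_nonneg r01.1]
      refine (mul_le_of_le_one_left Jy r01.2).trans ((W_lip P _ _).trans (mul_le_mul_of_nonneg_left ?_ Y6))
      rw [abs_sub_comm, abs_of_nonneg (by linarith [x1.1])]; linarith [x1.2]
    have e2 : D.c t k * ζ Gf - w m * ζ m + (Nu (U4) 1 m - U4 k) * ζ m = D.c t k * (ζ Gf - ζ m) + ζ m * ((Ea Z5 - Zq Z5) + (Zq Z5 - Zq x) + Yz k * (Jm Z5 - Jm x)) := by
      rw [hw, c]; ring
    change |D.c t k * ζ Gf - w m * ζ m + (Nu (U4) 1 m - U4 k) * ζ m| ≤ _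
    rw [e2]
    refine ☾.trans (add_le_add ?_ ?_)
    · rw [abs_mul]; exact mul_le_mul c1 z1 Jy (☆.trans c1)
    · rw [abs_mul]
      refine mul_le_mul z2 ?_ Jy S0
      have := abs_add_three (Ea Z5 - Zq Z5) (Zq Z5 - Zq x) (Yz k * (Jm Z5 - Jm x))
      linarith
  have kB : ∑k ∫ s in Jq t k..D.X t Jf, |Uv s| ≤ Jg := by
    rw [isuinadin fun k _ ↦ P.hk.abs.intervalIntegrable, D.X0, D.X2, iinofle P.hL.le]
    have := setIntegral_le_integral (s := Ioc 0 Je) P.hk.abs (Eventually.of_forall fun x ↦ abs_nonneg (Uv x))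
    linarith [P.hbB, abs_nonneg (Zq 0)]
  have kX : ∑k U2 = Je := by rw [fsurasuz, D.X0, D.X2, sub_zero]
  rw [fsuaddi, ← fmulsum, ← fmulsum, zs, fsuaddi, fsuaddi, ← fmulsum, kX, fsucoz, fcara, nsmul_eq_mul] at b2
  have hnp : Jc < n := by exact_mod_cast Zp
  have e4 : h ^ 2 * ((2 * n : ℕ) * en P n) = 2 * en P n := by rw [← hn]; push_cast; field_simp
  rw [hn] at b2 key
  rw [← hS] at key ⊢
  refine le_trans ?_ (e_Q hMq hh.le h1 (sqrt_nonneg _) (en_0 P n) Y6 P.hL.le S0)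
  refine add_le_add ((b1.trans b2).trans ?_) key
  have k5 := mul_le_mul_of_nonneg_left kB (mul_nonneg (sq_nonneg h) S0)
  have k6 : h ^ 2 * ((M + 2 * Jg) * S + S * ((2 * n : ℕ) * en P n + ∑k (∫ s in Jq t k..D.X t Jf, |Uv s|) + Jg * Je))
    = h ^ 2 * ((M + 2 * Jg) * S) + S * (h ^ 2 * ((2 * n : ℕ) * en P n)) + h ^ 2 * S * (∑k ∫ s in Jq t k..D.X t Jf, |Uv s|) + h ^ 2 * S * (Jg * Je) := by ring
  rw [k6, e4]
  linarith
end Dsc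
namespace Dsc
variable {P : Par} {n : ℕ} {I : Ini P n} (D : Dsc P n I)
lemma ini {c : ℕ → ℝ} (hc : ∀ k, c k ∈ Ns) {R : ℝ → ℝ} (Ri : Integrable R) (R0 : ∀ x, 0 ≤ R x) (hR : ∀ k < 2 * n, ∫ y in Yb k..I.x Jf, R y = c k / n)
    {φ : ℝ → ℝ} {K : ℝ} (hφ : Continuous φ) (hK : ∀ x ∈ Icc 0 Je, ∀ y ∈ Icc 0 Je, |φ x - φ y| ≤ K * |x - y|) :
    |(∫m c Jp * φ (itp n (Jq 0) 1 m)) - ∫ x in Jc..P.L, R x * φ x| ≤ 2 * Jl⁻¹ * Je * K := by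
  have hn := Zp
  have hnp : Jc < n := by exact_mod_cast Zp
  have hx : Jq 0 = Yb := D.iX
  have K0 : 0 ≤ K := by
    have := ☆.trans (hK Je ⟨P.hL.le, le_rfl⟩ 0 ⟨le_rfl, P.hL.le⟩)
    rw [sub_zero, abs_of_pos Uw] at this
    exact nonneg_of_mul_nonneg_left this Uw
  have kX : ∑k K * (Yb Jf - Yb k) = K * Je := by rw [← fmulsum, fsurasuz, I.x0, I.x2, sub_zero]
  have i1 : IntervalIntegrable (fun m ↦ c Jp * φ (Nu (Jq 0) 1 m)) volume 0 2 := (ix_ii hn c).mul_continuousOn (hφ.comp (itp_c 1)).continuousOn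
  have i2 := ix_ii hn fun k ↦ c k * φ Gr
  have s1 : |(∫m c Jp * φ (Nu (Jq 0) 1 m)) - Jl⁻¹ * ∑k c k * φ Gr| ≤ Jl⁻¹ * (K * Je) := by
    rw [← ix_int hn fun k ↦ c k * φ Gr, ← iinsu i1 i2, ← kX]
    refine (abs_ii zero_le_two).trans (ix_le hn (i1.sub i2).abs (fun k ↦ K * (Yb Jf - Yb k)) fun m hm ↦ ?_)
    have hk := ix_lt hn m
    have x1 := D.Xix 0 hm
    rw [hx] at x1 ⊢
    have h1 := I.xm Jp
    have h2 := I.xm Yp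
    rw [← mul_sub, abs_mul, abs_of_nonneg (hc _).1]
    refine (mul_le_of_le_one_left Jy (hc _).2).trans ((hK _ ⟨h1.1.trans x1.1, x1.2.trans h2.2⟩ _ h1).trans (mul_le_mul_of_nonneg_left ?_ K0))
    rw [abs_of_nonneg (by linarith [x1.1])]; linarith [x1.2]
  have Rφ : ∀ a b, IntervalIntegrable (fun x ↦ R x * φ x) volume a b := fun a b ↦ Ri.intervalIntegrable.mul_continuousOn hφ.continuousOn
  have s2 : |(∫ x in Jc..P.L, R x * φ x) - Jl⁻¹ * ∑k c k * φ Gr| ≤ Jl⁻¹ * (K * Je) := by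
    rw [← kX, fmulsum, fmulsum, ← I.x2, ← I.x0, ← isuinadin fun k _ ↦ Rφ _ _, ← fsusudi]
    refine (Finset.abs_sum_le_sum_abs _ _).trans (fsulesu fun k hk ↦ ?_)
    rw [fmera] at hk
    have hm := I.mono k hk
    have h1 := I.xm k
    have h2 := I.xm Jf
    have e : Jl⁻¹ * (c k * φ Gr) = ∫ x in Yb k..I.x Jf, R x * φ Gr := by
      rw [iinmuco, hR k hk]; field_simp
    rw [e, ← iinsu (Rφ _ _) (Ri.intervalIntegrable.mul_const _)]
    have h3 : ∫ x in Yb k..I.x Jf, |R x * φ x - R x * φ Gr| ≤ ∫ x in Yb k..I.x Jf, R x * (K * (Yb Jf - Yb k)) := by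
      refine iinmoon hm.le ((Rφ _ _).sub (Ri.intervalIntegrable.mul_const _)).abs (Ri.intervalIntegrable.mul_const _) fun x hx ↦ ?_
      rw [← mul_sub, abs_mul, abs_of_nonneg (R0 x)]
      refine mul_le_mul_of_nonneg_left ((hK _ ⟨h1.1.trans hx.1, hx.2.trans h2.2⟩ _ h1).trans (mul_le_mul_of_nonneg_left ?_ K0)) (R0 x)
      rw [abs_of_nonneg (by linarith [hx.1])]; linarith [hx.2]
    refine (abs_ii hm.le).trans (h3.trans ?_)
    rw [iinmuco, hR k hk, div_eq_inv_mul]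
    refine mul_le_mul_of_nonneg_right (mul_le_of_le_one_right Jh (hc k).2) (mul_nonneg K0 Js)
  rw [abs_le] at *
  constructor <;> linarith [s1.1, s1.2, s2.1, s2.2]
end Dsc
lemma exApprox (P : Par) : ∃ C K, ∀ n, 1 ≤ n → Nonempty (Approx P C (2 * en P n + √ Jl⁻¹ * K)) := by
  obtain ⟨C1, hC1⟩ := exS2 P
  obtain ⟨C2, hC2⟩ := exV2 P
  obtain ⟨C3, C30, hC3⟩ := exD P
  have B0 := Y6; have T0 := Zk; have hL := P.hL.le
  have a1 := abs_nonneg C1; have a2 := abs_nonneg C2; have a1p := le_abs_self C1; have a2p := le_abs_self C2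
  have m1 := mul_nonneg B0 C30
  have m2 := mul_nonneg B0 hL
  obtain ⟨C, hC⟩ : ∃ C, C = |C1| + 2 * |C2| + 3 * Jg + Gc * C3 + 2 * Ja := ⟨_, rfl⟩
  obtain ⟨K, hK⟩ : ∃ K, K = Hm + (16 * Jg + 12) * C3 + 2 * Je := ⟨_, rfl⟩
  refine ⟨C, K, fun n hn ↦ ?_⟩
  obtain ⟨I⟩ := exIni P hn
  obtain ⟨D₀⟩ := exDsc I
  obtain ⟨D, hD⟩ := D₀.exM
  have hnp : Jc < n := by exact_mod_cast Zp
  obtain ⟨h, eh⟩ : ∃ h, h = √ Jl⁻¹ := ⟨_, rfl⟩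
  have hh : 0 < h := by rw [eh]; positivity
  have hsq : Jl⁻¹ = h ^ 2 := by rw [eh, sq_sqrt Jh]
  have h1 : h ≤ 1 := by
    rw [eh, ← Real.sqrt_one]; exact sqrt_le_sqrt (inv_le_one_of_one_le₀ (by exact_mod_cast hn))
  rw [← eh]
  have E0 := en_0 P n
  have Cs := hC1 n I D; have Cv := hC2 n I D; have Cd := hC3 n I D
  have cs := D.cs
  have hAGC : h * K3 ≤ 2 * en P n + h * K := by
    have := mul_le_mul_of_nonneg_left Cd (by linarith : 0 ≤ 16 * Jg + 12)
    have : h * K3 ≤ h * K := mul_le_mul_of_nonneg_left (by rw [hK]; linarith) hh.le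
    linarith
  have cS : ∀ k, Continuous fun t ↦ Jl⁻¹ * ∑ i ∈ frange k, J4 t i := fun k ↦ by have := Ne; fun_prop
  have hin : ∀ Kp : ℝ, 0 ≤ Kp → 2 * Jl⁻¹ * Je * Kp ≤ (2 * en P n + h * K) * Kp := fun Kp h0 ↦ by
    refine mul_le_mul_of_nonneg_right ?_ h0
    rw [hsq, hK]
    have : h ^ 2 ≤ h := by nlinarith
    have := mul_le_mul_of_nonneg_right this hL
    have : 0 ≤ h * (Hm + (16 * Jg + 12) * C3) := mul_nonneg hh.le Js
    linarith
  have hK0 : ∀ (φ : ℝ → ℝ) (K : ℝ), (∀ x ∈ Icc 0 Je, ∀ y ∈ Icc 0 Je, |φ x - φ y| ≤ K * |x - y|) → 0 ≤ K := fun φ K hK ↦ by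
    have := ☆.trans (hK Je ⟨hL, le_rfl⟩ 0 ⟨le_rfl, hL⟩)
    rw [sub_zero, abs_of_pos Uw] at this
    exact nonneg_of_mul_nonneg_left this Uw
  obtain ⟨r1, r2, p1, p2, -, -⟩ := Rs P
  have conv : ∀ F G φ : ℝ → ℝ, (∀ x ∈ Ioo 0 Je, F x = G x) → ∫ x in Ioo 0 Je, G x * φ x = ∫ x in Jc..P.L, F x * φ x := fun F G φ hFG ↦ by
    rw [iinofle hL, integral_Ioc_eq_integral_Ioo]
    exact setIntegral_congr_fun measurableSet_Ioo fun x hx ↦ by beta_reduce; rw [hFG x hx]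
  have A02 : ∀ t, Y0 t 0 = 0 ∧ Y0 t Jz = 0 := fun t ↦ ⟨(Dsc.bd J1).1, (Dsc.bd J1).1⟩
  refine ⟨⟨fun t m ↦ Z2 Jp, fun t m ↦ Yz Jp, fun t m ↦ Fr P n (Kk Zy) Zy (Yz) Jp, fun t ↦ Nu Zy 1, fun t ↦ Nu (U4) 1,
    fun t ↦ Nu (fun k ↦ Jl⁻¹ * ∑ i ∈ frange k, Yz i) 1, fun t ↦ Nu (Y0 t) 1, fun t ↦ Nu (D.G t) 1, fun t m ↦ D.pk t Jp, Zv, fun t ↦ 1 + √(Ky t),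
    ix_N hn _ fun k _ ↦ D.cp k, ix_N hn _ fun k _ ↦ Ne k, ?_, itp_N _ Eb 1, itp_N _ D.cv 1, itp_N _ cS 1, itp_N _ D.cA 1, itp_N _ D.cG 1, ix_N hn _ fun k _ ↦ D.cpk k,
    fun t m ↦ Ul t _ Kl, fun t m ↦ (U7 t _).1, fun t m ↦ (U7 t _).2, fun t ↦ itp_RD hn fun m ↦ rfl, fun t ↦ by rw [itp_0 hn, D.X0],
    fun t ↦ by rw [itp_2 hn one_ne_zero, D.X2], itp_TD Eb fun t ht k _ ↦ D.dX t ht k, fun t ↦ itp_RD hn fun m ↦ ?_, fun t ↦ by rw [itp_0 hn]; simp,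
    fun t ↦ by rw [itp_2 hn one_ne_zero, hD t], itp_TD cS fun t ht k hk ↦ ?_, fun t ↦ itp_RD hn fun m ↦ ?_, fun t ↦ by rw [itp_0 hn, (A02 t).1], fun t ↦ by rw [itp_2 hn one_ne_zero, (A02 t).2],
    fun m ↦ ⟨Ne _, fun t ht ↦ D.dr t ht _⟩, fun t ↦ itp_RD hn fun m ↦ ?_, D.cs, D.s1, fun t m ↦ (D.hps t Kl).1, fun t m ↦ (D.hps t Kl).2,
    by linarith, ?_, fun t m hm ↦ ?_, fun t m hm ↦ ?_, fun t m hm ↦ ?_, ?_, ?_, ?_, continuous_const.add D.cvv.sqrt, fun t ↦ by positivity, ?_, fun t ht ζ ζp hζ hi h0 h2 ↦ ?_, fun φ Kp hφ hKp ↦ ?_, fun φ Kp hφ hKp ↦ ?_⟩⟩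
  · refine ix_N hn _ fun k hk ↦ ?_
    unfold Fr
    simp only [if_pos hk]
    exact continuous_const.mul ((D.cA Jf).sub (D.cA k))
  · rw [fsurasu]; field_simp; ring
  · have := (HasDerivAt.fun_sum fun i (_ : i ∈ frange k) ↦ D.dr t ht i).const_mul Jl⁻¹
    rwa [D.SFr t hk] at this
  · rw [Fr, if_pos Kl]; rfl
  · rw [Fr, if_pos Kl, Dsc.pk, Dsc.A, Dsc.A]
    change 2 * Yz Jp * (n * (An P n U6 Zy (Yz) Yp - An P n U6 Zy (Yz) Jp)) - _ = _
    ring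
  · exact (D.hv2).trans Js
  · obtain ⟨θ, k1, -, k3⟩ := itp_ix hn hm
    rw [k3 _ 1 one_ne_zero]
    refine (cvxp k1 (D.AG t _).1 (D.AG t _).1).trans (mul_le_mul_of_nonneg_right ?_ Dsc.s0)
    linarith
  · obtain ⟨θ, k1, -, k3⟩ := itp_ix hn hm
    rw [k3 _ 1 one_ne_zero]
    refine (cvxp k1 (D.AG t _).2 (D.AG t _).2).trans ?_
    rw [← mul_assoc]
    refine mul_le_mul_of_nonneg_right ?_ Dsc.s0
    linarith
  · obtain ⟨θ, k1, -, k3⟩ := itp_ix hn hm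
    rw [k3 _ 1 one_ne_zero]
    have := cvxp k1 (j := 1) (D.Ap t Kl (N9 rfl)) (D.Ap t Kl (Or.inr rfl))
    rw [add_mul, mul_assoc, sub_mul]
    exact this.trans Js
  · refine D.hpi.trans ?_
    have := mul_le_mul_of_nonneg_left Cd (by linarith : 0 ≤ 6 * Jg + 1)
    linarith
  · exact (D.hAG hh h1 hsq Y0 (fun r ↦ r - r ^ 2) Zn D.cA fun t k j z hk hj hz ↦ (Dsc.cell hh hsq hk hj hz).1).trans hAGC
  · exact (D.hAG hh h1 hsq D.G (fun r ↦ r ^ 2 - 4 / 3 * r ^ 3) Zn D.cG fun t k j z hk hj hz ↦ (Dsc.cell hh hsq hk hj hz).2).trans hAGC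
  · have : ∫t (1 + √(Ky t)) ^ 2 ≤ ∫t (2 + 2 * Ky t) := by
      refine iinmoon T0 (cin ((continuous_const.add D.cvv.sqrt).pow 2) _ _) (cin (continuous_const.add (continuous_const.mul D.cvv)) _ _) fun t _ ↦ ?_
      have v0 : 0 ≤ Ky t := mul_nonneg Jh (fsuno fun k _ ↦ sq_nonneg _)
      have := sq_sqrt v0
      nlinarith [sq_nonneg (1 - √(Ky t))]
    refine this.trans ?_
    rw [iinad (f := fun _ ↦ (2:ℝ)) (g := fun t ↦ 2 * Ky t) intervalIntegrable_const (cin (continuous_const.mul D.cvv) _ _), iincomu]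
    simp
    linarith
  · refine (D.hQ hh h1 hsq ht hζ hi h0 h2).trans ?_
    refine mul_le_mul_of_nonneg_right (mul_le_mul_of_nonneg_right ?_ Jh) (iinno (μ := volume) zero_le_two fun s _ ↦ abs_nonneg (ζp s))
    refine add_le_add le_rfl (mul_le_mul_of_nonneg_left ?_ hh.le)
    rw [hK]; linarith
  · have := D.ini (c := J4 0) (U7 0) r1 p1 (fun k hk ↦ by rw [I.hr k hk, D.ir]) hφ hKp
    rw [conv E7 P.ρ1 φ fun x hx ↦ indicator_of_mem hx _]
    exact this.trans (hin Kp (hK0 φ Kp hKp))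
  · have := D.ini (c := fun _ ↦ 1) (fun _ ↦ by simp) (r1.add r2) (fun x ↦ add_nonneg (p1 x) (p2 x)) (fun k hk ↦ I.hσ k hk) hφ hKp
    rw [conv (E7 + P.R2) (fun x ↦ P.ρ1 x + P.ρ2 x) φ fun x hx ↦ by simp only [Pi.add_apply]; rw [Par.R1, Par.R2, indicator_of_mem hx, indicator_of_mem hx]]
    simp only [one_mul] at this
    exact this.trans (hin Kp (hK0 φ Kp hKp))
lemma primD {L : ℝ} (hL : 0 < L) {u : ℝ → ℝ} (hd : ∀ x ∈ Ioo 0 L, DifferentiableAt ℝ u x) (hi : IntegrableOn (deriv u) Ef) :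
    ∃ (c : ℝ) (k : ℝ → ℝ), Integrable k ∧ (∀ x ∈ Ioo 0 L, k x = deriv u x) ∧ ∀ x ∈ Ioo 0 L, u x = c + ∫y k y := by
  have ki : Integrable (indicator Ef (deriv u)) := hi.integrable_indicator measurableSet_Ioo
  refine ⟨u (L / 2) - ∫ y in Jc..(L / 2), indicator Ef (deriv u) y, _, ki, fun x hx ↦ indicator_of_mem hx _, fun x hx ↦ ?_⟩
  have hs : uIcc (L / 2) x ⊆ Ioo 0 L := by
    intro y hy
    have := (ordConnected_Ioo (a := Jc) (b := L)).uIcc_subset (⟨by linarith, by linarith⟩ : L / 2 ∈ Ioo 0 L) hx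
    exact this hy
  have h1 : ∫ y in (L / 2)..x, indicator Ef (deriv u) y = u x - u (L / 2) := by
    refine iineqsuofha (fun y hy ↦ ?_) ki.intervalIntegrable
    rw [indicator_of_mem (hs hy)]
    exact (hd y (hs hy)).hasDerivAt
  have := iinadadin (ki.intervalIntegrable (a := 0) (b := L / 2)) (ki.intervalIntegrable (a := L / 2) (b := x))
  linarith
lemma law {f : ℝ → ℝ} (hf : PressureLaw f) : ∃ α lam : ℝ, 0 < α ∧ α ≤ 1 ∧ 0 < lam ∧
    (∀ s, 0 < s → gfun f s = lam * (s ^ α - 1)) ∧ (α = 1 → ∀ s, 0 < s → f s = lam * s * rlog s) := by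
  have key : ∀ (α lam : ℝ) (fp : ℝ → ℝ), 0 < α → (∀ z, 0 < z → HasDerivAt f (fp z) z) → (∀ z, 0 < z → HasDerivAt fp (lam * α * z ^ (α - 2)) z) →
      ∀ s, 0 < s → gfun f s = lam * (s ^ α - 1) := by
    intro α lam fp hα h1 h2 s hs
    have h3 : ∀ z, 0 < z → deriv (deriv f) z = lam * α * z ^ (α - 2) := fun z hz ↦ by
      have : deriv f =ᶠ[𝓝 z] fp := by
        filter_upwards [lt_mem_nhds hz] with y hy using (h1 y hy).deriv
      rw [this.deriv_eq, (h2 z hz).deriv]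
    have h4 : gfun f s = ∫ z in Y1..s, lam * α * z ^ (α - 1) := by
      refine iincoz fun z hz ↦ ?_
      have hz0 : 0 < z := lt_of_lt_of_le (lt_min one_pos hs) hz.1
      beta_reduce
      rw [h3 z hz0, show α - 1 = (α - 2) + 1 by ring, rpow_add_one hz0.ne']; ring
    rw [h4, iincomu, integral_rpow (N9 Js), sub_add_cancel, one_rpow]
    field_simp
  rcases hf with ⟨α, lam, ⟨h0, h1⟩, hl, hf⟩ | ⟨lam, hl, hf⟩
  · refine ⟨α, lam, h0, h1.le, hl, key α lam (fun z ↦ lam / (α - 1) * (α * z ^ (α - 1))) h0 (fun z hz ↦ ?_) (fun z hz ↦ ?_), fun h ↦ absurd h h1.ne⟩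
    · refine ((hasDerivAt_rpow_const (N9 hz.ne')).const_mul (lam / (α - 1))).congr_of_eventuallyEq ?_
      filter_upwards [lt_mem_nhds hz] with y hy using hf y hy
    · refine (((hasDerivAt_rpow_const (p := α - 1) (N9 hz.ne')).const_mul α).const_mul (lam / (α - 1))).congr_deriv ?_
      have : α - 1 ≠ 0 := by linarith
      rw [show α - 1 - 1 = α - 2 by ring]; field_simp
  · refine ⟨1, lam, one_pos, le_rfl, hl, key 1 lam (fun z ↦ lam * rlog z + lam) one_pos (fun z hz ↦ ?_) (fun z hz ↦ ?_), fun _ ↦ hf⟩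
    · refine ((((hasDerivAt_id z).const_mul lam).mul (hasDerivAt_log hz.ne')).congr_deriv ?_).congr_of_eventuallyEq ?_
      · simp; field_simp
      · filter_upwards [lt_mem_nhds hz] with y hy using hf y hy
    · refine (((hasDerivAt_log hz.ne').const_mul lam).add_const lam).congr_deriv ?_
      rw [show Y1 - 2 = -1 by norm_num, rpow_neg_one]; ring
lemma exAll (P : Par) : ∃ (C : ℝ) (Q : Sq P C) (r : _) (v : _), Sq.Lim Q (hyperfilter ℕ) r v := by
  obtain ⟨C, K, h⟩ := exApprox P
  have S : ∀ i : ℕ, Approx P C (2 * en P (i + 1) + √((i + 1 : ℕ):ℝ)⁻¹ * K) := fun i ↦ (h (i + 1) J5).some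
  have l1 := (en_lim (P := P)).comp (tendsto_add_atTop_nat 1)
  have l2 : Tendsto (fun i : ℕ ↦ √((i + 1 : ℕ):ℝ)⁻¹) atTop Zx := by
    have := ((continuous_sqrt.tendsto 0).comp tendsto_inv_atTop_nhds_zero_nat).comp (tendsto_add_atTop_nat 1)
    simpa [Function.comp_def] using this
  have l3 := (l1.const_mul 2).add (l2.mul_const K)
  obtain ⟨Q₀⟩ := exSq S (by simpa [Function.comp_def] using l3)
  exact ⟨C, Sq.exLim Q₀ _ Nat.hyperfilter_le_atTop⟩
end
end CD
/-- Main Theorem: existence of a weak solution to the cross-diffusion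
system with fast-diffusion or logarithmic pressure law. -/
theorem main_existence (L T : ℝ) (hL : 0 < L) (hT : 0 < T)
    (f : ℝ → ℝ) (hf : PressureLaw f)
    (V1 V2 : ℝ → ℝ)
    (hV1W : MemW 2 L V1) (hV2W : MemW 2 L V2)
    (hVdW : MemW 3 L (fun x => V1 x - V2 x))
    (hV1bc : deriv V1 0 = 0 ∧ deriv V1 L = 0)
    (hV2bc : deriv V2 0 = 0 ∧ deriv V2 L = 0)
    (ρ10 ρ20 : ℝ → ℝ)
    (hρ10 : IsProbDensity L ρ10) (hρ20 : IsProbDensity L ρ20)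
    (hr0 : ∃ r0 : ℝ → ℝ, Measurable r0 ∧ (∀ x, r0 x ∈ Icc (0:ℝ) 1) ∧
      (∀ᵐ x ∂(volume.restrict (Ioo 0 L)), r0 x * (ρ10 x + ρ20 x) = ρ10 x) ∧
      HasFiniteTV L r0)
    (hfin : IntegrableOn (fun x => f (ρ10 x + ρ20 x)) (Ioo 0 L)) :
    ∃ ρ1 ρ2 : ℝ → ℝ → ℝ,
      Measurable (fun q : ℝ × ℝ => ρ1 q.1 q.2) ∧
      Measurable (fun q : ℝ × ℝ => ρ2 q.1 q.2) ∧
      (∀ t x, 0 ≤ ρ1 t x) ∧ (∀ t x, 0 ≤ ρ2 t x) ∧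
      -- (i) for a.e. `t ∈ [0,T]`, `ρ₁(t,·)` and `ρ₂(t,·)` are probability densities
      (∀ᵐ t ∂(volume.restrict (Icc 0 T)),
        IsProbDensity L (ρ1 t) ∧ IsProbDensity L (ρ2 t)) ∧
      ∃ h : ℝ → ℝ → ℝ,
        -- (ii) `h ∈ L¹([0,T]×Ω)` is the weak spatial derivative of `g(σ)`
        IntegrableOn (fun q : ℝ × ℝ => h q.1 q.2) (Ioc 0 T ×ˢ Ioo 0 L) ∧
        (∀ ψ : ℝ × ℝ → ℝ, ContDiff ℝ (⊤ : ℕ∞) ψ → HasCompactSupport ψ →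
          tsupport ψ ⊆ Ioo 0 T ×ˢ Ioo 0 L →
          (∫ t in Ioc 0 T, ∫ x in Ioo 0 L,
              gfun f (ρ1 t x + ρ2 t x) * deriv (fun y => ψ (t, y)) x) =
            -(∫ t in Ioc 0 T, ∫ x in Ioo 0 L, h t x * ψ (t, x))) ∧
        -- (iii) the weak formulation of the system
        (∀ φ : ℝ × ℝ → ℝ, ContDiff ℝ 1 φ →
          (∃ t0, t0 < T ∧ ∀ t x : ℝ, t0 ≤ t → φ (t, x) = 0) →
          ((∫ x in Ioo 0 L, ρ10 x * φ (0, x)) +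
              (∫ t in Ioc 0 T, ∫ x in Ioo 0 L,
                ρ1 t x * deriv (fun τ => φ (τ, x)) t) =
            ∫ t in Ioc 0 T, ∫ x in Ioo 0 L,
              ((if ρ1 t x + ρ2 t x = 0 then 0
                  else ρ1 t x / (ρ1 t x + ρ2 t x)) * h t x +
                ρ1 t x * deriv V1 x) * deriv (fun y => φ (t, y)) x) ∧
          ((∫ x in Ioo 0 L, ρ20 x * φ (0, x)) +
              (∫ t in Ioc 0 T, ∫ x in Ioo 0 L,
                ρ2 t x * deriv (fun τ => φ (τ, x)) t) =
            ∫ t in Ioc 0 T, ∫ x in Ioo 0 L,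
              ((if ρ1 t x + ρ2 t x = 0 then 0
                  else ρ2 t x / (ρ1 t x + ρ2 t x)) * h t x +
                ρ2 t x * deriv V2 x) * deriv (fun y => φ (t, y)) x)) := by
  obtain ⟨α, lam, hα0, hα1, hlam, hgf, hlog⟩ := CD.law hf
  have e1 := @iteratedDeriv_one ℝ _ ℝ _ _
  have e2 : ∀ V : ℝ → ℝ, iteratedDeriv 2 V = deriv (deriv V) := fun V => by rw [iteratedDeriv_succ, e1]
  have e3 : ∀ V : ℝ → ℝ, iteratedDeriv 3 V = deriv (deriv (deriv V)) := fun V => by rw [iteratedDeriv_succ, e2]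
  obtain ⟨b0, k, hk, -, hb⟩ := CD.primD hL (u := deriv V2) (fun x hx => by have := hV2W.2 1 (by norm_num) x hx; rwa [e1] at this)
    (by have := hV2W.1 2 le_rfl; rwa [e2] at this)
  obtain ⟨c2, k2, hk2, hk2', hw2⟩ := CD.primD hL (u := deriv fun x => V1 x - V2 x) (fun x hx => by have := hVdW.2 1 (by norm_num) x hx; rwa [e1] at this)
    (by have := hVdW.1 2 (by norm_num); rwa [e2] at this)
  obtain ⟨c3, k3, hk3, -, hw3⟩ := CD.primD hL (u := deriv (deriv fun x => V1 x - V2 x)) (fun x hx => by have := hVdW.2 2 (by norm_num) x hx; rwa [e2] at this)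
    (by have := hVdW.1 3 le_rfl; rwa [e3] at this)
  obtain ⟨w, hw⟩ : ∃ w : ℝ → ℝ, w = fun x => c3 + ∫ y in (0:ℝ)..x, k3 y := ⟨_, rfl⟩
  have wc : Continuous w := by
    rw [hw]; exact continuous_const.add (intervalIntegral.continuous_primitive (fun a b => hk3.intervalIntegrable) 0)
  have wB : ∀ x, |w x| ≤ |c3| + ∫ y, |k3 y| := fun x => by
    rw [hw]
    refine (abs_add_le _ _).trans (add_le_add le_rfl ?_)
    rw [← Real.norm_eq_abs]
    refine intervalIntegral.norm_integral_le_integral_norm_uIoc.trans ?_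
    exact setIntegral_le_integral hk3.norm (Filter.Eventually.of_forall fun y => norm_nonneg _)
  obtain ⟨M, hM⟩ : ∃ M, M = |c3| + ∫ y, |k3 y| := ⟨_, rfl⟩
  rw [← hM] at wB
  have M0 : 0 ≤ M := (abs_nonneg _).trans (wB 0)
  have I0 : 0 ≤ ∫ y, |k y| := integral_nonneg fun y => abs_nonneg _
  have ML : 0 ≤ M * L := mul_nonneg M0 hL.le
  have a0 := abs_nonneg b0
  have a2 := abs_nonneg c2
  let P : CD.Par :=
    { L := L, T := T, α := α, lam := lam, B := |b0| + (∫ y, |k y|) + M + (|c2| + M * L)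
      b := fun x => b0 + ∫ y in (0:ℝ)..x, k y, k := k
      W := fun x => c2 + ∫ y in (0:ℝ)..x, w y, Wp := w, ρ1 := ρ10, ρ2 := ρ20
      hL := hL, hT := hT, hα0 := hα0, hα1 := hα1, hlam := hlam, hk := hk
      hb := fun x => by simp
      hbB := by simp only [intervalIntegral.integral_same, add_zero]; linarith
      hW := fun x => (wc.integral_hasStrictDerivAt 0 x).hasDerivAt.const_add c2
      hW'c := wc
      hW'B := fun x => (wB x).trans (by linarith)
      hWB := fun x hx => by
        have : |∫ y in (0:ℝ)..x, w y| ≤ M * L := by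
          rw [← Real.norm_eq_abs]
          refine (intervalIntegral.norm_integral_le_of_norm_le_const fun y _ => wB y).trans ?_
          rw [sub_zero, abs_of_nonneg hx.1]
          exact mul_le_mul_of_nonneg_left hx.2 M0
        refine (abs_add_le _ _).trans ?_
        linarith
      h1p := hρ10.1, h2p := hρ20.1, h1i := hρ10.2.1, h2i := hρ20.2.1, h1 := hρ10.2.2, h2 := hρ20.2.2
      hent := fun hα => by
        have m := (hρ10.2.1.add hρ20.2.1).1.aemeasurable
        refine (hfin.const_mul lam⁻¹).mono (m.mul (Real.measurable_log.comp_aemeasurable m)).aestronglyMeasurable ?_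
        filter_upwards [ae_restrict_mem measurableSet_Ioo] with x hx
        rcases (add_nonneg (hρ10.1 x hx) (hρ20.1 x hx)).eq_or_lt with h | h
        · rw [← h, zero_mul, norm_zero]; exact norm_nonneg _
        · rw [hlog hα _ h, mul_assoc lam, inv_mul_cancel_left₀ hlam.ne'] }
  obtain ⟨C, Q, r, v, H⟩ := CD.exAll P
  refine H.final Nat.hyperfilter_le_atTop (gf := gfun f) (d1 := deriv V1) (d2 := deriv V2) hgf (fun x hx => ?_) (fun x hx => hb x hx)
  have hd1 : DifferentiableAt ℝ V1 x := by simpa using hV1W.2 0 (by norm_num) x hx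
  have hd2 : DifferentiableAt ℝ V2 x := by simpa using hV2W.2 0 (by norm_num) x hx
  have h1 : deriv (fun x => V1 x - V2 x) x = deriv V1 x - deriv V2 x := deriv_fun_sub hd1 hd2
  have h2 : ∫ y in (0:ℝ)..x, k2 y = ∫ y in (0:ℝ)..x, w y := by
    refine intervalIntegral.integral_congr_ae (Filter.Eventually.of_forall fun y hy => ?_)
    rw [uIoc_of_le hx.1.le] at hy
    have hy' : y ∈ Ioo 0 L := ⟨hy.1, hy.2.trans_lt hx.2⟩
    rw [hk2' y hy', hw3 y hy', hw]
  have h3 := hw2 x hx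
  rw [h2] at h3
  have h4 := hb x hx
  change deriv V1 x = (b0 + ∫ y in (0:ℝ)..x, k y) + (c2 + ∫ y in (0:ℝ)..x, w y)
  linarith
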